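/- (Theorem 1.) For every T > 0 there exist a small positive number δ and a natural number 𝔎 such that the following holds: for all functions y*, v* ∈ C^∞([0,T]×[0,1]) with (y*(t,x), x·∂ₓy*(t,x), v*(t,x), x·∂ₓv*(t,x)) ∈ U⁴ for all (t,x) ∈ [0,T]×[0,1] and with max_{j+k ≤ 𝔎} ( ‖∂_t^j ∂_x^k y*‖_{L^∞}, ‖∂_t^j ∂_x^k v*‖_{L^∞} ) ≤ δ, there exist y, v ∈ C^∞([0,T]×[0,1]) taking values (together with x·∂ₓy, x·∂ₓv) in U, with y(0,·) = y*(0,·) and v(0,·) = v*(0,·), which satisfy ∂_t y − J(x, y, x∂ₓy)·v = 0 and ∂_t v + H₁(x, y, x∂ₓy, v)·(𝓛y) + H₂(x, y, x∂ₓy, v, x∂ₓv) = 0 on [0,T]×[0,1]. -/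

import Mathlib

open Set Real Filter

/-- The differential operator 𝓛:
`(𝓛y)(x) = −x(1−x)y''(x) − ((5/2)(1−x) − (N/2)x)y'(x) + ℓ₁(x)·x(1−x)·y'(x) + L₀(x)·y(x)`. -/
noncomputable def opL (N : ℝ) (ℓ₁ L₀ : ℝ → ℝ) (y : ℝ → ℝ) (x : ℝ) : ℝ :=
  -(x * (1 - x)) * deriv (deriv y) x
    - ((5 / 2) * (1 - x) - (N / 2) * x) * deriv y x
    + ℓ₁ x * (x * (1 - x)) * deriv y x
    + L₀ x * y x

/-- `𝓛y` expressed through the values `y`, `η = ∂ₓy`, `ζ = ∂ₓ²y`: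
`L(x,y,η,ζ) = −x(1−x)ζ − ((5/2)(1−x) − (N/2)x)η + ℓ₁(x)x(1−x)η + L₀(x)y`. -/
noncomputable def Lfun (N : ℝ) (ℓ₁ L₀ : ℝ → ℝ) (x y η ζ : ℝ) : ℝ :=
  -(x * (1 - x)) * ζ - ((5 / 2) * (1 - x) - (N / 2) * x) * η
    + ℓ₁ x * (x * (1 - x)) * η + L₀ x * y

namespace Gal

open Polynomial intervalIntegral
open scoped ContDiff

variable {N : ℝ}

/-- Weight of the Jacobi inner product on `[0,1]`. -/
noncomputable def wt (N x : ℝ) : ℝ := x ^ (3 / 2 : ℝ) * (1 - x) ^ (N / 2 - 1)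

/-- The weight multiplied by `x(1-x)`. -/
noncomputable def wtX (N x : ℝ) : ℝ := x ^ (5 / 2 : ℝ) * (1 - x) ^ (N / 2)

/-- First order coefficient of the Jacobi operator. -/
noncomputable def bb (N x : ℝ) : ℝ := 5 / 2 * (1 - x) - N / 2 * x

/-- Weighted inner product on `[0,1]`. -/
noncomputable def ip (N : ℝ) (f g : ℝ → ℝ) : ℝ := ∫ x in (0 : ℝ)..1, f x * g x * wt N x

lemma continuous_wt (hN : 4 < N) : Continuous (wt N) := by
  unfold wt
  exact (continuous_id.rpow_const (by intro x; right; norm_num)).mul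
    ((continuous_const.sub continuous_id).rpow_const (by intro x; right; linarith))

lemma continuous_bb : Continuous (bb N) := by unfold bb; fun_prop

lemma wt_nonneg {x : ℝ} (hx : x ∈ Icc (0 : ℝ) 1) : 0 ≤ wt N x :=
  mul_nonneg (rpow_nonneg hx.1 _) (rpow_nonneg (by linarith [hx.2]) _)

lemma wt_pos {x : ℝ} (hx : x ∈ Ioo (0 : ℝ) 1) : 0 < wt N x :=
  mul_pos (rpow_pos_of_pos hx.1 _) (rpow_pos_of_pos (by linarith [hx.2]) _)

lemma wtX_eq (hN : 4 < N) {x : ℝ} (hx : x ∈ Icc (0 : ℝ) 1) : wtX N x = x * (1 - x) * wt N x := by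
  unfold wtX wt
  have h1 : x ^ (5 / 2 : ℝ) = x * x ^ (3 / 2 : ℝ) := by
    rw [show (5 / 2 : ℝ) = 1 + 3 / 2 by norm_num, rpow_add' hx.1 (by norm_num), rpow_one]
  have h2 : (1 - x) ^ (N / 2) = (1 - x) * (1 - x) ^ (N / 2 - 1) := by
    rw [show (N / 2 : ℝ) = 1 + (N / 2 - 1) by ring,
      rpow_add' (by linarith [hx.2]) (by linarith), rpow_one]
    ring_nf
  rw [h1, h2]; ring

lemma hasDerivAt_wtX (hN : 4 < N) {x : ℝ} (hx : x ∈ Icc (0 : ℝ) 1) :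
    HasDerivAt (wtX N) (bb N x * wt N x) x := by
  have h1 : HasDerivAt (fun x : ℝ => x ^ (5 / 2 : ℝ)) (5 / 2 * x ^ (3 / 2 : ℝ)) x := by
    have := hasDerivAt_rpow_const (x := x) (p := (5 / 2 : ℝ)) (Or.inr (by norm_num))
    rwa [show (5 / 2 - 1 : ℝ) = 3 / 2 by norm_num] at this
  have h2 : HasDerivAt (fun x : ℝ => (1 - x) ^ (N / 2)) (-(N / 2 * (1 - x) ^ (N / 2 - 1))) x := by
    have h := hasDerivAt_rpow_const (x := 1 - x) (p := N / 2) (Or.inr (by linarith))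
    have := h.comp x ((hasDerivAt_id x).const_sub 1)
    exact this.congr_deriv (by ring)
  have h := h1.mul h2
  refine HasDerivAt.congr_deriv (f := wtX N) h ?_
  have e1 : x ^ (5 / 2 : ℝ) = x * x ^ (3 / 2 : ℝ) := by
    rw [show (5 / 2 : ℝ) = 1 + 3 / 2 by norm_num, rpow_add' hx.1 (by norm_num), rpow_one]
  have e2 : (1 - x) ^ (N / 2) = (1 - x) * (1 - x) ^ (N / 2 - 1) := by
    rw [show (N / 2 : ℝ) = 1 + (N / 2 - 1) by ring,
      rpow_add' (by linarith [hx.2]) (by linarith), rpow_one]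
    ring_nf
  rw [e1, e2]; unfold bb wt; ring

lemma wtX_zero : wtX N 0 = 0 := by unfold wtX; norm_num
lemma wtX_one (hN : 4 < N) : wtX N 1 = 0 := by
  unfold wtX; rw [sub_self, zero_rpow (by linarith), mul_zero]

lemma ip_comm (f g : ℝ → ℝ) : ip N f g = ip N g f := by
  unfold ip; congr 1; ext x; ring

lemma ip_congr {f f' g g' : ℝ → ℝ} (h : ∀ x ∈ Icc (0 : ℝ) 1, f x = f' x)
    (h' : ∀ x ∈ Icc (0 : ℝ) 1, g x = g' x) : ip N f g = ip N f' g' := by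
  unfold ip
  apply intervalIntegral.integral_congr
  intro x hx
  rw [uIcc_of_le zero_le_one] at hx
  simp only [h x hx, h' x hx]

lemma ip_intervalIntegrable (hN : 4 < N) {f g : ℝ → ℝ} (hf : ContinuousOn f (Icc 0 1))
    (hg : ContinuousOn g (Icc 0 1)) :
    IntervalIntegrable (fun x => f x * g x * wt N x) MeasureTheory.volume 0 1 := by
  apply ContinuousOn.intervalIntegrable
  rw [uIcc_of_le zero_le_one]
  exact (hf.mul hg).mul (continuous_wt hN).continuousOn

lemma ip_add_left (hN : 4 < N) {f f' g : ℝ → ℝ} (hf : ContinuousOn f (Icc 0 1))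
    (hf' : ContinuousOn f' (Icc 0 1)) (hg : ContinuousOn g (Icc 0 1)) :
    ip N (fun x => f x + f' x) g = ip N f g + ip N f' g := by
  unfold ip
  rw [← intervalIntegral.integral_add (ip_intervalIntegrable hN hf hg)
    (ip_intervalIntegrable hN hf' hg)]
  congr 1; ext x; ring

lemma ip_smul_left (c : ℝ) (f g : ℝ → ℝ) : ip N (fun x => c * f x) g = c * ip N f g := by
  unfold ip
  rw [← intervalIntegral.integral_const_mul]
  congr 1; ext x; ring

lemma ip_smul_right (c : ℝ) (f g : ℝ → ℝ) : ip N f (fun x => c * g x) = c * ip N f g := by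
  rw [ip_comm, ip_smul_left, ip_comm]

lemma ip_sub_left (hN : 4 < N) {f f' g : ℝ → ℝ} (hf : ContinuousOn f (Icc 0 1))
    (hf' : ContinuousOn f' (Icc 0 1)) (hg : ContinuousOn g (Icc 0 1)) :
    ip N (fun x => f x - f' x) g = ip N f g - ip N f' g := by
  have := ip_add_left hN (f := f) (f' := fun x => (-1) * f' x) hf (continuousOn_const.mul hf') hg
  rw [ip_smul_left] at this
  rw [show (fun x => f x - f' x) = fun x => f x + (-1) * f' x by ext; ring, this]; ring

lemma ip_add_right (hN : 4 < N) {f g g' : ℝ → ℝ} (hf : ContinuousOn f (Icc 0 1))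
    (hg : ContinuousOn g (Icc 0 1)) (hg' : ContinuousOn g' (Icc 0 1)) :
    ip N f (fun x => g x + g' x) = ip N f g + ip N f g' := by
  rw [ip_comm, ip_add_left hN hg hg' hf, ip_comm g, ip_comm g']

lemma ip_sum_left (hN : 4 < N) {ι : Type*} (s : Finset ι) {f : ι → ℝ → ℝ} {g : ℝ → ℝ}
    (hf : ∀ i ∈ s, ContinuousOn (f i) (Icc 0 1)) (hg : ContinuousOn g (Icc 0 1)) :
    ip N (fun x => ∑ i ∈ s, f i x) g = ∑ i ∈ s, ip N (f i) g := by
  unfold ip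
  rw [← intervalIntegral.integral_finsetSum
    (fun i hi => ip_intervalIntegrable hN (hf i hi) hg)]
  congr 1; ext x; rw [Finset.sum_mul, Finset.sum_mul]

lemma ip_self_nonneg (f : ℝ → ℝ) : 0 ≤ ip N f f := by
  unfold ip
  apply intervalIntegral.integral_nonneg zero_le_one
  intro x hx
  exact mul_nonneg (mul_self_nonneg _) (wt_nonneg hx)

lemma ip_self_eq_zero (hN : 4 < N) {f : ℝ → ℝ} (hf : ContinuousOn f (Icc 0 1))
    (h : ip N f f = 0) : ∀ x ∈ Icc (0 : ℝ) 1, f x = 0 := by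
  have key : ∀ x ∈ Ioo (0 : ℝ) 1, f x = 0 := by
    intro x hx
    by_contra hne
    have hpos : 0 < ip N f f := by
      unfold ip
      apply intervalIntegral.integral_pos zero_lt_one
      · exact (hf.mul hf).mul (continuous_wt hN).continuousOn
      · intro y hy
        exact mul_nonneg (mul_self_nonneg _) (wt_nonneg (Ioc_subset_Icc_self hy))
      · exact ⟨x, Ioo_subset_Icc_self hx, mul_pos (mul_self_pos.2 hne) (wt_pos hx)⟩
    linarith
  exact EqOn.of_subset_closure (f := f) (g := fun _ => 0) key hf continuousOn_const
    Ioo_subset_Icc_self (closure_Ioo (by norm_num)).ge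

/-- Integration by parts against `x(1-x)` times the weight. -/
lemma integral_wtX_deriv (hN : 4 < N) {f f' : ℝ → ℝ}
    (hf : ∀ x ∈ Icc (0 : ℝ) 1, HasDerivAt f (f' x) x) (hf' : ContinuousOn f' (Icc 0 1)) :
    ip N (fun x => x * (1 - x) * f' x + bb N x * f x) (fun _ => 1) = 0 := by
  have hfc : ContinuousOn f (Icc 0 1) := fun x hx => (hf x hx).continuousAt.continuousWithinAt
  have h := intervalIntegral.integral_eq_sub_of_hasDerivAt (a := 0) (b := 1)
    (f := fun x => wtX N x * f x)
    (f' := fun x => bb N x * wt N x * f x + wtX N x * f' x)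
    (by intro x hx; rw [uIcc_of_le zero_le_one] at hx; exact (hasDerivAt_wtX hN hx).mul (hf x hx))
    (by
      apply ContinuousOn.intervalIntegrable
      rw [uIcc_of_le zero_le_one]
      have : ContinuousOn (wtX N) (Icc 0 1) :=
        fun x hx => (hasDerivAt_wtX hN hx).continuousAt.continuousWithinAt
      exact ((continuous_bb.mul (continuous_wt hN)).continuousOn.mul hfc).add (this.mul hf'))
  rw [wtX_zero, wtX_one hN] at h
  simp only [zero_mul, sub_zero] at h
  rw [← h]
  unfold ip
  apply intervalIntegral.integral_congr
  intro x hx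
  rw [uIcc_of_le zero_le_one] at hx
  simp only [wtX_eq hN hx]; ring

/-- The Jacobi operator in terms of the first two derivatives. -/
noncomputable def lamV (N x d1 d2 : ℝ) : ℝ := -(x * (1 - x)) * d2 - bb N x * d1

lemma ip_lamV (hN : 4 < N) {f1 f2 g g1 : ℝ → ℝ}
    (hf1 : ∀ x ∈ Icc (0 : ℝ) 1, HasDerivAt f1 (f2 x) x) (hf2 : ContinuousOn f2 (Icc 0 1))
    (hg : ∀ x ∈ Icc (0 : ℝ) 1, HasDerivAt g (g1 x) x) (hg1 : ContinuousOn g1 (Icc 0 1)) :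
    ip N (fun x => lamV N x (f1 x) (f2 x)) g = ip N (fun x => x * (1 - x) * f1 x) g1 := by
  have cf1 : ContinuousOn f1 (Icc 0 1) := fun x hx => (hf1 x hx).continuousAt.continuousWithinAt
  have cg : ContinuousOn g (Icc 0 1) := fun x hx => (hg x hx).continuousAt.continuousWithinAt
  have cb : ContinuousOn (bb N) (Icc 0 1) := continuous_bb.continuousOn
  have h := integral_wtX_deriv hN (f := fun x => f1 x * g x)
    (f' := fun x => f2 x * g x + f1 x * g1 x)
    (fun x hx => (hf1 x hx).mul (hg x hx)) ((hf2.mul cg).add (cf1.mul hg1))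
  have e : ip N (fun x => x * (1 - x) * (f2 x * g x + f1 x * g1 x) + bb N x * (f1 x * g x))
      (fun _ => 1) = ip N (fun x => x * (1 - x) * f1 x) g1
      - ip N (fun x => lamV N x (f1 x) (f2 x)) g := by
    unfold ip
    rw [← intervalIntegral.integral_sub]
    · congr 1; ext x; unfold lamV; ring
    · exact ip_intervalIntegrable hN (by fun_prop) hg1
    · exact ip_intervalIntegrable hN (by unfold lamV; fun_prop) cg
  linarith

lemma ip_lamV_symm (hN : 4 < N) {f f1 f2 g g1 g2 : ℝ → ℝ}
    (hf : ∀ x ∈ Icc (0 : ℝ) 1, HasDerivAt f (f1 x) x)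
    (hf1 : ∀ x ∈ Icc (0 : ℝ) 1, HasDerivAt f1 (f2 x) x) (hf2 : ContinuousOn f2 (Icc 0 1))
    (hg : ∀ x ∈ Icc (0 : ℝ) 1, HasDerivAt g (g1 x) x)
    (hg1 : ∀ x ∈ Icc (0 : ℝ) 1, HasDerivAt g1 (g2 x) x) (hg2 : ContinuousOn g2 (Icc 0 1)) :
    ip N (fun x => lamV N x (f1 x) (f2 x)) g = ip N f (fun x => lamV N x (g1 x) (g2 x)) := by
  rw [ip_lamV hN hf1 hf2 hg (fun x hx => (hg1 x hx).continuousAt.continuousWithinAt),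
    ip_comm f, ip_lamV hN hg1 hg2 hf (fun x hx => (hf1 x hx).continuousAt.continuousWithinAt)]
  unfold ip; congr 1; ext x; ring

/-- Eigenvalues of the Jacobi operator. -/
noncomputable def lam (N : ℝ) (n : ℕ) : ℝ := n * (n + (3 + N) / 2)

lemma lam_strictMono (hN : 4 < N) : StrictMono (lam N) := by
  intro a b h
  have : (a : ℝ) < b := by exact_mod_cast h
  unfold lam
  have : (0 : ℝ) ≤ a := a.cast_nonneg
  nlinarith

/-- Coefficients of the (unnormalised) Jacobi polynomials. -/
noncomputable def jcoef (N : ℝ) (n : ℕ) : ℕ → ℝ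
  | 0 => 1
  | k + 1 => (lam N k - lam N n) * jcoef N n k / ((k + 1) * (k + 5 / 2))

lemma jcoef_eq_zero {n k : ℕ} (h : n < k) : jcoef N n k = 0 := by
  induction k with
  | zero => omega
  | succ k ih =>
    rcases Nat.lt_or_ge n k with h1 | h1
    · simp [jcoef, ih h1]
    · have : n = k := by omega
      subst this; simp [jcoef]

lemma jcoef_ne_zero (hN : 4 < N) {n k : ℕ} (h : k ≤ n) : jcoef N n k ≠ 0 := by
  induction k with
  | zero => simp [jcoef]
  | succ k ih =>
    have h1 : lam N k - lam N n ≠ 0 := sub_ne_zero.2 (lam_strictMono hN (by omega)).ne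
    have : ((k : ℝ) + 1) * (k + 5 / 2) ≠ 0 := by positivity
    simp only [jcoef]
    exact div_ne_zero (mul_ne_zero h1 (ih (by omega))) this

/-- Unnormalised Jacobi polynomials. -/
noncomputable def jpoly (N : ℝ) (n : ℕ) : ℝ[X] := ∑ k ∈ Finset.range (n + 1), monomial k (jcoef N n k)

lemma coeff_jpoly (n k : ℕ) : (jpoly N n).coeff k = jcoef N n k := by
  unfold jpoly
  simp only [finsetSum_coeff, coeff_monomial]
  rw [Finset.sum_ite_eq']
  split_ifs with h
  · rfl
  · rw [jcoef_eq_zero]; simpa using h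

lemma natDegree_jpoly (hN : 4 < N) (n : ℕ) : (jpoly N n).natDegree = n := by
  apply natDegree_eq_of_le_of_coeff_ne_zero
  · rw [natDegree_le_iff_coeff_eq_zero]
    intro k hk
    rw [coeff_jpoly, jcoef_eq_zero hk]
  · rw [coeff_jpoly]; exact jcoef_ne_zero hN le_rfl

lemma jpoly_eigen (n : ℕ) (x : ℝ) :
    lamV N x ((derivative (jpoly N n)).eval x) ((derivative (derivative (jpoly N n))).eval x)
      = lam N n * (jpoly N n).eval x := by
  obtain ⟨m, hm⟩ : ∃ m, m = 5 / 2 + N / 2 := ⟨_, rfl⟩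
  have key : -(X * derivative (derivative (jpoly N n)) - X * (X * derivative (derivative (jpoly N n))))
      - (C (5 / 2) * derivative (jpoly N n) - C m * (X * derivative (jpoly N n)))
      = C (lam N n) * jpoly N n := by
    ext k
    have hj : ∀ k : ℕ, jcoef N n (k + 1) * (((k : ℝ) + 1) * (k + 5 / 2))
        = (lam N k - lam N n) * jcoef N n k := by
      intro k
      have : ((k : ℝ) + 1) * (k + 5 / 2) ≠ 0 := by positivity
      simp only [jcoef]; field_simp
    rcases k with _ | _ | k
    · have := hj 0
      simp [coeff_jpoly, coeff_derivative] at this ⊢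
      unfold lam at this ⊢; simp at this ⊢; linarith
    · have := hj 1
      simp [coeff_jpoly, coeff_derivative, coeff_X_mul] at this ⊢
      unfold lam at this ⊢; push_cast at this ⊢; subst hm; linarith
    · have := hj (k + 2)
      simp [coeff_jpoly, coeff_derivative, coeff_X_mul] at this ⊢
      unfold lam at this ⊢; push_cast at this ⊢; subst hm; linarith
  have := congrArg (fun p => eval x p) key
  simp at this
  rw [← this]; subst hm; unfold lamV bb; ring

/-- Orthonormal Jacobi polynomials. -/
noncomputable def jp (N : ℝ) (n : ℕ) : ℝ[X] :=
  C (√(ip N (fun x => (jpoly N n).eval x) (fun x => (jpoly N n).eval x)))⁻¹ * jpoly N n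

lemma jpoly_norm_pos (hN : 4 < N) (n : ℕ) :
    0 < ip N (fun x => (jpoly N n).eval x) (fun x => (jpoly N n).eval x) := by
  refine lt_of_le_of_ne (ip_self_nonneg _) fun h => ?_
  have h0 := ip_self_eq_zero hN (Polynomial.continuous _).continuousOn h.symm 0 (by simp)
  have h1 : (jpoly N n).coeff 0 = 0 := by rwa [coeff_zero_eq_eval_zero]
  rw [coeff_jpoly] at h1
  simp [jcoef] at h1

lemma jp_eigen (n : ℕ) (x : ℝ) :
    lamV N x ((derivative (jp N n)).eval x) ((derivative (derivative (jp N n))).eval x)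
      = lam N n * (jp N n).eval x := by
  have := jpoly_eigen (N := N) n x
  unfold jp
  simp only [derivative_C_mul, eval_mul, eval_C]
  unfold lamV at this ⊢
  linear_combination (√(ip N (fun x => (jpoly N n).eval x) (fun x => (jpoly N n).eval x)))⁻¹ * this

lemma natDegree_jp (hN : 4 < N) (n : ℕ) : (jp N n).natDegree = n := by
  unfold jp
  rw [natDegree_C_mul, natDegree_jpoly hN]
  exact inv_ne_zero (Real.sqrt_pos.2 (jpoly_norm_pos hN n)).ne'

lemma polyDeriv (p : ℝ[X]) (x : ℝ) :
    HasDerivAt (fun x => p.eval x) ((derivative p).eval x) x := p.hasDerivAt x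

/-- Jacobi coefficient. -/
noncomputable def jc (N : ℝ) (n : ℕ) (f : ℝ → ℝ) : ℝ := ip N f (fun x => (jp N n).eval x)

lemma jc_lamV (hN : 4 < N) (n : ℕ) {f f1 f2 : ℝ → ℝ}
    (hf : ∀ x ∈ Icc (0 : ℝ) 1, HasDerivAt f (f1 x) x)
    (hf1 : ∀ x ∈ Icc (0 : ℝ) 1, HasDerivAt f1 (f2 x) x) (hf2 : ContinuousOn f2 (Icc 0 1)) :
    jc N n (fun x => lamV N x (f1 x) (f2 x)) = lam N n * jc N n f := by
  unfold jc
  rw [ip_lamV_symm hN hf hf1 hf2 (fun x _ => polyDeriv _ x) (fun x _ => polyDeriv _ x)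
    (Polynomial.continuous _).continuousOn, ← ip_smul_right]
  simp_rw [jp_eigen]

lemma jp_orthonormal (hN : 4 < N) (n k : ℕ) :
    jc N n (fun x => (jp N k).eval x) = if n = k then 1 else 0 := by
  split_ifs with h
  · subst h
    unfold jc jp
    have h := jpoly_norm_pos hN n
    simp only [eval_mul, eval_C]
    rw [ip_smul_left, ip_smul_right]
    set A := ip N (fun x => (jpoly N n).eval x) (fun x => (jpoly N n).eval x)
    rw [← mul_assoc, ← mul_inv, Real.mul_self_sqrt h.le, inv_mul_cancel₀ h.ne']
  · have h1 := jc_lamV hN n (f := fun x => (jp N k).eval x) (fun x _ => polyDeriv _ x)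
      (fun x _ => polyDeriv _ x) (Polynomial.continuous _).continuousOn
    simp_rw [jp_eigen] at h1
    have h2 : jc N n (fun x => lam N k * (jp N k).eval x)
      = lam N k * jc N n (fun x => (jp N k).eval x) := by unfold jc; rw [ip_smul_left]
    rw [h2] at h1
    have h3 : lam N k - lam N n ≠ 0 :=
      sub_ne_zero.2 fun e => h ((lam_strictMono hN).injective e).symm
    exact (mul_eq_zero.1 (by linarith : (lam N k - lam N n) * jc N n (fun x => (jp N k).eval x) = 0)).resolve_left h3

/-- Jacobi projection onto polynomials of degree at most `n`. -/
noncomputable def pj (N : ℝ) (n : ℕ) (f : ℝ → ℝ) : ℝ[X] :=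
  ∑ j ∈ Finset.range (n + 1), C (jc N j f) * jp N j

lemma exists_expansion {e : ℕ → ℝ[X]} (he : ∀ n, (e n).natDegree = n) (h0 : e 0 ≠ 0) (n : ℕ)
    (p : ℝ[X]) (hp : p.natDegree ≤ n) :
    ∃ a : ℕ → ℝ, p = ∑ j ∈ Finset.range (n + 1), C (a j) * e j := by
  induction n generalizing p with
  | zero =>
    have h1 : p = C (p.coeff 0) := eq_C_of_natDegree_le_zero hp
    have h2 : e 0 = C ((e 0).coeff 0) := eq_C_of_natDegree_le_zero (he 0).le
    have h3 : (e 0).coeff 0 ≠ 0 := by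
      intro h; rw [h, C_0] at h2; exact h0 h2
    refine ⟨fun _ => p.coeff 0 / (e 0).coeff 0, ?_⟩
    simp only [zero_add, Finset.range_one, Finset.sum_singleton]
    rw [h2, ← C_mul, coeff_C_zero, div_mul_cancel₀ _ h3]; exact h1
  | succ n ih =>
    have hd := he (n + 1)
    have hlc : (e (n + 1)).coeff (n + 1) ≠ 0 := by
      have h : (e (n + 1)).leadingCoeff ≠ 0 := by
        rw [Ne, leadingCoeff_eq_zero]
        intro h
        rw [h] at hd
        simp at hd
      rwa [leadingCoeff, hd] at h
    set c := p.coeff (n + 1) / (e (n + 1)).coeff (n + 1) with hc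
    have hq : (p - C c * e (n + 1)).natDegree ≤ n := by
      rw [natDegree_le_iff_coeff_eq_zero]
      intro k hk
      rcases Nat.lt_or_ge (n + 1) k with h | h
      · rw [coeff_sub, coeff_C_mul, coeff_eq_zero_of_natDegree_lt (by omega),
          coeff_eq_zero_of_natDegree_lt (by omega)]; ring
      · have : k = n + 1 := by omega
        subst this
        rw [coeff_sub, coeff_C_mul, hc, div_mul_cancel₀ _ hlc, sub_self]
    obtain ⟨a, ha⟩ := ih _ hq
    refine ⟨fun j => if j = n + 1 then c else a j, ?_⟩
    rw [Finset.sum_range_succ]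
    have : ∑ j ∈ Finset.range (n + 1), C (if j = n + 1 then c else a j) * e j
        = ∑ j ∈ Finset.range (n + 1), C (a j) * e j := by
      apply Finset.sum_congr rfl
      intro j hj
      have := Finset.mem_range.1 hj
      rw [if_neg (by omega)]
    simp only [this, ← ha, if_true]; ring

lemma jp_ne_zero (hN : 4 < N) (n : ℕ) : jp N n ≠ 0 := by
  intro h
  have := jp_orthonormal hN n n
  rw [h] at this
  simp [jc, ip] at this

lemma exists_jp_expansion (hN : 4 < N) (n : ℕ) (p : ℝ[X]) (hp : p.natDegree ≤ n) :
    ∃ a : ℕ → ℝ, p = ∑ j ∈ Finset.range (n + 1), C (a j) * jp N j :=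
  exists_expansion (natDegree_jp hN) (jp_ne_zero hN 0) n p hp

lemma jc_sum (hN : 4 < N) (a : ℕ → ℝ) (n k : ℕ) :
    jc N k (fun x => (∑ j ∈ Finset.range (n + 1), C (a j) * jp N j).eval x)
      = if k ≤ n then a k else 0 := by
  have h : jc N k (fun x => (∑ j ∈ Finset.range (n + 1), C (a j) * jp N j).eval x)
      = ∑ j ∈ Finset.range (n + 1), a j * jc N k (fun x => (jp N j).eval x) := by
    unfold jc
    simp only [eval_finsetSum, eval_mul, eval_C]
    rw [ip_sum_left hN]
    · simp_rw [ip_smul_left]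
    · intro i _; fun_prop
    · fun_prop
  rw [h]
  simp_rw [jp_orthonormal hN, mul_ite, mul_one, mul_zero]
  rw [Finset.sum_ite_eq]
  simp

lemma pj_poly (hN : 4 < N) {n : ℕ} {p : ℝ[X]} (hp : p.natDegree ≤ n) :
    pj N n (fun x => p.eval x) = p := by
  obtain ⟨a, ha⟩ := exists_jp_expansion hN n p hp
  conv_rhs => rw [ha]
  unfold pj
  apply Finset.sum_congr rfl
  intro j hj
  have h : jc N j (fun x => p.eval x) = a j := by
    rw [ha, jc_sum hN, if_pos (Nat.lt_succ_iff.1 (Finset.mem_range.1 hj))]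
  rw [h]

lemma jc_poly_eq_zero (hN : 4 < N) {n : ℕ} {p : ℝ[X]} (hp : p.natDegree < n) :
    jc N n (fun x => p.eval x) = 0 := by
  obtain ⟨a, ha⟩ := exists_jp_expansion hN p.natDegree p le_rfl
  have h := jc_sum hN a p.natDegree n
  rw [← ha, if_neg (by omega)] at h
  exact h

lemma abs_derivative_eval_one_le {n : ℕ} {q : ℝ[X]} (hq : q.natDegree ≤ n)
    (hb : ∀ x ∈ Icc (-1 : ℝ) 1, |q.eval x| ≤ 1) : |(derivative q).eval 1| ≤ (n : ℝ) ^ 2 := by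
  have hT : (derivative (Chebyshev.T ℝ n)).eval 1 = (n : ℝ) ^ 2 := by
    have := Chebyshev.derivative_T_eval_one (R := ℝ) n
    exact_mod_cast this
  have h1 := Chebyshev.eval_iterate_derivative_le_of_forall_abs_le_one (n := n) (k := 1) (x := 1) le_rfl
    (natDegree_le_iff_degree_le.1 hq) hb
  have h2 := Chebyshev.eval_iterate_derivative_le_of_forall_abs_le_one (n := n) (k := 1) (x := 1) (P := -q)
    le_rfl (natDegree_le_iff_degree_le.1 (by rwa [natDegree_neg])) (by simpa using hb)
  simp only [Function.iterate_one, derivative_neg, eval_neg] at h1 h2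
  rw [hT] at h1 h2
  exact abs_le.2 ⟨by linarith, h1⟩

/-- Markov inequality on `[0,1]`. -/
lemma markov {n : ℕ} {p : ℝ[X]} (hp : p.natDegree ≤ n) {M : ℝ}
    (hb : ∀ x ∈ Icc (0 : ℝ) 1, |p.eval x| ≤ M) :
    ∀ x ∈ Icc (0 : ℝ) 1, |(derivative p).eval x| ≤ 4 * (n : ℝ) ^ 2 * M := by
  have main : ∀ M : ℝ, 0 < M → (∀ x ∈ Icc (0 : ℝ) 1, |p.eval x| ≤ M) →
      ∀ x ∈ Icc (0 : ℝ) 1, |(derivative p).eval x| ≤ 4 * (n : ℝ) ^ 2 * M := by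
    intro M hM hb x hx
    have key : ∀ α β : ℝ, 1 / 4 ≤ |α| → α + β = x →
        (∀ s ∈ Icc (-1 : ℝ) 1, α * s + β ∈ Icc (0 : ℝ) 1) →
        |(derivative p).eval x| ≤ 4 * (n : ℝ) ^ 2 * M := by
      intro α β hα hx1 hs
      have h := abs_derivative_eval_one_le (n := n) (q := C M⁻¹ * p.comp (C α * X + C β)) (by
          refine (natDegree_C_mul_le _ _).trans ?_
          rw [natDegree_comp]
          calc p.natDegree * (C α * X + C β).natDegree ≤ p.natDegree * 1 := by
                gcongr; exact natDegree_linear_le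
            _ ≤ n := by simpa using hp)
        (by
          intro s hs'
          simp only [eval_mul, eval_C, eval_comp, eval_add, eval_X]
          rw [abs_mul, abs_of_pos (inv_pos.2 hM), inv_mul_le_iff₀ hM, mul_one]
          exact hb _ (hs s hs'))
      simp only [derivative_C_mul, derivative_comp, eval_mul, eval_C, eval_comp, eval_add, eval_X,
        derivative_add, derivative_C, add_zero, derivative_X, mul_one, hx1] at h
      rw [abs_mul, abs_of_pos (inv_pos.2 hM), inv_mul_le_iff₀ hM, abs_mul] at h
      have := abs_nonneg ((derivative p).eval x)
      nlinarith
    rcases le_total (1 / 2) x with h | h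
    · refine key (x / 2) (x / 2) (by rw [abs_of_nonneg (by linarith)]; linarith) (by ring) ?_
      intro s hs
      constructor <;> nlinarith [hs.1, hs.2, hx.1, hx.2]
    · refine key (-(1 - x) / 2) ((1 + x) / 2)
        (by rw [abs_of_nonpos (by linarith)]; linarith) (by ring) ?_
      intro s hs
      constructor <;> nlinarith [hs.1, hs.2, hx.1, hx.2]
  have hM0 : 0 ≤ M := (abs_nonneg _).trans (hb 0 (by simp))
  intro x hx
  have : ∀ ε : ℝ, 0 < ε → |(derivative p).eval x| ≤ 4 * (n : ℝ) ^ 2 * M + ε := by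
    intro ε hε
    have := main (M + ε / (4 * (n : ℝ) ^ 2 + 1)) (by positivity)
      (fun y hy => (hb y hy).trans (by have : 0 ≤ ε / (4 * (n : ℝ) ^ 2 + 1) := by positivity
                                       linarith)) x hx
    refine this.trans ?_
    rw [mul_add]
    gcongr
    rw [← mul_div_assoc, div_le_iff₀ (by positivity)]
    nlinarith
  exact le_of_forall_pos_le_add this

lemma markov_iterate {n : ℕ} {p : ℝ[X]} (hp : p.natDegree ≤ n) {M : ℝ}
    (hb : ∀ x ∈ Icc (0 : ℝ) 1, |p.eval x| ≤ M) (k : ℕ) :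
    ∀ x ∈ Icc (0 : ℝ) 1, |(derivative^[k] p).eval x| ≤ (4 * (n : ℝ) ^ 2) ^ k * M := by
  induction k with
  | zero => simpa using hb
  | succ k ih =>
    rw [Function.iterate_succ_apply']
    intro x hx
    have := markov ((natDegree_iterate_derivative p k).trans ((Nat.sub_le _ _).trans hp)) ih x hx
    rw [pow_succ]; linarith

lemma wt_le_one (hN : 4 < N) {x : ℝ} (hx : x ∈ Icc (0 : ℝ) 1) : wt N x ≤ 1 := by
  unfold wt
  have h1 : x ^ (3 / 2 : ℝ) ≤ 1 := rpow_le_one hx.1 hx.2 (by norm_num)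
  have h2 : (1 - x) ^ (N / 2 - 1) ≤ 1 := rpow_le_one (by linarith [hx.2]) (by linarith [hx.1]) (by linarith)
  have h3 : 0 ≤ (1 - x) ^ (N / 2 - 1) := rpow_nonneg (by linarith [hx.2]) _
  have h4 : 0 ≤ x ^ (3 / 2 : ℝ) := rpow_nonneg hx.1 _
  nlinarith

lemma wt_ge (hN : 4 < N) {q : ℕ} (hq : N / 2 + 1 / 2 ≤ q) {l x : ℝ} (hl : 0 < l) (hl1 : l ≤ 1)
    (h1 : l ≤ x) (h2 : l ≤ 1 - x) : l ^ q ≤ wt N x := by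
  unfold wt
  calc l ^ q = l ^ (q : ℝ) := (rpow_natCast _ _).symm
    _ ≤ l ^ (3 / 2 + (N / 2 - 1)) := rpow_le_rpow_of_exponent_ge hl hl1 (by linarith)
    _ = l ^ (3 / 2 : ℝ) * l ^ (N / 2 - 1) := rpow_add hl _ _
    _ ≤ _ := by
      apply mul_le_mul
      · exact rpow_le_rpow hl.le h1 (by norm_num)
      · exact rpow_le_rpow hl.le h2 (by linarith)
      · exact rpow_nonneg hl.le _
      · exact rpow_nonneg (by linarith) _

/-- Nikolskii inequality: the supremum of a polynomial is controlled by its weighted norm. -/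
lemma nikolskii (hN : 4 < N) : ∃ C : ℝ, 1 ≤ C ∧ ∃ c : ℕ, ∀ (n : ℕ) (p : ℝ[X]), p.natDegree ≤ n →
    ∀ x ∈ Icc (0 : ℝ) 1, |p.eval x| ≤ C * (1 + n : ℝ) ^ c *
      √(ip N (fun x => p.eval x) (fun x => p.eval x)) := by
  obtain ⟨q, hq⟩ := exists_nat_ge (N / 2 + 1 / 2)
  refine ⟨2 * 4 ^ (q + 1), by have : (1 : ℝ) ≤ 4 ^ (q + 1) := one_le_pow₀ (by norm_num)
                              linarith, q + 1, ?_⟩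
  intro n p hp
  obtain ⟨x0, hx0, hmax⟩ := isCompact_Icc.exists_isMaxOn (s := Icc (0 : ℝ) 1) ⟨0, by simp⟩
    (f := fun x => |p.eval x|) (by fun_prop)
  set M := |p.eval x0| with hM
  have hb : ∀ x ∈ Icc (0 : ℝ) 1, |p.eval x| ≤ M := fun x hx => hmax hx
  have hM0 : 0 ≤ M := abs_nonneg _
  have hd := markov hp hb
  set l : ℝ := 1 / (8 * (1 + n : ℝ) ^ 2) with hl
  have hn1 : (1 : ℝ) ≤ (1 + n : ℝ) ^ 2 := one_le_pow₀ (by linarith [(Nat.cast_nonneg n : (0 : ℝ) ≤ n)])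
  have hl0 : 0 < l := by positivity
  have hl8 : l ≤ 1 / 8 := by rw [hl]; apply one_div_le_one_div_of_le <;> linarith
  have hlow : ∀ x ∈ Icc (0 : ℝ) 1, |x - x0| ≤ l → M / 2 ≤ |p.eval x| := by
    intro x hx hxl
    have h := (convex_Icc (0 : ℝ) 1).norm_image_sub_le_of_norm_hasDerivWithin_le
      (f := fun x => p.eval x) (C := 4 * (n : ℝ) ^ 2 * M)
      (fun y _ => (polyDeriv p y).hasDerivWithinAt) hd hx0 hx
    simp only [Real.norm_eq_abs] at h
    have h3 : 4 * (n : ℝ) ^ 2 * M * |x - x0| ≤ M / 2 := by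
      have : (n : ℝ) ^ 2 ≤ (1 + n : ℝ) ^ 2 := by gcongr; linarith
      calc 4 * (n : ℝ) ^ 2 * M * |x - x0| ≤ 4 * (1 + n : ℝ) ^ 2 * M * l := by gcongr
        _ = M / 2 := by rw [hl]; field_simp; try ring
    have h4 : M ≤ |p.eval x| + |p.eval x - p.eval x0| := by
      rw [hM]
      have := abs_sub_abs_le_abs_sub (p.eval x0) (p.eval x)
      rw [abs_sub_comm] at this; linarith
    linarith
  have key : ∀ a : ℝ, l / 2 ≤ a → a + l / 2 ≤ 1 - l / 2 →
      (∀ x ∈ Icc a (a + l / 2), |x - x0| ≤ l) →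
      (M / 2) ^ 2 * (l / 2) ^ (q + 1) ≤ ip N (fun x => p.eval x) (fun x => p.eval x) := by
    intro a ha hb1 hal
    have hsub : Icc a (a + l / 2) ⊆ Icc 0 1 := Icc_subset_Icc (by linarith) (by linarith)
    have h1 : ∫ x in a..(a + l / 2), (M / 2) ^ 2 * (l / 2) ^ q
        ≤ ∫ x in a..(a + l / 2), p.eval x * p.eval x * wt N x := by
      apply intervalIntegral.integral_mono_on (by linarith) (by simp)
      · apply Continuous.intervalIntegrable
        have := continuous_wt hN
        fun_prop
      · intro x hx
        apply mul_le_mul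
        · rw [← sq, ← sq_abs (p.eval x)]
          have := hlow x (hsub hx) (hal x hx)
          gcongr
        · exact wt_ge hN hq (by linarith) (by linarith) (by linarith [hx.1]) (by linarith [hx.2])
        · positivity
        · exact mul_self_nonneg _
    have h2 : ∫ x in a..(a + l / 2), p.eval x * p.eval x * wt N x
        ≤ ip N (fun x => p.eval x) (fun x => p.eval x) := by
      unfold ip
      apply intervalIntegral.integral_mono_interval (by linarith) (by linarith) (by linarith)
      · refine (MeasureTheory.ae_restrict_mem measurableSet_Ioc).mono ?_
        intro x hx
        exact mul_nonneg (mul_self_nonneg _) (wt_nonneg (Ioc_subset_Icc_self hx))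
      · exact ip_intervalIntegrable hN (Polynomial.continuous _).continuousOn
          (Polynomial.continuous _).continuousOn
    rw [intervalIntegral.integral_const, smul_eq_mul] at h1
    calc (M / 2) ^ 2 * (l / 2) ^ (q + 1) = (a + l / 2 - a) * ((M / 2) ^ 2 * (l / 2) ^ q) := by ring
      _ ≤ _ := h1.trans h2
  have hfin : (M / 2) ^ 2 * (l / 2) ^ (q + 1) ≤ ip N (fun x => p.eval x) (fun x => p.eval x) := by
    rcases le_total x0 (1 / 2) with h | h
    · apply key (x0 + l / 2) (by linarith [hx0.1]) (by linarith)
      intro x hx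
      rw [abs_le]; constructor <;> linarith [hx.1, hx.2]
    · apply key (x0 - l) (by linarith) (by linarith [hx0.2])
      intro x hx
      rw [abs_le]; constructor <;> linarith [hx.1, hx.2]
  intro x hx
  refine (hb x hx).trans ?_
  set I := ip N (fun x => p.eval x) (fun x => p.eval x) with hI
  have hl2 : l / 2 = ((4 * (1 + n : ℝ)) ^ 2)⁻¹ := by rw [hl]; field_simp; norm_num; try ring
  rw [hl2] at hfin
  have h5 : M ^ 2 ≤ (2 * 4 ^ (q + 1) * (1 + n : ℝ) ^ (q + 1)) ^ 2 * I := by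
    have hpos : (0 : ℝ) < ((4 * (1 + n : ℝ)) ^ 2) ^ (q + 1) := by positivity
    rw [inv_pow] at hfin
    have h6 : (M / 2) ^ 2 ≤ I * ((4 * (1 + n : ℝ)) ^ 2) ^ (q + 1) := by
      rwa [← div_eq_mul_inv, div_le_iff₀ hpos] at hfin
    calc M ^ 2 = 4 * (M / 2) ^ 2 := by ring
      _ ≤ 4 * (I * ((4 * (1 + n : ℝ)) ^ 2) ^ (q + 1)) := by gcongr
      _ = _ := by rw [mul_assoc 2, ← mul_pow, mul_pow 2, ← pow_mul, ← pow_mul, mul_comm 2 (q + 1)]; ring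
  calc M = √(M ^ 2) := (Real.sqrt_sq hM0).symm
    _ ≤ √((2 * 4 ^ (q + 1) * (1 + n : ℝ) ^ (q + 1)) ^ 2 * I) := Real.sqrt_le_sqrt h5
    _ = _ := by rw [Real.sqrt_mul (by positivity), Real.sqrt_sq (by positivity)]

/-- `Cl k B Θ F`: smooth function on the line whose derivatives up to order `k` grow at rate `Θ`. -/
def Cl (k : ℕ) (B Θ : ℝ) (F : ℝ → ℝ) : Prop :=
  ContDiff ℝ ∞ F ∧ ∀ i ≤ k, ∀ θ, |iteratedDeriv i F θ| ≤ B * Θ ^ i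

namespace Cl
variable {k : ℕ} {B B' Θ : ℝ} {F G : ℝ → ℝ}

lemma nonneg (h : Cl k B Θ F) : 0 ≤ B := by
  have := (abs_nonneg _).trans (h.2 0 (Nat.zero_le _) 0)
  simpa using this

lemma abs_le (h : Cl k B Θ F) (θ : ℝ) : |F θ| ≤ B := by
  have := h.2 0 (Nat.zero_le _) θ
  simpa using this

lemma mono (h : Cl k B Θ F) (hB : B ≤ B') (hΘ : 0 ≤ Θ) : Cl k B' Θ F :=
  ⟨h.1, fun i hi θ => (h.2 i hi θ).trans (by gcongr)⟩

lemma of_le {l : ℕ} (h : Cl k B Θ F) (hl : l ≤ k) : Cl l B Θ F :=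
  ⟨h.1, fun i hi => h.2 i (hi.trans hl)⟩

lemma add (hF : Cl k B Θ F) (hG : Cl k B' Θ G) : Cl k (B + B') Θ (fun θ => F θ + G θ) := by
  refine ⟨hF.1.add hG.1, fun i hi θ => ?_⟩
  have := iteratedDeriv_add (n := i) (x := θ) (hF.1.contDiffAt.of_le (by exact_mod_cast le_top))
    (hG.1.contDiffAt.of_le (by exact_mod_cast le_top))
  rw [show (fun θ => F θ + G θ) = F + G from rfl, this]
  refine (abs_add_le _ _).trans ?_
  rw [add_mul]
  exact add_le_add (hF.2 i hi θ) (hG.2 i hi θ)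

lemma const_mul (c : ℝ) (hF : Cl k B Θ F) : Cl k (|c| * B) Θ (fun θ => c * F θ) := by
  refine ⟨contDiff_const.mul hF.1, fun i hi θ => ?_⟩
  rw [iteratedDeriv_const_mul_field, abs_mul, mul_assoc]
  gcongr
  exact hF.2 i hi θ

lemma neg (hF : Cl k B Θ F) : Cl k B Θ (fun θ => - F θ) := by
  have := hF.const_mul (-1)
  simpa using this

lemma sub (hF : Cl k B Θ F) (hG : Cl k B' Θ G) : Cl k (B + B') Θ (fun θ => F θ - G θ) := by
  simpa [sub_eq_add_neg] using hF.add hG.neg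

lemma mul (hΘ : 0 ≤ Θ) (hF : Cl k B Θ F) (hG : Cl k B' Θ G) :
    Cl k (2 ^ k * (B * B')) Θ (fun θ => F θ * G θ) := by
  refine ⟨hF.1.mul hG.1, fun i hi θ => ?_⟩
  have h := norm_iteratedFDeriv_mul_le (n := i) (N := ∞) hF.1 hG.1 θ (by exact_mod_cast le_top)
  simp only [norm_iteratedFDeriv_eq_norm_iteratedDeriv, Real.norm_eq_abs] at h
  refine h.trans ?_
  have hB := hF.nonneg
  have hB' := hG.nonneg
  calc ∑ j ∈ Finset.range (i + 1), (i.choose j : ℝ) * |iteratedDeriv j F θ| *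
        |iteratedDeriv (i - j) G θ|
      ≤ ∑ j ∈ Finset.range (i + 1), (i.choose j : ℝ) * (B * B' * Θ ^ i) := by
        refine Finset.sum_le_sum fun j hj => ?_
        have hj' : j ≤ i := Nat.lt_succ_iff.1 (Finset.mem_range.1 hj)
        rw [mul_assoc]
        refine mul_le_mul_of_nonneg_left ?_ (Nat.cast_nonneg _)
        calc _ ≤ (B * Θ ^ j) * (B' * Θ ^ (i - j)) :=
              mul_le_mul (hF.2 j (hj'.trans hi) θ) (hG.2 _ ((Nat.sub_le _ _).trans hi) θ)
                (abs_nonneg _) (by positivity)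
          _ = B * B' * (Θ ^ j * Θ ^ (i - j)) := by ring
          _ = _ := by rw [← pow_add, Nat.add_sub_cancel' hj']
    _ = 2 ^ i * (B * B' * Θ ^ i) := by
        rw [← Finset.sum_mul]
        congr 1
        exact_mod_cast Nat.sum_range_choose i
    _ ≤ 2 ^ k * (B * B' * Θ ^ i) := by gcongr; norm_num
    _ = _ := by ring

lemma const (c : ℝ) (hΘ : 0 ≤ Θ) : Cl k |c| Θ (fun _ => c) := by
  refine ⟨contDiff_const, fun i hi θ => ?_⟩
  rw [iteratedDeriv_const]
  split_ifs with h
  · simp [h]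
  · simpa using by positivity

lemma cos (hΘ : 1 ≤ Θ) : Cl k 1 Θ Real.cos :=
  ⟨Real.contDiff_cos, fun i _ θ => (Real.abs_iteratedDeriv_cos_le_one i θ).trans
    (by simpa using one_le_pow₀ hΘ)⟩

end Cl

lemma Cl.comp {m : ℕ} {Φ : (Fin m → ℝ) → ℝ} {K : Set (Fin m → ℝ)} (hK : IsCompact K)
    (hΦ : AnalyticOnNhd ℝ Φ K) (k : ℕ) :
    ∃ C : ℝ, 0 ≤ C ∧ ∀ (D : Fin m → ℝ → ℝ) (M Θ : ℝ), 1 ≤ M → 1 ≤ Θ → (∀ j, Cl k M Θ (D j)) →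
      (∀ θ, (fun j => D j θ) ∈ K) → Cl k (C * M ^ k) Θ (fun θ => Φ (fun j => D j θ)) := by
  have hbd : ∀ i : ℕ, ∃ C : ℝ, ∀ u ∈ K, ‖iteratedFDeriv ℝ i Φ u‖ ≤ C := fun i =>
    hK.exists_bound_of_continuousOn fun u hu =>
      (((hΦ u hu).contDiffAt (n := ω)).continuousAt_iteratedFDeriv (k := i) (by simp)).continuousWithinAt
  choose C hC using hbd
  refine ⟨k.factorial * ∑ i ∈ Finset.range (k + 1), |C i|, by positivity, ?_⟩
  intro D M Θ hM hΘ hD hDK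
  set f : ℝ → (Fin m → ℝ) := fun θ j => D j θ with hf
  have hfs : ContDiff ℝ ∞ f := contDiff_pi.2 fun j => (hD j).1
  have hana : ∀ θ, ContDiffAt ℝ ∞ Φ (f θ) := fun θ => ((hΦ _ (hDK θ)).contDiffAt (n := ω)).of_le le_top
  refine ⟨contDiff_iff_contDiffAt.2 fun θ => (hana θ).comp θ hfs.contDiffAt, fun i hi θ => ?_⟩
  obtain ⟨V, hV, hVK⟩ : ∃ V : Set (Fin m → ℝ), IsOpen V ∧ K ⊆ V ∧ ∀ u ∈ V, AnalyticAt ℝ Φ u :=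
    ⟨{u | AnalyticAt ℝ Φ u}, isOpen_analyticAt ℝ Φ, fun u hu => hΦ u hu, fun u hu => hu⟩
  have h := norm_iteratedFDerivWithin_comp_le (𝕜 := ℝ) (g := Φ) (f := f) (n := i) (N := ∞)
    (s := univ) (t := V) (x := θ) (C := ∑ i ∈ Finset.range (k + 1), |C i|) (D := M * Θ)
    (fun u hu => (((hVK.2 u hu).contDiffAt (n := ω)).of_le le_top).contDiffWithinAt)
    hfs.contDiffOn (by exact_mod_cast le_top) hV.uniqueDiffOn uniqueDiffOn_univ
    (fun θ _ => hVK.1 (hDK θ)) (mem_univ _) ?_ ?_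
  · rw [iteratedFDerivWithin_univ, norm_iteratedFDeriv_eq_norm_iteratedDeriv, Real.norm_eq_abs] at h
    refine h.trans ?_
    rw [mul_pow, ← mul_assoc]
    gcongr
  · intro l hl
    rw [iteratedFDerivWithin_of_isOpen l hV (hVK.1 (hDK θ))]
    refine (hC l _ (hDK θ)).trans ((le_abs_self _).trans ?_)
    exact Finset.single_le_sum (f := fun i => |C i|) (fun _ _ => abs_nonneg _)
      (Finset.mem_range.2 (by omega))
  · intro l hl1 hl
    rw [iteratedFDerivWithin_univ, norm_iteratedFDeriv_eq_norm_iteratedDeriv]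
    have hcoord : ∀ l : ℕ, iteratedDeriv l f = fun θ j => iteratedDeriv l (D j) θ := by
      intro l
      induction l with
      | zero => simp [hf]
      | succ l ih =>
        rw [iteratedDeriv_succ, ih]
        ext θ j
        rw [deriv_pi fun j => ?_]
        · simp only [iteratedDeriv_succ]
        · exact ((hD j).1.differentiable_iteratedDeriv l (by exact_mod_cast ENat.natCast_lt_top l)) θ
    rw [hcoord, pi_norm_le_iff_of_nonneg (by positivity)]
    intro j
    refine ((hD j).2 l (hl.trans hi) θ).trans ?_
    rw [mul_pow]
    gcongr
    exact le_self_pow₀ hM (by omega)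

/-- The change of variables `θ ↦ (1 - cos θ)/2` onto the unit interval. -/
noncomputable def xc (θ : ℝ) : ℝ := (1 - Real.cos θ) / 2

lemma xc_mem (θ : ℝ) : xc θ ∈ Icc (0 : ℝ) 1 := by
  unfold xc
  constructor <;> linarith [Real.neg_one_le_cos θ, Real.cos_le_one θ]

lemma xc_arccos {x : ℝ} (hx : x ∈ Icc (0 : ℝ) 1) : xc (arccos (1 - 2 * x)) = x := by
  unfold xc
  rw [Real.cos_arccos (by linarith [hx.2]) (by linarith [hx.1])]
  ring

lemma exists_xc {x : ℝ} (hx : x ∈ Icc (0 : ℝ) 1) : ∃ θ, xc θ = x := ⟨_, xc_arccos hx⟩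

lemma contDiff_xc : ContDiff ℝ ∞ xc := by
  unfold xc; exact (contDiff_const.sub Real.contDiff_cos).div_const _

lemma hasDerivAt_xc (θ : ℝ) : HasDerivAt xc (Real.sin θ / 2) θ := by
  unfold xc
  have := ((Real.hasDerivAt_cos θ).const_sub 1).div_const 2
  simpa using this

lemma xc_mul (θ : ℝ) : xc θ * (1 - xc θ) = (Real.sin θ / 2) * (Real.sin θ / 2) := by
  unfold xc
  nlinarith [Real.sin_sq_add_cos_sq θ]

lemma fourier_integral_deriv {F F' : ℝ → ℝ} (hF : ∀ θ, HasDerivAt F (F' θ) θ) (hF' : Continuous F')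
    (hper : Function.Periodic F (2 * π)) (m : ℤ) :
    ‖∫ θ in (0 : ℝ)..(2 * π), Complex.exp (-(m * θ * Complex.I)) * (F' θ : ℂ)‖
      = |(m : ℝ)| * ‖∫ θ in (0 : ℝ)..(2 * π), Complex.exp (-(m * θ * Complex.I)) * (F θ : ℂ)‖ := by
  have hFc : Continuous F := continuous_iff_continuousAt.2 fun θ => (hF θ).continuousAt
  have hd : ∀ θ : ℝ, HasDerivAt (fun θ : ℝ => Complex.exp (-(m * θ * Complex.I)) * (F θ : ℂ))
      (Complex.exp (-(m * θ * Complex.I)) * (F' θ : ℂ) -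
        (m * Complex.I) * (Complex.exp (-(m * θ * Complex.I)) * (F θ : ℂ))) θ := by
    intro θ
    have h1 : HasDerivAt (fun θ : ℝ => (-((m : ℂ) * θ * Complex.I))) (-(m * 1 * Complex.I)) θ :=
      ((((hasDerivAt_id θ).ofReal_comp).const_mul (m : ℂ)).mul_const Complex.I).neg
    exact (h1.cexp.mul ((hF θ).ofReal_comp)).congr_deriv (by ring)
  have h := intervalIntegral.integral_eq_sub_of_hasDerivAt (a := 0) (b := 2 * π) (fun θ _ => hd θ)
    (Continuous.intervalIntegrable (by fun_prop) _ _)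
  have e1 : Complex.exp (-(m * ((2 * π : ℝ) : ℂ) * Complex.I)) = 1 := by
    rw [Complex.exp_eq_one_iff]
    exact ⟨-m, by push_cast; ring⟩
  have e2 : F (2 * π) = F 0 := by simpa using hper 0
  rw [e1, e2] at h
  simp only [Complex.ofReal_zero, mul_zero, zero_mul, neg_zero, Complex.exp_zero, sub_self] at h
  rw [intervalIntegral.integral_sub (Continuous.intervalIntegrable (by fun_prop) _ _)
    (Continuous.intervalIntegrable (by fun_prop) _ _), intervalIntegral.integral_const_mul,
    sub_eq_zero] at h
  rw [h, norm_mul, norm_mul, Complex.norm_I, mul_one, Complex.norm_intCast]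

lemma fourier_integral_decay {F : ℝ → ℝ} (hF : ContDiff ℝ ∞ F) (hper : Function.Periodic F (2 * π))
    {k : ℕ} {B : ℝ} (hB : ∀ θ, |iteratedDeriv k F θ| ≤ B) (m : ℤ) :
    |(m : ℝ)| ^ k * ‖∫ θ in (0 : ℝ)..(2 * π), Complex.exp (-(m * θ * Complex.I)) * (F θ : ℂ)‖
      ≤ 2 * π * B := by
  induction k generalizing F with
  | zero =>
    simp only [iteratedDeriv_zero] at hB
    rw [pow_zero, one_mul]
    refine (intervalIntegral.norm_integral_le_of_norm_le_const (C := B) ?_).trans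
      (by rw [sub_zero, abs_of_pos Real.two_pi_pos]; linarith)
    intro θ _
    rw [norm_mul, Complex.norm_exp]
    simpa using hB θ
  | succ k ih =>
    have hd : ∀ θ, HasDerivAt F (deriv F θ) θ := fun θ =>
      (hF.differentiable (by simp) θ).hasDerivAt
    have hF' := (contDiff_infty_iff_deriv.1 hF).2
    have hper' : Function.Periodic (deriv F) (2 * π) := by
      intro θ
      rw [← deriv_comp_add_const]
      congr 1
      ext y
      exact hper y
    have := ih hF' hper' (fun θ => by rw [← iteratedDeriv_succ']; exact hB θ)
    rw [fourier_integral_deriv hd hF'.continuous hper] at this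
    rwa [pow_succ, mul_assoc]

lemma abs_sub_sum_le {ι : Type*} (s : Finset ι) {a b : ι → ℝ} {A : ℝ} (ha : HasSum a A)
    (hb : Summable b) (hb0 : ∀ i, 0 ≤ b i) (hab : ∀ i ∉ s, |a i| ≤ b i) :
    |A - ∑ i ∈ s, a i| ≤ ∑' i, b i := by
  have h1 : HasSum (fun m : {m : ι // m ∉ s} => a m) (A - ∑ i ∈ s, a i) :=
    (Finset.hasSum_compl_iff s).2 (by rw [sub_add_cancel]; exact ha)
  have h2 := tsum_of_norm_bounded (f := fun m : {m : ι // m ∉ s} => a m)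
    (hb.subtype {m | m ∉ s}).hasSum (fun m => hab m m.2)
  rw [h1.tsum_eq, Real.norm_eq_abs] at h2
  exact h2.trans (hb.tsum_subtype_le _ {m | m ∉ s} hb0)

/-- Approximation of smooth functions of `θ` by polynomials in `x`. -/
lemma jackson : ∃ S : ℝ, 1 ≤ S ∧ ∀ (k : ℕ) (f : ℝ → ℝ) (B : ℝ), ContDiff ℝ ∞ (fun θ => f (xc θ)) →
    (∀ θ, |iteratedDeriv (k + 2) (fun θ => f (xc θ)) θ| ≤ B) → ∀ n : ℕ, ∃ p : ℝ[X], p.natDegree ≤ n ∧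
      ∀ x ∈ Icc (0 : ℝ) 1, |f x - p.eval x| ≤ S * B / (1 + n : ℝ) ^ k := by
  have hsum : Summable fun m : ℤ => 1 / (m : ℝ) ^ 2 := Real.summable_one_div_int_pow.2 (by norm_num)
  have hS0 : 0 ≤ ∑' m : ℤ, 1 / (m : ℝ) ^ 2 := tsum_nonneg fun m => by positivity
  refine ⟨1 + ∑' m : ℤ, 1 / (m : ℝ) ^ 2, by linarith, ?_⟩
  intro k f B hF hB n
  set F : ℝ → ℝ := fun θ => f (xc θ) with hFdef
  have hB0 : 0 ≤ B := (abs_nonneg _).trans (hB 0)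
  have hper : Function.Periodic F (2 * π) := by
    intro θ; simp [hFdef, xc]
  have heven : ∀ θ, F (-θ) = F θ := by
    intro θ; simp [hFdef, xc]
  have : Fact (0 < 2 * π) := ⟨Real.two_pi_pos⟩
  have hperC : Function.Periodic (fun θ => (F θ : ℂ)) (2 * π) := fun θ => by simp only [hper θ]
  set g : C(AddCircle (2 * π), ℂ) := ⟨hperC.lift, by
    have : Continuous fun θ => (F θ : ℂ) := Complex.continuous_ofReal.comp hF.continuous
    exact continuous_coinduced_dom.2 this⟩ with hg
  have hgF : ∀ θ : ℝ, g θ = F θ := fun θ => rfl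
  have hc : ∀ m : ℤ, |(m : ℝ)| ^ (k + 2) * ‖fourierCoeff g m‖ ≤ B := by
    intro m
    rw [fourierCoeff_eq_intervalIntegral _ _ 0, zero_add, norm_smul]
    have h1 := fourier_integral_decay hF hper hB m
    have h2 : (∫ x in (0 : ℝ)..(2 * π), (fourier (-m) (x : AddCircle (2 * π)) : ℂ) • g x) =
        ∫ θ in (0 : ℝ)..(2 * π), Complex.exp (-(m * θ * Complex.I)) * (F θ : ℂ) := by
      congr 1; ext θ
      rw [hgF, fourier_coe_apply, smul_eq_mul]
      congr 2
      have : (π : ℂ) ≠ 0 := by exact_mod_cast Real.pi_ne_zero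
      push_cast
      field_simp
    have h3 := Real.two_pi_pos
    rw [h2, Real.norm_eq_abs, abs_of_pos (one_div_pos.2 h3)]
    rw [mul_left_comm, one_div, inv_mul_le_iff₀ h3]
    exact h1
  have hc2 : ∀ m : ℤ, m ≠ 0 → ‖fourierCoeff g m‖ ≤ B / |(m : ℝ)| ^ (k + 2) := by
    intro m hm
    rw [le_div_iff₀ (pow_pos (abs_pos.2 (by exact_mod_cast hm)) _), mul_comm]
    exact hc m
  have habs1 : ∀ m : ℤ, m ≠ 0 → (1 : ℝ) ≤ |(m : ℝ)| := fun m hm => by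
    exact_mod_cast Int.one_le_abs hm
  have hsc : Summable (fourierCoeff g) := by
    have h0 : Summable (fun m : ℤ => B * (1 / (m : ℝ) ^ 2) + if m = 0 then ‖fourierCoeff g 0‖ else 0) :=
      (hsum.mul_left B).add (summable_of_ne_finset_zero (s := {0}) (by
        intro m hm; rw [if_neg (by simpa using hm)]))
    refine Summable.of_norm_bounded h0 fun m => ?_
    split_ifs with hm
    · subst hm; simp
    · rw [add_zero]
      refine (hc2 m hm).trans ?_
      rw [div_eq_mul_one_div, ← sq_abs (m : ℝ)]
      have h1 := habs1 m hm
      have h2 : |(m : ℝ)| ^ 2 ≤ |(m : ℝ)| ^ (k + 2) := pow_le_pow_right₀ h1 (by omega)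
      gcongr
  have hser : ∀ θ : ℝ, HasSum (fun m : ℤ => (fourierCoeff g m).re * Real.cos (m * θ)) (F θ) := by
    intro θ
    have h1 := has_pointwise_sum_fourier_series_of_summable hsc (θ : AddCircle (2 * π))
    have h2 := has_pointwise_sum_fourier_series_of_summable hsc ((-θ : ℝ) : AddCircle (2 * π))
    rw [hgF] at h1 h2
    rw [heven] at h2
    have h3 := ((h1.add h2).mul_left (1 / 2 : ℂ)).mapL Complex.reCLM
    have e : Complex.reCLM (1 / 2 * ((F θ : ℂ) + F θ)) = F θ := by
      rw [← two_mul, ← mul_assoc]; norm_num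
    rw [e] at h3
    refine h3.congr_fun ?_ |> fun h => h
    intro m
    have e1 : (fourier m (θ : AddCircle (2 * π)) : ℂ) + fourier m ((-θ : ℝ) : AddCircle (2 * π)) =
        2 * (Real.cos (m * θ) : ℂ) := by
      have hp : (π : ℂ) ≠ 0 := by exact_mod_cast Real.pi_ne_zero
      rw [fourier_coe_apply, fourier_coe_apply, Complex.ofReal_cos, Complex.cos]
      have a1 : 2 * (π : ℂ) * Complex.I * m * θ / ((2 * π : ℝ) : ℂ) = ((m * θ : ℝ) : ℂ) * Complex.I := by
        push_cast; field_simp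
      have a2 : 2 * (π : ℂ) * Complex.I * m * ((-θ : ℝ) : ℂ) / ((2 * π : ℝ) : ℂ)
          = -((m * θ : ℝ) : ℂ) * Complex.I := by
        push_cast; field_simp
      rw [a1, a2]; ring
    simp only [smul_eq_mul]
    rw [← mul_add, e1, Complex.reCLM_apply]
    rw [show (1 / 2 : ℂ) * (fourierCoeff g m * (2 * (Real.cos (m * θ) : ℂ)))
      = fourierCoeff g m * (Real.cos (m * θ) : ℂ) by ring, Complex.re_mul_ofReal]
  set s : Finset ℤ := Finset.Icc (-n : ℤ) n with hs
  refine ⟨∑ m ∈ s, C (fourierCoeff g m).re * (Chebyshev.T ℝ m).comp (1 - 2 * X), ?_, ?_⟩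
  · refine natDegree_sum_le_of_forall_le _ _ fun m hm => ?_
    refine (natDegree_C_mul_le _ _).trans ?_
    rw [natDegree_comp, Chebyshev.natDegree_T]
    have h1 : m.natAbs ≤ n := by
      rw [hs, Finset.mem_Icc] at hm; omega
    have h2 : (1 - 2 * X : ℝ[X]).natDegree ≤ 1 := by compute_degree
    calc _ ≤ n * 1 := Nat.mul_le_mul h1 h2
      _ = n := mul_one n
  · intro x hx
    obtain ⟨θ, rfl⟩ := exists_xc hx
    have hev : (∑ m ∈ s, C (fourierCoeff g m).re * (Chebyshev.T ℝ m).comp (1 - 2 * X)).eval (xc θ)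
        = ∑ m ∈ s, (fourierCoeff g m).re * Real.cos (m * θ) := by
      rw [eval_finsetSum]
      refine Finset.sum_congr rfl fun m _ => ?_
      rw [eval_mul, eval_C, eval_comp]
      congr 1
      have : (1 - 2 * X : ℝ[X]).eval (xc θ) = Real.cos θ := by
        simp [xc]; ring
      rw [this, Chebyshev.T_real_cos]
    rw [hev]
    have h1 := abs_sub_sum_le s (hser θ) (hsum.mul_left (B / (1 + n : ℝ) ^ k))
      (fun m => by positivity) ?_
    · refine h1.trans ?_
      rw [tsum_mul_left]
      calc _ ≤ B / (1 + n : ℝ) ^ k * (1 + ∑' m : ℤ, 1 / (m : ℝ) ^ 2) := by gcongr; linarith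
        _ = _ := by ring
    · intro m hm
      have hmn : (1 + n : ℝ) ≤ |(m : ℝ)| := by
        have : (1 + n : ℤ) ≤ |m| := by
          rw [hs, Finset.mem_Icc, ← abs_le] at hm; omega
        exact_mod_cast this
      have hm0 : m ≠ 0 := by
        rintro rfl; exact hm (by simp [hs])
      rw [abs_mul]
      calc _ ≤ ‖fourierCoeff g m‖ * 1 := by
            gcongr
            · exact Complex.abs_re_le_norm _
            · exact Real.abs_cos_le_one _
        _ ≤ B / |(m : ℝ)| ^ (k + 2) := by rw [mul_one]; exact hc2 m hm0
        _ = B / |(m : ℝ)| ^ k * (1 / (m : ℝ) ^ 2) := by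
            rw [pow_add, sq_abs]; field_simp
        _ ≤ _ := by gcongr

lemma exists_cos_expansion {n : ℕ} {p : ℝ[X]} (hp : p.natDegree ≤ n) {M : ℝ}
    (hM : ∀ x ∈ Icc (0 : ℝ) 1, |p.eval x| ≤ M) : ∃ a : ℕ → ℝ, (∀ m ≤ n, |a m| ≤ 2 * M) ∧
      ∀ θ, p.eval (xc θ) = ∑ m ∈ Finset.range (n + 1), a m * Real.cos (m * θ) := by
  set P : ℝ[X] := p.comp (C (1 / 2) * (1 - X)) with hP
  have hPd : P.natDegree ≤ n := by
    rw [hP, natDegree_comp]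
    have : (C (1 / 2) * (1 - X) : ℝ[X]).natDegree ≤ 1 := by compute_degree
    calc _ ≤ n * 1 := Nat.mul_le_mul hp this
      _ = n := mul_one n
  have hPev : ∀ θ, P.eval (Real.cos θ) = p.eval (xc θ) := by
    intro θ
    rw [hP, eval_comp]
    congr 1
    simp [xc]; ring
  obtain ⟨a, ha⟩ := exists_expansion (e := fun n => Chebyshev.T ℝ n)
    (fun n => by rw [Chebyshev.natDegree_T]; simp) (by simp) n P hPd
  have hexp : ∀ θ, p.eval (xc θ) = ∑ m ∈ Finset.range (n + 1), a m * Real.cos (m * θ) := by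
    intro θ
    rw [← hPev, ha, eval_finsetSum]
    refine Finset.sum_congr rfl fun m _ => ?_
    rw [eval_mul, eval_C, Chebyshev.T_real_cos]
    simp
  have hM0 : 0 ≤ M := (abs_nonneg _).trans (hM 0 (by simp))
  refine ⟨a, fun k hk => ?_, hexp⟩
  have horth : ∀ m : ℕ, ∫ θ in (0 : ℝ)..π, Real.cos (m * θ) * Real.cos (k * θ)
      = if m = k then (if k = 0 then π else π / 2) else 0 := by
    intro m
    have e : ∫ θ in (0 : ℝ)..π, Real.cos (m * θ) * Real.cos (k * θ) =
        ∫ x, (Chebyshev.T ℝ m).eval x * (Chebyshev.T ℝ k).eval x ∂Chebyshev.measureT := by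
      rw [Chebyshev.integral_measureT_eq_integral_cos]
      simp
    rw [e]
    split_ifs with h1 h2
    · subst h1; subst h2; exact_mod_cast Chebyshev.integral_eval_T_real_mul_self_measureT_zero
    · subst h1; exact Chebyshev.integral_T_real_mul_self_measureT_of_ne_zero h2
    · exact Chebyshev.integral_eval_T_real_mul_eval_T_real_measureT_of_ne h1
  have hi : ∫ θ in (0 : ℝ)..π, p.eval (xc θ) * Real.cos (k * θ) =
      a k * (if k = 0 then π else π / 2) := by
    simp only [hexp, Finset.sum_mul]
    rw [intervalIntegral.integral_finsetSum
      (fun m _ => Continuous.intervalIntegrable (by fun_prop) _ _)]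
    simp only [mul_assoc, intervalIntegral.integral_const_mul, horth]
    rw [Finset.sum_eq_single k]
    · simp
    · intro b _ hb; simp [hb]
    · intro h; exact absurd (Finset.mem_range.2 (by omega)) h
  have hbd := intervalIntegral.norm_integral_le_of_norm_le_const (a := 0) (b := π) (C := M)
    (f := fun θ => p.eval (xc θ) * Real.cos (k * θ)) (fun θ _ => by
      rw [norm_mul, Real.norm_eq_abs, Real.norm_eq_abs]
      calc _ ≤ M * 1 := by
            gcongr
            · exact hM _ (xc_mem θ)
            · exact Real.abs_cos_le_one _
        _ = M := mul_one M)
  rw [hi, Real.norm_eq_abs, abs_mul, sub_zero, abs_of_pos Real.pi_pos] at hbd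
  have hpi := Real.pi_pos
  have h2 : π / 2 ≤ |if k = 0 then π else π / 2| := by
    split_ifs
    · rw [abs_of_pos hpi]; linarith
    · exact le_abs_self _
  have h3 : |a k| * (π / 2) ≤ M * π := (mul_le_mul_of_nonneg_left h2 (abs_nonneg _)).trans hbd
  nlinarith

lemma contDiff_poly (p : ℝ[X]) : ContDiff ℝ ∞ (fun x => p.eval x) := by
  simpa [Polynomial.aeval_def, Polynomial.eval₂_eq_eval_map] using p.contDiff_aeval (𝕜 := ℝ) ∞

lemma contDiff_poly_xc (p : ℝ[X]) : ContDiff ℝ ∞ (fun θ => p.eval (xc θ)) :=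
  (contDiff_poly p).comp contDiff_xc

lemma bernstein {n : ℕ} {p : ℝ[X]} (hp : p.natDegree ≤ n) {M : ℝ}
    (hM : ∀ x ∈ Icc (0 : ℝ) 1, |p.eval x| ≤ M) (k : ℕ) (θ : ℝ) :
    |iteratedDeriv k (fun θ => p.eval (xc θ)) θ| ≤ 2 * M * (1 + n : ℝ) ^ (k + 1) := by
  obtain ⟨a, ha, he⟩ := exists_cos_expansion hp hM
  have hM0 : 0 ≤ M := (abs_nonneg _).trans (hM 0 (by simp))
  rw [funext he]
  rw [iteratedDeriv_fun_sum (fun m _ => by fun_prop)]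
  have hterm : ∀ m ∈ Finset.range (n + 1),
      |iteratedDeriv k (fun θ => a m * Real.cos (m * θ)) θ| ≤ 2 * M * (1 + n : ℝ) ^ k := by
    intro m hm
    have hmn : m ≤ n := Nat.lt_succ_iff.1 (Finset.mem_range.1 hm)
    rw [iteratedDeriv_const_mul_field, abs_mul, iteratedDeriv_comp_const_mul Real.contDiff_cos,
      abs_mul, abs_pow, Nat.abs_cast]
    calc _ ≤ (2 * M) * ((1 + n : ℝ) ^ k * 1) := by
          have : (m : ℝ) ≤ n := by exact_mod_cast hmn
          gcongr
          · exact ha m hmn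
          · linarith
          · exact Real.abs_iteratedDeriv_cos_le_one _ _
      _ = _ := by ring
  refine (Finset.abs_sum_le_sum_abs _ _).trans ((Finset.sum_le_sum hterm).trans ?_)
  rw [Finset.sum_const, Finset.card_range, nsmul_eq_mul]
  push_cast
  exact le_of_eq (by ring)

/-- Polynomial growth of the orthonormal polynomials and their derivatives. -/
lemma jp_bound (hN : 4 < N) : ∃ C : ℝ, 1 ≤ C ∧ ∃ c : ℕ, 2 ≤ c ∧ (∀ i j : ℕ, ∀ x ∈ Icc (0 : ℝ) 1,
      |(derivative^[i] (jp N j)).eval x| ≤ C * 4 ^ i * (1 + j : ℝ) ^ (c + 2 * i)) ∧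
    ∀ i j k : ℕ, ∀ θ, |iteratedDeriv k (fun θ => (derivative^[i] (jp N j)).eval (xc θ)) θ|
      ≤ C * 4 ^ i * (1 + j : ℝ) ^ (c + 2 * i + k) := by
  obtain ⟨C, hC, c, h⟩ := nikolskii hN
  have key : ∀ i j : ℕ, ∀ x ∈ Icc (0 : ℝ) 1,
      |(derivative^[i] (jp N j)).eval x| ≤ C * 4 ^ i * (1 + j : ℝ) ^ (c + 2 * i) := by
    intro i j x hx
    have h1 : ∀ x ∈ Icc (0 : ℝ) 1, |(jp N j).eval x| ≤ C * (1 + j : ℝ) ^ c := by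
      intro x hx
      have h2 := h j (jp N j) (natDegree_jp hN j).le x hx
      have h3 := jp_orthonormal hN j j
      rw [if_pos rfl] at h3
      unfold jc at h3
      rwa [h3, Real.sqrt_one, mul_one] at h2
    refine (markov_iterate (natDegree_jp hN j).le h1 i x hx).trans ?_
    rw [mul_pow, ← pow_mul, pow_add]
    calc _ ≤ 4 ^ i * (1 + j : ℝ) ^ (2 * i) * (C * (1 + j : ℝ) ^ c) := by gcongr; linarith
      _ = _ := by ring
  refine ⟨2 * C, by linarith, c + 2, by omega, fun i j x hx => (key i j x hx).trans ?_, ?_⟩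
  · have hj : (1 : ℝ) ≤ 1 + j := by linarith [(Nat.cast_nonneg j : (0 : ℝ) ≤ j)]
    gcongr
    · linarith
    · omega
  · intro i j k θ
    have hj : (1 : ℝ) ≤ 1 + j := by linarith [(Nat.cast_nonneg j : (0 : ℝ) ≤ j)]
    refine (bernstein ((natDegree_iterate_derivative _ _).trans ((Nat.sub_le _ _).trans
      (natDegree_jp hN j).le)) (key i j) k θ).trans ?_
    calc _ = 2 * C * 4 ^ i * (1 + j : ℝ) ^ (c + 2 * i + (k + 1)) := by
          rw [pow_add _ (c + 2 * i) (k + 1)]; ring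
      _ ≤ _ := mul_le_mul_of_nonneg_left (pow_le_pow_right₀ hj (by omega)) (by positivity)

lemma ip_mono (hN : 4 < N) {f g f' g' : ℝ → ℝ} (hf : ContinuousOn f (Icc 0 1))
    (hg : ContinuousOn g (Icc 0 1)) (hf' : ContinuousOn f' (Icc 0 1))
    (hg' : ContinuousOn g' (Icc 0 1)) (h : ∀ x ∈ Icc (0 : ℝ) 1, f x * g x ≤ f' x * g' x) :
    ip N f g ≤ ip N f' g' := by
  unfold ip
  apply intervalIntegral.integral_mono_on zero_le_one
    (ip_intervalIntegrable hN hf hg) (ip_intervalIntegrable hN hf' hg')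
  intro x hx
  exact mul_le_mul_of_nonneg_right (h x hx) (wt_nonneg hx)

lemma ip_cs (hN : 4 < N) {f g : ℝ → ℝ} (hf : ContinuousOn f (Icc 0 1))
    (hg : ContinuousOn g (Icc 0 1)) : |ip N f g| ≤ √(ip N f f) * √(ip N g g) := by
  have key : ∀ t : ℝ, 0 ≤ ip N g g * (t * t) + 2 * ip N f g * t + ip N f f := by
    intro t
    have hc : ContinuousOn (fun x => t * g x) (Icc 0 1) := continuousOn_const.fun_mul hg
    have h := ip_self_nonneg (N := N) (fun x => f x + t * g x)
    rw [ip_add_left hN hf hc (hf.fun_add hc), ip_add_right hN hf hf hc, ip_add_right hN hc hf hc,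
      ip_smul_left, ip_smul_left, ip_smul_right, ip_smul_right, ip_comm g f] at h
    nlinarith
  have h := discrim_le_zero key
  rw [discrim] at h
  rw [← Real.sqrt_mul (ip_self_nonneg _)]
  apply Real.abs_le_sqrt
  nlinarith

lemma ip_mul_bound (hN : 4 < N) {a f g : ℝ → ℝ} {M : ℝ} (ha : ContinuousOn a (Icc 0 1))
    (hf : ContinuousOn f (Icc 0 1)) (hg : ContinuousOn g (Icc 0 1))
    (hM : ∀ x ∈ Icc (0 : ℝ) 1, |a x| ≤ M) :
    |ip N (fun x => a x * f x) g| ≤ M * (√(ip N f f) * √(ip N g g)) := by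
  have hM0 : 0 ≤ M := (abs_nonneg _).trans (hM 0 (by simp))
  refine (ip_cs hN (ha.fun_mul hf) hg).trans ?_
  rw [← mul_assoc]
  refine mul_le_mul_of_nonneg_right ?_ (Real.sqrt_nonneg _)
  rw [Real.sqrt_le_left (by positivity), mul_pow, Real.sq_sqrt (ip_self_nonneg _),
    ← ip_smul_left]
  refine ip_mono hN (ha.fun_mul hf) (ha.fun_mul hf) (continuousOn_const.fun_mul hf) hf fun x hx => ?_
  have h1 : a x ^ 2 ≤ M ^ 2 := by
    rw [← sq_abs]; exact pow_le_pow_left₀ (abs_nonneg _) (hM x hx) 2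
  nlinarith [mul_le_mul_of_nonneg_right h1 (sq_nonneg (f x))]

lemma ip_jp_self (hN : 4 < N) (n : ℕ) :
    ip N (fun x => (jp N n).eval x) (fun x => (jp N n).eval x) = 1 := by
  simpa [jc] using jp_orthonormal hN n n

lemma ip_one_le (hN : 4 < N) : ip N (fun _ => 1) (fun _ => 1) ≤ 1 := by
  unfold ip
  have : ∫ x in (0 : ℝ)..1, 1 * 1 * wt N x ≤ ∫ x in (0 : ℝ)..1, (1 : ℝ) := by
    apply intervalIntegral.integral_mono_on zero_le_one
    · exact ip_intervalIntegrable hN (f := fun _ => 1) (g := fun _ => 1) continuousOn_const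
        continuousOn_const
    · exact intervalIntegrable_const
    · intro x hx; simpa using wt_le_one hN hx
  simpa using this

lemma abs_jc_le (hN : 4 < N) (n : ℕ) {f : ℝ → ℝ} {M : ℝ} (hf : ContinuousOn f (Icc 0 1))
    (hM : ∀ x ∈ Icc (0 : ℝ) 1, |f x| ≤ M) : |jc N n f| ≤ M := by
  have hM0 : 0 ≤ M := (abs_nonneg _).trans (hM 0 (by simp))
  have h := ip_mul_bound hN (f := fun _ => 1) (g := fun x => (jp N n).eval x) hf
    continuousOn_const (Polynomial.continuous _).continuousOn hM
  rw [ip_jp_self hN, Real.sqrt_one, mul_one] at h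
  simp only [mul_one] at h
  refine h.trans ?_
  have : √(ip N (fun _ => 1) (fun _ => 1)) ≤ 1 := by
    rw [Real.sqrt_le_one]; exact ip_one_le hN
  nlinarith

/-- The derivative `x(1-x)∂ₓ` of the orthonormal polynomials. -/
noncomputable def Xjp (N : ℝ) (n : ℕ) : ℝ[X] := X * (1 - X) * derivative (jp N n)

lemma eval_Xjp (n : ℕ) (x : ℝ) : (Xjp N n).eval x = x * (1 - x) * (derivative (jp N n)).eval x := by
  simp [Xjp]

lemma natDegree_X_derivative (q : ℝ[X]) :
    (X * (1 - X) * derivative q).natDegree ≤ q.natDegree + 1 := by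
  rcases Nat.eq_zero_or_pos q.natDegree with h | h
  · rw [natDegree_eq_zero] at h
    obtain ⟨c, rfl⟩ := h
    simp
  · refine natDegree_mul_le.trans ?_
    have h1 : (X * (1 - X) : ℝ[X]).natDegree ≤ 2 := by compute_degree
    have h2 := natDegree_derivative_le q
    omega

lemma natDegree_Xjp (hN : 4 < N) (n : ℕ) : (Xjp N n).natDegree ≤ n + 1 :=
  (natDegree_X_derivative _).trans_eq (by rw [natDegree_jp hN])

noncomputable def kap (N : ℝ) : ℝ := (3 + N) / 4
noncomputable def nu (N : ℝ) (n : ℕ) : ℝ := n + kap N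

lemma lam_eq (n : ℕ) : lam N n = nu N n ^ 2 - kap N ^ 2 := by
  unfold lam nu kap; ring

lemma kap_ge (hN : 4 < N) : 1 ≤ kap N := by unfold kap; linarith
lemma nu_ge (hN : 4 < N) (n : ℕ) : (n : ℝ) + 1 ≤ nu N n := by
  unfold nu; linarith [kap_ge hN]
lemma nu_le (hN : 4 < N) (n : ℕ) : nu N n ≤ kap N * (1 + n) := by
  unfold nu; nlinarith [kap_ge hN, (Nat.cast_nonneg n : (0 : ℝ) ≤ n)]
lemma nu_pos (hN : 4 < N) (n : ℕ) : 0 < nu N n := by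
  linarith [nu_ge hN n, (Nat.cast_nonneg n : (0 : ℝ) ≤ n)]

lemma sqrt_ip_Xjp (hN : 4 < N) (n : ℕ) :
    √(ip N (fun x => (Xjp N n).eval x) (fun x => (Xjp N n).eval x)) ≤ nu N n := by
  rw [Real.sqrt_le_left (nu_pos hN n).le]
  have h := ip_lamV hN (fun x _ => polyDeriv (derivative (jp N n)) x)
    (Polynomial.continuous _).continuousOn (fun x _ => polyDeriv (jp N n) x)
    (Polynomial.continuous _).continuousOn
  have h2 : ip N (fun x => lamV N x ((derivative (jp N n)).eval x)
      ((derivative (derivative (jp N n))).eval x)) (fun x => (jp N n).eval x) = lam N n := by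
    simp only [jp_eigen]
    rw [ip_smul_left, ip_jp_self hN, mul_one]
  rw [h2] at h
  have h3 : ip N (fun x => (Xjp N n).eval x) (fun x => (Xjp N n).eval x) ≤ lam N n := by
    rw [h]
    refine ip_mono hN (Polynomial.continuous _).continuousOn (Polynomial.continuous _).continuousOn
      (Continuous.continuousOn (by fun_prop)) (Polynomial.continuous _).continuousOn fun x hx => ?_
    rw [eval_Xjp]
    have h0 : 0 ≤ x * (1 - x) := mul_nonneg hx.1 (by linarith [hx.2])
    have h1 : x * (1 - x) ≤ 1 := by nlinarith [hx.1, hx.2]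
    have : 0 ≤ x * (1 - x) * ((derivative (jp N n)).eval x) ^ 2 := by positivity
    nlinarith
  rw [lam_eq] at h3
  nlinarith [sq_nonneg (kap N)]

lemma continuousOn_mul_one_sub : ContinuousOn (fun x : ℝ => x * (1 - x)) (Icc 0 1) := by fun_prop

/-- Integration by parts for `x(1-x)∂ₓ`. -/
lemma ip_X_add (hN : 4 < N) {f f' g g' : ℝ → ℝ}
    (hf : ∀ x ∈ Icc (0 : ℝ) 1, HasDerivAt f (f' x) x) (hf' : ContinuousOn f' (Icc 0 1))
    (hg : ∀ x ∈ Icc (0 : ℝ) 1, HasDerivAt g (g' x) x) (hg' : ContinuousOn g' (Icc 0 1)) :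
    ip N (fun x => x * (1 - x) * f' x) g + ip N (fun x => x * (1 - x) * g' x) f
      = - ip N (fun x => bb N x * f x) g := by
  have hfc : ContinuousOn f (Icc 0 1) := fun x hx => (hf x hx).continuousAt.continuousWithinAt
  have hgc : ContinuousOn g (Icc 0 1) := fun x hx => (hg x hx).continuousAt.continuousWithinAt
  have hb := (continuous_bb (N := N)).continuousOn (s := Icc 0 1)
  have hx := continuousOn_mul_one_sub
  have h := integral_wtX_deriv hN (fun x hx => (hf x hx).mul (hg x hx))
    ((hf'.mul hgc).add (hfc.mul hg'))
  have e : ip N (fun x => x * (1 - x) * f' x) g + ip N (fun x => x * (1 - x) * g' x) f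
      + ip N (fun x => bb N x * f x) g = 0 := by
    rw [← h]
    unfold ip
    rw [← intervalIntegral.integral_add (ip_intervalIntegrable hN (hx.fun_mul hf') hgc)
      (ip_intervalIntegrable hN (hx.fun_mul hg') hfc), ← intervalIntegral.integral_add
      ((ip_intervalIntegrable hN (hx.fun_mul hf') hgc).add
      (ip_intervalIntegrable hN (hx.fun_mul hg') hfc)) (ip_intervalIntegrable hN (hb.fun_mul hfc) hgc)]
    congr 1
    ext x
    simp only [Pi.mul_apply]
    ring
  linarith

lemma ip_poly_eq_zero (hN : 4 < N) {n : ℕ} {p : ℝ[X]} (hp : p.natDegree < n) :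
    ip N (fun x => p.eval x) (fun x => (jp N n).eval x) = 0 := jc_poly_eq_zero hN hp

/-- Entries of multiplication operators are small off the diagonal. -/
lemma ip_mul_jp_le (hN : 4 < N) {f : ℝ → ℝ} (hf : ContinuousOn f (Icc 0 1)) {p : ℝ[X]} {ε : ℝ}
    (hp : ∀ x ∈ Icc (0 : ℝ) 1, |f x - p.eval x| ≤ ε) {j k : ℕ}
    (hd : p = 0 ∨ p.natDegree < Nat.dist j k) :
    |ip N (fun x => f x * (jp N k).eval x) (fun x => (jp N j).eval x)| ≤ ε := by
  have cp := fun q : ℝ[X] => q.continuous.continuousOn (s := Icc 0 1)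
  have h0 : ip N (fun x => p.eval x * (jp N k).eval x) (fun x => (jp N j).eval x) = 0 := by
    rcases hd with rfl | hd
    · simp [ip]
    · have e : Nat.dist j k = j - k + (k - j) := rfl
      rcases lt_or_ge k j with h | h
      · have := ip_poly_eq_zero hN (n := j) (p := p * jp N k) (by
          refine natDegree_mul_le.trans_lt ?_
          rw [natDegree_jp hN]; omega)
        simpa only [eval_mul] using this
      · have := ip_poly_eq_zero hN (n := k) (p := p * jp N j) (by
          refine natDegree_mul_le.trans_lt ?_
          rw [natDegree_jp hN]; omega)
        rw [← this]
        unfold ip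
        congr 1; ext x; simp only [eval_mul]; ring
  have h1 := ip_mul_bound hN (f := fun x => (jp N k).eval x) (g := fun x => (jp N j).eval x)
    (hf.fun_sub (cp p)) (cp _) (cp _) hp
  rw [ip_jp_self hN, ip_jp_self hN, Real.sqrt_one, mul_one, mul_one] at h1
  have h2 := ip_sub_left hN (hf.fun_mul (cp (jp N k))) ((cp p).fun_mul (cp (jp N k))) (cp (jp N j))
  rw [h0, sub_zero] at h2
  rw [← h2]
  simpa only [sub_mul] using h1

lemma ip_mul_Xjp_le (hN : 4 < N) {f : ℝ → ℝ} (hf : ContinuousOn f (Icc 0 1)) {p : ℝ[X]} {ε : ℝ}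
    (hp : ∀ x ∈ Icc (0 : ℝ) 1, |f x - p.eval x| ≤ ε) {j k : ℕ}
    (hd : p = 0 ∨ p.natDegree + 1 < Nat.dist j k) :
    |ip N (fun x => f x * (Xjp N k).eval x) (fun x => (jp N j).eval x)| ≤ ε * nu N k := by
  have hε : 0 ≤ ε := (abs_nonneg _).trans (hp 0 (by simp))
  have cp := fun q : ℝ[X] => q.continuous.continuousOn (s := Icc 0 1)
  have h0 : ip N (fun x => p.eval x * (Xjp N k).eval x) (fun x => (jp N j).eval x) = 0 := by
    rcases hd with rfl | hd
    · simp [ip]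
    · have e : Nat.dist j k = j - k + (k - j) := rfl
      rcases lt_or_ge k j with h | h
      · have := ip_poly_eq_zero hN (n := j) (p := p * Xjp N k) (by
          refine natDegree_mul_le.trans_lt ?_
          have := natDegree_Xjp hN k
          omega)
        simpa only [eval_mul] using this
      · have hx := ip_X_add hN (fun x _ => polyDeriv (jp N k) x) (cp _)
          (fun x _ => polyDeriv (p * jp N j) x) (cp _)
        have dp : (p * jp N j).natDegree ≤ p.natDegree + j :=
          natDegree_mul_le.trans_eq (by rw [natDegree_jp hN])
        have d1 : (X * (1 - X) * derivative (p * jp N j)).natDegree < k := by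
          have := natDegree_X_derivative (p * jp N j)
          omega
        have d2 : ((C (5 / 2) * (1 - X) - C (N / 2) * X) * (p * jp N j)).natDegree < k := by
          refine natDegree_mul_le.trans_lt ?_
          have h1 : (C (5 / 2) * (1 - X) - C (N / 2) * X : ℝ[X]).natDegree ≤ 1 := by
            compute_degree
          omega
        have z1 := ip_poly_eq_zero hN d1
        have z2 := ip_poly_eq_zero hN d2
        have e1 : ip N (fun x => x * (1 - x) * (derivative (p * jp N j)).eval x)
            (fun x => (jp N k).eval x) = 0 := by
          rw [← z1]; congr 1; ext x; simp
        have e2 : ip N (fun x => bb N x * (jp N k).eval x)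
            (fun x => (p * jp N j).eval x) = 0 := by
          rw [← z2]; unfold ip bb; congr 1; ext x; simp only [eval_mul, eval_sub, eval_C, eval_X, eval_one]; ring
        rw [e1, e2, add_zero, neg_zero] at hx
        rw [← hx]
        unfold ip; congr 1; ext x; simp only [eval_Xjp, eval_mul]; ring
  have h1 := ip_mul_bound hN (f := fun x => (Xjp N k).eval x) (g := fun x => (jp N j).eval x)
    (hf.fun_sub (cp p)) (cp _) (cp _) hp
  rw [ip_jp_self hN, Real.sqrt_one, mul_one] at h1
  have h2 := ip_sub_left hN (hf.fun_mul (cp (Xjp N k))) ((cp p).fun_mul (cp (Xjp N k))) (cp (jp N j))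
  rw [h0, sub_zero] at h2
  rw [← h2]
  refine le_trans ?_ (mul_le_mul_of_nonneg_left (sqrt_ip_Xjp hN k) hε)
  simpa only [sub_mul] using h1

/-- The off-diagonal decay profile. -/
noncomputable def mu (s : ℕ) (Θ : ℝ) (d : ℕ) : ℝ := ((1 + d : ℝ) ^ 4 * (1 + d / Θ) ^ s)⁻¹

/-- `f` is approximated by polynomials at the rate `mu s Θ`. -/
def Ap (M : ℝ) (s : ℕ) (Θ : ℝ) (f : ℝ → ℝ) : Prop :=
  ContinuousOn f (Icc 0 1) ∧ (∀ x ∈ Icc (0 : ℝ) 1, |f x| ≤ M) ∧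
    ∀ n : ℕ, ∃ p : ℝ[X], p.natDegree ≤ n ∧ ∀ x ∈ Icc (0 : ℝ) 1, |f x - p.eval x| ≤ M * mu s Θ n

lemma mu_pos {Θ : ℝ} (hΘ : 1 ≤ Θ) (s d : ℕ) : 0 < mu s Θ d := by
  have : 0 < Θ := by linarith
  unfold mu; positivity

lemma mu_le {Θ : ℝ} (hΘ : 1 ≤ Θ) (s : ℕ) {d e : ℕ} (h : (1 + d : ℝ) ≤ 3 * (1 + e))
    (h2 : (d : ℝ) ≤ 2 + e) :
    mu s Θ e ≤ 3 ^ (4 + s) * mu s Θ d := by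
  have h0 : 0 < Θ := by linarith
  unfold mu
  rw [← div_eq_mul_inv, inv_eq_one_div, div_le_div_iff₀ (by positivity) (by positivity), one_mul,
    pow_add]
  have h1 : 1 + d / Θ ≤ 3 * (1 + e / Θ) := by
    have : (d : ℝ) / Θ ≤ (2 + e) / Θ := by gcongr
    have h3 : (2 : ℝ) / Θ ≤ 2 := by rw [div_le_iff₀ h0]; linarith
    have h4 : 0 ≤ (e : ℝ) / Θ := by positivity
    rw [add_div] at this
    linarith
  calc _ ≤ (3 * (1 + e : ℝ)) ^ 4 * (3 * (1 + e / Θ)) ^ s := by gcongr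
    _ = _ := by rw [mul_pow, mul_pow]; ring

lemma Ap.tail {M Θ : ℝ} {s : ℕ} {f : ℝ → ℝ} (hΘ : 1 ≤ Θ) (h : Ap M s Θ f) (d : ℕ) :
    ∃ p : ℝ[X], (p = 0 ∨ p.natDegree + 1 < d) ∧
      ∀ x ∈ Icc (0 : ℝ) 1, |f x - p.eval x| ≤ 3 ^ (4 + s) * M * mu s Θ d := by
  have hM0 : 0 ≤ M := (abs_nonneg _).trans (h.2.1 0 (by simp))
  rcases lt_or_ge d 2 with hd | hd
  · refine ⟨0, Or.inl rfl, fun x hx => ?_⟩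
    rw [eval_zero, sub_zero]
    have hd' : (d : ℝ) ≤ 1 := by exact_mod_cast Nat.lt_succ_iff.1 hd
    have := mu_le hΘ s (d := d) (e := 0) (by push_cast; linarith) (by push_cast; linarith)
    have h1 : mu s Θ 0 = 1 := by simp [mu]
    rw [h1] at this
    nlinarith [h.2.1 x hx, mul_le_mul_of_nonneg_left this hM0]
  · obtain ⟨p, hp, hb⟩ := h.2.2 (d - 2)
    refine ⟨p, Or.inr (by omega), fun x hx => (hb x hx).trans ?_⟩
    have hc : ((d - 2 : ℕ) : ℝ) = d - 2 := by push_cast [hd]; ring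
    have hd' : (2 : ℝ) ≤ d := by exact_mod_cast hd
    have := mu_le hΘ s (d := d) (e := d - 2) (by rw [hc]; linarith) (by rw [hc]; linarith)
    nlinarith [mul_le_mul_of_nonneg_left this hM0]

lemma Ap.mat {M Θ : ℝ} {s : ℕ} {f : ℝ → ℝ} (hN : 4 < N) (hΘ : 1 ≤ Θ) (h : Ap M s Θ f) (j k : ℕ) :
    |ip N (fun x => f x * (jp N k).eval x) (fun x => (jp N j).eval x)|
      ≤ 3 ^ (4 + s) * M * mu s Θ (Nat.dist j k) ∧
    |ip N (fun x => f x * (Xjp N k).eval x) (fun x => (jp N j).eval x)|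
      ≤ 3 ^ (4 + s) * M * mu s Θ (Nat.dist j k) * nu N k := by
  obtain ⟨p, hp, hb⟩ := h.tail hΘ (Nat.dist j k)
  exact ⟨ip_mul_jp_le hN h.1 hb (hp.imp_right fun h => by omega), ip_mul_Xjp_le hN h.1 hb hp⟩

lemma ip_Xjp_add (hN : 4 < N) {f f' : ℝ → ℝ} (hf : ∀ x ∈ Icc (0 : ℝ) 1, HasDerivAt f (f' x) x)
    (hf' : ContinuousOn f' (Icc 0 1)) (j k : ℕ) :
    ip N (fun x => f x * (Xjp N k).eval x) (fun x => (jp N j).eval x) +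
    ip N (fun x => f x * (Xjp N j).eval x) (fun x => (jp N k).eval x) =
    - ip N (fun x => (x * (1 - x) * f' x + bb N x * f x) * (jp N k).eval x)
      (fun x => (jp N j).eval x) := by
  have cp := fun q : ℝ[X] => q.continuous.continuousOn (s := Icc 0 1)
  have hfc : ContinuousOn f (Icc 0 1) := fun x hx => (hf x hx).continuousAt.continuousWithinAt
  have h := ip_X_add hN (f := fun x => f x * (jp N k).eval x) (fun x hx => (hf x hx).mul (polyDeriv (jp N k) x))
    ((hf'.fun_mul (cp _)).fun_add (hfc.fun_mul (cp _))) (fun x _ => polyDeriv (jp N j) x) (cp _)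
  have hb := (continuous_bb (N := N)).continuousOn (s := Icc 0 1)
  have hx := continuousOn_mul_one_sub
  have e1 : ip N (fun x => x * (1 - x) * (f' x * (jp N k).eval x + f x * (derivative (jp N k)).eval x))
      (fun x => (jp N j).eval x) =
      ip N (fun x => x * (1 - x) * f' x * (jp N k).eval x) (fun x => (jp N j).eval x)
      + ip N (fun x => f x * (Xjp N k).eval x) (fun x => (jp N j).eval x) := by
    rw [← ip_add_left hN ((hx.fun_mul hf').fun_mul (cp _)) (hfc.fun_mul (cp _)) (cp _)]
    congr 1; ext x; simp only [eval_Xjp]; ring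
  have e2 : ip N (fun x => x * (1 - x) * (derivative (jp N j)).eval x)
      (fun x => f x * (jp N k).eval x) =
      ip N (fun x => f x * (Xjp N j).eval x) (fun x => (jp N k).eval x) := by
    unfold ip; congr 1; ext x; simp only [eval_Xjp]; ring
  have e3 : ip N (fun x => (x * (1 - x) * f' x + bb N x * f x) * (jp N k).eval x)
      (fun x => (jp N j).eval x) =
      ip N (fun x => x * (1 - x) * f' x * (jp N k).eval x) (fun x => (jp N j).eval x)
      + ip N (fun x => bb N x * (f x * (jp N k).eval x)) (fun x => (jp N j).eval x) := by
    rw [← ip_add_left hN ((hx.fun_mul hf').fun_mul (cp _)) (hb.fun_mul (hfc.fun_mul (cp _))) (cp _)]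
    congr 1; ext x; ring
  have h' : ip N (fun x => x * (1 - x) * (f' x * (jp N k).eval x + f x * (derivative (jp N k)).eval x))
      (fun x => (jp N j).eval x) + ip N (fun x => x * (1 - x) * (derivative (jp N j)).eval x)
      (fun x => f x * (jp N k).eval x) =
      - ip N (fun x => bb N x * (f x * (jp N k).eval x)) (fun x => (jp N j).eval x) := h
  rw [e1, e2] at h'
  rw [e3]
  linarith

/-- Polynomial growth constants for the orthonormal polynomials. -/
structure JB (N C : ℝ) (c : ℕ) : Prop where
  hN : 4 < N
  one_le : 1 ≤ C
  two_le : 2 ≤ c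
  bound : ∀ i j : ℕ, ∀ x ∈ Icc (0 : ℝ) 1,
    |(derivative^[i] (jp N j)).eval x| ≤ C * 4 ^ i * (1 + j : ℝ) ^ (c + 2 * i)
  bound_iter : ∀ i j k : ℕ, ∀ θ, |iteratedDeriv k (fun θ => (derivative^[i] (jp N j)).eval (xc θ)) θ|
    ≤ C * 4 ^ i * (1 + j : ℝ) ^ (c + 2 * i + k)

/-- Constant in the polynomial approximation theorem. -/
structure JS (S : ℝ) : Prop where
  one_le : 1 ≤ S
  approx : ∀ (k : ℕ) (f : ℝ → ℝ) (B : ℝ), ContDiff ℝ ∞ (fun θ => f (xc θ)) →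
    (∀ θ, |iteratedDeriv (k + 2) (fun θ => f (xc θ)) θ| ≤ B) → ∀ n : ℕ,
    ∃ p : ℝ[X], p.natDegree ≤ n ∧ ∀ x ∈ Icc (0 : ℝ) 1, |f x - p.eval x| ≤ S * B / (1 + n : ℝ) ^ k

lemma exists_JB (hN : 4 < N) : ∃ C c, JB N C c := by
  obtain ⟨C, hC, c, hc, h1, h2⟩ := jp_bound hN
  exact ⟨C, c, hN, hC, hc, h1, h2⟩

lemma exists_JS : ∃ S, JS S := by
  obtain ⟨S, hS, h⟩ := jackson
  exact ⟨S, hS, h⟩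

lemma continuousOn_of_comp_xc {f : ℝ → ℝ} (h : Continuous fun θ => f (xc θ)) :
    ContinuousOn f (Icc 0 1) :=
  (h.comp (by fun_prop : Continuous fun x : ℝ => arccos (1 - 2 * x))).continuousOn.congr fun x hx =>
    congrArg f (xc_arccos hx).symm

lemma Cl.continuousOn {k : ℕ} {B Θ : ℝ} {f : ℝ → ℝ} (h : Cl k B Θ (fun θ => f (xc θ))) :
    ContinuousOn f (Icc 0 1) := continuousOn_of_comp_xc h.1.continuous

lemma Cl.abs_le_on {k : ℕ} {B Θ : ℝ} {f : ℝ → ℝ} (h : Cl k B Θ (fun θ => f (xc θ))) :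
    ∀ x ∈ Icc (0 : ℝ) 1, |f x| ≤ B := by
  intro x hx
  obtain ⟨θ, rfl⟩ := exists_xc hx
  exact h.abs_le θ

lemma Cl.approx {S : ℝ} (hS : JS S) {k : ℕ} {B Θ : ℝ} {f : ℝ → ℝ}
    (h : Cl (k + 2) B Θ (fun θ => f (xc θ))) (n : ℕ) :
    ∃ p : ℝ[X], p.natDegree ≤ n ∧
      ∀ x ∈ Icc (0 : ℝ) 1, |f x - p.eval x| ≤ S * (B * Θ ^ (k + 2)) / (1 + n : ℝ) ^ k :=
  hS.approx k f _ h.1 (h.2 (k + 2) le_rfl) n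

/-- Combining a low-order bound at scale `1` with a high-order bound at scale `Θ`. -/
lemma Ap.of_cl {S : ℝ} (hS : JS S) (s : ℕ) {B Θ : ℝ} {f : ℝ → ℝ} (hΘ : 1 ≤ Θ)
    (h1 : Cl 16 B 1 (fun θ => f (xc θ))) (h2 : Cl (2 * s + 2) B Θ (fun θ => f (xc θ))) :
    Ap (2 ^ s * S * B) s Θ f := by
  have hB := h1.nonneg
  have hS1 := hS.one_le
  have h0 : 0 < Θ := by linarith
  refine ⟨h1.continuousOn, fun x hx => (h1.abs_le_on x hx).trans ?_, fun n => ?_⟩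
  · have : (1 : ℝ) ≤ 2 ^ s := one_le_pow₀ (by norm_num)
    have h3 : 1 ≤ 2 ^ s * S := by nlinarith
    nlinarith
  obtain ⟨p, hp, hpb⟩ := h1.approx (k := 14) hS n
  obtain ⟨q, hq, hqb⟩ := h2.approx hS n
  rw [one_pow, mul_one] at hpb
  have hn0 : (0 : ℝ) ≤ n := Nat.cast_nonneg n
  have hmu := mu_pos hΘ s n
  rcases le_or_gt (n : ℝ) Θ with hn | hn
  · refine ⟨p, hp, fun x hx => (hpb x hx).trans ?_⟩
    have e1 : (1 : ℝ) / (1 + n) ^ 14 ≤ 2 ^ s * mu s Θ n := by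
      unfold mu
      rw [← div_eq_mul_inv, div_le_div_iff₀ (by positivity) (by positivity), one_mul]
      have : 1 + n / Θ ≤ 2 := by
        have : n / Θ ≤ 1 := (div_le_one h0).2 hn
        linarith
      calc (1 + n : ℝ) ^ 4 * (1 + n / Θ) ^ s ≤ (1 + n : ℝ) ^ 14 * 2 ^ s := by
            gcongr
            · linarith
            · norm_num
        _ = _ := by ring
    calc S * B / (1 + n : ℝ) ^ 14 = S * B * (1 / (1 + n) ^ 14) := by ring
      _ ≤ S * B * (2 ^ s * mu s Θ n) := by gcongr
      _ = _ := by ring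
  · have key : (S * B / (1 + n : ℝ) ^ 14) * (S * (B * Θ ^ (2 * s + 2)) / (1 + n : ℝ) ^ (2 * s))
        ≤ (2 ^ s * S * B * mu s Θ n) * (2 ^ s * S * B * mu s Θ n) := by
      have hr : 1 + n / Θ ≤ 2 * (1 + n) / Θ := by
        rw [le_div_iff₀ h0]; field_simp; nlinarith
      have hm : (Θ / (2 * (1 + n))) ^ s / (1 + n) ^ 4 ≤ mu s Θ n := by
        have h5 : Θ / (2 * (1 + n)) ≤ (1 + n / Θ)⁻¹ := by
          rw [← inv_div]; exact inv_anti₀ (by positivity) hr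
        unfold mu
        rw [mul_inv, ← inv_pow (1 + n / Θ), div_eq_mul_inv, mul_comm]
        exact mul_le_mul_of_nonneg_left (pow_le_pow_left₀ (by positivity) h5 s) (by positivity)
      have hΘn : Θ ^ 2 / (1 + n) ^ 14 ≤ 1 / (1 + n : ℝ) ^ 8 := by
        rw [div_le_div_iff₀ (by positivity) (by positivity), one_mul]
        calc Θ ^ 2 * (1 + n : ℝ) ^ 8 ≤ (1 + n) ^ 2 * (1 + n) ^ 8 := by gcongr; linarith
          _ = (1 + n : ℝ) ^ 10 := by ring
          _ ≤ _ := pow_le_pow_right₀ (by linarith) (by norm_num)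
      calc _ = (S * B) ^ 2 * (Θ ^ 2 / (1 + n) ^ 14) * ((Θ / (1 + n)) ^ s) ^ 2 := by
            rw [← pow_mul, div_pow, mul_comm s 2, pow_add]; ring
        _ ≤ (S * B) ^ 2 * (1 / (1 + n) ^ 8) * ((Θ / (1 + n)) ^ s) ^ 2 := by gcongr
        _ = (2 ^ s * S * B * ((Θ / (2 * (1 + n))) ^ s / (1 + n) ^ 4)) *
            (2 ^ s * S * B * ((Θ / (2 * (1 + n))) ^ s / (1 + n) ^ 4)) := by
            rw [show Θ / (2 * (1 + (n : ℝ))) = (Θ / (1 + n)) / 2 by field_simp, div_pow _ (2 : ℝ)]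
            field_simp
        _ ≤ _ := by gcongr
    have hT : 0 ≤ 2 ^ s * S * B * mu s Θ n := by positivity
    rcases le_total (S * B / (1 + n : ℝ) ^ 14)
      (S * (B * Θ ^ (2 * s + 2)) / (1 + n : ℝ) ^ (2 * s)) with h | h
    · refine ⟨p, hp, fun x hx => (hpb x hx).trans ?_⟩
      have h3 : 0 ≤ S * B / (1 + n : ℝ) ^ 14 := by positivity
      exact abs_le_of_sq_le_sq' (by nlinarith) hT |>.2
    · refine ⟨q, hq, fun x hx => (hqb x hx).trans ?_⟩
      have h3 : 0 ≤ S * (B * Θ ^ (2 * s + 2)) / (1 + n : ℝ) ^ (2 * s) := by positivity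
      exact abs_le_of_sq_le_sq' (by nlinarith) hT |>.2

lemma jc_sub (hN : 4 < N) (j : ℕ) {f g : ℝ → ℝ} (hf : ContinuousOn f (Icc 0 1))
    (hg : ContinuousOn g (Icc 0 1)) : jc N j (fun x => f x - g x) = jc N j f - jc N j g :=
  ip_sub_left hN hf hg (Polynomial.continuous _).continuousOn

lemma jc_decay {S : ℝ} (hN : 4 < N) (hS : JS S) {k : ℕ} {B Θ : ℝ} {f : ℝ → ℝ} (hΘ : 1 ≤ Θ)
    (h : Cl (k + 2) B Θ (fun θ => f (xc θ))) (j : ℕ) :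
    |jc N j f| ≤ 2 ^ k * S * (B * Θ ^ (k + 2)) / (1 + j : ℝ) ^ k := by
  have hB := h.nonneg
  have hS1 := hS.one_le
  have h2k : (1 : ℝ) ≤ 2 ^ k := one_le_pow₀ (by norm_num)
  have hΘk : (1 : ℝ) ≤ Θ ^ (k + 2) := one_le_pow₀ hΘ
  rcases Nat.eq_zero_or_pos j with rfl | hj
  · refine (abs_jc_le hN 0 h.continuousOn h.abs_le_on).trans ?_
    simp only [CharP.cast_eq_zero, add_zero, one_pow, div_one]
    calc B = 1 * 1 * (B * 1) := by ring
      _ ≤ _ := by gcongr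
  · obtain ⟨p, hp, hb⟩ := h.approx hS (j - 1)
    have e := jc_sub hN j h.continuousOn p.continuous.continuousOn
    rw [jc_poly_eq_zero hN (by omega), sub_zero] at e
    rw [← e]
    refine (abs_jc_le hN j (h.continuousOn.fun_sub p.continuous.continuousOn) hb).trans ?_
    have hj1 : (1 : ℝ) ≤ j := by exact_mod_cast hj
    rw [Nat.cast_sub hj, Nat.cast_one, show (1 + ((j : ℝ) - 1)) = j by ring, div_le_div_iff₀
      (by positivity) (by positivity)]
    calc S * (B * Θ ^ (k + 2)) * (1 + j : ℝ) ^ k ≤ S * (B * Θ ^ (k + 2)) * (2 * j) ^ k := by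
          gcongr; linarith
      _ = _ := by rw [mul_pow]; ring

lemma summable_sq : Summable fun j : ℕ => ((1 + j : ℝ) ^ 2)⁻¹ := by
  have := (summable_nat_add_iff 1).2 (Real.summable_nat_pow_inv.2 (by norm_num : 1 < 2))
  refine this.congr fun j => ?_
  push_cast; rw [add_comm]

noncomputable def Z2 : ℝ := ∑' j : ℕ, ((1 + j : ℝ) ^ 2)⁻¹

lemma Z2_ge : 1 ≤ Z2 := by
  have := summable_sq.le_tsum 0 (fun j _ => by positivity)
  simpa [Z2] using this

lemma summable_of_decay {g : ℕ → ℝ} {A : ℝ} (h : ∀ j : ℕ, |g j| ≤ A / (1 + j : ℝ) ^ 2) :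
    Summable g :=
  Summable.of_norm_bounded (summable_sq.mul_left A) fun j => by
    rw [Real.norm_eq_abs]; exact (h j).trans_eq (div_eq_mul_inv _ _)

lemma tail_bound {g : ℕ → ℝ} {A : ℝ} {k : ℕ} (h : ∀ j : ℕ, |g j| ≤ A / (1 + j : ℝ) ^ (k + 2))
    (n : ℕ) : |∑' j, g (j + (n + 1))| ≤ A * Z2 / (1 + n : ℝ) ^ k := by
  have hA : 0 ≤ A := by have := (abs_nonneg _).trans (h 0); simpa using this
  have hs : HasSum (fun j : ℕ => A / (1 + n : ℝ) ^ k * ((1 + j : ℝ) ^ 2)⁻¹)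
    (A / (1 + n : ℝ) ^ k * Z2) := summable_sq.hasSum.mul_left _
  have := tsum_of_norm_bounded (f := fun j => g (j + (n + 1))) hs fun j => by
    rw [Real.norm_eq_abs]
    refine (h _).trans ?_
    rw [← div_eq_mul_inv, div_div]
    push_cast
    rw [pow_add]
    have hj : (0 : ℝ) ≤ j := Nat.cast_nonneg j
    have hn : (0 : ℝ) ≤ n := Nat.cast_nonneg n
    gcongr <;> linarith
  rw [Real.norm_eq_abs] at this
  exact this.trans_eq (by ring)

/-- The orthonormal polynomials and their derivatives in the angular variable. -/
noncomputable def E (N : ℝ) (i j : ℕ) (θ : ℝ) : ℝ := (derivative^[i] (jp N j)).eval (xc θ)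

lemma contDiff_E (i j : ℕ) : ContDiff ℝ ∞ (E N i j) := contDiff_poly_xc _

lemma hasSum_jc {C S : ℝ} {c : ℕ} (hJ : JB N C c) (hS : JS S) {B Θ : ℝ} {f : ℝ → ℝ} (hΘ : 1 ≤ Θ)
    (h : Cl (c + 4) B Θ (fun θ => f (xc θ))) (θ : ℝ) :
    HasSum (fun j => jc N j f * E N 0 j θ) (f (xc θ)) := by
  have hN := hJ.hN
  have hC := hJ.one_le
  have hB := h.nonneg
  have hS1 := hS.one_le
  have hEb : ∀ j : ℕ, ∀ x ∈ Icc (0 : ℝ) 1, |(jp N j).eval x| ≤ C * (1 + j : ℝ) ^ c := by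
    intro j x hx; simpa using hJ.bound 0 j x hx
  have hsum : Summable fun j => jc N j f * E N 0 j θ := by
    apply summable_of_decay (A := 2 ^ (c + 2) * S * (B * Θ ^ (c + 2 + 2)) * C)
    intro j
    rw [abs_mul]
    have h1 := jc_decay hN hS (k := c + 2) hΘ h j
    have h2 : |E N 0 j θ| ≤ C * (1 + j : ℝ) ^ c := hEb j _ (xc_mem θ)
    refine (mul_le_mul h1 h2 (abs_nonneg _) (by positivity)).trans_eq ?_
    rw [pow_add (1 + j : ℝ)]; field_simp
  refine (hsum.hasSum_iff_tendsto_nat).2 ?_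
  rw [← tendsto_add_atTop_iff_nat 1]
  have hb : ∀ n : ℕ, |f (xc θ) - ∑ j ∈ Finset.range (n + 1), jc N j f * E N 0 j θ| ≤
      2 * (S * (B * Θ ^ (c + 2 + 2)) * C) / (1 + n : ℝ) := by
    intro n
    obtain ⟨p, hp, hpb⟩ := h.approx (k := c + 2) hS n
    set e := S * (B * Θ ^ (c + 2 + 2)) / (1 + n : ℝ) ^ (c + 2) with he
    have he0 : 0 ≤ e := by positivity
    have e1 : p.eval (xc θ) = ∑ j ∈ Finset.range (n + 1), jc N j (fun x => p.eval x) * E N 0 j θ := by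
      conv_lhs => rw [← pj_poly hN hp]
      unfold pj E
      simp [eval_finsetSum]
    have e2 : f (xc θ) - ∑ j ∈ Finset.range (n + 1), jc N j f * E N 0 j θ =
        (f (xc θ) - p.eval (xc θ)) -
        ∑ j ∈ Finset.range (n + 1), jc N j (fun x => f x - p.eval x) * E N 0 j θ := by
      have : ∑ j ∈ Finset.range (n + 1), jc N j (fun x => f x - p.eval x) * E N 0 j θ =
          ∑ j ∈ Finset.range (n + 1), jc N j f * E N 0 j θ - p.eval (xc θ) := by
        rw [e1, ← Finset.sum_sub_distrib]
        refine Finset.sum_congr rfl fun j _ => ?_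
        rw [jc_sub hN j h.continuousOn p.continuous.continuousOn]; ring
      rw [this]; ring
    rw [e2]
    have h3 : |∑ j ∈ Finset.range (n + 1), jc N j (fun x => f x - p.eval x) * E N 0 j θ| ≤
        (1 + n) * (e * (C * (1 + n : ℝ) ^ c)) := by
      refine (Finset.abs_sum_le_sum_abs _ _).trans ?_
      have : ∀ j ∈ Finset.range (n + 1), |jc N j (fun x => f x - p.eval x) * E N 0 j θ| ≤
          e * (C * (1 + n : ℝ) ^ c) := by
        intro j hj
        have hjn : (j : ℝ) ≤ n := by exact_mod_cast Nat.lt_succ_iff.1 (Finset.mem_range.1 hj)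
        rw [abs_mul]
        refine mul_le_mul (abs_jc_le hN j (h.continuousOn.fun_sub p.continuous.continuousOn) hpb)
          ((hEb j _ (xc_mem θ)).trans ?_) (abs_nonneg _) he0
        gcongr
      refine (Finset.sum_le_sum this).trans ?_
      rw [Finset.sum_const, Finset.card_range, nsmul_eq_mul]
      push_cast
      exact le_of_eq (by ring)
    have h4 : (1 : ℝ) ≤ (1 + n) ^ (c + 1) := one_le_pow₀ (by linarith [(Nat.cast_nonneg n : (0 : ℝ) ≤ n)])
    calc _ ≤ e + (1 + n) * (e * (C * (1 + n : ℝ) ^ c)) :=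
          (abs_sub _ _).trans (add_le_add (hpb _ (xc_mem θ)) h3)
      _ = e * 1 + e * C * (1 + n : ℝ) ^ (c + 1) := by ring
      _ ≤ e * C * (1 + n : ℝ) ^ (c + 1) + e * C * (1 + n : ℝ) ^ (c + 1) := by
          have : (1 : ℝ) ≤ C * (1 + n : ℝ) ^ (c + 1) := by nlinarith
          nlinarith
      _ = _ := by rw [he, pow_add _ (c + 1) 1]; field_simp; ring
  rw [tendsto_iff_norm_sub_tendsto_zero]
  have hlim : Tendsto (fun n : ℕ => 2 * (S * (B * Θ ^ (c + 2 + 2)) * C) / (1 + n : ℝ)) atTop (nhds 0) := by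
    apply Tendsto.div_atTop tendsto_const_nhds
    exact tendsto_atTop_add_const_left _ _ tendsto_natCast_atTop_atTop
  refine squeeze_zero (fun n => norm_nonneg _) (fun n => ?_) hlim
  rw [Real.norm_eq_abs, abs_sub_comm]
  exact hb n

/-- The truncation error is small, together with its first angular derivative. -/
lemma tail_le {C S : ℝ} {c : ℕ} (hJ : JB N C c) (hS : JS S) {k : ℕ} {B Θ : ℝ} {f : ℝ → ℝ}
    (hΘ : 1 ≤ Θ) (h : Cl (k + c + 5) B Θ (fun θ => f (xc θ))) (n : ℕ) (θ : ℝ) :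
    |f (xc θ) - (pj N n f).eval (xc θ)| ≤
      2 ^ (k + c + 3) * S * C * Z2 * (B * Θ ^ (k + c + 5)) / (1 + n : ℝ) ^ k ∧
    |deriv (fun θ => f (xc θ) - (pj N n f).eval (xc θ)) θ| ≤
      2 ^ (k + c + 3) * S * C * Z2 * (B * Θ ^ (k + c + 5)) / (1 + n : ℝ) ^ k := by
  have hN := hJ.hN
  have hC := hJ.one_le
  have hB := h.nonneg
  have hS1 := hS.one_le
  have h0 : (0 : ℝ) ≤ Θ := by linarith
  have hpj : ∀ θ, (pj N n f).eval (xc θ) =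
      ∑ j ∈ Finset.range (n + 1), jc N j f * E N 0 j θ := by
    intro θ; unfold pj E; simp [eval_finsetSum]
  have heq : ∀ θ, f (xc θ) - (pj N n f).eval (xc θ) =
      ∑' j, jc N (j + (n + 1)) f * E N 0 (j + (n + 1)) θ := by
    intro θ
    have hs := hasSum_jc hJ hS hΘ (h.of_le (by omega)) θ
    rw [hpj, ← hs.tsum_eq, ← hs.summable.sum_add_tsum_nat_add (n + 1)]
    ring
  have hd : ∀ m : ℕ, m ≤ 1 → ∀ j θ, |jc N j f * iteratedDeriv m (E N 0 j) θ| ≤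
      2 ^ (k + c + 3) * S * C * (B * Θ ^ (k + c + 5)) / (1 + j : ℝ) ^ (k + 2) := by
    intro m hm j θ
    rw [abs_mul]
    have h1 := jc_decay hN hS (k := k + c + 3) hΘ h j
    have h2 : |iteratedDeriv m (E N 0 j) θ| ≤ C * (1 + j : ℝ) ^ (c + 1) := by
      refine (hJ.bound_iter 0 j m θ).trans ?_
      have : (1 : ℝ) ≤ 1 + j := by linarith [(Nat.cast_nonneg j : (0 : ℝ) ≤ j)]
      rw [pow_zero, mul_one]
      exact mul_le_mul_of_nonneg_left (pow_le_pow_right₀ this (by omega)) (by positivity)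
    refine (mul_le_mul h1 h2 (abs_nonneg _) (by positivity)).trans_eq ?_
    rw [show k + c + 3 = (c + 1) + (k + 2) by ring, pow_add (1 + j : ℝ), ]; field_simp; ring_nf
  constructor
  · rw [heq]
    have := tail_bound (g := fun j => jc N j f * E N 0 j θ) (fun j => by
      simpa using hd 0 (by norm_num) j θ) n
    exact this.trans_eq (by ring)
  · rw [funext heq]
    have hu : Summable fun j : ℕ => 2 ^ (k + c + 3) * S * C * (B * Θ ^ (k + c + 5)) /
        (1 + (j + (n + 1) : ℕ) : ℝ) ^ (k + 2) := by
      refine (summable_nat_add_iff (f := fun j : ℕ => 2 ^ (k + c + 3) * S * C * (B * Θ ^ (k + c + 5)) /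
        (1 + j : ℝ) ^ (k + 2)) (n + 1)).2 (summable_of_decay
        (A := 2 ^ (k + c + 3) * S * C * (B * Θ ^ (k + c + 5))) fun j => ?_)
      rw [abs_of_nonneg (by positivity)]
      have : (1 : ℝ) ≤ 1 + j := by linarith [(Nat.cast_nonneg j : (0 : ℝ) ≤ j)]
      exact div_le_div_of_nonneg_left (by positivity) (by positivity)
        (pow_le_pow_right₀ this (by omega))
    have hE : ∀ j θ, HasDerivAt (fun θ => jc N j f * E N 0 j θ)
        (jc N j f * iteratedDeriv 1 (E N 0 j) θ) θ := by
      intro j θ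
      rw [iteratedDeriv_one]
      exact ((contDiff_E 0 j).differentiable (by simp) θ).hasDerivAt.const_mul _
    have hsm := (hasSum_jc hJ hS hΘ (h.of_le (by omega)) 0).summable
    rw [(hasDerivAt_tsum hu (fun j θ => hE (j + (n + 1)) θ) (fun j θ => by
      rw [Real.norm_eq_abs]; exact hd 1 le_rfl _ θ) ((summable_nat_add_iff (n + 1)).2 hsm) θ).deriv]
    have := tail_bound (g := fun j => jc N j f * iteratedDeriv 1 (E N 0 j) θ)
      (fun j => hd 1 le_rfl j θ) n
    exact this.trans_eq (by ring)

noncomputable def rho (d : ℕ) : ℝ := ((1 + d : ℝ) ^ 2)⁻¹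

lemma rho_nonneg (d : ℕ) : 0 ≤ rho d := by unfold rho; positivity

lemma sum_rho_inj {s : Finset ℕ} {g : ℕ → ℕ} (hg : InjOn g s) : ∑ k ∈ s, rho (g k) ≤ Z2 := by
  rw [← Finset.sum_image (f := rho) hg]
  exact summable_sq.sum_le_tsum _ fun j _ => rho_nonneg j

lemma sum_rho (j : ℕ) (s : Finset ℕ) : ∑ k ∈ s, rho (Nat.dist j k) ≤ 2 * Z2 := by
  rw [← Finset.sum_filter_add_sum_filter_not s (fun k => k ≤ j), two_mul]
  refine add_le_add (sum_rho_inj fun a ha b hb h => ?_) (sum_rho_inj fun a ha b hb h => ?_)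
  all_goals
    simp only [Finset.coe_filter, mem_ofPred_eq] at ha hb
    simp only [Nat.dist] at h
    omega

lemma schur {K : ℝ} {A : ℕ → ℕ → ℝ} (hA : ∀ j k, |A j k| ≤ K * rho (Nat.dist j k))
    (s : Finset ℕ) (x y : ℕ → ℝ) :
    |∑ j ∈ s, ∑ k ∈ s, A j k * (x j * y k)| ≤ K * Z2 * (∑ j ∈ s, x j ^ 2 + ∑ j ∈ s, y j ^ 2) := by
  have hK : 0 ≤ K := by
    have := (abs_nonneg _).trans (hA 0 0)
    simpa [rho] using this
  have h1 : ∀ j k, |A j k * (x j * y k)| ≤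
      K / 2 * (rho (Nat.dist j k) * x j ^ 2) + K / 2 * (rho (Nat.dist k j) * y k ^ 2) := by
    intro j k
    have h2 : |x j * y k| ≤ (x j ^ 2 + y k ^ 2) / 2 := by
      rw [abs_le]; constructor <;> nlinarith [sq_nonneg (x j + y k), sq_nonneg (x j - y k)]
    rw [abs_mul, Nat.dist_comm k j]
    calc _ ≤ (K * rho (Nat.dist j k)) * ((x j ^ 2 + y k ^ 2) / 2) :=
          mul_le_mul (hA j k) h2 (abs_nonneg _) (mul_nonneg hK (rho_nonneg _))
      _ = _ := by ring
  have hsum : ∀ z : ℕ → ℝ, ∑ j ∈ s, ∑ k ∈ s, K / 2 * (rho (Nat.dist j k) * z j ^ 2) ≤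
      K * Z2 * ∑ j ∈ s, z j ^ 2 := by
    intro z
    rw [Finset.mul_sum]
    refine Finset.sum_le_sum fun j _ => ?_
    rw [← Finset.mul_sum, ← Finset.sum_mul]
    have := sum_rho j s
    calc K / 2 * ((∑ k ∈ s, rho (Nat.dist j k)) * z j ^ 2) ≤ K / 2 * ((2 * Z2) * z j ^ 2) := by
          gcongr
      _ = _ := by ring
  calc |∑ j ∈ s, ∑ k ∈ s, A j k * (x j * y k)|
      ≤ ∑ j ∈ s, ∑ k ∈ s, |A j k * (x j * y k)| :=
        (Finset.abs_sum_le_sum_abs _ _).trans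
          (Finset.sum_le_sum fun j _ => Finset.abs_sum_le_sum_abs _ _)
    _ ≤ ∑ j ∈ s, ∑ k ∈ s, (K / 2 * (rho (Nat.dist j k) * x j ^ 2) +
          K / 2 * (rho (Nat.dist k j) * y k ^ 2)) :=
        Finset.sum_le_sum fun j _ => Finset.sum_le_sum fun k _ => h1 j k
    _ = ∑ j ∈ s, ∑ k ∈ s, K / 2 * (rho (Nat.dist j k) * x j ^ 2) +
        ∑ k ∈ s, ∑ j ∈ s, K / 2 * (rho (Nat.dist k j) * y k ^ 2) := by
        rw [Finset.sum_comm (s := s) (t := s) (f := fun k j => K / 2 * (rho (Nat.dist k j) * y k ^ 2)),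
          ← Finset.sum_add_distrib]
        simp only [Finset.sum_add_distrib]
    _ ≤ K * Z2 * ∑ j ∈ s, x j ^ 2 + K * Z2 * ∑ j ∈ s, y j ^ 2 := add_le_add (hsum x) (hsum y)
    _ = _ := by ring

/-- Frequency weight. -/
noncomputable def wg (N Θ : ℝ) (j : ℕ) : ℝ := 1 + nu N j / Θ

lemma wg_ge (hN : 4 < N) {Θ : ℝ} (hΘ : 1 ≤ Θ) (j : ℕ) : 1 ≤ wg N Θ j := by
  have := nu_pos hN j
  unfold wg; have : 0 ≤ nu N j / Θ := by positivity
  linarith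

lemma nu_le_wg {Θ : ℝ} (hΘ : 1 ≤ Θ) (j : ℕ) : nu N j ≤ Θ * wg N Θ j := by
  unfold wg
  rw [mul_add, mul_div_cancel₀ _ (by linarith)]; linarith

lemma dist_cast (j k : ℕ) : |(j : ℝ) - k| = (Nat.dist j k : ℝ) := by
  rcases le_total j k with h | h
  · rw [Nat.dist_eq_sub_of_le h, Nat.cast_sub h, abs_sub_comm, abs_of_nonneg]
    have : (j : ℝ) ≤ k := by exact_mod_cast h
    linarith
  · rw [Nat.dist_comm, Nat.dist_eq_sub_of_le h, Nat.cast_sub h, abs_of_nonneg]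
    have : (k : ℝ) ≤ j := by exact_mod_cast h
    linarith

lemma nu_sub (j k : ℕ) : |nu N j - nu N k| = (Nat.dist j k : ℝ) := by
  rw [← dist_cast]; unfold nu; ring_nf

lemma wg_sub {Θ : ℝ} (hΘ : 1 ≤ Θ) (j k : ℕ) :
    |wg N Θ j - wg N Θ k| = (Nat.dist j k : ℝ) / Θ := by
  rw [← nu_sub (N := N)]
  have : 0 < Θ := by linarith
  unfold wg
  rw [show 1 + nu N j / Θ - (1 + nu N k / Θ) = (nu N j - nu N k) / Θ by ring, abs_div,
    abs_of_pos this]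

lemma wg_le (hN : 4 < N) {Θ : ℝ} (hΘ : 1 ≤ Θ) (j k : ℕ) :
    wg N Θ j ≤ wg N Θ k * (1 + (Nat.dist j k : ℝ) / Θ) := by
  have h1 := le_abs_self (wg N Θ j - wg N Θ k)
  rw [wg_sub hΘ] at h1
  have h2 := wg_ge hN hΘ k
  have : 0 ≤ (Nat.dist j k : ℝ) / Θ := by positivity
  nlinarith

lemma wg_pow_le (hN : 4 < N) {Θ : ℝ} (hΘ : 1 ≤ Θ) (s j k : ℕ) :
    wg N Θ j ^ (2 * s) ≤ wg N Θ j ^ s * wg N Θ k ^ s * (1 + (Nat.dist j k : ℝ) / Θ) ^ s := by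
  have h1 := wg_ge hN hΘ j
  have h2 := pow_le_pow_left₀ (by linarith) (wg_le hN hΘ j k) s
  rw [mul_pow] at h2
  calc wg N Θ j ^ (2 * s) = wg N Θ j ^ s * wg N Θ j ^ s := by ring
    _ ≤ wg N Θ j ^ s * (wg N Θ k ^ s * (1 + (Nat.dist j k : ℝ) / Θ) ^ s) := by gcongr
    _ = _ := by ring

lemma wg_pow_le' (hN : 4 < N) {Θ : ℝ} (hΘ : 1 ≤ Θ) (s j k : ℕ) :
    wg N Θ k ^ (2 * s) ≤ wg N Θ j ^ s * wg N Θ k ^ s * (1 + (Nat.dist j k : ℝ) / Θ) ^ s := by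
  have := wg_pow_le hN hΘ s k j
  rw [Nat.dist_comm] at this
  linarith

lemma wg_diff (hN : 4 < N) {Θ : ℝ} (hΘ : 1 ≤ Θ) (s j k : ℕ) :
    |wg N Θ j ^ (2 * s) - wg N Θ k ^ (2 * s)| * max (nu N j) (nu N k) ≤
      2 * s * (Nat.dist j k : ℝ) *
        (wg N Θ j ^ s * wg N Θ k ^ s * (1 + (Nat.dist j k : ℝ) / Θ) ^ s) := by
  have h0 : 0 < Θ := by linarith
  have h1 := wg_ge hN hΘ j
  have h2 := wg_ge hN hΘ k
  have hp := nu_pos hN j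
  have hmax : max (nu N j) (nu N k) ≤ Θ * max (wg N Θ j) (wg N Θ k) := by
    refine max_le ((nu_le_wg hΘ j).trans ?_) ((nu_le_wg hΘ k).trans ?_)
    · exact mul_le_mul_of_nonneg_left (le_max_left _ _) h0.le
    · exact mul_le_mul_of_nonneg_left (le_max_right _ _) h0.le
  have hd := abs_pow_sub_pow_le (wg N Θ j) (wg N Θ k) (2 * s)
  rw [wg_sub hΘ, abs_of_nonneg (by linarith : 0 ≤ wg N Θ j),
    abs_of_nonneg (by linarith : 0 ≤ wg N Θ k)] at hd
  have hmm : max (wg N Θ j) (wg N Θ k) ^ (2 * s) ≤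
      wg N Θ j ^ s * wg N Θ k ^ s * (1 + (Nat.dist j k : ℝ) / Θ) ^ s := by
    rcases max_choice (wg N Θ j) (wg N Θ k) with h | h <;> rw [h]
    · exact wg_pow_le hN hΘ s j k
    · exact wg_pow_le' hN hΘ s j k
  rcases Nat.eq_zero_or_pos s with rfl | hs
  · simp
  have hm0 : 0 ≤ max (wg N Θ j) (wg N Θ k) := le_max_of_le_left (by linarith)
  calc _ ≤ ((Nat.dist j k : ℝ) / Θ * ((2 * s : ℕ) : ℝ) *
          max (wg N Θ j) (wg N Θ k) ^ (2 * s - 1)) * (Θ * max (wg N Θ j) (wg N Θ k)) :=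
        mul_le_mul hd hmax (le_max_of_le_left hp.le) (by positivity)
    _ = 2 * s * (Nat.dist j k : ℝ) * (max (wg N Θ j) (wg N Θ k) ^ (2 * s - 1 + 1)) := by
        rw [pow_succ]; push_cast; field_simp
    _ ≤ _ := by
        rw [show 2 * s - 1 + 1 = 2 * s by omega]
        exact mul_le_mul_of_nonneg_left hmm (by positivity)

lemma mu_mul {Θ : ℝ} (hΘ : 1 ≤ Θ) (s d : ℕ) :
    mu s Θ d * (1 + d : ℝ) * (1 + d / Θ) ^ s ≤ rho d := by
  have h0 : 0 < Θ := by linarith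
  have : 0 < (1 + d / Θ) ^ s := by positivity
  have e : mu s Θ d * (1 + d : ℝ) * (1 + d / Θ) ^ s = ((1 + d : ℝ) ^ 3)⁻¹ := by
    unfold mu; field_simp
  rw [e]
  unfold rho
  have : (1 : ℝ) ≤ 1 + d := by linarith [(Nat.cast_nonneg d : (0 : ℝ) ≤ d)]
  exact inv_anti₀ (by positivity) (pow_le_pow_right₀ this (by norm_num))

lemma symm_form (s : Finset ℕ) (P : ℕ → ℕ → ℝ) (W C : ℕ → ℝ) :
    2 * ∑ j ∈ s, ∑ k ∈ s, W j * P j k * (C j * C k) =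
      ∑ j ∈ s, ∑ k ∈ s, ((W j - W k) * P j k + W k * (P j k + P k j)) * (C j * C k) := by
  have h : ∑ j ∈ s, ∑ k ∈ s, W j * P j k * (C j * C k) =
      ∑ j ∈ s, ∑ k ∈ s, W k * P k j * (C j * C k) := by
    rw [Finset.sum_comm]
    refine Finset.sum_congr rfl fun j _ => Finset.sum_congr rfl fun k _ => by ring
  rw [two_mul]
  nth_rewrite 2 [h]
  rw [← Finset.sum_add_distrib]
  refine Finset.sum_congr rfl fun j _ => ?_
  rw [← Finset.sum_add_distrib]
  exact Finset.sum_congr rfl fun k _ => by ring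

/-- Weighted forms controlled by Schur's test. -/
lemma weighted_form (hN : 4 < N) {Θ K : ℝ} (hΘ : 1 ≤ Θ) (s : ℕ) {A : ℕ → ℕ → ℝ}
    (hA : ∀ j k, |A j k| ≤ K * rho (Nat.dist j k) * (wg N Θ j ^ s * wg N Θ k ^ s))
    (S : Finset ℕ) (x y : ℕ → ℝ) :
    |∑ j ∈ S, ∑ k ∈ S, A j k * (x j * y k)| ≤
      K * Z2 * (∑ j ∈ S, wg N Θ j ^ (2 * s) * x j ^ 2 + ∑ j ∈ S, wg N Θ j ^ (2 * s) * y j ^ 2) := by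
  have hw : ∀ j, 0 < wg N Θ j ^ s := fun j =>
    pow_pos (by linarith [wg_ge hN hΘ j]) s
  have := schur (K := K) (A := fun j k => A j k / (wg N Θ j ^ s * wg N Θ k ^ s)) (fun j k => by
    rw [abs_div, abs_of_pos (mul_pos (hw j) (hw k)), div_le_iff₀ (mul_pos (hw j) (hw k))]
    exact hA j k) S (fun j => wg N Θ j ^ s * x j) (fun j => wg N Θ j ^ s * y j)
  have e : ∀ z : ℕ → ℝ, ∀ j, (wg N Θ j ^ s * z j) ^ 2 = wg N Θ j ^ (2 * s) * z j ^ 2 := by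
    intro z j; ring
  simp only [e] at this
  refine (le_of_eq (congrArg _ ?_)).trans this
  refine Finset.sum_congr rfl fun j _ => Finset.sum_congr rfl fun k _ => ?_
  have := (hw j).ne'
  have := (hw k).ne'
  field_simp

/-- The energy inequality for the symmetrized matrix system. -/
lemma energy_form (hN : 4 < N) {Θ M : ℝ} (hΘ : 1 ≤ Θ) (hM : 0 ≤ M) (s : ℕ)
    {al P B S : ℕ → ℕ → ℝ}
    (hal : ∀ j k, |al j k| ≤ M * mu s Θ (Nat.dist j k)) (hals : ∀ j k, al j k = al k j)
    (hP : ∀ j k, |P j k| ≤ M * mu s Θ (Nat.dist j k) * nu N j)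
    (hPs : ∀ j k, |P j k + P k j| ≤ M * mu s Θ (Nat.dist j k) * (1 + Nat.dist j k))
    (hB : ∀ j k, |B j k| ≤ M * mu s Θ (Nat.dist j k))
    (hS : ∀ j k, |S j k| ≤ M * mu s Θ (Nat.dist j k) * nu N k)
    (hSs : ∀ j k, |S j k + S k j| ≤ M * mu s Θ (Nat.dist j k) * (1 + Nat.dist j k))
    (I : Finset ℕ) (C D r1 r2 C' D' : ℕ → ℝ)
    (hC : ∀ j ∈ I, C' j = ∑ k ∈ I, (nu N j * al j k * D k + P j k * C k) - r1 j)
    (hD : ∀ j ∈ I, D' j = ∑ k ∈ I, (-(al j k * nu N k * C k) + B j k * C k + S j k * D k) - r2 j) :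
    |∑ j ∈ I, wg N Θ j ^ (2 * s) * (2 * C j * C' j + 2 * D j * D' j)| ≤
      ((8 * s + 4) * Z2 * M + 1) * ∑ j ∈ I, wg N Θ j ^ (2 * s) * (C j ^ 2 + D j ^ 2) +
        ∑ j ∈ I, wg N Θ j ^ (2 * s) * (r1 j ^ 2 + r2 j ^ 2) := by
  set W : ℕ → ℝ := fun j => wg N Θ j ^ (2 * s) with hW
  have h0 : 0 < Θ := by linarith
  have hwp : ∀ j, 0 < wg N Θ j ^ s := fun j => pow_pos (by linarith [wg_ge hN hΘ j]) s
  have hWp : ∀ j, 0 < W j := fun j => pow_pos (by linarith [wg_ge hN hΘ j]) _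
  have hmu : ∀ d, 0 < mu s Θ d := mu_pos hΘ s
  -- difference of weights against a factor `nu`
  have hdiff : ∀ j k (X : ℝ), |X| ≤ M * mu s Θ (Nat.dist j k) * max (nu N j) (nu N k) →
      |(W j - W k) * X| ≤ 2 * s * M * rho (Nat.dist j k) * (wg N Θ j ^ s * wg N Θ k ^ s) := by
    intro j k X hX
    rw [abs_mul]
    calc _ ≤ |W j - W k| * (M * mu s Θ (Nat.dist j k) * max (nu N j) (nu N k)) :=
          mul_le_mul_of_nonneg_left hX (abs_nonneg _)
      _ = M * mu s Θ (Nat.dist j k) * (|W j - W k| * max (nu N j) (nu N k)) := by ring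
      _ ≤ M * mu s Θ (Nat.dist j k) * (2 * s * (Nat.dist j k : ℝ) *
          (wg N Θ j ^ s * wg N Θ k ^ s * (1 + (Nat.dist j k : ℝ) / Θ) ^ s)) :=
          mul_le_mul_of_nonneg_left (wg_diff hN hΘ s j k) (mul_nonneg hM (hmu _).le)
      _ ≤ M * mu s Θ (Nat.dist j k) * (2 * s * (1 + (Nat.dist j k : ℝ)) *
          (wg N Θ j ^ s * wg N Θ k ^ s * (1 + (Nat.dist j k : ℝ) / Θ) ^ s)) := by
          have := (hmu (Nat.dist j k)).le
          have := (hwp j).le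
          have := (hwp k).le
          gcongr; linarith
      _ = 2 * s * M * (mu s Θ (Nat.dist j k) * (1 + (Nat.dist j k : ℝ)) *
          (1 + (Nat.dist j k : ℝ) / Θ) ^ s) * (wg N Θ j ^ s * wg N Θ k ^ s) := by ring
      _ ≤ _ := by
          have := mu_mul hΘ s (Nat.dist j k)
          have := (hwp j).le
          have := (hwp k).le
          gcongr
  have hone : ∀ j k i (X : ℝ), W i ≤ wg N Θ j ^ s * wg N Θ k ^ s *
      (1 + (Nat.dist j k : ℝ) / Θ) ^ s → |X| ≤ M * mu s Θ (Nat.dist j k) * (1 + Nat.dist j k) →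
      |W i * X| ≤ M * rho (Nat.dist j k) * (wg N Θ j ^ s * wg N Θ k ^ s) := by
    intro j k i X hi hX
    rw [abs_mul, abs_of_pos (hWp i)]
    calc _ ≤ (wg N Θ j ^ s * wg N Θ k ^ s * (1 + (Nat.dist j k : ℝ) / Θ) ^ s) *
          (M * mu s Θ (Nat.dist j k) * (1 + Nat.dist j k)) :=
          mul_le_mul hi hX (abs_nonneg _) ((hWp i).le.trans hi)
      _ = M * (mu s Θ (Nat.dist j k) * (1 + (Nat.dist j k : ℝ)) *
          (1 + (Nat.dist j k : ℝ) / Θ) ^ s) * (wg N Θ j ^ s * wg N Θ k ^ s) := by ring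
      _ ≤ _ := by
          have := mu_mul hΘ s (Nat.dist j k)
          have := (hwp j).le
          have := (hwp k).le
          gcongr
  have hq : ∀ (Q : ℕ → ℕ → ℝ), (∀ j k, |Q j k| ≤ M * mu s Θ (Nat.dist j k) * max (nu N j) (nu N k))
      → (∀ j k, |Q j k + Q k j| ≤ M * mu s Θ (Nat.dist j k) * (1 + Nat.dist j k)) → ∀ x : ℕ → ℝ,
      |2 * ∑ j ∈ I, ∑ k ∈ I, W j * Q j k * (x j * x k)| ≤
        (2 * s + 1) * M * Z2 * (2 * ∑ j ∈ I, W j * x j ^ 2) := by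
    intro Q h1 h2 x
    rw [symm_form, two_mul (∑ j ∈ I, W j * x j ^ 2)]
    refine weighted_form hN hΘ s (fun j k => (abs_add_le _ _).trans ?_) I x x
    have e1 := hdiff j k _ (h1 j k)
    have e2 := hone j k k _ (wg_pow_le' hN hΘ s j k) (h2 j k)
    linarith
  have b1 : |∑ j ∈ I, ∑ k ∈ I, ((W j - W k) * (2 * nu N j * al j k)) * (C j * D k)| ≤
      (4 * s * M) * Z2 * (∑ j ∈ I, W j * C j ^ 2 + ∑ j ∈ I, W j * D j ^ 2) := by
    refine weighted_form hN hΘ s (fun j k => ?_) I C D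
    have := hdiff j k (nu N j * al j k) (by
      rw [abs_mul, abs_of_pos (nu_pos hN j), mul_comm]
      exact mul_le_mul (hal j k) (le_max_left _ _) (nu_pos hN j).le
        (mul_nonneg hM (hmu _).le))
    rw [show (W j - W k) * (2 * nu N j * al j k) = 2 * ((W j - W k) * (nu N j * al j k)) by ring,
      abs_mul, abs_of_pos (by norm_num : (0 : ℝ) < 2)]
    linarith
  have b2 := hq P (fun j k => (hP j k).trans (mul_le_mul_of_nonneg_left (le_max_left _ _)
    (mul_nonneg hM (hmu _).le))) hPs C
  have b3 := hq S (fun j k => (hS j k).trans (mul_le_mul_of_nonneg_left (le_max_right _ _)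
    (mul_nonneg hM (hmu _).le))) hSs D
  have b4 : |∑ j ∈ I, ∑ k ∈ I, (2 * (W j * B j k)) * (D j * C k)| ≤
      (2 * M) * Z2 * (∑ j ∈ I, W j * D j ^ 2 + ∑ j ∈ I, W j * C j ^ 2) := by
    refine weighted_form hN hΘ s (fun j k => ?_) I D C
    have := hone j k j (B j k) (wg_pow_le hN hΘ s j k) ((hB j k).trans (by
      have := (hmu (Nat.dist j k)).le
      have h3 : (0 : ℝ) ≤ Nat.dist j k := Nat.cast_nonneg _
      exact le_mul_of_one_le_right (by positivity) (by linarith)))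
    rw [abs_mul, abs_of_pos (by norm_num : (0 : ℝ) < 2)]
    linarith
  have b5 : |∑ j ∈ I, W j * (2 * C j * r1 j + 2 * D j * r2 j)| ≤
      ∑ j ∈ I, W j * (C j ^ 2 + D j ^ 2) + ∑ j ∈ I, W j * (r1 j ^ 2 + r2 j ^ 2) := by
    rw [← Finset.sum_add_distrib]
    refine (Finset.abs_sum_le_sum_abs _ _).trans (Finset.sum_le_sum fun j _ => ?_)
    rw [abs_mul, abs_of_pos (hWp j), ← mul_add]
    refine mul_le_mul_of_nonneg_left ?_ (hWp j).le
    rw [abs_le]; constructor <;> nlinarith [sq_nonneg (C j + r1 j), sq_nonneg (C j - r1 j),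
      sq_nonneg (D j + r2 j), sq_nonneg (D j - r2 j)]
  have hswap : ∑ j ∈ I, ∑ k ∈ I, W j * (al j k * nu N k) * (D j * C k) =
      ∑ j ∈ I, ∑ k ∈ I, W k * (al j k * nu N j) * (C j * D k) := by
    rw [Finset.sum_comm]
    refine Finset.sum_congr rfl fun j _ => Finset.sum_congr rfl fun k _ => ?_
    rw [hals k j]; ring
  have key : ∑ j ∈ I, W j * (2 * C j * C' j + 2 * D j * D' j) =
      ∑ j ∈ I, ∑ k ∈ I, ((W j - W k) * (2 * nu N j * al j k)) * (C j * D k) +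
      2 * ∑ j ∈ I, ∑ k ∈ I, W j * P j k * (C j * C k) +
      2 * ∑ j ∈ I, ∑ k ∈ I, W j * S j k * (D j * D k) +
      ∑ j ∈ I, ∑ k ∈ I, (2 * (W j * B j k)) * (D j * C k) -
      ∑ j ∈ I, W j * (2 * C j * r1 j + 2 * D j * r2 j) := by
    have e1 : ∑ j ∈ I, ∑ k ∈ I, ((W j - W k) * (2 * nu N j * al j k)) * (C j * D k) =
        ∑ j ∈ I, ∑ k ∈ I, 2 * (W j * nu N j * al j k * (C j * D k)) -
        ∑ j ∈ I, ∑ k ∈ I, 2 * (W j * (al j k * nu N k) * (D j * C k)) := by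
      simp only [← Finset.mul_sum]
      rw [hswap, ← mul_sub, ← Finset.sum_sub_distrib]
      simp only [← Finset.sum_sub_distrib, Finset.mul_sum]
      refine Finset.sum_congr rfl fun j _ => Finset.sum_congr rfl fun k _ => by ring
    rw [e1]
    simp only [Finset.mul_sum, ← Finset.sum_add_distrib, ← Finset.sum_sub_distrib]
    refine Finset.sum_congr rfl fun j hj => ?_
    rw [hC j hj, hD j hj]
    have e2 : ∑ k ∈ I, 2 * (W j * nu N j * al j k * (C j * D k)) -
        ∑ k ∈ I, 2 * (W j * (al j k * nu N k) * (D j * C k)) +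
        ∑ k ∈ I, 2 * (W j * P j k * (C j * C k)) + ∑ k ∈ I, 2 * (W j * S j k * (D j * D k)) +
        ∑ k ∈ I, 2 * (W j * B j k) * (D j * C k) =
        W j * (2 * C j * ∑ k ∈ I, (nu N j * al j k * D k + P j k * C k) +
        2 * D j * ∑ k ∈ I, (-(al j k * nu N k * C k) + B j k * C k + S j k * D k)) := by
      simp only [Finset.mul_sum, ← Finset.sum_add_distrib, ← Finset.sum_sub_distrib]
      exact Finset.sum_congr rfl fun k _ => by ring
    simp only [Finset.sum_add_distrib, Finset.sum_sub_distrib] at e2 ⊢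
    linarith
  have hE : ∑ j ∈ I, W j * (C j ^ 2 + D j ^ 2) =
      ∑ j ∈ I, W j * C j ^ 2 + ∑ j ∈ I, W j * D j ^ 2 := by
    rw [← Finset.sum_add_distrib]; exact Finset.sum_congr rfl fun j _ => by ring
  rw [key]
  have t : ∀ a b c d e : ℝ, |a + b + c + d - e| ≤ |a| + |b| + |c| + |d| + |e| := by
    intro a b c d e
    calc |a + b + c + d - e| ≤ |a + b + c + d| + |e| := abs_sub _ _
      _ ≤ |a + b + c| + |d| + |e| := by gcongr; exact abs_add_le _ _
      _ ≤ |a + b| + |c| + |d| + |e| := by gcongr; exact abs_add_le _ _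
      _ ≤ _ := by gcongr; exact abs_add_le _ _
  refine (t _ _ _ _ _).trans ?_
  rw [hE] at b5 ⊢
  nlinarith [b1, b2, b3, b4, b5]

section ODE
open scoped NNReal

lemma gronwallBound_le {K G x : ℝ} (hK : 0 ≤ K) (hG : 0 ≤ G) :
    gronwallBound 0 K G x ≤ G * x * exp (K * x) := by
  rcases hK.eq_or_lt with rfl | hK
  · simp [gronwallBound_K0]
  · rw [gronwallBound_of_K_ne_0 hK.ne']
    have h1 : exp (K * x) - 1 ≤ K * x * exp (K * x) := by
      have h2 := Real.add_one_le_exp (-(K * x))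
      have h3 : exp (-(K * x)) * exp (K * x) = 1 := by rw [← exp_add]; simp
      nlinarith [exp_pos (K * x)]
    calc (0 : ℝ) * exp (K * x) + G / K * (exp (K * x) - 1) ≤ G / K * (K * x * exp (K * x)) := by
          rw [zero_mul, zero_add]; exact mul_le_mul_of_nonneg_left h1 (by positivity)
      _ = _ := by field_simp

variable {V : Type*} [NormedAddCommGroup V] [NormedSpace ℝ V]

lemma gronwall_right {f f' : ℝ → V} {K G τ : ℝ} (hK : 0 ≤ K) (hG : 0 ≤ G) (hτ : 0 ≤ τ)
    (hf : ∀ t, HasDerivAt f (f' t) t) (h0 : f 0 = 0) (hb : ∀ t, ‖f' t‖ ≤ K * ‖f t‖ + G)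
    (hs : ∀ t, τ ≤ t → f' t = 0) {t : ℝ} (ht : 0 ≤ t) : ‖f t‖ ≤ G * τ * exp (K * τ) := by
  have hc : Continuous f := continuous_iff_continuousAt.2 fun t => (hf t).continuousAt
  have h1 : ∀ t ∈ Icc 0 τ, ‖f t‖ ≤ G * τ * exp (K * τ) := by
    intro t ht
    have := norm_le_gronwallBound_of_norm_deriv_right_le (δ := 0) (K := K) (ε := G) (a := 0)
      (b := τ) hc.continuousOn (fun x _ => (hf x).hasDerivWithinAt) (by simp [h0])
      (fun x _ => hb x) t ht
    rw [sub_zero] at this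
    refine this.trans ((gronwallBound_le hK hG).trans ?_)
    have := ht.1
    have := ht.2
    gcongr
  rcases le_total t τ with h | h
  · exact h1 t ⟨ht, h⟩
  · have := constant_of_has_deriv_right_zero (f := f) (a := τ) (b := t) hc.continuousOn
      (fun x hx => by have := hf x; rw [hs x hx.1] at this; exact this.hasDerivWithinAt) t ⟨h, le_rfl⟩
    rw [this]; exact h1 τ ⟨hτ, le_rfl⟩

lemma gronwall_supp {f f' : ℝ → V} {K G τ : ℝ} (hK : 0 ≤ K) (hG : 0 ≤ G) (hτ : 0 ≤ τ)
    (hf : ∀ t, HasDerivAt f (f' t) t) (h0 : f 0 = 0) (hb : ∀ t, ‖f' t‖ ≤ K * ‖f t‖ + G)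
    (hs : ∀ t, τ ≤ |t| → f' t = 0) (t : ℝ) : ‖f t‖ ≤ G * τ * exp (K * τ) := by
  rcases le_total 0 t with h | h
  · exact gronwall_right hK hG hτ hf h0 hb (fun t ht => hs t (ht.trans (le_abs_self t))) h
  · have := gronwall_right (f := fun t => f (-t)) (f' := fun t => -f' (-t)) hK hG hτ
      (fun t => by simpa [Function.comp_def] using (hf (-t)).scomp t (hasDerivAt_neg t)) (by simpa using h0)
      (fun t => by rw [norm_neg]; exact hb (-t))
      (fun t ht => by rw [hs (-t) (by rw [abs_neg]; exact ht.trans (le_abs_self t)), neg_zero])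
      (t := -t) (by linarith)
    simpa using this

/-- Global solutions of globally Lipschitz systems with compact time support. -/
lemma exists_ode {ι : Type*} [Fintype ι] {f : ℝ → (ι → ℝ) → ι → ℝ} {K : ℝ≥0} {τ : ℝ} (hτ : 0 ≤ τ)
    (hL : ∀ t, LipschitzWith K (f t)) (hc : ∀ x, Continuous fun t => f t x)
    (hs : ∀ t, τ ≤ |t| → ∀ x, f t x = 0) :
    ∃ c : ℝ → ι → ℝ, c 0 = 0 ∧ ∀ t, HasDerivAt c (f t (c t)) t := by
  obtain ⟨B, hB⟩ := isCompact_Icc.exists_bound_of_continuousOn (s := Icc (-τ) τ) (hc 0).continuousOn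
  have hB0 : 0 ≤ B := (norm_nonneg _).trans (hB 0 ⟨by linarith, hτ⟩)
  have hB' : ∀ t, ‖f t 0‖ ≤ B := by
    intro t
    rcases le_or_gt τ |t| with h | h
    · rw [hs t h, norm_zero]; exact hB0
    · exact hB t (abs_le.1 h.le)
  have hfb : ∀ t x, ‖f t x‖ ≤ K * ‖x‖ + B := by
    intro t x
    have h1 := (hL t).dist_le_mul x 0
    rw [dist_zero_right, dist_eq_norm] at h1
    calc ‖f t x‖ = ‖(f t x - f t 0) + f t 0‖ := by simp
      _ ≤ _ := (norm_add_le _ _).trans (add_le_add h1 (hB' t))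
  set R := B * τ * exp (K * τ) with hR
  have hR0 : 0 ≤ R := by positivity
  let P : (ι → ℝ) → ι → ℝ := fun x i => max (-R) (min R (x i))
  have hPL : LipschitzWith 1 P := by
    refine LipschitzWith.of_dist_le_mul fun x y => ?_
    rw [NNReal.coe_one, one_mul]
    refine (dist_pi_le_iff dist_nonneg).2 fun i => ?_
    rw [Real.dist_eq]
    refine (abs_max_sub_max_le_max _ _ _ _).trans ?_
    rw [sub_self, abs_zero]
    refine max_le dist_nonneg ((abs_min_sub_min_le_max _ _ _ _).trans ?_)
    rw [sub_self, abs_zero]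
    exact max_le dist_nonneg ((Real.dist_eq _ _).symm.le.trans (dist_le_pi_dist x y i))
  have hPR : ∀ x, ‖P x‖ ≤ R := fun x => (pi_norm_le_iff_of_nonneg hR0).2 fun i => by
    rw [Real.norm_eq_abs, abs_le]
    exact ⟨le_max_left _ _, max_le (by linarith) (min_le_left _ _)⟩
  have hPx : ∀ x, ‖x‖ ≤ R → P x = x := by
    intro x hx
    funext i
    have := (norm_le_pi_norm x i).trans hx
    rw [Real.norm_eq_abs, abs_le] at this
    simp only [P]
    rw [min_eq_right this.2, max_eq_right this.1]
  have hPle : ∀ x, ‖P x‖ ≤ ‖x‖ := by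
    intro x
    have h0 : P 0 = 0 := hPx 0 (by simpa using hR0)
    have := hPL.dist_le_mul x 0
    rwa [h0, dist_zero_right, dist_zero_right, NNReal.coe_one, one_mul] at this
  have hPf : ∀ t, LipschitzWith K fun x => f t (P x) := fun t => by
    simpa [Function.comp_def] using (hL t).comp hPL
  let L : ℝ≥0 := ⟨K * R + B, by positivity⟩
  have hpl : IsPicardLindelof (fun t x => f t (P x)) (tmin := -τ) (tmax := τ)
      ⟨0, by linarith, hτ⟩ 0 (L * ⟨τ, hτ⟩) 0 L K :=
    { lipschitzOnWith := fun t _ => (hPf t).lipschitzOnWith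
      continuousOn := fun x _ => (hc (P x)).continuousOn
      norm_le := fun t _ x _ => (hfb t _).trans (by
        change _ ≤ K * R + B
        have := hPR x
        gcongr)
      mul_max_le := by simp; exact le_rfl }
  obtain ⟨α, hα0, hα⟩ := hpl.exists_eq_forall_mem_Icc_hasDerivWithinAt₀
  have hα0 : α 0 = 0 := hα0
  have hτI : -τ ≤ τ := by linarith
  have hαc : ContinuousOn α (Icc (-τ) τ) := fun t ht => (hα t ht).continuousWithinAt
  let β : ℝ → ι → ℝ := fun t => α (projIcc (-τ) τ hτI t)
  have hβ : Continuous β := by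
    have := hαc.domRestrict
    exact this.comp continuous_projIcc
  have hjoint : Continuous fun p : (ι → ℝ) × ℝ => f p.2 (P p.1) :=
    continuous_prod_of_continuous_lipschitzWith (fun p : (ι → ℝ) × ℝ => f p.2 (P p.1)) K
      (fun a => hc (P a)) (fun t => hPf t)
  have hi : Continuous fun s => f s (P (β s)) := hjoint.comp (hβ.prodMk continuous_id)
  let c : ℝ → ι → ℝ := fun t => ∫ s in (0 : ℝ)..t, f s (P (β s))
  have hcd : ∀ t, HasDerivAt c (f t (P (β t))) t := fun t =>
    (hi.integral_hasStrictDerivAt 0 t).hasDerivAt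
  have hc0 : c 0 = 0 := by simp [c]
  have hcα : ∀ t ∈ Icc (-τ) τ, c t = α t := by
    intro t ht
    have h0 : (0 : ℝ) ∈ Icc (-τ) τ := ⟨by linarith, hτ⟩
    have := (convex_Icc (-τ) τ).norm_image_sub_le_of_norm_hasDerivWithin_le (C := 0)
      (f := fun t => c t - α t) (f' := fun t => f t (P (β t)) - f t (P (α t)))
      (fun x hx => (hcd x).hasDerivWithinAt.fun_sub (hα x hx)) (fun x hx => by
        simp only [β]; rw [projIcc_of_mem hτI hx]; simp) h0 ht
    rw [zero_mul, hc0, hα0] at this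
    have := norm_le_zero_iff.1 this
    simpa [sub_eq_zero] using this
  have hcd' : ∀ t, HasDerivAt c (f t (P (c t))) t := by
    intro t
    have h := hcd t
    rcases le_or_gt τ |t| with h1 | h1
    · rw [hs t h1] at h ⊢; exact h
    · have ht := abs_le.1 h1.le
      have e : β t = c t := by
        rw [hcα t ht]; simp only [β]; rw [projIcc_of_mem hτI ht]
      rwa [e] at h
  have hbound := gronwall_supp (f := c) (f' := fun t => f t (P (c t))) K.2 hB0 hτ hcd' hc0
    (fun t => (hfb t _).trans (add_le_add (mul_le_mul_of_nonneg_left (hPle _) K.2) le_rfl)) (fun t ht => hs t ht _)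
  refine ⟨c, hc0, fun t => ?_⟩
  have := hcd' t
  rwa [hPx _ (hbound t)] at this

end ODE

section LinearODE
open scoped NNReal

lemma bounded_of_supp {f : ℝ → ℝ} {τ : ℝ} (hf : Continuous f) (hs : ∀ t, τ ≤ |t| → f t = 0) :
    ∃ B : ℝ≥0, ∀ t, |f t| ≤ B := by
  obtain ⟨B, hB⟩ := isCompact_Icc.exists_bound_of_continuousOn (s := Icc (-τ) τ) hf.continuousOn
  refine ⟨⟨|B|, abs_nonneg _⟩, fun t => ?_⟩
  change |f t| ≤ |B|
  rcases le_or_gt τ |t| with h | h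
  · rw [hs t h, abs_zero]; exact abs_nonneg _
  · exact (hB t (abs_le.1 h.le)).trans (le_abs_self _)

lemma exists_linear_ode {ι : Type*} [Fintype ι] {G : ℝ → ι → ι → ℝ} {b : ℝ → ι → ℝ} {τ : ℝ}
    (hτ : 0 ≤ τ) (hG : ∀ i j, Continuous fun t => G t i j) (hb : ∀ i, Continuous fun t => b t i)
    (hGs : ∀ t, τ ≤ |t| → ∀ i j, G t i j = 0) (hbs : ∀ t, τ ≤ |t| → ∀ i, b t i = 0) :
    ∃ c : ℝ → ι → ℝ, (∀ i, c 0 i = 0) ∧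
      ∀ t i, HasDerivAt (fun t => c t i) (∑ j, G t i j * c t j + b t i) t := by
  choose B hB using fun i j => bounded_of_supp (hG i j) (fun t ht => hGs t ht i j)
  obtain ⟨c, hc0, hc⟩ := exists_ode (f := fun t x i => ∑ j, G t i j * x j + b t i)
    (K := ∑ i, ∑ j, B i j) hτ (fun t => by
      refine LipschitzWith.of_dist_le_mul fun x y => (dist_pi_le_iff (by positivity)).2 fun i => ?_
      rw [Real.dist_eq, add_sub_add_right_eq_sub, ← Finset.sum_sub_distrib]
      calc |∑ j, (G t i j * x j - G t i j * y j)| ≤ ∑ j, |G t i j * x j - G t i j * y j| :=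
            Finset.abs_sum_le_sum_abs _ _
        _ ≤ ∑ j, (B i j : ℝ) * dist x y := Finset.sum_le_sum fun j _ => by
            rw [← mul_sub, abs_mul]
            exact mul_le_mul (hB i j t) ((Real.dist_eq _ _).symm.le.trans (dist_le_pi_dist x y j))
              (abs_nonneg _) (B i j).2
        _ = ((∑ j, B i j : ℝ≥0) : ℝ) * dist x y := by rw [← Finset.sum_mul]; push_cast; rfl
        _ ≤ _ := by
            refine mul_le_mul_of_nonneg_right (NNReal.coe_le_coe.2 ?_) dist_nonneg
            exact Finset.single_le_sum (f := fun i => ∑ j, B i j) (fun i _ => zero_le)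
              (Finset.mem_univ i))
    (fun x => continuous_pi fun i => (continuous_finsetSum _ fun j _ =>
      (hG i j).mul continuous_const).add (hb i))
    (fun t ht x => by funext i; simp [hGs t ht, hbs t ht])
  exact ⟨c, fun i => by rw [hc0]; rfl, fun t i => hasDerivAt_pi.1 (hc t) i⟩

lemma exists_linear_ode_pair {P Q R S : ℝ → ℕ → ℕ → ℝ} {b1 b2 : ℝ → ℕ → ℝ} {τ : ℝ} (hτ : 0 ≤ τ)
    (n : ℕ) (hP : ∀ i j, Continuous fun t => P t i j) (hQ : ∀ i j, Continuous fun t => Q t i j)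
    (hR : ∀ i j, Continuous fun t => R t i j) (hS : ∀ i j, Continuous fun t => S t i j)
    (hb1 : ∀ i, Continuous fun t => b1 t i) (hb2 : ∀ i, Continuous fun t => b2 t i)
    (hs : ∀ t, τ ≤ |t| → ∀ i j, P t i j = 0 ∧ Q t i j = 0 ∧ R t i j = 0 ∧ S t i j = 0)
    (hbs : ∀ t, τ ≤ |t| → ∀ i, b1 t i = 0 ∧ b2 t i = 0) :
    ∃ c d : ℝ → ℕ → ℝ, (∀ j, c 0 j = 0 ∧ d 0 j = 0) ∧ (∀ t j, n < j → c t j = 0 ∧ d t j = 0) ∧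
      ∀ t, ∀ j ≤ n,
        HasDerivAt (fun t => c t j)
          (∑ k ∈ Finset.range (n + 1), (P t j k * c t k + Q t j k * d t k) + b1 t j) t ∧
        HasDerivAt (fun t => d t j)
          (∑ k ∈ Finset.range (n + 1), (R t j k * c t k + S t j k * d t k) + b2 t j) t := by
  obtain ⟨z, hz0, hz⟩ := exists_linear_ode (ι := Fin (n + 1) ⊕ Fin (n + 1))
    (G := fun t i j => Sum.elim (fun i : Fin (n + 1) => Sum.elim (fun j : Fin (n + 1) => P t i j)
        (fun j : Fin (n + 1) => Q t i j) j)
      (fun i : Fin (n + 1) => Sum.elim (fun j : Fin (n + 1) => R t i j)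
        (fun j : Fin (n + 1) => S t i j) j) i)
    (b := fun t => Sum.elim (fun i : Fin (n + 1) => b1 t i) (fun i : Fin (n + 1) => b2 t i))
    hτ (by rintro (i | i) (j | j) <;> simp [hP, hQ, hR, hS]) (by rintro (i | i) <;> simp [hb1, hb2])
    (by rintro t ht (i | i) (j | j) <;> simp [hs t ht]) (by rintro t ht (i | i) <;> simp [hbs t ht])
  refine ⟨fun t j => if h : j < n + 1 then z t (Sum.inl ⟨j, h⟩) else 0,
    fun t j => if h : j < n + 1 then z t (Sum.inr ⟨j, h⟩) else 0, fun j => ?_, fun t j hj => ?_,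
    fun t j hj => ?_⟩
  · constructor <;> simp [hz0]
  · have : ¬ j < n + 1 := by omega
    simp [this]
  · have h : j < n + 1 := by omega
    have e1 := hz t (Sum.inl ⟨j, h⟩)
    have e2 := hz t (Sum.inr ⟨j, h⟩)
    simp only [Fintype.sum_sum_type, Sum.elim_inl, Sum.elim_inr] at e1 e2
    simp only [dif_pos h]
    refine ⟨e1.congr_deriv ?_, e2.congr_deriv ?_⟩ <;>
    · rw [Finset.sum_range, Finset.sum_add_distrib]
      congr 1
      congr 1 <;> exact Finset.sum_congr rfl fun k _ => by simp [k.2]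

end LinearODE

/-- Matrix of multiplication by `f`. -/
noncomputable def mm (N : ℝ) (f : ℝ → ℝ) (j k : ℕ) : ℝ :=
  ip N (fun x => f x * (jp N k).eval x) (fun x => (jp N j).eval x)

/-- Matrix of `f` times `x(1-x)∂ₓ`. -/
noncomputable def mX (N : ℝ) (f : ℝ → ℝ) (j k : ℕ) : ℝ :=
  ip N (fun x => f x * (Xjp N k).eval x) (fun x => (jp N j).eval x)

lemma mm_symm (f : ℝ → ℝ) (j k : ℕ) : mm N f j k = mm N f k j := by
  unfold mm ip
  refine intervalIntegral.integral_congr fun x _ => ?_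
  simp only; ring

/-- Coefficients of the linearized system at a fixed time. -/
structure Lc (N M : ℝ) (s : ℕ) (Θ : ℝ) (A a0 a1 b0 b1 s0 s1 a1' s1' : ℝ → ℝ) : Prop where
  hA : Ap M s Θ A
  ha0 : Ap M s Θ a0
  ha1 : Ap M s Θ a1
  hb0 : Ap M s Θ b0
  hb1 : Ap M s Θ b1
  hs0 : Ap M s Θ s0
  hs1 : Ap M s Θ s1
  da : ∀ x ∈ Icc (0 : ℝ) 1, HasDerivAt a1 (a1' x) x
  ds : ∀ x ∈ Icc (0 : ℝ) 1, HasDerivAt s1 (s1' x) x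
  ca : ContinuousOn a1' (Icc 0 1)
  cs : ContinuousOn s1' (Icc 0 1)
  Da : Ap M s Θ (fun x => x * (1 - x) * a1' x + bb N x * a1 x)
  Ds : Ap M s Θ (fun x => x * (1 - x) * s1' x + bb N x * s1 x)

lemma first_order_mat {M Θ : ℝ} {s : ℕ} (hN : 4 < N) (hΘ : 1 ≤ Θ) {f g g' : ℝ → ℝ}
    (hf : Ap M s Θ f) (hg : Ap M s Θ g) (dg : ∀ x ∈ Icc (0 : ℝ) 1, HasDerivAt g (g' x) x)
    (cg : ContinuousOn g' (Icc 0 1)) (hD : Ap M s Θ (fun x => x * (1 - x) * g' x + bb N x * g x))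
    (j k : ℕ) :
    |mm N f j k + mX N g j k| ≤ 2 * (3 ^ (4 + s) * M * mu s Θ (Nat.dist j k)) * nu N k ∧
    |(mm N f j k + mX N g j k) + (mm N f k j + mX N g k j)| ≤
      3 * (3 ^ (4 + s) * M * mu s Θ (Nat.dist j k)) := by
  have h1 := (hf.mat hN hΘ j k).1
  have h2 := (hg.mat hN hΘ j k).2
  have h3 := (hD.mat hN hΘ j k).1
  have h4 := ip_Xjp_add (N := N) hN dg cg j k
  have h5 : (1 : ℝ) ≤ nu N k := by
    linarith [nu_ge hN k, (Nat.cast_nonneg k : (0 : ℝ) ≤ k)]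
  have h0 := (abs_nonneg _).trans h1
  constructor
  · refine (abs_add_le _ _).trans ?_
    have : |mm N f j k| ≤ 3 ^ (4 + s) * M * mu s Θ (Nat.dist j k) * nu N k :=
      h1.trans (le_mul_of_one_le_right h0 h5)
    have h6 : |mX N g j k| ≤ _ := h2
    linarith
  · have e : (mm N f j k + mX N g j k) + (mm N f k j + mX N g k j) =
        2 * mm N f j k - mm N (fun x => x * (1 - x) * g' x + bb N x * g x) j k := by
      have : mX N g j k + mX N g k j =
        - mm N (fun x => x * (1 - x) * g' x + bb N x * g x) j k := h4
      rw [mm_symm f k j]; linarith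
    rw [e]
    have h1' : |mm N f j k| ≤ _ := h1
    have h3' : |mm N (fun x => x * (1 - x) * g' x + bb N x * g x) j k| ≤ _ := h3
    refine (abs_sub _ _).trans ?_
    rw [abs_mul, abs_of_pos (by norm_num : (0 : ℝ) < 2)]
    linarith

/-- Energy constant. -/
noncomputable def eK (N : ℝ) (s : ℕ) (M : ℝ) : ℝ :=
  (8 * s + 4) * Z2 * ((8 + kap N ^ 2) * (3 ^ (4 + s) * M)) + 1

lemma linear_energy_deriv {M Θ : ℝ} {s : ℕ} (hN : 4 < N) (hΘ : 1 ≤ Θ) (hM : 0 ≤ M)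
    {A a0 a1 b0 b1 s0 s1 a1' s1' : ℝ → ℝ} (h : Lc N M s Θ A a0 a1 b0 b1 s0 s1 a1' s1') (n : ℕ)
    {c d c' d' r1 r2 : ℕ → ℝ}
    (hc : ∀ j ≤ n, c' j = ∑ k ∈ Finset.range (n + 1), ((mm N a0 j k + mX N a1 j k) * c k +
      mm N A j k * d k) + -r1 j)
    (hd : ∀ j ≤ n, d' j = ∑ k ∈ Finset.range (n + 1), ((-(mm N A j k * lam N k) +
      (mm N b0 j k + mX N b1 j k)) * c k + (mm N s0 j k + mX N s1 j k) * d k) + -r2 j) :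
    |∑ j ∈ Finset.range (n + 1), wg N Θ j ^ (2 * s) *
        (2 * (nu N j * c j) * (nu N j * c' j) + 2 * d j * d' j)| ≤
      eK N s M * ∑ j ∈ Finset.range (n + 1), wg N Θ j ^ (2 * s) * ((nu N j * c j) ^ 2 + d j ^ 2) +
        ∑ j ∈ Finset.range (n + 1), wg N Θ j ^ (2 * s) * ((nu N j * r1 j) ^ 2 + r2 j ^ 2) := by
  set M1 := 3 ^ (4 + s) * M with hM1
  have hM10 : 0 ≤ M1 := by positivity
  have hν : ∀ k, 0 < nu N k := nu_pos hN
  have hν1 : ∀ k, 1 ≤ nu N k := fun k => by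
    linarith [nu_ge hN k, (Nat.cast_nonneg k : (0 : ℝ) ≤ k)]
  have hmu : ∀ d, 0 < mu s Θ d := mu_pos hΘ s
  have hm0 : ∀ j k, 0 ≤ M1 * mu s Θ (Nat.dist j k) := fun j k => mul_nonneg hM10 (hmu _).le
  have hcoef : (1 : ℝ) ≤ 8 + kap N ^ 2 ∧ 8 ≤ 8 + kap N ^ 2 := by
    constructor <;> nlinarith [sq_nonneg (kap N)]
  have up : ∀ (C X Y : ℝ), 0 ≤ Y → C ≤ 8 + kap N ^ 2 → X ≤ C * Y → X ≤ (8 + kap N ^ 2) * Y :=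
    fun C X Y hY hC hX => hX.trans (mul_le_mul_of_nonneg_right hC hY)
  have hA := fun j k => (h.hA.mat hN hΘ j k).1
  have hPm := first_order_mat hN hΘ h.ha0 h.ha1 h.da h.ca h.Da
  have hSm := first_order_mat hN hΘ h.hs0 h.hs1 h.ds h.cs h.Ds
  have hdist : ∀ j k, |nu N j - nu N k| = (Nat.dist j k : ℝ) := nu_sub
  have hratio : ∀ j k (X : ℝ), |X| ≤ 2 * (M1 * mu s Θ (Nat.dist j k)) * nu N k →
      |X / nu N k| ≤ 2 * (M1 * mu s Θ (Nat.dist j k)) := by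
    intro j k X hX
    rwa [abs_div, abs_of_pos (hν k), div_le_iff₀ (hν k)]
  refine energy_form hN hΘ (M := (8 + kap N ^ 2) * M1) (by positivity) s
    (al := fun j k => mm N A j k)
    (P := fun j k => nu N j * (mm N a0 j k + mX N a1 j k) / nu N k)
    (B := fun j k => ((mm N b0 j k + mX N b1 j k) + kap N ^ 2 * mm N A j k) / nu N k)
    (S := fun j k => mm N s0 j k + mX N s1 j k)
    (r1 := fun j => nu N j * r1 j) (r2 := r2)
    (fun j k => ?_) (fun j k => mm_symm A j k) (fun j k => ?_) (fun j k => ?_) (fun j k => ?_)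
    (fun j k => ?_) (fun j k => ?_) (Finset.range (n + 1)) (fun j => nu N j * c j) d
    (fun j => nu N j * c' j) d' (fun j hj => ?_) (fun j hj => ?_)
  · rw [mul_assoc]
    exact up 1 _ _ (hm0 j k) hcoef.1 (by rw [one_mul]; exact hA j k)
  · rw [mul_assoc, mul_assoc]
    refine up 2 _ _ (mul_nonneg hM10 (mul_nonneg (hmu _).le (hν j).le)) (by linarith [hcoef.2]) ?_
    rw [mul_div_assoc, abs_mul, abs_of_pos (hν j)]
    have := mul_le_mul_of_nonneg_left (hratio j k _ (hPm j k).1) (hν j).le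
    linarith
  · have h1 := hratio j k _ (hPm j k).1
    have h2 := hratio k j _ (hPm k j).1
    rw [Nat.dist_comm] at h2
    have h3 := (hPm j k).2
    have hd0 : (0 : ℝ) ≤ Nat.dist j k := Nat.cast_nonneg _
    rw [mul_assoc, mul_assoc]
    refine up 8 _ _ (mul_nonneg hM10 (mul_nonneg (hmu _).le (by positivity))) hcoef.2 ?_
    set p := mm N a0 j k + mX N a1 j k
    set q := mm N a0 k j + mX N a1 k j
    have e : nu N j * p / nu N k + nu N k * q / nu N j =
        (p + q) + ((nu N j - nu N k) * (p / nu N k) + (nu N k - nu N j) * (q / nu N j)) := by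
      have := (hν j).ne'
      have := (hν k).ne'
      field_simp; ring
    rw [e]
    have h4 : |(nu N j - nu N k) * (p / nu N k)| ≤
        Nat.dist j k * (2 * (M1 * mu s Θ (Nat.dist j k))) := by
      rw [abs_mul, hdist]; exact mul_le_mul_of_nonneg_left h1 hd0
    have h5 : |(nu N k - nu N j) * (q / nu N j)| ≤
        Nat.dist j k * (2 * (M1 * mu s Θ (Nat.dist j k))) := by
      rw [abs_mul, hdist, Nat.dist_comm k j]; exact mul_le_mul_of_nonneg_left h2 hd0
    have h6 := abs_add_le (p + q)
      ((nu N j - nu N k) * (p / nu N k) + (nu N k - nu N j) * (q / nu N j))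
    have h7 := abs_add_le ((nu N j - nu N k) * (p / nu N k)) ((nu N k - nu N j) * (q / nu N j))
    have := hm0 j k
    nlinarith
  · rw [mul_assoc, abs_div, abs_of_pos (hν k), div_le_iff₀ (hν k)]
    have h1 := h.hb0.mat hN hΘ j k
    have h2 := h.hb1.mat hN hΘ j k
    have h3 := hA j k
    have h4 : |mm N b0 j k| ≤ _ := h1.1
    have h5 : |mX N b1 j k| ≤ _ := h2.2
    have h6 : |mm N A j k| ≤ _ := h3
    have h7 := abs_add_le (mm N b0 j k + mX N b1 j k) (kap N ^ 2 * mm N A j k)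
    have h8 := abs_add_le (mm N b0 j k) (mX N b1 j k)
    rw [abs_mul, abs_of_nonneg (sq_nonneg (kap N))] at h7
    have h9 := hm0 j k
    have h10 := le_mul_of_one_le_right h9 (hν1 k)
    have h11 : kap N ^ 2 * |mm N A j k| ≤ kap N ^ 2 * (M1 * mu s Θ (Nat.dist j k) * nu N k) :=
      mul_le_mul_of_nonneg_left (h6.trans h10) (sq_nonneg _)
    have h12 : 0 ≤ M1 * mu s Θ (Nat.dist j k) * nu N k := mul_nonneg h9 (hν k).le
    nlinarith
  · rw [mul_assoc, mul_assoc]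
    refine up 2 _ _ (mul_nonneg hM10 (mul_nonneg (hmu _).le (hν k).le)) (by linarith [hcoef.2]) ?_
    have := (hSm j k).1
    linarith
  · rw [mul_assoc, mul_assoc]
    have hd0 : (0 : ℝ) ≤ Nat.dist j k := Nat.cast_nonneg _
    refine up 3 _ _ (mul_nonneg hM10 (mul_nonneg (hmu _).le (by positivity))) (by linarith [hcoef.2]) ?_
    have := (hSm j k).2
    have := hm0 j k
    nlinarith
  · rw [hc j (by simpa [Nat.lt_succ_iff] using hj), mul_add, Finset.mul_sum, mul_neg,
      ← sub_eq_add_neg]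
    congr 1
    refine Finset.sum_congr rfl fun k _ => ?_
    have := (hν k).ne'
    field_simp; ring
  · rw [hd j (by simpa [Nat.lt_succ_iff] using hj), ← sub_eq_add_neg]
    congr 1
    refine Finset.sum_congr rfl fun k _ => ?_
    have := (hν k).ne'
    rw [lam_eq]
    field_simp; ring

/-- Rapidly decaying sequences. -/
def Rapid (a : ℕ → ℝ) : Prop := ∀ k : ℕ, ∃ A : ℝ, ∀ j : ℕ, |a j| * (1 + j : ℝ) ^ k ≤ A

lemma Rapid.of_finite {a : ℕ → ℝ} {n : ℕ} (h : ∀ j, n < j → a j = 0) : Rapid a := fun k =>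
  ⟨∑ i ∈ Finset.range (n + 1), |a i| * (1 + i : ℝ) ^ k, fun j => by
    have h0 : ∀ i ∈ Finset.range (n + 1), 0 ≤ |a i| * (1 + i : ℝ) ^ k := fun i _ => by positivity
    rcases le_or_gt j n with hj | hj
    · exact Finset.single_le_sum (f := fun i => |a i| * (1 + i : ℝ) ^ k) h0
        (Finset.mem_range.2 (by omega))
    · rw [h j hj, abs_zero, zero_mul]; exact Finset.sum_nonneg h0⟩

/-- The `i`-th derivative of the series with coefficients `a`. -/
noncomputable def jet (N : ℝ) (i : ℕ) (a : ℕ → ℝ) (x : ℝ) : ℝ :=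
  ∑' j, a j * (derivative^[i] (jp N j)).eval x

lemma jet_eq_sum {a : ℕ → ℝ} {n : ℕ} (h : ∀ j, n < j → a j = 0) (i : ℕ) (x : ℝ) :
    jet N i a x = ∑ j ∈ Finset.range (n + 1), a j * (derivative^[i] (jp N j)).eval x :=
  tsum_eq_sum fun j hj => by
    rw [h j (by simpa [Nat.lt_succ_iff] using hj), zero_mul]

lemma jet_zero (i : ℕ) (x : ℝ) : jet N i (fun _ => 0) x = 0 := by simp [jet]

lemma hasDerivAt_jet {a : ℕ → ℝ} {n : ℕ} (h : ∀ j, n < j → a j = 0) (i : ℕ) (x : ℝ) :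
    HasDerivAt (jet N i a) (jet N (i + 1) a x) x := by
  rw [jet_eq_sum h, show jet N i a = fun x => ∑ j ∈ Finset.range (n + 1),
    a j * (derivative^[i] (jp N j)).eval x from funext fun x => jet_eq_sum h i x]
  refine HasDerivAt.fun_sum fun j _ => ?_
  rw [Function.iterate_succ_apply']
  exact (Polynomial.hasDerivAt _ x).const_mul _

lemma jet_term_le {C : ℝ} {c : ℕ} (hJ : JB N C c) {a A : ℝ} {i m j : ℕ}
    (ha : |a| * (1 + j : ℝ) ^ (c + 2 * i + 2 + m) ≤ A) (θ : ℝ) :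
    |iteratedDeriv m (fun θ => a * E N i j θ) θ| ≤ C * 4 ^ i * A * ((1 + j : ℝ) ^ 2)⁻¹ := by
  have hC := hJ.one_le
  have h1 : (0 : ℝ) < (1 + j : ℝ) ^ 2 := by positivity
  rw [iteratedDeriv_const_mul_field, abs_mul, ← div_eq_mul_inv, le_div_iff₀ h1]
  calc |a| * |iteratedDeriv m (E N i j) θ| * (1 + j : ℝ) ^ 2
      ≤ |a| * (C * 4 ^ i * (1 + j : ℝ) ^ (c + 2 * i + m)) * (1 + j : ℝ) ^ 2 := by
        gcongr; exact hJ.bound_iter i j m θ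
    _ = C * 4 ^ i * (|a| * (1 + j : ℝ) ^ (c + 2 * i + 2 + m)) := by
        rw [show c + 2 * i + 2 + m = (c + 2 * i + m) + 2 by ring, pow_add _ _ 2]; ring
    _ ≤ C * 4 ^ i * A := by gcongr

lemma jet_point_le {C : ℝ} {c : ℕ} (hJ : JB N C c) {a A : ℝ} {i j : ℕ}
    (ha : |a| * (1 + j : ℝ) ^ (c + 2 * i + 2) ≤ A) {x : ℝ} (hx : x ∈ Icc (0 : ℝ) 1) :
    |a * (derivative^[i] (jp N j)).eval x| ≤ C * 4 ^ i * A * ((1 + j : ℝ) ^ 2)⁻¹ := by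
  obtain ⟨θ, hθ⟩ := exists_xc hx
  have := jet_term_le hJ (m := 0) ha θ
  simpa [E, hθ] using this

lemma summable_jet {C : ℝ} {c : ℕ} (hJ : JB N C c) {a : ℕ → ℝ} {A : ℝ} {i : ℕ}
    (ha : ∀ j, |a j| * (1 + j : ℝ) ^ (c + 2 * i + 2) ≤ A) {x : ℝ} (hx : x ∈ Icc (0 : ℝ) 1) :
    Summable fun j => a j * (derivative^[i] (jp N j)).eval x :=
  Summable.of_norm_bounded (summable_sq.mul_left (C * 4 ^ i * A)) fun j => jet_point_le hJ (ha j) hx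

lemma abs_jet_le {C : ℝ} {c : ℕ} (hJ : JB N C c) {a : ℕ → ℝ} {A : ℝ} {i : ℕ}
    (ha : ∀ j, |a j| * (1 + j : ℝ) ^ (c + 2 * i + 2) ≤ A) {x : ℝ} (hx : x ∈ Icc (0 : ℝ) 1) :
    |jet N i a x| ≤ C * 4 ^ i * A * Z2 := by
  unfold jet Z2
  rw [← Real.norm_eq_abs]
  exact tsum_of_norm_bounded (summable_sq.hasSum.mul_left (C * 4 ^ i * A))
    fun j => jet_point_le hJ (ha j) hx

lemma cl_jet {C : ℝ} {c : ℕ} (hJ : JB N C c) {a : ℕ → ℝ} (ha : Rapid a) {B Θ : ℝ} {k i : ℕ}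
    (hb : ∀ m ≤ k, ∀ j, |a j| * (1 + j : ℝ) ^ (c + 2 * i + 2 + m) ≤ B * Θ ^ m) :
    Cl k (C * 4 ^ i * Z2 * B) Θ (fun θ => jet N i a (xc θ)) := by
  choose A hA using fun m => ha (c + 2 * i + 2 + m)
  have hf : ∀ j, ContDiff ℝ ∞ fun θ => a j * E N i j θ := fun j =>
    contDiff_const.mul (contDiff_E i j)
  have hv : ∀ m : ℕ, Summable fun j : ℕ => C * 4 ^ i * A m * ((1 + j : ℝ) ^ 2)⁻¹ := fun m =>
    summable_sq.mul_left _
  have h'f : ∀ (m j : ℕ) (θ : ℝ), ‖iteratedFDeriv ℝ m (fun θ => a j * E N i j θ) θ‖ ≤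
      C * 4 ^ i * A m * ((1 + j : ℝ) ^ 2)⁻¹ := fun m j θ => by
    rw [norm_iteratedFDeriv_eq_norm_iteratedDeriv]
    exact jet_term_le hJ (hA m j) θ
  refine ⟨contDiff_tsum (N := ⊤) hf (fun m _ => hv m) (fun m j θ _ => h'f m j θ), fun m hm θ => ?_⟩
  have e := iteratedFDeriv_tsum_apply (N := ⊤) hf (fun m _ => hv m) (fun m j θ _ => h'f m j θ)
    (k := m) le_top θ
  rw [← Real.norm_eq_abs, ← norm_iteratedFDeriv_eq_norm_iteratedDeriv]
  change ‖iteratedFDeriv ℝ m (fun θ => ∑' j, a j * E N i j θ) θ‖ ≤ _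
  rw [e]
  refine (tsum_of_norm_bounded (summable_sq.hasSum.mul_left (C * 4 ^ i * (B * Θ ^ m)))
    fun j => ?_).trans (le_of_eq (by unfold Z2; ring))
  rw [norm_iteratedFDeriv_eq_norm_iteratedDeriv]
  exact jet_term_le hJ (hb m hm j) θ

lemma continuous_jet {C : ℝ} {c : ℕ} (hJ : JB N C c) {a : ℝ → ℕ → ℝ} {A : ℝ} {i : ℕ}
    (ha : ∀ t j, |a t j| * (1 + j : ℝ) ^ (c + 2 * i + 2) ≤ A)
    (hc : ∀ j, Continuous fun t => a t j) :
    Continuous fun p : ℝ × ℝ => jet N i (a p.1) (xc p.2) := by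
  refine continuous_tsum (u := fun j : ℕ => C * 4 ^ i * A * ((1 + j : ℝ) ^ 2)⁻¹) (fun j => ?_)
    (summable_sq.mul_left _) fun j p => jet_point_le hJ (ha p.1 j) (xc_mem p.2)
  exact ((hc j).comp continuous_fst).mul ((contDiff_E i j).continuous.comp continuous_snd)

lemma hasDerivAt_jet_time {C : ℝ} {c : ℕ} (hJ : JB N C c) {a a' : ℝ → ℕ → ℝ} {A A' : ℝ} {i : ℕ}
    (ha : ∀ t j, |a t j| * (1 + j : ℝ) ^ (c + 2 * i + 2) ≤ A)
    (ha' : ∀ t j, |a' t j| * (1 + j : ℝ) ^ (c + 2 * i + 2) ≤ A')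
    (hd : ∀ t j, HasDerivAt (fun t => a t j) (a' t j) t) {x : ℝ} (hx : x ∈ Icc (0 : ℝ) 1) (t : ℝ) :
    HasDerivAt (fun t => jet N i (a t) x) (jet N i (a' t) x) t :=
  hasDerivAt_tsum (u := fun j : ℕ => C * 4 ^ i * A' * ((1 + j : ℝ) ^ 2)⁻¹) (y₀ := t)
    (summable_sq.mul_left _) (fun j t => (hd t j).mul_const _)
    (fun j t => jet_point_le hJ (ha' t j) hx) (summable_jet hJ (ha t) hx) t

lemma cl_jet_low {C : ℝ} {c : ℕ} (hJ : JB N C c) {a : ℕ → ℝ} (ha : Rapid a) {r : ℝ} {k i w : ℕ}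
    (hw : c + 2 * i + 2 + k ≤ w) (hb : ∀ j, |a j| * (1 + j : ℝ) ^ w ≤ r) :
    Cl k (C * 4 ^ i * Z2 * r) 1 (fun θ => jet N i a (xc θ)) :=
  cl_jet hJ ha fun m hm j => by
    rw [one_pow, mul_one]
    refine le_trans ?_ (hb j)
    exact mul_le_mul_of_nonneg_left (pow_le_pow_right₀
      (by linarith [(Nat.cast_nonneg j : (0 : ℝ) ≤ j)]) (by omega)) (abs_nonneg _)

lemma cl_jet_high {C : ℝ} {c : ℕ} (hJ : JB N C c) {a : ℕ → ℝ} {r Θ : ℝ} (hΘ : 1 ≤ Θ)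
    (ha : ∀ j : ℕ, Θ < j → a j = 0) (k : ℕ) {i w : ℕ} (hw : c + 2 * i + 2 ≤ w)
    (hb : ∀ j, |a j| * (1 + j : ℝ) ^ w ≤ r) :
    Cl k (C * 4 ^ i * Z2 * (2 ^ k * r)) Θ (fun θ => jet N i a (xc θ)) :=
  cl_jet hJ (Rapid.of_finite (n := ⌈Θ⌉₊) fun j hj => ha j (Nat.lt_of_ceil_lt hj)) fun m hm j => by
    have hr : 0 ≤ r := (by positivity : (0 : ℝ) ≤ |a 0| * (1 + (0 : ℕ) : ℝ) ^ w).trans (hb 0)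
    rcases lt_or_ge Θ j with h | h
    · rw [ha j h, abs_zero, zero_mul]; positivity
    · have hj : (0 : ℝ) ≤ j := Nat.cast_nonneg j
      calc |a j| * (1 + j : ℝ) ^ (c + 2 * i + 2 + m)
          = |a j| * (1 + j : ℝ) ^ (c + 2 * i + 2) * (1 + j : ℝ) ^ m := by rw [pow_add _ _ m]; ring
        _ ≤ |a j| * (1 + j : ℝ) ^ w * (2 * Θ) ^ m := by
            gcongr
            · linarith
            · linarith
        _ ≤ r * (2 ^ k * Θ ^ m) := by
            rw [mul_pow]
            refine mul_le_mul (hb j) ?_ (by positivity) hr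
            exact mul_le_mul_of_nonneg_right (pow_le_pow_right₀ one_le_two hm) (by positivity)
        _ = _ := by ring

lemma cl_jet_weighted {C : ℝ} {c : ℕ} (hJ : JB N C c) {a : ℕ → ℝ} {A Θ : ℝ} {n : ℕ} (hΘ : 1 ≤ Θ)
    (h0 : ∀ j, n < j → a j = 0) {s : ℕ} (ha : ∀ j, |a j| * (1 + j / Θ) ^ s ≤ A) (i : ℕ) :
    Cl s (C * 4 ^ i * Z2 * (A * (1 + n : ℝ) ^ (c + 2 * i + 2))) Θ
      (fun θ => jet N i a (xc θ)) :=
  cl_jet hJ (Rapid.of_finite h0) fun m hm j => by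
    have hA : 0 ≤ A := (by positivity : (0 : ℝ) ≤ |a 0| * (1 + (0 : ℕ) / Θ) ^ s).trans (ha 0)
    rcases lt_or_ge n j with h | h
    · rw [h0 j h, abs_zero, zero_mul]; positivity
    · have hj : (0 : ℝ) ≤ j := Nat.cast_nonneg j
      have hjn : (j : ℝ) ≤ n := by exact_mod_cast h
      have hp : (0 : ℝ) < Θ := by linarith
      have h1 : (1 + j : ℝ) ≤ Θ * (1 + j / Θ) := by
        rw [mul_add, mul_one, mul_div_cancel₀ _ hp.ne']; linarith
      have h2 : (1 : ℝ) ≤ 1 + j / Θ := by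
        have : 0 ≤ j / Θ := by positivity
        linarith
      have h3 := pow_le_pow_right₀ h2 hm
      calc |a j| * (1 + j : ℝ) ^ (c + 2 * i + 2 + m)
          = |a j| * ((1 + j : ℝ) ^ (c + 2 * i + 2) * (1 + j : ℝ) ^ m) := by rw [pow_add _ _ m]
        _ ≤ |a j| * ((1 + n : ℝ) ^ (c + 2 * i + 2) * (Θ * (1 + j / Θ)) ^ m) := by gcongr
        _ = |a j| * (1 + j / Θ) ^ m * ((1 + n : ℝ) ^ (c + 2 * i + 2) * Θ ^ m) := by
            rw [mul_pow]; ring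
        _ ≤ |a j| * (1 + j / Θ) ^ s * ((1 + n : ℝ) ^ (c + 2 * i + 2) * Θ ^ m) := by gcongr
        _ ≤ A * ((1 + n : ℝ) ^ (c + 2 * i + 2) * Θ ^ m) := by gcongr; exact ha j
        _ = _ := by ring

lemma jc_weighted {S : ℝ} (hN : 4 < N) (hS : JS S) {s : ℕ} {B Θ : ℝ} {f : ℝ → ℝ} (hΘ : 1 ≤ Θ)
    (h : Cl (s + 2) B Θ (fun θ => f (xc θ))) (j : ℕ) :
    |jc N j f| * (1 + j / Θ) ^ s ≤ 4 ^ s * S * (B * Θ ^ 2) := by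
  have hB := h.nonneg
  have hS1 := hS.one_le
  have hp : (0 : ℝ) < Θ := by linarith
  have hj : (0 : ℝ) ≤ j := Nat.cast_nonneg j
  have h1 := abs_jc_le hN j h.continuousOn h.abs_le_on
  have h2 := jc_decay hN hS hΘ h j
  rcases le_or_gt (j : ℝ) Θ with hjΘ | hjΘ
  · have h3 : (1 + j / Θ) ≤ 2 := by
      have := (div_le_one hp).2 hjΘ
      linarith
    have h4 : (2 : ℝ) ^ s ≤ 4 ^ s := pow_le_pow_left₀ (by norm_num) (by norm_num) s
    have h5 : (1 : ℝ) ≤ Θ ^ 2 := one_le_pow₀ hΘ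
    calc |jc N j f| * (1 + j / Θ) ^ s ≤ B * 4 ^ s := by
          refine mul_le_mul h1 (le_trans ?_ h4) (by positivity) hB
          exact pow_le_pow_left₀ (by positivity) h3 s
      _ ≤ B * 4 ^ s * (S * Θ ^ 2) := le_mul_of_one_le_right (by positivity)
          (one_le_mul_of_one_le_of_one_le hS1 h5)
      _ = _ := by ring
  · rw [le_div_iff₀ (by positivity)] at h2
    have h3 : (1 + j / Θ) ≤ 2 * (1 + j) / Θ := by
      rw [le_div_iff₀ hp, add_mul, div_mul_cancel₀ _ hp.ne']; linarith
    calc |jc N j f| * (1 + j / Θ) ^ s ≤ |jc N j f| * (2 * (1 + j) / Θ) ^ s := by gcongr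
      _ = |jc N j f| * (1 + j : ℝ) ^ s * (2 / Θ) ^ s := by
          rw [mul_assoc, ← mul_pow]; congr 2; ring
      _ ≤ 2 ^ s * S * (B * Θ ^ (s + 2)) * (2 / Θ) ^ s := by gcongr
      _ = _ := by
          rw [div_pow, pow_add, show (4 : ℝ) = 2 * 2 by norm_num, mul_pow]
          field_simp

/-- Frequency scales `Θ` and sizes `n` for a family of functions, with the orders of
differentiation under control. -/
structure Scale (I : Type*) where
  Θ : I → ℝ
  n : I → ℝ
  P : ℕ → Prop
  hΘ : ∀ i, 1 ≤ Θ i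
  hn : ∀ i, 1 ≤ n i

/-- Uniform bounds for families of functions of time and space. -/
def Tame {I : Type*} (σ : Scale I) (e : ℕ) (G : I → ℝ → ℝ → ℝ) : Prop :=
  (∀ i, Continuous fun p : ℝ × ℝ => G i p.1 (xc p.2)) ∧
    ∀ k, σ.P k → ∃ C : ℝ, ∀ i t, Cl k (C * σ.n i ^ e) (σ.Θ i) (fun θ => G i t (xc θ))

namespace Tame
variable {I : Type*} {σ : Scale I} {e e' : ℕ} {F G : I → ℝ → ℝ → ℝ}

lemma mono (h : Tame σ e G) (he : e ≤ e') : Tame σ e' G :=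
  ⟨h.1, fun k hk => by
    obtain ⟨C, hC⟩ := h.2 k hk
    refine ⟨|C|, fun i t => (hC i t).mono ?_ (zero_le_one.trans (σ.hΘ i))⟩
    have h1 := pow_le_pow_right₀ (σ.hn i) he
    have h0 : (0 : ℝ) ≤ σ.n i ^ e := pow_nonneg (zero_le_one.trans (σ.hn i)) _
    exact mul_le_mul (le_abs_self C) h1 h0 (abs_nonneg C)⟩

lemma add (hF : Tame σ e F) (hG : Tame σ e G) : Tame σ e (fun i t x => F i t x + G i t x) :=
  ⟨fun i => (hF.1 i).add (hG.1 i), fun k hk => by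
    obtain ⟨C, hC⟩ := hF.2 k hk
    obtain ⟨D, hD⟩ := hG.2 k hk
    exact ⟨C + D, fun i t => by rw [add_mul]; exact (hC i t).add (hD i t)⟩⟩

lemma neg (hF : Tame σ e F) : Tame σ e (fun i t x => -F i t x) :=
  ⟨fun i => (hF.1 i).neg, fun k hk => by
    obtain ⟨C, hC⟩ := hF.2 k hk
    exact ⟨C, fun i t => (hC i t).neg⟩⟩

lemma sub (hF : Tame σ e F) (hG : Tame σ e G) : Tame σ e (fun i t x => F i t x - G i t x) := by
  simpa only [sub_eq_add_neg] using hF.add hG.neg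

lemma mul (hF : Tame σ e F) (hG : Tame σ e' G) :
    Tame σ (e + e') (fun i t x => F i t x * G i t x) :=
  ⟨fun i => (hF.1 i).mul (hG.1 i), fun k hk => by
    obtain ⟨C, hC⟩ := hF.2 k hk
    obtain ⟨D, hD⟩ := hG.2 k hk
    refine ⟨2 ^ k * (C * D), fun i t => ?_⟩
    have := (hC i t).mul (zero_le_one.trans (σ.hΘ i)) (hD i t)
    rwa [show 2 ^ k * (C * D) * σ.n i ^ (e + e') =
      2 ^ k * (C * σ.n i ^ e * (D * σ.n i ^ e')) by rw [pow_add]; ring]⟩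

lemma mul₀ (hF : Tame σ 0 F) (hG : Tame σ e G) : Tame σ e (fun i t x => F i t x * G i t x) := by
  simpa only [zero_add] using hF.mul hG

lemma time {g : I → ℝ → ℝ} {B : ℝ} (hc : ∀ i, Continuous (g i)) (hB : ∀ i t, |g i t| ≤ B) :
    Tame σ 0 (fun i t _ => g i t) :=
  ⟨fun i => (hc i).comp continuous_fst, fun k _ => ⟨B, fun i t => by
    rw [pow_zero, mul_one]
    exact (Cl.const _ (zero_le_one.trans (σ.hΘ i))).mono (hB i t) (zero_le_one.trans (σ.hΘ i))⟩⟩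

lemma const (c : ℝ) : Tame σ 0 (fun _ _ _ => c) :=
  time (g := fun _ _ => c) (B := |c|) (fun _ => continuous_const) fun _ _ => le_rfl

lemma id : Tame σ 0 (fun _ _ x => x) :=
  ⟨fun _ => contDiff_xc.continuous.comp continuous_snd, fun k _ => ⟨|1 / 2| * (|1| + 1), fun i t => by
    rw [pow_zero, mul_one]
    have := (((Cl.const (k := k) 1 (zero_le_one.trans (σ.hΘ i))).sub
      (Cl.cos (σ.hΘ i))).const_mul (1 / 2))
    refine (congrArg _ ?_).mpr this
    funext θ; unfold xc; ring⟩⟩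

lemma zero : Tame σ e (fun _ _ _ => 0) := (const 0).mono (Nat.zero_le e)

lemma sum {κ : Type*} (s : Finset κ) {F : κ → I → ℝ → ℝ → ℝ} (h : ∀ a ∈ s, Tame σ e (F a)) :
    Tame σ e (fun i t x => ∑ a ∈ s, F a i t x) := by
  classical
  induction s using Finset.induction_on with
  | empty => simpa using zero
  | insert a s ha ih =>
    simp only [Finset.sum_insert ha]
    exact (h a (Finset.mem_insert_self a s)).add (ih fun b hb => h b (Finset.mem_insert_of_mem hb))

lemma comp {m : ℕ} {Φ : (Fin m → ℝ) → ℝ} {K : Set (Fin m → ℝ)} (hK : IsCompact K)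
    (hΦ : AnalyticOnNhd ℝ Φ K) {D : I → ℝ → ℝ → Fin m → ℝ}
    (hD : ∀ j, Tame σ 0 (fun i t x => D i t x j))
    (hDK : ∀ i t, ∀ x ∈ Icc (0 : ℝ) 1, D i t x ∈ K) : Tame σ 0 (fun i t x => Φ (D i t x)) := by
  refine ⟨fun i => ?_, fun k hk => ?_⟩
  · refine hΦ.continuousOn.comp_continuous (continuous_pi fun j => (hD j).1 i) fun p =>
      hDK i p.1 _ (xc_mem p.2)
  · choose C hC using fun j => (hD j).2 k hk
    obtain ⟨A, hA, hcomp⟩ := Cl.comp hK hΦ k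
    refine ⟨A * (1 + ∑ j, |C j|) ^ k, fun i t => ?_⟩
    rw [pow_zero, mul_one]
    refine hcomp (fun j θ => D i t (xc θ) j) _ (σ.Θ i)
      (le_add_of_nonneg_right (Finset.sum_nonneg fun _ _ => abs_nonneg _)) (σ.hΘ i)
      (fun j => (hC j i t).mono ?_ (zero_le_one.trans (σ.hΘ i))) fun θ => hDK i t _ (xc_mem θ)
    rw [pow_zero, mul_one]
    have := Finset.single_le_sum (f := fun j => |C j|) (fun _ _ => abs_nonneg _) (Finset.mem_univ j)
    linarith [le_abs_self (C j)]

lemma bound (h : Tame σ e G) {k : ℕ} (hk : σ.P k) :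
    ∃ C : ℝ, 0 ≤ C ∧ ∀ i t, ∀ x ∈ Icc (0 : ℝ) 1, |G i t x| ≤ C * σ.n i ^ e := by
  obtain ⟨C, hC⟩ := h.2 k hk
  refine ⟨|C|, abs_nonneg _, fun i t x hx => ((hC i t).abs_le_on x hx).trans ?_⟩
  exact mul_le_mul_of_nonneg_right (le_abs_self C) (pow_nonneg (zero_le_one.trans (σ.hn i)) _)

lemma continuousOn (h : Tame σ e G) (i : I) (t : ℝ) : ContinuousOn (G i t) (Icc 0 1) :=
  continuousOn_of_comp_xc ((h.1 i).comp (Continuous.prodMk_right t))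

end Tame

/-- Directional derivative written through coordinates. -/
lemma fderiv_eq_sum {m : ℕ} (Φ : (Fin m → ℝ) → ℝ) (p v : Fin m → ℝ) :
    fderiv ℝ Φ p v = ∑ j, fderiv ℝ Φ p (Pi.single j 1) * v j := by
  conv_lhs => rw [pi_eq_sum_univ' v]
  rw [map_sum]
  exact Finset.sum_congr rfl fun j _ => by rw [map_smul, smul_eq_mul, mul_comm]

lemma analyticOnNhd_partial {m : ℕ} {Φ : (Fin m → ℝ) → ℝ} {K : Set (Fin m → ℝ)}
    (hΦ : AnalyticOnNhd ℝ Φ K) (v : Fin m → ℝ) : AnalyticOnNhd ℝ (fun p => fderiv ℝ Φ p v) K :=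
  fun p hp => ((ContinuousLinearMap.apply ℝ ℝ v).analyticAt _).comp (hΦ p hp).fderiv

lemma Tame.fderiv_comp {I : Type*} {σ : Scale I} {m : ℕ} {Φ : (Fin m → ℝ) → ℝ}
    {K : Set (Fin m → ℝ)} (hK : IsCompact K)
    (hΦ : AnalyticOnNhd ℝ Φ K) {D D' : I → ℝ → ℝ → Fin m → ℝ}
    (hD : ∀ j, Tame σ 0 (fun i t x => D i t x j)) {e : ℕ} (hD' : ∀ j, Tame σ e (fun i t x => D' i t x j))
    (hDK : ∀ i t, ∀ x ∈ Icc (0 : ℝ) 1, D i t x ∈ K) :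
    Tame σ e (fun i t x => fderiv ℝ Φ (D i t x) (D' i t x)) := by
  have h : (fun i t x => fderiv ℝ Φ (D i t x) (D' i t x)) =
      fun i t x => ∑ j, fderiv ℝ Φ (D i t x) (Pi.single j 1) * D' i t x j := by
    funext i t x; exact fderiv_eq_sum _ _ _
  rw [h]
  exact Tame.sum _ fun j _ => (Tame.comp hK (analyticOnNhd_partial hΦ _) hD hDK).mul₀ (hD' j)

/-- Continuity in time of inner products. -/
lemma continuous_ip (hN : 4 < N) {f g : ℝ → ℝ → ℝ}
    (hf : Continuous fun p : ℝ × ℝ => f p.1 (xc p.2))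
    (hg : Continuous fun p : ℝ × ℝ => g p.1 (xc p.2)) : Continuous fun t => ip N (f t) (g t) := by
  have hθ : Continuous fun x : ℝ => arccos (1 - 2 * x) := by fun_prop
  have e : ∀ t, ip N (f t) (g t) = ∫ x in (0 : ℝ)..1, f t (xc (arccos (1 - 2 * x))) *
      g t (xc (arccos (1 - 2 * x))) * wt N x := fun t => by
    unfold ip
    refine intervalIntegral.integral_congr fun x hx => ?_
    rw [uIcc_of_le zero_le_one] at hx
    simp only [xc_arccos hx]
  simp only [e]
  refine intervalIntegral.continuous_parametric_intervalIntegral_of_continuous' ?_ 0 1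
  have h1 : Continuous fun p : ℝ × ℝ => (p.1, arccos (1 - 2 * p.2)) :=
    continuous_fst.prodMk (hθ.comp continuous_snd)
  exact ((hf.comp h1).mul (hg.comp h1)).mul ((continuous_wt hN).comp continuous_snd)

lemma jc_add (hN : 4 < N) (j : ℕ) {f g : ℝ → ℝ} (hf : ContinuousOn f (Icc 0 1))
    (hg : ContinuousOn g (Icc 0 1)) : jc N j (fun x => f x + g x) = jc N j f + jc N j g :=
  ip_add_left hN hf hg (jp N j).continuous.continuousOn

lemma jc_congr (j : ℕ) {f g : ℝ → ℝ} (h : ∀ x ∈ Icc (0 : ℝ) 1, f x = g x) : jc N j f = jc N j g :=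
  ip_congr h fun _ _ => rfl

lemma jc_zero (j : ℕ) : jc N j (fun _ => 0) = 0 := by simp [jc, ip]

lemma jc_smul (j : ℕ) (c : ℝ) (f : ℝ → ℝ) : jc N j (fun x => c * f x) = c * jc N j f :=
  ip_smul_left c f _

lemma jc_finset_sum (hN : 4 < N) (j n : ℕ) {f : ℕ → ℝ → ℝ} (hf : ∀ k, ContinuousOn (f k) (Icc 0 1))
    (c : ℕ → ℝ) : jc N j (fun x => ∑ k ∈ Finset.range (n + 1), c k * f k x) =
      ∑ k ∈ Finset.range (n + 1), c k * jc N j (f k) := by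
  unfold jc
  rw [ip_sum_left hN _ (fun k _ => continuousOn_const.fun_mul (hf k)) (jp N j).continuous.continuousOn]
  exact Finset.sum_congr rfl fun k _ => ip_smul_left _ _ _

lemma continuousOn_jet {a : ℕ → ℝ} {n : ℕ} (h : ∀ j, n < j → a j = 0) (i : ℕ) (s : Set ℝ) :
    ContinuousOn (jet N i a) s :=
  (continuous_iff_continuousAt.2 fun x => (hasDerivAt_jet h i x).continuousAt).continuousOn

lemma jc_mul_jet (hN : 4 < N) {f : ℝ → ℝ} (hf : ContinuousOn f (Icc 0 1)) {a : ℕ → ℝ} {n : ℕ}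
    (h : ∀ j, n < j → a j = 0) (j : ℕ) : jc N j (fun x => f x * jet N 0 a x) =
      ∑ k ∈ Finset.range (n + 1), mm N f j k * a k := by
  have e : (fun x => f x * jet N 0 a x) =
      fun x => ∑ k ∈ Finset.range (n + 1), a k * (f x * (jp N k).eval x) := by
    funext x
    rw [jet_eq_sum h, Finset.mul_sum]
    exact Finset.sum_congr rfl fun k _ => by simp only [Function.iterate_zero, id]; ring
  rw [e, jc_finset_sum hN j n (fun k => hf.fun_mul (jp N k).continuous.continuousOn)]
  exact Finset.sum_congr rfl fun k _ => mul_comm _ _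

lemma jc_mul_Xjet (hN : 4 < N) {f : ℝ → ℝ} (hf : ContinuousOn f (Icc 0 1)) {a : ℕ → ℝ} {n : ℕ}
    (h : ∀ j, n < j → a j = 0) (j : ℕ) : jc N j (fun x => f x * (x * (1 - x) * jet N 1 a x)) =
      ∑ k ∈ Finset.range (n + 1), mX N f j k * a k := by
  have e : (fun x => f x * (x * (1 - x) * jet N 1 a x)) =
      fun x => ∑ k ∈ Finset.range (n + 1), a k * (f x * (Xjp N k).eval x) := by
    funext x
    rw [jet_eq_sum h, Finset.mul_sum, Finset.mul_sum]
    exact Finset.sum_congr rfl fun k _ => by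
      simp only [Function.iterate_one, eval_Xjp]; ring
  rw [e, jc_finset_sum hN j n (fun k => hf.fun_mul (Xjp N k).continuous.continuousOn)]
  exact Finset.sum_congr rfl fun k _ => mul_comm _ _

lemma lamV_jet {a : ℕ → ℝ} {n : ℕ} (h : ∀ j, n < j → a j = 0) (x : ℝ) :
    lamV N x (jet N 1 a x) (jet N 2 a x) = jet N 0 (fun j => lam N j * a j) x := by
  rw [jet_eq_sum h, jet_eq_sum h, jet_eq_sum (n := n) (fun j hj => by rw [h j hj, mul_zero])]
  unfold lamV
  rw [Finset.mul_sum, Finset.mul_sum, ← Finset.sum_sub_distrib]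
  refine Finset.sum_congr rfl fun k _ => ?_
  have := jp_eigen (N := N) k x
  unfold lamV at this
  simp only [Function.iterate_succ, Function.iterate_zero, Function.comp_apply, id] at this ⊢
  linear_combination a k * this

lemma jc_mul_lamV (hN : 4 < N) {f : ℝ → ℝ} (hf : ContinuousOn f (Icc 0 1)) {a : ℕ → ℝ} {n : ℕ}
    (h : ∀ j, n < j → a j = 0) (j : ℕ) :
    jc N j (fun x => f x * lamV N x (jet N 1 a x) (jet N 2 a x)) =
      ∑ k ∈ Finset.range (n + 1), mm N f j k * lam N k * a k := by
  simp only [lamV_jet h]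
  rw [jc_mul_jet hN hf (n := n) (fun j hj => by rw [h j hj, mul_zero])]
  exact Finset.sum_congr rfl fun k _ => by ring

/-- Right-hand side of the first linear equation. -/
noncomputable def lin1 (N : ℝ) (K : Fin 7 → ℝ → ℝ) (h q : ℕ → ℝ) (x : ℝ) : ℝ :=
  K 0 x * jet N 0 q x + K 1 x * jet N 0 h x + K 2 x * (x * (1 - x) * jet N 1 h x)

/-- Right-hand side of the second linear equation. -/
noncomputable def lin2 (N : ℝ) (K : Fin 7 → ℝ → ℝ) (h q : ℕ → ℝ) (x : ℝ) : ℝ :=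
  -(K 0 x * lamV N x (jet N 1 h x) (jet N 2 h x)) + K 3 x * jet N 0 h x +
    K 4 x * (x * (1 - x) * jet N 1 h x) + K 5 x * jet N 0 q x + K 6 x * (x * (1 - x) * jet N 1 q x)

section
variable {K : Fin 7 → ℝ → ℝ} {h q : ℕ → ℝ} {n : ℕ}

lemma continuousOn_lamV (hh : ∀ j, n < j → h j = 0) :
    ContinuousOn (fun x => lamV N x (jet N 1 h x) (jet N 2 h x)) (Icc 0 1) :=
  (continuousOn_mul_one_sub.fun_neg.fun_mul (continuousOn_jet hh 2 _)).fun_sub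
    (continuous_bb.continuousOn.fun_mul (continuousOn_jet hh 1 _))

lemma continuousOn_lin1 (hK : ∀ m, ContinuousOn (K m) (Icc 0 1)) (hh : ∀ j, n < j → h j = 0)
    (hq : ∀ j, n < j → q j = 0) : ContinuousOn (lin1 N K h q) (Icc 0 1) := by
  have hx := continuousOn_mul_one_sub
  exact (((hK 0).fun_mul (continuousOn_jet hq 0 _)).fun_add ((hK 1).fun_mul (continuousOn_jet hh 0 _))).fun_add
    ((hK 2).fun_mul (hx.fun_mul (continuousOn_jet hh 1 _)))

lemma continuousOn_lin2 (hK : ∀ m, ContinuousOn (K m) (Icc 0 1)) (hh : ∀ j, n < j → h j = 0)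
    (hq : ∀ j, n < j → q j = 0) : ContinuousOn (lin2 N K h q) (Icc 0 1) := by
  have hx := continuousOn_mul_one_sub
  exact (((((hK 0).fun_mul (continuousOn_lamV hh)).fun_neg.fun_add ((hK 3).fun_mul (continuousOn_jet hh 0 _))).fun_add
    ((hK 4).fun_mul (hx.fun_mul (continuousOn_jet hh 1 _)))).fun_add
    ((hK 5).fun_mul (continuousOn_jet hq 0 _))).fun_add ((hK 6).fun_mul (hx.fun_mul (continuousOn_jet hq 1 _)))

lemma jc_lin1 (hN : 4 < N) (hK : ∀ m, ContinuousOn (K m) (Icc 0 1)) (hh : ∀ j, n < j → h j = 0)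
    (hq : ∀ j, n < j → q j = 0) (j : ℕ) : jc N j (lin1 N K h q) = ∑ k ∈ Finset.range (n + 1),
      ((mm N (K 1) j k + mX N (K 2) j k) * h k + mm N (K 0) j k * q k) := by
  have hx := continuousOn_mul_one_sub
  have c1 := (hK 0).fun_mul (continuousOn_jet (N := N) hq 0 _)
  have c2 := (hK 1).fun_mul (continuousOn_jet (N := N) hh 0 _)
  have c3 := (hK 2).fun_mul (hx.fun_mul (continuousOn_jet (N := N) hh 1 _))
  unfold lin1
  rw [jc_add hN j (c1.fun_add c2) c3, jc_add hN j c1 c2, jc_mul_jet hN (hK 0) hq,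
    jc_mul_jet hN (hK 1) hh, jc_mul_Xjet hN (hK 2) hh, ← Finset.sum_add_distrib,
    ← Finset.sum_add_distrib]
  exact Finset.sum_congr rfl fun k _ => by ring

lemma jc_lin2 (hN : 4 < N) (hK : ∀ m, ContinuousOn (K m) (Icc 0 1)) (hh : ∀ j, n < j → h j = 0)
    (hq : ∀ j, n < j → q j = 0) (j : ℕ) : jc N j (lin2 N K h q) = ∑ k ∈ Finset.range (n + 1),
      ((-(mm N (K 0) j k * lam N k) + (mm N (K 3) j k + mX N (K 4) j k)) * h k +
        (mm N (K 5) j k + mX N (K 6) j k) * q k) := by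
  have hx := continuousOn_mul_one_sub
  have c1 := ((hK 0).fun_mul (continuousOn_lamV (N := N) hh)).fun_neg
  have c2 := (hK 3).fun_mul (continuousOn_jet (N := N) hh 0 _)
  have c3 := (hK 4).fun_mul (hx.fun_mul (continuousOn_jet (N := N) hh 1 _))
  have c4 := (hK 5).fun_mul (continuousOn_jet (N := N) hq 0 _)
  have c5 := (hK 6).fun_mul (hx.fun_mul (continuousOn_jet (N := N) hq 1 _))
  have e1 : jc N j (fun x => -(K 0 x * lamV N x (jet N 1 h x) (jet N 2 h x))) =
      -∑ k ∈ Finset.range (n + 1), mm N (K 0) j k * lam N k * h k := by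
    rw [← jc_mul_lamV hN (hK 0) hh, ← neg_one_mul, ← jc_smul]
    simp only [neg_one_mul]
  unfold lin2
  rw [jc_add hN j (((c1.fun_add c2).fun_add c3).fun_add c4) c5, jc_add hN j ((c1.fun_add c2).fun_add c3) c4,
    jc_add hN j (c1.fun_add c2) c3, jc_add hN j c1 c2, e1, jc_mul_jet hN (hK 3) hh,
    jc_mul_jet hN (hK 5) hq, jc_mul_Xjet hN (hK 4) hh, jc_mul_Xjet hN (hK 6) hq,
    ← Finset.sum_neg_distrib, ← Finset.sum_add_distrib, ← Finset.sum_add_distrib,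
    ← Finset.sum_add_distrib, ← Finset.sum_add_distrib]
  exact Finset.sum_congr rfl fun k _ => by ring

end

/-- A trajectory of coefficient sequences vanishing beyond degree `n` and constant for `τ ≤ |t|`. -/
structure Traj (n : ℕ) (τ : ℝ) (h h' : ℝ → ℕ → ℝ) : Prop where
  zero : ∀ t j, n < j → h t j = 0
  zero' : ∀ t j, n < j → h' t j = 0
  deriv : ∀ t j, HasDerivAt (fun t => h t j) (h' t j) t
  cont : ∀ j, Continuous fun t => h' t j
  supp : ∀ t j, τ ≤ |t| → h' t j = 0

lemma Traj.continuous {n : ℕ} {τ : ℝ} {h h' : ℝ → ℕ → ℝ} (H : Traj n τ h h') (j : ℕ) :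
    Continuous fun t => h t j :=
  continuous_iff_continuousAt.2 fun t => (H.deriv t j).continuousAt

lemma linear_instance (hN : 4 < N) {τ : ℝ} (hτ : 0 ≤ τ) (n : ℕ) {K : Fin 7 → ℝ → ℝ → ℝ}
    {R1 R2 : ℝ → ℝ → ℝ} (hK : ∀ m, Continuous fun p : ℝ × ℝ => K m p.1 (xc p.2))
    (hR1 : Continuous fun p : ℝ × ℝ => R1 p.1 (xc p.2))
    (hR2 : Continuous fun p : ℝ × ℝ => R2 p.1 (xc p.2))
    (hKs : ∀ m t x, τ ≤ |t| → K m t x = 0)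
    (hRs : ∀ t x, τ ≤ |t| → R1 t x = 0 ∧ R2 t x = 0) :
    ∃ h q h' q' : ℝ → ℕ → ℝ, Traj n τ h h' ∧ Traj n τ q q' ∧ (∀ j, h 0 j = 0 ∧ q 0 j = 0) ∧
      (∀ t, ∀ j ≤ n, h' t j = jc N j (fun x => lin1 N (fun m => K m t) (h t) (q t) x - R1 t x) ∧
        q' t j = jc N j (fun x => lin2 N (fun m => K m t) (h t) (q t) x - R2 t x)) ∧
      ∀ (s : ℕ) (M Θ G : ℝ) (a1' s1' : ℝ → ℝ → ℝ), 1 ≤ Θ → 0 ≤ M → 0 ≤ G →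
        (∀ t, Lc N M s Θ (K 0 t) (K 1 t) (K 2 t) (K 3 t) (K 4 t) (K 5 t) (K 6 t) (a1' t) (s1' t)) →
        (∀ t, ∑ j ∈ Finset.range (n + 1), wg N Θ j ^ (2 * s) *
          ((nu N j * jc N j (R1 t)) ^ 2 + jc N j (R2 t) ^ 2) ≤ G) →
        ∀ t, ∑ j ∈ Finset.range (n + 1), wg N Θ j ^ (2 * s) *
          ((nu N j * h t j) ^ 2 + q t j ^ 2) ≤ G * τ * exp (eK N s M * τ) := by
  have hjp : ∀ j, Continuous fun p : ℝ × ℝ => (jp N j).eval (xc p.2) := fun j =>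
    (jp N j).continuous.comp (contDiff_xc.continuous.comp continuous_snd)
  have hXp : ∀ j, Continuous fun p : ℝ × ℝ => (Xjp N j).eval (xc p.2) := fun j =>
    (Xjp N j).continuous.comp (contDiff_xc.continuous.comp continuous_snd)
  have cmm : ∀ m i j, Continuous fun t => mm N (K m t) i j := fun m i j =>
    continuous_ip hN (f := fun t x => K m t x * (jp N j).eval x) (g := fun _ x => (jp N i).eval x)
      ((hK m).mul (hjp j)) (hjp i)
  have cmX : ∀ m i j, Continuous fun t => mX N (K m t) i j := fun m i j =>
    continuous_ip hN (f := fun t x => K m t x * (Xjp N j).eval x) (g := fun _ x => (jp N i).eval x)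
      ((hK m).mul (hXp j)) (hjp i)
  have cR1 : ∀ j, Continuous fun t => jc N j (R1 t) := fun j =>
    continuous_ip hN (g := fun _ x => (jp N j).eval x) hR1 (hjp j)
  have cR2 : ∀ j, Continuous fun t => jc N j (R2 t) := fun j =>
    continuous_ip hN (g := fun _ x => (jp N j).eval x) hR2 (hjp j)
  have zmm : ∀ t, τ ≤ |t| → ∀ m i j, mm N (K m t) i j = 0 := fun t ht m i j => by
    simp [mm, ip, hKs m t _ ht]
  have zmX : ∀ t, τ ≤ |t| → ∀ m i j, mX N (K m t) i j = 0 := fun t ht m i j => by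
    simp [mX, ip, hKs m t _ ht]
  obtain ⟨h, q, h0, hz, hd⟩ := exists_linear_ode_pair (τ := τ) hτ n
    (P := fun t j k => mm N (K 1 t) j k + mX N (K 2 t) j k) (Q := fun t j k => mm N (K 0 t) j k)
    (R := fun t j k => -(mm N (K 0 t) j k * lam N k) + (mm N (K 3 t) j k + mX N (K 4 t) j k))
    (S := fun t j k => mm N (K 5 t) j k + mX N (K 6 t) j k)
    (b1 := fun t j => -jc N j (R1 t)) (b2 := fun t j => -jc N j (R2 t))
    (fun i j => (cmm 1 i j).add (cmX 2 i j)) (fun i j => cmm 0 i j)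
    (fun i j => ((cmm 0 i j).mul continuous_const).neg.add ((cmm 3 i j).add (cmX 4 i j)))
    (fun i j => (cmm 5 i j).add (cmX 6 i j)) (fun j => (cR1 j).neg) (fun j => (cR2 j).neg)
    (fun t ht i j => by simp [zmm t ht, zmX t ht])
    (fun t ht i => by simp [jc, ip, hRs t _ ht])
  set p1 : ℝ → ℕ → ℝ := fun t j => ∑ k ∈ Finset.range (n + 1), ((mm N (K 1 t) j k + mX N (K 2 t) j k)
    * h t k + mm N (K 0 t) j k * q t k) + -jc N j (R1 t) with hp1
  set p2 : ℝ → ℕ → ℝ := fun t j => ∑ k ∈ Finset.range (n + 1), ((-(mm N (K 0 t) j k * lam N k) +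
    (mm N (K 3 t) j k + mX N (K 4 t) j k)) * h t k +
    (mm N (K 5 t) j k + mX N (K 6 t) j k) * q t k) + -jc N j (R2 t) with hp2
  have hdh : ∀ t j, HasDerivAt (fun t => h t j) (if j ≤ n then p1 t j else 0) t := fun t j => by
    split_ifs with hj
    · exact (hd t j hj).1
    · have : (fun t => h t j) = fun _ => 0 := funext fun t => (hz t j (by omega)).1
      rw [this]; exact hasDerivAt_const t 0
  have hdq : ∀ t j, HasDerivAt (fun t => q t j) (if j ≤ n then p2 t j else 0) t := fun t j => by
    split_ifs with hj
    · exact (hd t j hj).2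
    · have : (fun t => q t j) = fun _ => 0 := funext fun t => (hz t j (by omega)).2
      rw [this]; exact hasDerivAt_const t 0
  have ch : ∀ j, Continuous fun t => h t j := fun j =>
    continuous_iff_continuousAt.2 fun t => (hdh t j).continuousAt
  have cq : ∀ j, Continuous fun t => q t j := fun j =>
    continuous_iff_continuousAt.2 fun t => (hdq t j).continuousAt
  have cK : ∀ t m, ContinuousOn (K m t) (Icc 0 1) := fun t m =>
    continuousOn_of_comp_xc ((hK m).comp (Continuous.prodMk_right t))
  have cOR1 : ∀ t, ContinuousOn (R1 t) (Icc 0 1) := fun t =>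
    continuousOn_of_comp_xc (hR1.comp (Continuous.prodMk_right t))
  have cOR2 : ∀ t, ContinuousOn (R2 t) (Icc 0 1) := fun t =>
    continuousOn_of_comp_xc (hR2.comp (Continuous.prodMk_right t))
  have s1 : ∀ t j, τ ≤ |t| → p1 t j = 0 := fun t j ht => by
    simp [hp1, zmm t ht, zmX t ht, jc, ip, hRs t _ ht]
  have s2 : ∀ t j, τ ≤ |t| → p2 t j = 0 := fun t j ht => by
    simp [hp2, zmm t ht, zmX t ht, jc, ip, hRs t _ ht]
  refine ⟨h, q, fun t j => if j ≤ n then p1 t j else 0, fun t j => if j ≤ n then p2 t j else 0,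
    ⟨fun t j hj => (hz t j hj).1, fun t j hj => if_neg (by omega), hdh, fun j => ?_, fun t j ht => ?_⟩,
    ⟨fun t j hj => (hz t j hj).2, fun t j hj => if_neg (by omega), hdq, fun j => ?_, fun t j ht => ?_⟩,
    h0, fun t j hj => ?_, ?_⟩
  · split_ifs
    · exact (continuous_finsetSum _ fun k _ => (((cmm 1 j k).add (cmX 2 j k)).mul (ch k)).add
        ((cmm 0 j k).mul (cq k))).add (cR1 j).neg
    · exact continuous_const
  · simp only [s1 t j ht, ite_self]
  · split_ifs
    · exact (continuous_finsetSum _ fun k _ => ((((cmm 0 j k).mul continuous_const).neg.add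
        ((cmm 3 j k).add (cmX 4 j k))).mul (ch k)).add
        (((cmm 5 j k).add (cmX 6 j k)).mul (cq k))).add (cR2 j).neg
    · exact continuous_const
  · simp only [s2 t j ht, ite_self]
  · simp only [if_pos hj]
    rw [jc_sub hN j (continuousOn_lin1 (cK t) (fun j hj => (hz t j hj).1)
      (fun j hj => (hz t j hj).2)) (cOR1 t), jc_sub hN j (continuousOn_lin2 (cK t)
      (fun j hj => (hz t j hj).1) (fun j hj => (hz t j hj).2)) (cOR2 t),
      jc_lin1 hN (cK t) (fun j hj => (hz t j hj).1) (fun j hj => (hz t j hj).2),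
      jc_lin2 hN (cK t) (fun j hj => (hz t j hj).1) (fun j hj => (hz t j hj).2)]
    exact ⟨rfl, rfl⟩
  · intro s M Θ G a1' s1' hΘ hM hG hLc hGr t
    have hw : ∀ j, 0 ≤ wg N Θ j ^ (2 * s) := fun j =>
      pow_nonneg (zero_le_one.trans (wg_ge hN hΘ j)) _
    set Ef : ℝ → ℝ := fun t => ∑ j ∈ Finset.range (n + 1), wg N Θ j ^ (2 * s) *
      ((nu N j * h t j) ^ 2 + q t j ^ 2) with hEf
    have hE0 : ∀ t, 0 ≤ Ef t := fun t => Finset.sum_nonneg fun j _ => mul_nonneg (hw j) (by positivity)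
    have hdE : ∀ t, HasDerivAt Ef (∑ j ∈ Finset.range (n + 1), wg N Θ j ^ (2 * s) *
        (2 * (nu N j * h t j) * (nu N j * (if j ≤ n then p1 t j else 0)) +
          2 * q t j * (if j ≤ n then p2 t j else 0))) t := fun t => by
      refine (HasDerivAt.fun_sum fun j _ => ((((hdh t j).const_mul (nu N j)).fun_pow 2).fun_add
        ((hdq t j).fun_pow 2)).const_mul (wg N Θ j ^ (2 * s))).congr_deriv ?_
      refine Finset.sum_congr rfl fun j _ => ?_
      push_cast; ring
    have hK0 : 0 ≤ eK N s M := by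
      have : 0 ≤ Z2 := zero_le_one.trans Z2_ge
      unfold eK; positivity
    have := gronwall_supp (f := Ef) hK0 hG hτ hdE (by simp [hEf, h0]) (fun t => ?_) (fun t ht => ?_) t
    · exact (le_abs_self _).trans this
    · rw [Real.norm_eq_abs, Real.norm_eq_abs, abs_of_nonneg (hE0 t)]
      refine (linear_energy_deriv hN hΘ hM (hLc t) n (c := h t) (d := q t)
        (r1 := fun j => jc N j (R1 t)) (r2 := fun j => jc N j (R2 t))
        (fun j hj => ?_) fun j hj => ?_).trans (add_le_add le_rfl (hGr t))
      · rw [if_pos hj]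
      · rw [if_pos hj]
    · simp [s1 t _ ht, s2 t _ ht]

/-- The frequency-one scale with sixteen derivatives. -/
def Scale.low {I : Type*} (_ : Scale I) : Scale I where
  Θ := fun _ => 1
  n := fun _ => 1
  P := fun k => k ≤ 16
  hΘ := fun _ => le_rfl
  hn := fun _ => le_rfl

section
variable {I : Type*} {σ : Scale I}

/-- Uniform bounds at all orders at frequency `Θ`, and for sixteen derivatives at frequency one. -/
def Both (σ : Scale I) (G : I → ℝ → ℝ → ℝ) : Prop := Tame σ 0 G ∧ Tame σ.low 0 G

namespace Both
variable {F G : I → ℝ → ℝ → ℝ}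

lemma add (hF : Both σ F) (hG : Both σ G) : Both σ (fun i t x => F i t x + G i t x) :=
  ⟨hF.1.add hG.1, hF.2.add hG.2⟩

lemma neg (hF : Both σ F) : Both σ (fun i t x => -F i t x) := ⟨hF.1.neg, hF.2.neg⟩

lemma sub (hF : Both σ F) (hG : Both σ G) : Both σ (fun i t x => F i t x - G i t x) :=
  ⟨hF.1.sub hG.1, hF.2.sub hG.2⟩

lemma mul (hF : Both σ F) (hG : Both σ G) : Both σ (fun i t x => F i t x * G i t x) :=
  ⟨hF.1.mul₀ hG.1, hF.2.mul₀ hG.2⟩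

lemma time {g : ℝ → ℝ} {B : ℝ} (hc : Continuous g) (hB : ∀ t, |g t| ≤ B) :
    Both σ (fun _ t _ => g t) :=
  ⟨Tame.time (g := fun _ => g) (fun _ => hc) fun _ => hB,
    Tame.time (g := fun _ => g) (fun _ => hc) fun _ => hB⟩

lemma const (c : ℝ) : Both σ (fun _ _ _ => c) := ⟨Tame.const c, Tame.const c⟩

lemma id : Both σ (fun _ _ x => x) := ⟨Tame.id, Tame.id⟩

lemma weight : Both σ (fun _ _ x => x * (1 - x)) := id.mul ((const 1).sub id)

lemma drift : Both σ (fun _ _ x => bb N x) := by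
  unfold bb
  exact ((const (5 / 2)).mul ((const 1).sub id)).sub ((const (N / 2)).mul id)

lemma comp {m : ℕ} {Φ : (Fin m → ℝ) → ℝ} {K : Set (Fin m → ℝ)} (hK : IsCompact K)
    (hΦ : AnalyticOnNhd ℝ Φ K) {D : I → ℝ → ℝ → Fin m → ℝ} (hD : ∀ j, Both σ (fun i t x => D i t x j))
    (hDK : ∀ i t, ∀ x ∈ Icc (0 : ℝ) 1, D i t x ∈ K) : Both σ (fun i t x => Φ (D i t x)) :=
  ⟨Tame.comp hK hΦ (fun j => (hD j).1) hDK, Tame.comp hK hΦ (fun j => (hD j).2) hDK⟩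

lemma fderiv_comp {m : ℕ} {Φ : (Fin m → ℝ) → ℝ} {K : Set (Fin m → ℝ)} (hK : IsCompact K)
    (hΦ : AnalyticOnNhd ℝ Φ K) {D D' : I → ℝ → ℝ → Fin m → ℝ}
    (hD : ∀ j, Both σ (fun i t x => D i t x j)) (hD' : ∀ j, Both σ (fun i t x => D' i t x j))
    (hDK : ∀ i t, ∀ x ∈ Icc (0 : ℝ) 1, D i t x ∈ K) :
    Both σ (fun i t x => fderiv ℝ Φ (D i t x) (D' i t x)) :=
  ⟨Tame.fderiv_comp hK hΦ (fun j => (hD j).1) (fun j => (hD' j).1) hDK,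
    Tame.fderiv_comp hK hΦ (fun j => (hD j).2) (fun j => (hD' j).2) hDK⟩

lemma ap {S : ℝ} (hS : JS S) (hσ : ∀ k, σ.P k) (hG : Both σ G) (s : ℕ) :
    ∃ M, ∀ i t, Ap M s (σ.Θ i) (G i t) := by
  obtain ⟨C, hC⟩ := hG.1.2 (2 * s + 2) (hσ _)
  obtain ⟨D, hD⟩ := hG.2.2 16 (le_refl 16)
  refine ⟨2 ^ s * S * max C D, fun i t => Ap.of_cl hS s (σ.hΘ i) ?_ ?_⟩
  · refine (hD i t).mono ?_ zero_le_one
    rw [pow_zero, mul_one]; exact le_max_right _ _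
  · refine (hC i t).mono ?_ (zero_le_one.trans (σ.hΘ i))
    rw [pow_zero, mul_one]; exact le_max_left _ _

lemma bounded (hG : Both σ G) : ∃ C, 0 ≤ C ∧ ∀ i t, ∀ x ∈ Icc (0 : ℝ) 1, |G i t x| ≤ C := by
  obtain ⟨C, hC0, hC⟩ := hG.2.bound (k := 16) (le_refl 16)
  exact ⟨C, hC0, fun i t x hx => by simpa using hC i t x hx⟩

lemma cont (hG : Both σ G) (i : I) (t : ℝ) : ContinuousOn (G i t) (Icc 0 1) := hG.1.continuousOn i t

end Both

/-- Tame bounds for coefficient sequences. -/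
def TC (σ : Scale I) (e : ℕ) (h : I → ℝ → ℕ → ℝ) : Prop :=
  ∀ s : ℕ, ∃ C : ℝ, ∀ i t j, |h i t j| * (1 + j / σ.Θ i) ^ s ≤ C * σ.n i ^ e

/-- Smallness bounds for coefficient sequences. -/
def SC (σ : Scale I) (ε : I → ℝ) (e : ℕ) (h : I → ℝ → ℕ → ℝ) : Prop :=
  ∃ C : ℝ, ∀ i t j, |h i t j| ≤ C * σ.n i ^ e * ε i

/-- Smallness bounds for functions. -/
def Sm (σ : Scale I) (ε : I → ℝ) (e : ℕ) (G : I → ℝ → ℝ → ℝ) : Prop :=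
  ∃ C : ℝ, ∀ i t, ∀ x ∈ Icc (0 : ℝ) 1, |G i t x| ≤ C * σ.n i ^ e * ε i

/-- Coefficients of the linearised problem. -/
structure LinCoef (τ : ℝ) (σ : Scale I) (K : Fin 7 → I → ℝ → ℝ → ℝ) (a1' s1' : I → ℝ → ℝ → ℝ) :
    Prop where
  both : ∀ m, Both σ (K m)
  da : ∀ i t, ∀ x ∈ Icc (0 : ℝ) 1, HasDerivAt (K 2 i t) (a1' i t x) x
  ds : ∀ i t, ∀ x ∈ Icc (0 : ℝ) 1, HasDerivAt (K 6 i t) (s1' i t x) x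
  ba : Both σ a1'
  bs : Both σ s1'
  supp : ∀ m i t x, τ ≤ |t| → K m i t x = 0

lemma Ap.mono {M M' Θ : ℝ} {s : ℕ} {f : ℝ → ℝ} (hΘ : 1 ≤ Θ) (h : Ap M s Θ f) (hM : M ≤ M') :
    Ap M' s Θ f :=
  ⟨h.1, fun x hx => (h.2.1 x hx).trans hM, fun n => by
    obtain ⟨p, hp, hb⟩ := h.2.2 n
    exact ⟨p, hp, fun x hx => (hb x hx).trans (mul_le_mul_of_nonneg_right hM (mu_pos hΘ s n).le)⟩⟩

lemma LinCoef.lc {S : ℝ} (hS : JS S) (hσ : ∀ k, σ.P k) {τ : ℝ} {K : Fin 7 → I → ℝ → ℝ → ℝ}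
    {a1' s1' : I → ℝ → ℝ → ℝ} (h : LinCoef τ σ K a1' s1') (s : ℕ) :
    ∃ M, 0 ≤ M ∧ ∀ i t, Lc N M s (σ.Θ i) (K 0 i t) (K 1 i t) (K 2 i t) (K 3 i t) (K 4 i t) (K 5 i t)
      (K 6 i t) (a1' i t) (s1' i t) := by
  choose M hM using fun m => (h.both m).ap hS hσ s
  obtain ⟨A, hA⟩ := ((Both.weight.mul h.ba).add ((Both.drift (N := N)).mul (h.both 2))).ap hS hσ s
  obtain ⟨B, hB⟩ := ((Both.weight.mul h.bs).add ((Both.drift (N := N)).mul (h.both 6))).ap hS hσ s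
  have h0 : 0 ≤ ∑ m, |M m| := Finset.sum_nonneg fun _ _ => abs_nonneg _
  have hm : ∀ m, M m ≤ ∑ m, |M m| + |A| + |B| := fun m => by
    have := Finset.single_le_sum (f := fun j => |M j|) (fun _ _ => abs_nonneg _) (Finset.mem_univ m)
    linarith [le_abs_self (M m), abs_nonneg A, abs_nonneg B]
  have ap := fun i t m => (hM m i t).mono (σ.hΘ i) (hm m)
  exact ⟨∑ m, |M m| + |A| + |B|, by positivity, fun i t =>
    ⟨ap i t 0, ap i t 1, ap i t 2, ap i t 3, ap i t 4, ap i t 5, ap i t 6, h.da i t, h.ds i t,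
      h.ba.cont i t, h.bs.cont i t,
      (hA i t).mono (σ.hΘ i) (by linarith [le_abs_self A, abs_nonneg B]),
      (hB i t).mono (σ.hΘ i) (by linarith [le_abs_self B, abs_nonneg A])⟩⟩

lemma wg_le_weight (hN : 4 < N) {Θ : ℝ} (hΘ : 1 ≤ Θ) (j : ℕ) :
    1 + j / Θ ≤ wg N Θ j ∧ wg N Θ j ≤ (1 + kap N) * (1 + j / Θ) := by
  have hk := kap_ge hN
  have h0 : 0 < Θ := by linarith
  have e : wg N Θ j = 1 + j / Θ + kap N / Θ := by unfold wg nu; ring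
  have h1 : kap N / Θ ≤ kap N := div_le_self (by linarith) hΘ
  have h2 : 0 ≤ kap N / Θ := by positivity
  have h3 : 0 ≤ (j : ℝ) / Θ := by positivity
  constructor
  · linarith
  · nlinarith

/-- Extraction of coefficient bounds from the energy estimate. -/
lemma energy_extract (hN : 4 < N) {Θ A E τ : ℝ} (hΘ : 1 ≤ Θ) (hA : 0 ≤ A) {n s : ℕ} (hn : 1 ≤ n) (hτ : 0 ≤ τ)
    {R1 R2 : ℝ → ℝ → ℝ} {h q : ℝ → ℕ → ℝ}
    (hz : ∀ t j, n < j → h t j = 0 ∧ q t j = 0)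
    (hE : ∀ G, 0 ≤ G → (∀ t, ∑ j ∈ Finset.range (n + 1), wg N Θ j ^ (2 * s) *
          ((nu N j * jc N j (R1 t)) ^ 2 + jc N j (R2 t) ^ 2) ≤ G) →
        ∀ t, ∑ j ∈ Finset.range (n + 1), wg N Θ j ^ (2 * s) *
          ((nu N j * h t j) ^ 2 + q t j ^ 2) ≤ G * τ * exp E)
    (hR : ∀ t j, |jc N j (R1 t)| * (1 + j / Θ) ^ s ≤ A ∧ |jc N j (R2 t)| * (1 + j / Θ) ^ s ≤ A) (t : ℝ) (j : ℕ) :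
    |h t j| * (1 + j / Θ) ^ s ≤ 4 * kap N * (1 + kap N) ^ s * (τ * exp E + 1) * (n : ℝ) ^ 2 * A ∧
      |q t j| * (1 + j / Θ) ^ s ≤ 4 * kap N * (1 + kap N) ^ s * (τ * exp E + 1) * (n : ℝ) ^ 2 * A := by
  have hk := kap_ge hN
  have hn' : (1 : ℝ) ≤ n := by exact_mod_cast hn
  have hW : ∀ j : ℕ, (0 : ℝ) ≤ 1 + j / Θ := fun j => by
    have : 0 < Θ := by linarith
    positivity
  have hw0 : ∀ j, 0 ≤ wg N Θ j := fun j => zero_le_one.trans (wg_ge hN hΘ j)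
  set B := 2 * kap N * n * ((1 + kap N) ^ s * A) with hB
  have hB0 : 0 ≤ B := by positivity
  have hb : ∀ (r : ℝ) (j : ℕ), |r| * (1 + j / Θ) ^ s ≤ A → |wg N Θ j ^ s * r| ≤ (1 + kap N) ^ s * A :=
    fun r j hr => by
      rw [abs_mul, abs_of_nonneg (pow_nonneg (hw0 j) s), mul_comm]
      calc |r| * wg N Θ j ^ s ≤ |r| * ((1 + kap N) * (1 + j / Θ)) ^ s :=
            mul_le_mul_of_nonneg_left (pow_le_pow_left₀ (hw0 j) (wg_le_weight hN hΘ j).2 s) (abs_nonneg r)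
        _ = (1 + kap N) ^ s * (|r| * (1 + j / Θ) ^ s) := by rw [mul_pow]; ring
        _ ≤ _ := mul_le_mul_of_nonneg_left hr (by positivity)
  have hνn : ∀ j ≤ n, nu N j ≤ 2 * kap N * n := fun j hj => by
    have := nu_le hN j
    have h2 : (j : ℝ) ≤ n := by exact_mod_cast hj
    nlinarith
  have key : ∀ t, ∑ j ∈ Finset.range (n + 1), wg N Θ j ^ (2 * s) *
      ((nu N j * h t j) ^ 2 + q t j ^ 2) ≤ (2 * n * (2 * B ^ 2)) * τ * exp E := by
    refine hE _ (by positivity) fun t => ?_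
    have hj : ∀ j ∈ Finset.range (n + 1), wg N Θ j ^ (2 * s) *
        ((nu N j * jc N j (R1 t)) ^ 2 + jc N j (R2 t) ^ 2) ≤ 2 * B ^ 2 := fun j hj => by
      have hj' : j ≤ n := by simpa [Nat.lt_succ_iff] using hj
      have e1 := hb _ j (hR t j).1
      have e2 := hb _ j (hR t j).2
      have hν := nu_pos hN j
      have f1 : |nu N j * (wg N Θ j ^ s * jc N j (R1 t))| ≤ B := by
        rw [abs_mul, abs_of_pos hν]
        exact mul_le_mul (hνn j hj') e1 (abs_nonneg _) (by positivity)
      have f2 : |wg N Θ j ^ s * jc N j (R2 t)| ≤ B := by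
        refine e2.trans (le_mul_of_one_le_left (by positivity) ?_)
        nlinarith
      have g1 := sq_le_sq' (abs_le.1 f1).1 (abs_le.1 f1).2
      have g2 := sq_le_sq' (abs_le.1 f2).1 (abs_le.1 f2).2
      have : wg N Θ j ^ (2 * s) * ((nu N j * jc N j (R1 t)) ^ 2 + jc N j (R2 t) ^ 2) =
        (nu N j * (wg N Θ j ^ s * jc N j (R1 t))) ^ 2 + (wg N Θ j ^ s * jc N j (R2 t)) ^ 2 := by
        rw [mul_comm 2 s, pow_mul]; ring
      linarith
    refine (Finset.sum_le_sum hj).trans ?_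
    rw [Finset.sum_const, Finset.card_range, nsmul_eq_mul]
    push_cast
    exact mul_le_mul_of_nonneg_right (by linarith) (by positivity)
  have hX0 : 0 ≤ τ * exp E := by positivity
  have fin : ∀ z : ℝ, z ^ 2 ≤ (2 * n * (2 * B ^ 2)) * τ * exp E → |z| ≤
      4 * kap N * (1 + kap N) ^ s * (τ * exp E + 1) * (n : ℝ) ^ 2 * A := fun z hz => by
    have e : 4 * kap N * (1 + kap N) ^ s * (τ * exp E + 1) * (n : ℝ) ^ 2 * A =
      2 * n * (τ * exp E + 1) * B := by rw [hB]; ring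
    rw [e]
    refine abs_le_of_sq_le_sq (hz.trans ?_) (by positivity)
    have h1 : (n : ℝ) ≤ n ^ 2 := by nlinarith
    have h2 : τ * exp E ≤ (τ * exp E + 1) ^ 2 := by nlinarith
    calc 2 * n * (2 * B ^ 2) * τ * exp E = 4 * B ^ 2 * (n * (τ * exp E)) := by ring
      _ ≤ 4 * B ^ 2 * (n ^ 2 * (τ * exp E + 1) ^ 2) :=
        mul_le_mul_of_nonneg_left (mul_le_mul h1 h2 hX0 (by positivity)) (by positivity)
      _ = _ := by ring
  rcases le_or_gt j n with hj | hj
  · have hmem : j ∈ Finset.range (n + 1) := Finset.mem_range.2 (by omega)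
    have h1 := (Finset.single_le_sum (f := fun j => wg N Θ j ^ (2 * s) *
      ((nu N j * h t j) ^ 2 + q t j ^ 2)) (fun j _ => mul_nonneg (pow_nonneg (hw0 j) _)
        (by positivity)) hmem).trans (key t)
    have hW1 := pow_le_pow_left₀ (hW j) (wg_le_weight hN hΘ j).1 s
    have hWp : 0 ≤ (1 + j / Θ) ^ s := pow_nonneg (hW j) s
    have hw2 : wg N Θ j ^ (2 * s) = (wg N Θ j ^ s) ^ 2 := by rw [mul_comm, pow_mul]
    have hν : 1 ≤ nu N j := by linarith [nu_ge hN j, (Nat.cast_nonneg j : (0 : ℝ) ≤ j)]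
    rw [hw2] at h1
    have hWsq := pow_le_pow_left₀ hWp hW1 2
    have a1 : (h t j * (1 + j / Θ) ^ s) ^ 2 ≤ (wg N Θ j ^ s) ^ 2 * (nu N j * h t j) ^ 2 := by
      rw [mul_pow, mul_comm]
      refine mul_le_mul hWsq ?_ (sq_nonneg _) (sq_nonneg _)
      rw [mul_pow]
      exact le_mul_of_one_le_left (sq_nonneg _) (one_le_pow₀ hν)
    have a2 : (q t j * (1 + j / Θ) ^ s) ^ 2 ≤ (wg N Θ j ^ s) ^ 2 * q t j ^ 2 := by
      rw [mul_pow, mul_comm]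
      exact mul_le_mul_of_nonneg_right hWsq (sq_nonneg _)
    have p1 : 0 ≤ (wg N Θ j ^ s) ^ 2 * (nu N j * h t j) ^ 2 := by positivity
    have p2 : 0 ≤ (wg N Θ j ^ s) ^ 2 * q t j ^ 2 := by positivity
    have b1 := fin _ (a1.trans (by linarith))
    have b2 := fin _ (a2.trans (by linarith))
    rw [abs_mul, abs_of_nonneg hWp] at b1 b2
    exact ⟨b1, b2⟩
  · rw [(hz t j hj).1, (hz t j hj).2, abs_zero, zero_mul]
    have : 0 ≤ 4 * kap N * (1 + kap N) ^ s * (τ * exp E + 1) * (n : ℝ) ^ 2 * A := by positivity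
    exact ⟨this, this⟩

lemma Tame.tc {S : ℝ} (hN : 4 < N) (hS : JS S) (hσ : ∀ k, σ.P k) (hΘn : ∀ i, σ.Θ i ≤ σ.n i) {e : ℕ}
    {G : I → ℝ → ℝ → ℝ} (hG : Tame σ e G) : TC σ (e + 2) (fun i t j => jc N j (G i t)) := fun s => by
  obtain ⟨C, hC⟩ := hG.2 (s + 2) (hσ _)
  refine ⟨4 ^ s * S * C, fun i t j => (jc_weighted hN hS (σ.hΘ i) (hC i t) j).trans ?_⟩
  have h0 := (hC i t).nonneg
  have h1 : (0 : ℝ) ≤ σ.Θ i := zero_le_one.trans (σ.hΘ i)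
  have hS0 : 0 ≤ S := zero_le_one.trans hS.one_le
  calc 4 ^ s * S * (C * σ.n i ^ e * σ.Θ i ^ 2) ≤ 4 ^ s * S * (C * σ.n i ^ e * σ.n i ^ 2) := by
        have := pow_le_pow_left₀ h1 (hΘn i) 2
        gcongr
    _ = _ := by rw [pow_add]; ring

/-- Solution of the linearised Galerkin system with tame and low-norm bounds. -/
theorem linear_step {S : ℝ} (hN : 4 < N) (hS : JS S) (hσ : ∀ k, σ.P k) (hΘn : ∀ i, σ.Θ i ≤ σ.n i)
    {n : I → ℕ} (hn : ∀ i, σ.n i = n i) {τ : ℝ} (hτ : 0 ≤ τ) {K : Fin 7 → I → ℝ → ℝ → ℝ}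
    {a1' s1' : I → ℝ → ℝ → ℝ} (hK : LinCoef τ σ K a1' s1') {R1 R2 : I → ℝ → ℝ → ℝ} {e : ℕ}
    (hR1 : Tame σ e R1) (hR2 : Tame σ e R2)
    (hRs : ∀ i t x, τ ≤ |t| → R1 i t x = 0 ∧ R2 i t x = 0) :
    ∃ h q h' q' : I → ℝ → ℕ → ℝ, (∀ i, Traj (n i) τ (h i) (h' i) ∧ Traj (n i) τ (q i) (q' i)) ∧
      (∀ i j, h i 0 j = 0 ∧ q i 0 j = 0) ∧
      (∀ i t, ∀ j ≤ n i,
        h' i t j = jc N j (fun x => lin1 N (fun m => K m i t) (h i t) (q i t) x - R1 i t x) ∧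
        q' i t j = jc N j (fun x => lin2 N (fun m => K m i t) (h i t) (q i t) x - R2 i t x)) ∧
      TC σ (e + 4) h ∧ TC σ (e + 4) q ∧
      ∀ (ε : I → ℝ) (f : ℕ), (∀ i, 0 ≤ ε i) → Sm σ ε f R1 → Sm σ ε f R2 →
        SC σ ε (f + 2) h ∧ SC σ ε (f + 2) q := by
  choose h q h' q' H1 H2 H3 H4 H5 using fun i => linear_instance hN hτ (n i) (K := fun m => K m i)
    (fun m => (hK.both m).1.1 i) (hR1.1 i) (hR2.1 i) (fun m => hK.supp m i) (hRs i)
  have hz : ∀ i t j, n i < j → h i t j = 0 ∧ q i t j = 0 := fun i t j hj =>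
    ⟨(H1 i).zero t j hj, (H2 i).zero t j hj⟩
  have hn1 : ∀ i, 1 ≤ n i := fun i => by
    have := σ.hn i
    rw [hn i] at this; exact_mod_cast this
  have hk := kap_ge hN
  have tc : ∀ s : ℕ, ∃ C : ℝ, ∀ i t j, |h i t j| * (1 + j / σ.Θ i) ^ s ≤ C * σ.n i ^ (e + 4) ∧
      |q i t j| * (1 + j / σ.Θ i) ^ s ≤ C * σ.n i ^ (e + 4) := fun s => by
    obtain ⟨M, hM, hL⟩ := hK.lc (N := N) hS hσ s
    obtain ⟨C1, hC1⟩ := hR1.tc hN hS hσ hΘn s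
    obtain ⟨C2, hC2⟩ := hR2.tc hN hS hσ hΘn s
    have hC0 : 0 ≤ |C1| + |C2| := by positivity
    refine ⟨4 * kap N * (1 + kap N) ^ s * (τ * exp (eK N s M * τ) + 1) * (|C1| + |C2|),
      fun i t j => ?_⟩
    have hn0 : 0 ≤ σ.n i ^ (e + 2) := pow_nonneg (zero_le_one.trans (σ.hn i)) _
    have := energy_extract hN (σ.hΘ i) (A := (|C1| + |C2|) * σ.n i ^ (e + 2)) (by positivity)
      (hn1 i) hτ (hz i) (fun G hG hb => H5 i s M (σ.Θ i) G (a1' i) (s1' i) (σ.hΘ i) hM hG (hL i) hb)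
      (fun t j => ⟨(hC1 i t j).trans (mul_le_mul_of_nonneg_right
        (by linarith [le_abs_self C1, abs_nonneg C2]) hn0), (hC2 i t j).trans
        (mul_le_mul_of_nonneg_right (by linarith [le_abs_self C2, abs_nonneg C1]) hn0)⟩) t j
    have e1 : 4 * kap N * (1 + kap N) ^ s * (τ * exp (eK N s M * τ) + 1) * (n i : ℝ) ^ 2 *
        ((|C1| + |C2|) * σ.n i ^ (e + 2)) = 4 * kap N * (1 + kap N) ^ s *
        (τ * exp (eK N s M * τ) + 1) * (|C1| + |C2|) * σ.n i ^ (e + 4) := by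
      rw [hn i, show e + 4 = e + 2 + 2 from rfl, pow_add (n i : ℝ) (e + 2) 2]; ring
    rwa [e1] at this
  refine ⟨h, q, h', q', fun i => ⟨H1 i, H2 i⟩, H3, H4, fun s => ?_, fun s => ?_, fun ε f hε h1 h2 => ?_⟩
  · obtain ⟨C, hC⟩ := tc s
    exact ⟨C, fun i t j => (hC i t j).1⟩
  · obtain ⟨C, hC⟩ := tc s
    exact ⟨C, fun i t j => (hC i t j).2⟩
  · obtain ⟨M, hM, hL⟩ := hK.lc (N := N) hS hσ 0
    obtain ⟨C1, hC1⟩ := h1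
    obtain ⟨C2, hC2⟩ := h2
    have key : ∀ i t j, |h i t j| ≤ 4 * kap N * (τ * exp (eK N 0 M * τ) + 1) * (|C1| + |C2|) *
        σ.n i ^ (f + 2) * ε i ∧ |q i t j| ≤ 4 * kap N * (τ * exp (eK N 0 M * τ) + 1) *
        (|C1| + |C2|) * σ.n i ^ (f + 2) * ε i := fun i t j => by
      have hn0 : 0 ≤ σ.n i ^ f * ε i :=
        mul_nonneg (pow_nonneg (zero_le_one.trans (σ.hn i)) _) (hε i)
      have b1 : ∀ t j, |jc N j (R1 i t)| * (1 + j / σ.Θ i) ^ 0 ≤ (|C1| + |C2|) * (σ.n i ^ f * ε i) :=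
        fun t j => by
          rw [pow_zero, mul_one]
          refine (abs_jc_le hN j (hR1.continuousOn i t) (hC1 i t)).trans ?_
          rw [mul_assoc]
          exact mul_le_mul_of_nonneg_right (by linarith [le_abs_self C1, abs_nonneg C2]) hn0
      have b2 : ∀ t j, |jc N j (R2 i t)| * (1 + j / σ.Θ i) ^ 0 ≤ (|C1| + |C2|) * (σ.n i ^ f * ε i) :=
        fun t j => by
          rw [pow_zero, mul_one]
          refine (abs_jc_le hN j (hR2.continuousOn i t) (hC2 i t)).trans ?_
          rw [mul_assoc]
          exact mul_le_mul_of_nonneg_right (by linarith [le_abs_self C2, abs_nonneg C1]) hn0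
      have := energy_extract hN (σ.hΘ i) (A := (|C1| + |C2|) * (σ.n i ^ f * ε i)) (by positivity)
        (hn1 i) hτ (hz i)
        (fun G hG hb => H5 i 0 M (σ.Θ i) G (a1' i) (s1' i) (σ.hΘ i) hM hG (hL i) hb)
        (fun t j => ⟨b1 t j, b2 t j⟩) t j
      simp only [pow_zero, mul_one] at this
      have e1 : 4 * kap N * (τ * exp (eK N 0 M * τ) + 1) * (n i : ℝ) ^ 2 *
        ((|C1| + |C2|) * (σ.n i ^ f * ε i)) = 4 * kap N * (τ * exp (eK N 0 M * τ) + 1) *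
        (|C1| + |C2|) * σ.n i ^ (f + 2) * ε i := by
        rw [hn i, pow_add (n i : ℝ) f 2]; ring
      rwa [e1] at this
    exact ⟨⟨_, fun i t j => (key i t j).1⟩, ⟨_, fun i t j => (key i t j).2⟩⟩

end

section

variable {I : Type*} {σ : Scale I} {ε : I → ℝ}

/-- Tame bounds with some power of `n`. -/
def TX (σ : Scale I) (G : I → ℝ → ℝ → ℝ) : Prop := ∃ e, Tame σ e G

/-- Small functions, up to a power of `n`. -/
def SX (σ : Scale I) (ε : I → ℝ) (G : I → ℝ → ℝ → ℝ) : Prop := ∃ e, Sm σ ε e G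

/-- Tame coefficients with some power of `n`. -/
def TCX (σ : Scale I) (h : I → ℝ → ℕ → ℝ) : Prop := ∃ e, TC σ e h

/-- Small coefficients, up to a power of `n`. -/
def SCX (σ : Scale I) (ε : I → ℝ) (h : I → ℝ → ℕ → ℝ) : Prop := ∃ e, SC σ ε e h

section
variable {F G : I → ℝ → ℝ → ℝ}

lemma Both.tx (h : Both σ G) : TX σ G := ⟨0, h.1⟩

lemma TX.add (hF : TX σ F) (hG : TX σ G) : TX σ (fun i t x => F i t x + G i t x) := by
  obtain ⟨e, he⟩ := hF
  obtain ⟨f, hf⟩ := hG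
  exact ⟨max e f, (he.mono (le_max_left _ _)).add (hf.mono (le_max_right _ _))⟩

lemma TX.neg (hF : TX σ F) : TX σ (fun i t x => -F i t x) := by
  obtain ⟨e, he⟩ := hF
  exact ⟨e, he.neg⟩

lemma TX.sub (hF : TX σ F) (hG : TX σ G) : TX σ (fun i t x => F i t x - G i t x) := by
  simpa only [sub_eq_add_neg] using hF.add hG.neg

lemma TX.mul (hF : TX σ F) (hG : TX σ G) : TX σ (fun i t x => F i t x * G i t x) := by
  obtain ⟨e, he⟩ := hF
  obtain ⟨f, hf⟩ := hG
  exact ⟨_, he.mul hf⟩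

lemma Sm.mono (hε : ∀ i, 0 ≤ ε i) {e f : ℕ} (h : Sm σ ε e G) (hef : e ≤ f) : Sm σ ε f G := by
  obtain ⟨C, hC⟩ := h
  refine ⟨|C|, fun i t x hx => (hC i t x hx).trans ?_⟩
  have h1 := pow_le_pow_right₀ (σ.hn i) hef
  have h0 : (0 : ℝ) ≤ σ.n i ^ e := pow_nonneg (zero_le_one.trans (σ.hn i)) _
  exact mul_le_mul_of_nonneg_right (mul_le_mul (le_abs_self C) h1 h0 (abs_nonneg C)) (hε i)

lemma SX.add (hε : ∀ i, 0 ≤ ε i) (hF : SX σ ε F) (hG : SX σ ε G) :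
    SX σ ε (fun i t x => F i t x + G i t x) := by
  obtain ⟨e, he⟩ := hF
  obtain ⟨f, hf⟩ := hG
  obtain ⟨C, hC⟩ := he.mono hε (le_max_left e f)
  obtain ⟨D, hD⟩ := hf.mono hε (le_max_right e f)
  refine ⟨max e f, C + D, fun i t x hx => (abs_add_le _ _).trans ?_⟩
  linarith [hC i t x hx, hD i t x hx]

lemma SX.neg (hF : SX σ ε F) : SX σ ε (fun i t x => -F i t x) := by
  obtain ⟨e, C, h⟩ := hF
  exact ⟨e, C, fun i t x hx => by rw [abs_neg]; exact h i t x hx⟩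

lemma SX.sub (hε : ∀ i, 0 ≤ ε i) (hF : SX σ ε F) (hG : SX σ ε G) :
    SX σ ε (fun i t x => F i t x - G i t x) := by
  simpa only [sub_eq_add_neg] using hF.add hε hG.neg

lemma SX.bmul (hF : Both σ F) (hG : SX σ ε G) : SX σ ε (fun i t x => F i t x * G i t x) := by
  obtain ⟨C, hC0, hC⟩ := hF.bounded
  obtain ⟨e, D, hD⟩ := hG
  refine ⟨e, C * D, fun i t x hx => ?_⟩
  rw [abs_mul, mul_assoc, mul_assoc, ← mul_assoc D]
  exact mul_le_mul (hC i t x hx) (hD i t x hx) (abs_nonneg _) hC0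

lemma TX.cont (hG : TX σ G) (i : I) (t : ℝ) : ContinuousOn (G i t) (Icc 0 1) := by
  obtain ⟨e, he⟩ := hG
  exact he.continuousOn i t

end

/-- A state of the Galerkin system, with the scale it lives on. -/
structure FinSupp (n : I → ℕ) (h : I → ℝ → ℕ → ℝ) : Prop where
  zero : ∀ i t j, n i < j → h i t j = 0
  cont : ∀ i j, Continuous fun t => h i t j

section
variable {Cb : ℝ} {c : ℕ} {n : I → ℕ} {h : I → ℝ → ℕ → ℝ}

lemma FinSupp.bound (H : FinSupp n h) (i : I) {B : ℝ} (hB0 : 0 ≤ B) (hB : ∀ t j, |h i t j| ≤ B)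
    (w : ℕ) (t : ℝ) (j : ℕ) : |h i t j| * (1 + j : ℝ) ^ w ≤ B * (1 + n i : ℝ) ^ w := by
  rcases le_or_gt j (n i) with hj | hj
  · have h1 : (1 + j : ℝ) ≤ 1 + n i := by
      have : (j : ℝ) ≤ n i := by exact_mod_cast hj
      linarith
    exact mul_le_mul (hB t j) (pow_le_pow_left₀ (by positivity) h1 w) (by positivity) hB0
  · rw [H.zero i t j hj, abs_zero, zero_mul]; positivity

lemma one_add_pow_le {i : I} (hn : σ.n i = n i) (k : ℕ) :
    (1 + n i : ℝ) ^ k ≤ 2 ^ k * σ.n i ^ k := by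
  rw [← mul_pow, ← hn]
  exact pow_le_pow_left₀ (by linarith [σ.hn i]) (by linarith [σ.hn i]) _

lemma TCX.jet (hJ : JB N Cb c) (hn : ∀ i, σ.n i = n i) (H : FinSupp n h) (hh : TCX σ h) (m : ℕ) :
    TX σ (fun i t x => jet N m (h i t) x) := by
  obtain ⟨e, he⟩ := hh
  refine ⟨e + (c + 2 * m + 2), fun i => ?_, fun k _ => ?_⟩
  · obtain ⟨C, hC⟩ := he 0
    refine continuous_jet hJ (a := h i) (A := |C| * σ.n i ^ e * (1 + n i : ℝ) ^ (c + 2 * m + 2))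
      (fun t j => H.bound i ?_ (fun t j => ?_) _ t j) (H.cont i)
    · have := pow_nonneg (zero_le_one.trans (σ.hn i)) e
      positivity
    · have := hC i t j
      rw [pow_zero, mul_one] at this
      exact this.trans (mul_le_mul_of_nonneg_right (le_abs_self C)
        (pow_nonneg (zero_le_one.trans (σ.hn i)) e))
  · obtain ⟨C, hC⟩ := he k
    have hb := zero_le_one.trans hJ.one_le
    have hz := zero_le_one.trans Z2_ge
    refine ⟨Cb * 4 ^ m * Z2 * (|C| * 2 ^ (c + 2 * m + 2)), fun i t => (cl_jet_weighted hJ (σ.hΘ i)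
      (H.zero i t) (hC i t) m).mono ?_ (zero_le_one.trans (σ.hΘ i))⟩
    have h1 := σ.hn i
    have h3 := one_add_pow_le (hn i) (c + 2 * m + 2)
    have h4 : 0 ≤ σ.n i ^ e := pow_nonneg (by linarith) _
    calc Cb * 4 ^ m * Z2 * (C * σ.n i ^ e * (1 + n i : ℝ) ^ (c + 2 * m + 2))
        ≤ Cb * 4 ^ m * Z2 * (|C| * σ.n i ^ e * (2 ^ (c + 2 * m + 2) * σ.n i ^ (c + 2 * m + 2))) := by
          refine mul_le_mul_of_nonneg_left (mul_le_mul (mul_le_mul_of_nonneg_right (le_abs_self C) h4)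
            h3 (by positivity) (by positivity)) (by positivity)
      _ = _ := by rw [pow_add (σ.n i) e]; ring

lemma SCX.jet (hJ : JB N Cb c) (hε : ∀ i, 0 ≤ ε i) (hn : ∀ i, σ.n i = n i) (H : FinSupp n h)
    (hh : SCX σ ε h) (m : ℕ) : SX σ ε (fun i t x => jet N m (h i t) x) := by
  obtain ⟨e, C, hC⟩ := hh
  have hb := zero_le_one.trans hJ.one_le
  have hz := zero_le_one.trans Z2_ge
  refine ⟨e + (c + 2 * m + 2), Cb * 4 ^ m * (|C| * 2 ^ (c + 2 * m + 2)) * Z2, fun i t x hx => ?_⟩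
  have h1 := σ.hn i
  have h4 : 0 ≤ σ.n i ^ e * ε i := mul_nonneg (pow_nonneg (by linarith) _) (hε i)
  have h3 := one_add_pow_le (hn i) (c + 2 * m + 2)
  refine (abs_jet_le hJ (a := h i t) (H.bound i (B := |C| * (σ.n i ^ e * ε i)) (by positivity)
    (fun t j => ?_) _ t) hx).trans ?_
  · refine (hC i t j).trans ?_
    rw [mul_assoc]
    exact mul_le_mul_of_nonneg_right (le_abs_self C) h4
  · calc Cb * 4 ^ m * (|C| * (σ.n i ^ e * ε i) * (1 + n i : ℝ) ^ (c + 2 * m + 2)) * Z2 ≤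
        Cb * 4 ^ m * (|C| * (σ.n i ^ e * ε i) * (2 ^ (c + 2 * m + 2) * σ.n i ^ (c + 2 * m + 2))) * Z2 := by
          gcongr
      _ = _ := by rw [pow_add (σ.n i) e]; ring

/-- Coefficients of a function, cut off at degree `n`. -/
noncomputable def cut (N : ℝ) (n : ℕ) (f : ℝ → ℝ) (j : ℕ) : ℝ := if j ≤ n then jc N j f else 0

lemma jet_cut (n : ℕ) (f : ℝ → ℝ) (x : ℝ) : jet N 0 (cut N n f) x = (pj N n f).eval x := by
  rw [jet_eq_sum (n := n) (fun j hj => by rw [cut, if_neg (by omega)]), pj, eval_finsetSum]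
  refine Finset.sum_congr rfl fun j hj => ?_
  rw [cut, if_pos (by simpa [Nat.lt_succ_iff] using hj)]
  simp

lemma FinSupp.of_cut (hN : 4 < N) {G : I → ℝ → ℝ → ℝ} (hG : TX σ G) :
    FinSupp n (fun i t => cut N (n i) (G i t)) := by
  obtain ⟨e, he⟩ := hG
  refine ⟨fun i t j hj => if_neg (by omega), fun i j => ?_⟩
  unfold cut
  split_ifs
  · exact continuous_ip hN (g := fun _ x => (jp N j).eval x) (he.1 i)
      ((jp N j).continuous.comp (contDiff_xc.continuous.comp continuous_snd))
  · exact continuous_const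

lemma TX.tcx {S : ℝ} (hN : 4 < N) (hS : JS S) (hσ : ∀ k, σ.P k) (hΘn : ∀ i, σ.Θ i ≤ σ.n i)
    {G : I → ℝ → ℝ → ℝ} (hG : TX σ G) : TCX σ (fun i t => cut N (n i) (G i t)) := by
  obtain ⟨e, he⟩ := hG
  refine ⟨e + 2, fun s => ?_⟩
  obtain ⟨C, hC⟩ := he.tc hN hS hσ hΘn s
  refine ⟨C, fun i t j => ?_⟩
  have hW : 0 ≤ (1 + j / σ.Θ i : ℝ) ^ s := by
    have := zero_le_one.trans (σ.hΘ i)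
    positivity
  simp only [cut]
  split_ifs
  · exact hC i t j
  · rw [abs_zero, zero_mul]
    exact (mul_nonneg (abs_nonneg _) hW).trans (hC i t j)

lemma SX.scx (hN : 4 < N) {G : I → ℝ → ℝ → ℝ} (hc : ∀ i t, ContinuousOn (G i t) (Icc 0 1)) (hG : SX σ ε G) :
    SCX σ ε (fun i t => cut N (n i) (G i t)) := by
  obtain ⟨e, C, hC⟩ := hG
  refine ⟨e, C, fun i t j => ?_⟩
  have := abs_jc_le hN j (hc i t) (hC i t)
  simp only [cut]
  split_ifs
  · exact this
  · rw [abs_zero]; exact (abs_nonneg _).trans this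

/-- Error functions: rapidly decreasing in `Θ / n`. -/
def Err (σ : Scale I) (G : I → ℝ → ℝ → ℝ) : Prop :=
  ∃ e : ℕ, ∀ k : ℕ, ∃ C : ℝ, ∀ i t, ∀ x ∈ Icc (0 : ℝ) 1,
    |G i t x| ≤ C * σ.n i ^ e * (σ.Θ i / σ.n i) ^ k

section
variable {F G : I → ℝ → ℝ → ℝ}

lemma Err.add (hF : Err σ F) (hG : Err σ G) : Err σ (fun i t x => F i t x + G i t x) := by
  obtain ⟨e, he⟩ := hF
  obtain ⟨f, hf⟩ := hG
  refine ⟨max e f, fun k => ?_⟩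
  obtain ⟨C, hC⟩ := he k
  obtain ⟨D, hD⟩ := hf k
  refine ⟨|C| + |D|, fun i t x hx => (abs_add_le _ _).trans ?_⟩
  have h0 := zero_le_one.trans (σ.hn i)
  have hq : 0 ≤ (σ.Θ i / σ.n i) ^ k := pow_nonneg (div_nonneg (zero_le_one.trans (σ.hΘ i)) h0) k
  have h1 : C * σ.n i ^ e ≤ |C| * σ.n i ^ max e f :=
    mul_le_mul (le_abs_self C) (pow_le_pow_right₀ (σ.hn i) (le_max_left e f)) (pow_nonneg h0 _) (abs_nonneg C)
  have h2 : D * σ.n i ^ f ≤ |D| * σ.n i ^ max e f :=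
    mul_le_mul (le_abs_self D) (pow_le_pow_right₀ (σ.hn i) (le_max_right e f)) (pow_nonneg h0 _) (abs_nonneg D)
  have := mul_le_mul_of_nonneg_right h1 hq
  have := mul_le_mul_of_nonneg_right h2 hq
  have := hC i t x hx
  have := hD i t x hx
  linarith

lemma Err.neg (hF : Err σ F) : Err σ (fun i t x => -F i t x) := by
  obtain ⟨e, he⟩ := hF
  refine ⟨e, fun k => ?_⟩
  obtain ⟨C, h⟩ := he k
  exact ⟨C, fun i t x hx => by rw [abs_neg]; exact h i t x hx⟩

lemma Err.bmul (hF : Both σ F) (hG : Err σ G) : Err σ (fun i t x => F i t x * G i t x) := by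
  obtain ⟨C, hC0, hC⟩ := hF.bounded
  obtain ⟨e, he⟩ := hG
  refine ⟨e, fun k => ?_⟩
  obtain ⟨D, hD⟩ := he k
  refine ⟨C * D, fun i t x hx => ?_⟩
  rw [abs_mul, mul_assoc, mul_assoc, ← mul_assoc D]
  exact mul_le_mul (hC i t x hx) (hD i t x hx) (abs_nonneg _) hC0

lemma Err.tail {S : ℝ} (hJ : JB N Cb c) (hS : JS S) (hσ : ∀ k, σ.P k) (hn : ∀ i, σ.n i = n i)
    (hΘn : ∀ i, σ.Θ i ≤ σ.n i) (hG : TX σ G) :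
    Err σ (fun i t x => G i t x - (pj N (n i) (G i t)).eval x) ∧
    ∀ τ' : I → ℝ → ℝ → ℝ, (∀ i t, ∀ x ∈ Icc (0 : ℝ) 1,
      HasDerivAt (fun x => G i t x - (pj N (n i) (G i t)).eval x) (τ' i t x) x) →
      Err σ (fun i t x => x * (1 - x) * τ' i t x) := by
  obtain ⟨e, he⟩ := hG
  have hb := zero_le_one.trans hJ.one_le
  have hz := zero_le_one.trans Z2_ge
  have hS0 := zero_le_one.trans hS.one_le
  have key : ∀ k, ∃ C, ∀ i t θ,
      |G i t (xc θ) - (pj N (n i) (G i t)).eval (xc θ)| ≤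
        C * σ.n i ^ (e + c + 5) * (σ.Θ i / σ.n i) ^ k ∧
      |_root_.deriv (fun θ => G i t (xc θ) - (pj N (n i) (G i t)).eval (xc θ)) θ| ≤
        C * σ.n i ^ (e + c + 5) * (σ.Θ i / σ.n i) ^ k := fun k => by
    obtain ⟨C, hC⟩ := he.2 (k + c + 5) (hσ _)
    refine ⟨2 ^ (k + c + 3) * S * Cb * Z2 * |C|, fun i t θ => ?_⟩
    have h0 := zero_le_one.trans (σ.hΘ i)
    have h1 : 0 < σ.n i := zero_lt_one.trans_le (σ.hn i)
    have hle : 2 ^ (k + c + 3) * S * Cb * Z2 * (C * σ.n i ^ e * σ.Θ i ^ (k + c + 5)) /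
        (1 + n i : ℝ) ^ k ≤ 2 ^ (k + c + 3) * S * Cb * Z2 * |C| * σ.n i ^ (e + c + 5) *
          (σ.Θ i / σ.n i) ^ k := by
      rw [div_pow, ← hn i, ← mul_div_assoc]
      have a1 : σ.Θ i ^ (k + c + 5) ≤ σ.n i ^ (c + 5) * σ.Θ i ^ k := by
        rw [show k + c + 5 = c + 5 + k by omega, pow_add]
        exact mul_le_mul_of_nonneg_right (pow_le_pow_left₀ h0 (hΘn i) _) (pow_nonneg h0 _)
      have a2 : C * σ.n i ^ e * σ.Θ i ^ (k + c + 5) ≤ |C| * σ.n i ^ e * (σ.n i ^ (c + 5) * σ.Θ i ^ k) := by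
        have : C * σ.n i ^ e ≤ |C| * σ.n i ^ e :=
          mul_le_mul_of_nonneg_right (le_abs_self C) (by positivity)
        exact mul_le_mul this a1 (by positivity) (by positivity)
      have a3 : 2 ^ (k + c + 3) * S * Cb * Z2 * |C| * σ.n i ^ (e + c + 5) * σ.Θ i ^ k =
          2 ^ (k + c + 3) * S * Cb * Z2 * (|C| * σ.n i ^ e * (σ.n i ^ (c + 5) * σ.Θ i ^ k)) := by
        rw [add_assoc e, pow_add (σ.n i) e]; ring
      rw [a3]
      have a4 : σ.n i ^ k ≤ (1 + σ.n i) ^ k := pow_le_pow_left₀ h1.le (by linarith) k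
      refine div_le_div₀ (by positivity) (mul_le_mul_of_nonneg_left a2 (by positivity))
        (pow_pos h1 k) a4
    have := tail_le hJ hS (σ.hΘ i) (hC i t) (n i) θ
    exact ⟨this.1.trans hle, this.2.trans hle⟩
  refine ⟨⟨e + c + 5, fun k => ?_⟩, fun τ' hτ' => ⟨e + c + 5, fun k => ?_⟩⟩
  · obtain ⟨C, hC⟩ := key k
    refine ⟨C, fun i t x hx => ?_⟩
    obtain ⟨θ, rfl⟩ := exists_xc hx
    exact (hC i t θ).1
  · obtain ⟨C, hC⟩ := key k
    refine ⟨C, fun i t x hx => ?_⟩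
    obtain ⟨θ, rfl⟩ := exists_xc hx
    have hd := ((hτ' i t _ hx).comp θ (hasDerivAt_xc θ)).deriv
    have h2 := (hC i t θ).2
    have e1 : (fun θ => G i t (xc θ) - (pj N (n i) (G i t)).eval (xc θ)) =
      (fun x => G i t x - (pj N (n i) (G i t)).eval x) ∘ xc := rfl
    rw [e1, hd] at h2
    refine le_trans ?_ h2
    change |xc θ * (1 - xc θ) * τ' i t (xc θ)| ≤ _
    rw [xc_mul, show sin θ / 2 * (sin θ / 2) * τ' i t (xc θ) = (sin θ / 2) * (τ' i t (xc θ) * (sin θ / 2)) by ring,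
      abs_mul]
    refine mul_le_of_le_one_left (abs_nonneg _) ?_
    rw [abs_div, abs_two]
    linarith [abs_sin_le_one θ]

end

end

end

lemma hasDerivAt_jc_time (hN : 4 < N) {f f' : ℝ → ℝ → ℝ}
    (hf : Continuous fun p : ℝ × ℝ => f p.1 (xc p.2))
    (hf' : Continuous fun p : ℝ × ℝ => f' p.1 (xc p.2))
    (hd : ∀ t, ∀ x ∈ Icc (0 : ℝ) 1, HasDerivAt (fun t => f t x) (f' t x) t) (j : ℕ) (t : ℝ) :
    HasDerivAt (fun t => jc N j (f t)) (jc N j (f' t)) t := by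
  have e : ∀ g : ℝ → ℝ → ℝ, ∀ t, jc N j (g t) = ∫ x in (0 : ℝ)..1, g t (xc (arccos (1 - 2 * x))) *
      (jp N j).eval x * wt N x := fun g t => by
    unfold jc ip
    refine intervalIntegral.integral_congr fun x hx => ?_
    rw [uIcc_of_le zero_le_one] at hx
    simp only [xc_arccos hx]
  simp only [e]
  have h1 : Continuous fun p : ℝ × ℝ => (p.1, arccos (1 - 2 * p.2)) :=
    continuous_fst.prodMk ((by fun_prop : Continuous fun x : ℝ => arccos (1 - 2 * x)).comp continuous_snd)
  have hw : Continuous fun x : ℝ => (jp N j).eval x * wt N x :=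
    (jp N j).continuous.mul (continuous_wt hN)
  have key : ∀ g : ℝ → ℝ → ℝ, (Continuous fun p : ℝ × ℝ => g p.1 (xc p.2)) →
      Continuous fun p : ℝ × ℝ => g p.1 (xc (arccos (1 - 2 * p.2))) * (jp N j).eval p.2 * wt N p.2 :=
    fun g hg => by
      simp only [mul_assoc]
      exact (hg.comp h1).mul (hw.comp continuous_snd)
  obtain ⟨B, hB⟩ := ((isCompact_Icc (a := t - 1) (b := t + 1)).prod
    (isCompact_Icc (a := (0 : ℝ)) (b := 1))).exists_bound_of_continuousOn (key f' hf').continuousOn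
  refine (intervalIntegral.hasDerivAt_integral_of_dominated_loc_of_deriv_le
    (F := fun t x => f t (xc (arccos (1 - 2 * x))) * (jp N j).eval x * wt N x)
    (F' := fun t x => f' t (xc (arccos (1 - 2 * x))) * (jp N j).eval x * wt N x)
    (bound := fun _ => B) (s := Icc (t - 1) (t + 1)) (Icc_mem_nhds (by linarith) (by linarith))
    (Eventually.of_forall fun s => ?_) ?_ ?_ ?_ intervalIntegrable_const ?_).2
  · exact ((key f hf).comp (Continuous.prodMk_right s)).aestronglyMeasurable
  · exact ((key f hf).comp (Continuous.prodMk_right t)).intervalIntegrable _ _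
  · exact ((key f' hf').comp (Continuous.prodMk_right t)).aestronglyMeasurable
  · refine Eventually.of_forall fun x hx' s hs => ?_
    rw [uIoc_of_le zero_le_one] at hx'
    exact hB (s, x) ⟨hs, ⟨hx'.1.le, hx'.2⟩⟩
  · refine Eventually.of_forall fun x _ s _ => ?_
    exact ((hd s _ (xc_mem _)).mul_const _).mul_const _

lemma taylor_remainder {m : ℕ} {F : (Fin m → ℝ) → ℝ} {K : Set (Fin m → ℝ)} (hK : IsCompact K)
    (hc : Convex ℝ K) (hF : AnalyticOnNhd ℝ F K) :
    ∃ C, 0 ≤ C ∧ ∀ p ∈ K, ∀ q ∈ K, |F q - F p - fderiv ℝ F p (q - p)| ≤ C * ‖q - p‖ ^ 2 := by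
  have hF2 : AnalyticOnNhd ℝ (fderiv ℝ F) K := hF.fderiv
  obtain ⟨C, hC⟩ := hK.exists_bound_of_continuousOn hF2.fderiv.continuousOn
  refine ⟨|C|, abs_nonneg C, fun p hp q hq => ?_⟩
  have hs : segment ℝ p q ⊆ K := hc.segment_subset hp hq
  have h1 : ∀ z ∈ segment ℝ p q, ‖fderiv ℝ F z - fderiv ℝ F p‖ ≤ |C| * ‖q - p‖ := fun z hz => by
    have := hc.norm_image_sub_le_of_norm_hasFDerivWithin_le (f := fderiv ℝ F) (C := |C|)
      (fun w hw => (hF2 w hw).differentiableAt.hasFDerivAt.hasFDerivWithinAt)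
      (fun w hw => (hC w hw).trans (le_abs_self C)) hp (hs hz)
    refine this.trans (mul_le_mul_of_nonneg_left ?_ (abs_nonneg C))
    obtain ⟨a, b, ha, hb, hab, rfl⟩ := hz
    have : a • p + b • q - p = b • (q - p) := by
      rw [← eq_sub_iff_add_eq] at hab; subst hab; module
    rw [this, norm_smul, Real.norm_of_nonneg hb]
    exact mul_le_of_le_one_left (norm_nonneg _) (by linarith)
  have := (convex_segment p q).norm_image_sub_le_of_norm_hasFDerivWithin_le' (f := F)
    (φ := fderiv ℝ F p)
    (fun w hw => (hF w (hs hw)).differentiableAt.hasFDerivAt.hasFDerivWithinAt) h1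
    (left_mem_segment ℝ p q) (right_mem_segment ℝ p q)
  rw [Real.norm_eq_abs] at this
  exact this.trans (by rw [sq, mul_assoc])

lemma lipschitz_compact {m : ℕ} {F : (Fin m → ℝ) → ℝ} {K : Set (Fin m → ℝ)} (hK : IsCompact K)
    (hc : Convex ℝ K) (hF : AnalyticOnNhd ℝ F K) :
    ∃ C, 0 ≤ C ∧ ∀ p ∈ K, ∀ q ∈ K, |F q - F p| ≤ C * ‖q - p‖ := by
  obtain ⟨C, hC⟩ := hK.exists_bound_of_continuousOn hF.fderiv.continuousOn
  refine ⟨|C|, abs_nonneg C, fun p hp q hq => ?_⟩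
  exact hc.norm_image_sub_le_of_norm_hasFDerivWithin_le (f := F) (C := |C|)
      (fun w hw => (hF w hw).differentiableAt.hasFDerivAt.hasFDerivWithinAt)
      (fun w hw => (hC w hw).trans (le_abs_self C)) hp hq

/-- Quasilinear system `∂ₜy = F1`, `∂ₜv = F2` on the segment, in the variables
`(x, y, y_x, y_xx, v, v_x)`, together with the structure of its linearisation. -/
structure Prob (N : ℝ) where
  K : Set (Fin 6 → ℝ)
  F1 : (Fin 6 → ℝ) → ℝ
  F2 : (Fin 6 → ℝ) → ℝ
  al : (Fin 6 → ℝ) → ℝ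
  be : (Fin 6 → ℝ) → ℝ
  ga : (Fin 6 → ℝ) → ℝ
  a0 : (Fin 6 → ℝ) → ℝ
  a1 : (Fin 6 → ℝ) → ℝ
  b0 : (Fin 6 → ℝ) → ℝ
  b1 : (Fin 6 → ℝ) → ℝ
  c0 : (Fin 6 → ℝ) → ℝ
  c1 : (Fin 6 → ℝ) → ℝ
  compact : IsCompact K
  convex : Convex ℝ K
  hF1 : AnalyticOnNhd ℝ F1 K
  hF2 : AnalyticOnNhd ℝ F2 K
  hal : AnalyticOnNhd ℝ al K
  hbe : AnalyticOnNhd ℝ be K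
  hga : AnalyticOnNhd ℝ ga K
  ha0 : AnalyticOnNhd ℝ a0 K
  ha1 : AnalyticOnNhd ℝ a1 K
  hb0 : AnalyticOnNhd ℝ b0 K
  hb1 : AnalyticOnNhd ℝ b1 K
  hc0 : AnalyticOnNhd ℝ c0 K
  hc1 : AnalyticOnNhd ℝ c1 K
  hbg : ∀ p ∈ K, be p * ga p = 1
  d1 : ∀ p ∈ K, ∀ V : Fin 6 → ℝ, V 0 = 0 → fderiv ℝ F1 p V =
    a0 p * V 1 + p 0 * (1 - p 0) * a1 p * V 2 + al p * ga p * V 4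
  d2 : ∀ p ∈ K, ∀ V : Fin 6 → ℝ, V 0 = 0 → fderiv ℝ F2 p V =
    -(al p * be p * lamV N (p 0) (V 2) (V 3)) + b0 p * V 1 + p 0 * (1 - p 0) * b1 p * V 2 +
      c0 p * V 4 + p 0 * (1 - p 0) * c1 p * V 5

/-- The point of the jet space at which the nonlinearities are evaluated. -/
noncomputable def D (N : ℝ) (a b : ℕ → ℝ) (x : ℝ) : Fin 6 → ℝ :=
  ![x, jet N 0 a x, jet N 1 a x, jet N 2 a x, jet N 0 b x, jet N 1 b x]

/-- Space derivative of `D`. -/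
noncomputable def Dx (N : ℝ) (a b : ℕ → ℝ) (x : ℝ) : Fin 6 → ℝ :=
  ![1, jet N 1 a x, jet N 2 a x, jet N 3 a x, jet N 1 b x, jet N 2 b x]

/-- Variation of `D`. -/
noncomputable def Dt (N : ℝ) (a b : ℕ → ℝ) (x : ℝ) : Fin 6 → ℝ :=
  ![0, jet N 0 a x, jet N 1 a x, jet N 2 a x, jet N 0 b x, jet N 1 b x]

lemma forall_fin6 {p : Fin 6 → Prop} (h0 : p 0) (h1 : p 1) (h2 : p 2) (h3 : p 3) (h4 : p 4)
    (h5 : p 5) (j : Fin 6) : p j := by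
  fin_cases j <;> assumption

lemma hasDerivAt_D {a b : ℕ → ℝ} {n : ℕ} (ha : ∀ j, n < j → a j = 0) (hb : ∀ j, n < j → b j = 0)
    (x : ℝ) : HasDerivAt (D N a b) (Dx N a b x) x := by
  refine hasDerivAt_pi.2 (forall_fin6 ?_ ?_ ?_ ?_ ?_ ?_)
  · exact hasDerivAt_id x
  · exact hasDerivAt_jet ha 0 x
  · exact hasDerivAt_jet ha 1 x
  · exact hasDerivAt_jet ha 2 x
  · exact hasDerivAt_jet hb 0 x
  · exact hasDerivAt_jet hb 1 x

lemma hasDerivAt_comp_D {Φ : (Fin 6 → ℝ) → ℝ} {a b : ℕ → ℝ} {n : ℕ} {x : ℝ}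
    (hΦ : AnalyticAt ℝ Φ (D N a b x))
    (ha : ∀ j, n < j → a j = 0) (hb : ∀ j, n < j → b j = 0) :
    HasDerivAt (fun x => Φ (D N a b x)) (fderiv ℝ Φ (D N a b x) (Dx N a b x)) x :=
  hΦ.differentiableAt.hasFDerivAt.comp_hasDerivAt x (hasDerivAt_D ha hb x)

lemma hasDerivAt_jet_time_finite {a a' : ℝ → ℕ → ℝ} {n : ℕ} (ha : ∀ t j, n < j → a t j = 0)
    (ha' : ∀ t j, n < j → a' t j = 0)
    (hd : ∀ t j, HasDerivAt (fun t => a t j) (a' t j) t) (i : ℕ) (x t : ℝ) :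
    HasDerivAt (fun t => jet N i (a t) x) (jet N i (a' t) x) t := by
  simp only [jet_eq_sum (ha _), jet_eq_sum (ha' _)]
  exact HasDerivAt.fun_sum fun j _ => (hd t j).mul_const _

lemma hasDerivAt_D_time {a a' b b' : ℝ → ℕ → ℝ} {n : ℕ} {τ : ℝ} (ha : Traj n τ a a')
    (hb : Traj n τ b b') (x t : ℝ) :
    HasDerivAt (fun t => D N (a t) (b t) x) (Dt N (a' t) (b' t) x) t := by
  have h := fun i => hasDerivAt_jet_time_finite (N := N) ha.zero ha.zero' ha.deriv i x t
  have h' := fun i => hasDerivAt_jet_time_finite (N := N) hb.zero hb.zero' hb.deriv i x t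
  exact hasDerivAt_pi.2 (forall_fin6 (hasDerivAt_const t x) (h 0) (h 1) (h 2) (h' 0) (h' 1))

lemma hasDerivAt_comp_D_time {Φ : (Fin 6 → ℝ) → ℝ} {a a' b b' : ℝ → ℕ → ℝ} {n : ℕ} {τ x t : ℝ}
    (hΦ : AnalyticAt ℝ Φ (D N (a t) (b t) x)) (ha : Traj n τ a a') (hb : Traj n τ b b') :
    HasDerivAt (fun t => Φ (D N (a t) (b t) x))
      (fderiv ℝ Φ (D N (a t) (b t) x) (Dt N (a' t) (b' t) x)) t :=
  (hΦ.differentiableAt.hasFDerivAt (x := D N (a t) (b t) x)).comp_hasDerivAt t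
    (f := fun t => D N (a t) (b t) x) (hasDerivAt_D_time ha hb x t)

lemma jet_add_finite {a b : ℕ → ℝ} {n : ℕ} (ha : ∀ j, n < j → a j = 0) (hb : ∀ j, n < j → b j = 0)
    (i : ℕ) (x : ℝ) : jet N i (fun j => a j + b j) x = jet N i a x + jet N i b x := by
  rw [jet_eq_sum ha, jet_eq_sum hb, jet_eq_sum (n := n) (fun j hj => by rw [ha j hj, hb j hj, add_zero]),
    ← Finset.sum_add_distrib]
  exact Finset.sum_congr rfl fun j _ => add_mul _ _ _

lemma D_add {a b h k : ℕ → ℝ} {n : ℕ} (ha : ∀ j, n < j → a j = 0) (hb : ∀ j, n < j → b j = 0)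
    (hh : ∀ j, n < j → h j = 0) (hk : ∀ j, n < j → k j = 0) (x : ℝ) :
    D N (fun j => a j + h j) (fun j => b j + k j) x = D N a b x + Dt N h k x := by
  simp only [D, Dt, jet_add_finite ha hh, jet_add_finite hb hk]
  simp [Matrix.add_cons]

lemma weight_mono {u r : ℝ} {j w w' : ℕ} (h : |u| * (1 + j : ℝ) ^ w ≤ r) (hw : w' ≤ w) :
    |u| * (1 + j : ℝ) ^ w' ≤ r := by
  refine le_trans (mul_le_mul_of_nonneg_left ?_ (abs_nonneg u)) h
  exact pow_le_pow_right₀ (by linarith [Nat.cast_nonneg (α := ℝ) j]) hw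

lemma both_jet {I : Type*} {σ : Scale I} {Cb r : ℝ} {c : ℕ} {m : I → ℕ} (hJ : JB N Cb c)
    (hm : ∀ i, σ.Θ i = m i) {a : I → ℝ → ℕ → ℝ} (h0 : ∀ i t j, m i < j → a i t j = 0)
    (hb : ∀ i t (j : ℕ), |a i t j| * (1 + j : ℝ) ^ (c + 26) ≤ r)
    (hc : ∀ i j, Continuous fun t => a i t j) {l : ℕ} (hl : l ≤ 3) :
    Both σ (fun i t x => jet N l (a i t) x) := by
  have hcont : ∀ i, Continuous fun p : ℝ × ℝ => jet N l (a i p.1) (xc p.2) := fun i =>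
    continuous_jet hJ (fun t j => weight_mono (hb i t j) (by omega)) (hc i)
  refine ⟨⟨hcont, fun k _ => ⟨Cb * 4 ^ l * Z2 * (2 ^ k * r), fun i t => ?_⟩⟩,
    ⟨hcont, fun k hk => ⟨Cb * 4 ^ l * Z2 * r, fun i t => ?_⟩⟩⟩
  · rw [pow_zero, mul_one]
    refine cl_jet_high hJ (σ.hΘ i) (fun j hj => h0 i t j ?_) k (w := c + 26) (by omega) (hb i t)
    rw [hm i] at hj
    exact_mod_cast hj
  · rw [pow_zero, mul_one]
    change k ≤ 16 at hk
    exact cl_jet_low hJ (Rapid.of_finite (h0 i t)) (w := c + 26) (by omega) (hb i t)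

/-- Coefficient trajectories of `y` and `v`, with their time derivatives. -/
structure St where
  Y : ℝ → ℕ → ℝ
  V : ℝ → ℕ → ℝ
  Y' : ℝ → ℕ → ℝ
  V' : ℝ → ℕ → ℝ

namespace St

/-- Evaluation point of a state. -/
noncomputable def pt (N : ℝ) (s : St) (t x : ℝ) : Fin 6 → ℝ := D N (s.Y t) (s.V t) x

/-- Admissible states of degree `m`. -/
structure Good (P : Prob N) (τ r : ℝ) (w m : ℕ) (s : St) : Prop where
  y : Traj m τ s.Y s.Y'
  v : Traj m τ s.V s.V'
  bY : ∀ t (j : ℕ), |s.Y t j| * (1 + j : ℝ) ^ w ≤ r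
  bV : ∀ t (j : ℕ), |s.V t j| * (1 + j : ℝ) ^ w ≤ r
  bY' : ∀ t (j : ℕ), |s.Y' t j| * (1 + j : ℝ) ^ w ≤ r
  bV' : ∀ t (j : ℕ), |s.V' t j| * (1 + j : ℝ) ^ w ≤ r
  mem : ∀ t, ∀ x ∈ Icc (0 : ℝ) 1, s.pt N t x ∈ P.K

/-- Residual of the first equation. -/
noncomputable def res1 (P : Prob N) (χ : ℝ → ℝ) (s : St) (t x : ℝ) : ℝ :=
  jet N 0 (s.Y' t) x - χ t * P.F1 (s.pt N t x)

/-- Residual of the second equation. -/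
noncomputable def res2 (P : Prob N) (χ : ℝ → ℝ) (s : St) (t x : ℝ) : ℝ :=
  jet N 0 (s.V' t) x - χ t * P.F2 (s.pt N t x)

/-- Space derivative of a function along a state. -/
noncomputable def dx (N : ℝ) (Φ : (Fin 6 → ℝ) → ℝ) (s : St) (t x : ℝ) : ℝ :=
  fderiv ℝ Φ (s.pt N t x) (Dx N (s.Y t) (s.V t) x)

/-- Time derivative of a function along a state. -/
noncomputable def dt (N : ℝ) (Φ : (Fin 6 → ℝ) → ℝ) (s : St) (t x : ℝ) : ℝ :=
  fderiv ℝ Φ (s.pt N t x) (Dt N (s.Y' t) (s.V' t) x)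

/-- Coefficients of the symmetrised linearisation. -/
noncomputable def cf (P : Prob N) (χ : ℝ → ℝ) (s : St) : Fin 7 → ℝ → ℝ → ℝ :=
  ![fun t x => χ t * P.al (s.pt N t x),
    fun t x => χ t * P.a0 (s.pt N t x),
    fun t x => χ t * P.a1 (s.pt N t x),
    fun t x => χ t * (P.ga (s.pt N t x) * P.b0 (s.pt N t x)),
    fun t x => χ t * (P.ga (s.pt N t x) * P.b1 (s.pt N t x)),
    fun t x => χ t * (P.c0 (s.pt N t x) +
      P.ga (s.pt N t x) * P.c1 (s.pt N t x) * (x * (1 - x) * s.dx N P.be t x)) -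
      P.ga (s.pt N t x) * s.dt N P.be t x,
    fun t x => χ t * P.c1 (s.pt N t x)]

end St

/-- A family of states to which the Newton step is applied. -/
structure Setting {I : Type*} (P : Prob N) (σ : Scale I) (χ : ℝ → ℝ) (τ r S Cb : ℝ) (c : ℕ)
    (m n : I → ℕ) (s : I → St) : Prop where
  hN : 4 < N
  hJ : JB N Cb c
  hS : JS S
  hσ : ∀ k, σ.P k
  hm : ∀ i, σ.Θ i = m i
  hn : ∀ i, σ.n i = n i
  hmn : ∀ i, σ.Θ i ≤ σ.n i
  hτ : 0 ≤ τ
  χc : Continuous χ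
  χ1 : ∀ t, |χ t| ≤ 1
  χ0 : ∀ t, τ ≤ |t| → χ t = 0
  good : ∀ i, (s i).Good P τ r (c + 26) (m i)

namespace Setting
variable {I : Type*} {P : Prob N} {σ : Scale I} {χ : ℝ → ℝ} {τ r S Cb : ℝ} {c : ℕ}
  {m n : I → ℕ} {s : I → St} (H : Setting P σ χ τ r S Cb c m n s)
include H

lemma jY {l : ℕ} (hl : l ≤ 3) : Both σ (fun i t x => jet N l ((s i).Y t) x) :=
  both_jet H.hJ H.hm (fun i => (H.good i).y.zero) (fun i => (H.good i).bY)
    (fun i => (H.good i).y.continuous) hl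

lemma jV {l : ℕ} (hl : l ≤ 3) : Both σ (fun i t x => jet N l ((s i).V t) x) :=
  both_jet H.hJ H.hm (fun i => (H.good i).v.zero) (fun i => (H.good i).bV)
    (fun i => (H.good i).v.continuous) hl

lemma jY' {l : ℕ} (hl : l ≤ 3) : Both σ (fun i t x => jet N l ((s i).Y' t) x) :=
  both_jet H.hJ H.hm (fun i => (H.good i).y.zero') (fun i => (H.good i).bY')
    (fun i => (H.good i).y.cont) hl

lemma jV' {l : ℕ} (hl : l ≤ 3) : Both σ (fun i t x => jet N l ((s i).V' t) x) :=
  both_jet H.hJ H.hm (fun i => (H.good i).v.zero') (fun i => (H.good i).bV')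
    (fun i => (H.good i).v.cont) hl

lemma both_pt (j : Fin 6) : Both σ (fun i t x => (s i).pt N t x j) := by
  revert j
  exact forall_fin6 Both.id (H.jY (l := 0) (by omega)) (H.jY (l := 1) (by omega))
    (H.jY (l := 2) (by omega)) (H.jV (l := 0) (by omega)) (H.jV (l := 1) (by omega))

lemma both_comp {Φ : (Fin 6 → ℝ) → ℝ} (hΦ : AnalyticOnNhd ℝ Φ P.K) :
    Both σ (fun i t x => Φ ((s i).pt N t x)) :=
  Both.comp P.compact hΦ H.both_pt fun i => (H.good i).mem

lemma both_dx {Φ : (Fin 6 → ℝ) → ℝ} (hΦ : AnalyticOnNhd ℝ Φ P.K) :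
    Both σ (fun i t x => (s i).dx N Φ t x) :=
  Both.fderiv_comp P.compact hΦ H.both_pt (D' := fun i t x => Dx N ((s i).Y t) ((s i).V t) x)
    (forall_fin6 (Both.const 1) (H.jY (l := 1) (by omega)) (H.jY (l := 2) (by omega))
    (H.jY (l := 3) (by omega)) (H.jV (l := 1) (by omega)) (H.jV (l := 2) (by omega)))
    fun i => (H.good i).mem

lemma both_dt {Φ : (Fin 6 → ℝ) → ℝ} (hΦ : AnalyticOnNhd ℝ Φ P.K) :
    Both σ (fun i t x => (s i).dt N Φ t x) :=
  Both.fderiv_comp P.compact hΦ H.both_pt (D' := fun i t x => Dt N ((s i).Y' t) ((s i).V' t) x)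
    (forall_fin6 (Both.const 0) (H.jY' (l := 0) (by omega)) (H.jY' (l := 1) (by omega))
    (H.jY' (l := 2) (by omega)) (H.jV' (l := 0) (by omega)) (H.jV' (l := 1) (by omega)))
    fun i => (H.good i).mem

lemma both_χ : Both σ (fun _ t _ => χ t) := Both.time H.χc H.χ1

lemma both_res1 : Both σ (fun i t x => (s i).res1 P χ t x) :=
  (H.jY' (l := 0) (by omega)).sub (H.both_χ.mul (H.both_comp P.hF1))

lemma both_res2 : Both σ (fun i t x => (s i).res2 P χ t x) :=
  (H.jV' (l := 0) (by omega)).sub (H.both_χ.mul (H.both_comp P.hF2))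

lemma jet_out {i : I} {t : ℝ} (ht : τ ≤ |t|) (l : ℕ) (x : ℝ) :
    jet N l ((s i).Y' t) x = 0 ∧ jet N l ((s i).V' t) x = 0 := by
  rw [show (s i).Y' t = fun _ => 0 from funext fun j => (H.good i).y.supp t j ht,
    show (s i).V' t = fun _ => 0 from funext fun j => (H.good i).v.supp t j ht, jet_zero]
  exact ⟨rfl, rfl⟩

lemma dt_out {i : I} {t : ℝ} (ht : τ ≤ |t|) (x : ℝ) (Φ : (Fin 6 → ℝ) → ℝ) :
    (s i).dt N Φ t x = 0 := by
  have : Dt N ((s i).Y' t) ((s i).V' t) x = 0 := funext <| forall_fin6 rfl (H.jet_out ht 0 x).1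
    (H.jet_out ht 1 x).1 (H.jet_out ht 2 x).1 (H.jet_out ht 0 x).2 (H.jet_out ht 1 x).2
  rw [St.dt, this, map_zero]

lemma linCoef : LinCoef τ σ (fun k i t x => (s i).cf P χ k t x)
    (fun i t x => χ t * (s i).dx N P.a1 t x) (fun i t x => χ t * (s i).dx N P.c1 t x) where
  both k := by
    have hχ := H.both_χ
    have g := H.both_comp P.hga
    fin_cases k
    · exact hχ.mul (H.both_comp P.hal)
    · exact hχ.mul (H.both_comp P.ha0)
    · exact hχ.mul (H.both_comp P.ha1)
    · exact hχ.mul (g.mul (H.both_comp P.hb0))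
    · exact hχ.mul (g.mul (H.both_comp P.hb1))
    · exact (hχ.mul ((H.both_comp P.hc0).add ((g.mul (H.both_comp P.hc1)).mul
        (Both.weight.mul (H.both_dx P.hbe))))).sub (g.mul (H.both_dt P.hbe))
    · exact hχ.mul (H.both_comp P.hc1)
  da i t x hx := (hasDerivAt_comp_D (P.ha1 _ ((H.good i).mem t x hx)) ((H.good i).y.zero t)
    ((H.good i).v.zero t)).const_mul (χ t)
  ds i t x hx := (hasDerivAt_comp_D (P.hc1 _ ((H.good i).mem t x hx)) ((H.good i).y.zero t)
    ((H.good i).v.zero t)).const_mul (χ t)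
  ba := H.both_χ.mul (H.both_dx P.ha1)
  bs := H.both_χ.mul (H.both_dx P.hc1)
  supp k i t x ht := by
    have h1 := H.χ0 t ht
    have h2 := H.dt_out (i := i) ht x P.be
    fin_cases k <;> simp [St.cf, h1, h2]

end Setting

lemma jet_cut_one (n : ℕ) (f : ℝ → ℝ) (x : ℝ) :
    jet N 1 (cut N n f) x = (pj N n f).derivative.eval x := by
  have h1 := hasDerivAt_jet (N := N) (a := cut N n f) (n := n)
    (fun j hj => by rw [cut, if_neg (by omega)]) 0 x
  rw [show jet N 0 (cut N n f) = fun x => (pj N n f).eval x from funext (jet_cut n f)] at h1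
  exact h1.unique ((pj N n f).hasDerivAt x)

section
variable {I : Type*} {σ : Scale I} {ε : I → ℝ}

lemma SX.abs {F : I → ℝ → ℝ → ℝ} (h : SX σ ε F) : SX σ ε (fun i t x => |F i t x|) := by
  obtain ⟨e, C, hC⟩ := h
  exact ⟨e, C, fun i t x hx => by rw [abs_abs]; exact hC i t x hx⟩

lemma SX.norm_Dt {Cb : ℝ} {c : ℕ} (hJ : JB N Cb c) (hε : ∀ i, 0 ≤ ε i) {n : I → ℕ}
    (hn : ∀ i, σ.n i = n i) {h k : I → ℝ → ℕ → ℝ} (Fh : FinSupp n h) (Fk : FinSupp n k)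
    (hh : SCX σ ε h) (hk : SCX σ ε k) :
    SX σ ε (fun i t x => ‖Dt N (h i t) (k i t) x‖) := by
  have a := fun l => (hh.jet hJ hε hn Fh l).abs
  have b := fun l => (hk.jet hJ hε hn Fk l).abs
  obtain ⟨e, C, hC⟩ := ((((a 0).add hε (a 1)).add hε (a 2)).add hε (b 0)).add hε (b 1)
  refine ⟨e, C, fun i t x hx => ?_⟩
  have h1 := (le_abs_self _).trans (hC i t x hx)
  rw [abs_of_nonneg (norm_nonneg _)]
  refine le_trans ?_ h1
  have p0 := abs_nonneg (jet N 0 (h i t) x)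
  have p1 := abs_nonneg (jet N 1 (h i t) x)
  have p2 := abs_nonneg (jet N 2 (h i t) x)
  have p3 := abs_nonneg (jet N 0 (k i t) x)
  have p4 := abs_nonneg (jet N 1 (k i t) x)
  refine (pi_norm_le_iff_of_nonneg (by positivity)).2 (forall_fin6 ?_ ?_ ?_ ?_ ?_ ?_) <;>
    simp only [Dt, Real.norm_eq_abs] <;> simp <;> linarith

end

namespace Setting
variable {I : Type*} {P : Prob N} {σ : Scale I} {χ : ℝ → ℝ} {τ r S Cb : ℝ} {c : ℕ}
  {m n : I → ℕ} {s : I → St} (H : Setting P σ χ τ r S Cb c m n s)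
include H

lemma tx_lin1 {h q : I → ℝ → ℕ → ℝ} (Fh : FinSupp n h) (Fq : FinSupp n q) (hh : TCX σ h)
    (hq : TCX σ q) : TX σ (fun i t => lin1 N (fun k => (s i).cf P χ k t) (h i t) (q i t)) := by
  have K := H.linCoef.both
  have a := hh.jet H.hJ H.hn Fh
  have b := hq.jet H.hJ H.hn Fq
  exact (((K 0).tx.mul (b 0)).add ((K 1).tx.mul (a 0))).add
    ((K 2).tx.mul (Both.weight.tx.mul (a 1)))

lemma sx_lin1 {ε : I → ℝ} (hε : ∀ i, 0 ≤ ε i) {h q : I → ℝ → ℕ → ℝ} (Fh : FinSupp n h)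
    (Fq : FinSupp n q) (hh : SCX σ ε h) (hq : SCX σ ε q) :
    SX σ ε (fun i t => lin1 N (fun k => (s i).cf P χ k t) (h i t) (q i t)) := by
  have K := H.linCoef.both
  have a := hh.jet H.hJ hε H.hn Fh
  have b := hq.jet H.hJ hε H.hn Fq
  exact ((SX.bmul (K 0) (b 0)).add hε (SX.bmul (K 1) (a 0))).add hε
    (SX.bmul (K 2) (SX.bmul Both.weight (a 1)))

lemma tx_lin2 {h q : I → ℝ → ℕ → ℝ} (Fh : FinSupp n h) (Fq : FinSupp n q) (hh : TCX σ h)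
    (hq : TCX σ q) : TX σ (fun i t => lin2 N (fun k => (s i).cf P χ k t) (h i t) (q i t)) := by
  have K := H.linCoef.both
  have a := hh.jet H.hJ H.hn Fh
  have b := hq.jet H.hJ H.hn Fq
  have l : TX σ (fun i t x => lamV N x (jet N 1 (h i t) x) (jet N 2 (h i t) x)) :=
    (Both.weight.neg.tx.mul (a 2)).sub (Both.drift.tx.mul (a 1))
  exact (((((K 0).tx.mul l).neg.add ((K 3).tx.mul (a 0))).add
    ((K 4).tx.mul (Both.weight.tx.mul (a 1)))).add ((K 5).tx.mul (b 0))).add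
    ((K 6).tx.mul (Both.weight.tx.mul (b 1)))

lemma sx_lin2 {ε : I → ℝ} (hε : ∀ i, 0 ≤ ε i) {h q : I → ℝ → ℕ → ℝ} (Fh : FinSupp n h)
    (Fq : FinSupp n q) (hh : SCX σ ε h) (hq : SCX σ ε q) :
    SX σ ε (fun i t => lin2 N (fun k => (s i).cf P χ k t) (h i t) (q i t)) := by
  have K := H.linCoef.both
  have a := hh.jet H.hJ hε H.hn Fh
  have b := hq.jet H.hJ hε H.hn Fq
  have l : SX σ ε (fun i t x => lamV N x (jet N 1 (h i t) x) (jet N 2 (h i t) x)) :=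
    (SX.bmul Both.weight.neg (a 2)).sub hε (SX.bmul Both.drift (a 1))
  exact ((((SX.bmul (K 0) l).neg.add hε (SX.bmul (K 3) (a 0))).add hε
    (SX.bmul (K 4) (SX.bmul Both.weight (a 1)))).add hε (SX.bmul (K 5) (b 0))).add hε
    (SX.bmul (K 6) (SX.bmul Both.weight (b 1)))

end Setting

/-- Sum of a state and an increment. -/
def St.add (s u : St) : St where
  Y t j := s.Y t j + u.Y t j
  V t j := s.V t j + u.V t j
  Y' t j := s.Y' t j + u.Y' t j
  V' t j := s.V' t j + u.V' t j

lemma residual_identity {χ F1 Q F al a0 a1 ga be x Y' h' h0 h1 q0 k0 dF R : ℝ} (hb : be * ga = 1)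
    (hF : F = F1 + dF + Q)
    (hd : dF = a0 * h0 + x * (1 - x) * a1 * h1 + al * ga * k0) (hR : R = Y' - χ * F1) :
    Y' + h' - χ * F = -(χ * al * q0 + χ * a0 * h0 + χ * a1 * (x * (1 - x) * h1) - R - h') +
      χ * (al * ga * (be * q0 - k0)) - χ * Q := by
  subst hF hd hR
  linear_combination (-(χ * al * q0)) * hb

lemma residual_identity_two {χ F2 Q F al be ga b0 b1 c0 c1 x bx bt V' k' q' lv h0 h1 q0 q1 k0 k1 dF R : ℝ}
    (hb : be * ga = 1) (hF : F = F2 + dF + Q)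
    (hd : dF = -(al * be * lv) + b0 * h0 + x * (1 - x) * b1 * h1 + c0 * k0 + x * (1 - x) * c1 * k1)
    (hR : R = V' - χ * F2) :
    V' + k' - χ * F = χ * (c0 * (be * q0 - k0)) +
      χ * (c1 * (x * (1 - x) * (bx * q0 + be * q1 - k1))) -
      be * (-(χ * al * lv) + χ * (ga * b0) * h0 + χ * (ga * b1) * (x * (1 - x) * h1) +
        (χ * (c0 + ga * c1 * (x * (1 - x) * bx)) - ga * bt) * q0 + χ * c1 * (x * (1 - x) * q1) -
        ga * R - q') - (bt * q0 + be * q' - k') - χ * Q := by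
  subst hF hd hR
  linear_combination (-(V' - χ * F2) + χ * b0 * h0 + χ * b1 * (x * (1 - x) * h1) +
    χ * c1 * (x * (1 - x) * bx) * q0 - bt * q0) * hb

lemma Err.sub {I : Type*} {σ : Scale I} {F G : I → ℝ → ℝ → ℝ} (hF : Err σ F) (hG : Err σ G) :
    Err σ (fun i t x => F i t x - G i t x) := by
  simpa only [sub_eq_add_neg] using hF.add hG.neg

/-- Quadratic convergence bound, up to spectral errors. -/
def QuadBound {I : Type*} (σ : Scale I) (ε : I → ℝ) (Q : I → Prop) (G : I → ℝ → ℝ → ℝ) : Prop :=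
  ∃ f : ℕ, ∀ l : ℕ, ∃ C : ℝ, ∀ i, Q i → ∀ t, ∀ x ∈ Icc (0 : ℝ) 1,
    |G i t x| ≤ C * σ.n i ^ f * ((σ.Θ i / σ.n i) ^ l + ε i ^ 2)

lemma QuadBound.of {I : Type*} {σ : Scale I} {ε : I → ℝ} {Q : I → Prop} {G E B : I → ℝ → ℝ → ℝ}
    {χ : ℝ → ℝ} (χ1 : ∀ t, |χ t| ≤ 1) (hE : Err σ E) (hB : SX σ ε B) {C0 : ℝ}
    (h : ∀ i, Q i → ∀ t, ∀ x ∈ Icc (0 : ℝ) 1, ∃ q : ℝ, G i t x = E i t x - χ t * q ∧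
      |q| ≤ C0 * B i t x ^ 2) : QuadBound σ ε Q G := by
  obtain ⟨e, hE⟩ := hE
  obtain ⟨f, D, hD⟩ := hB
  refine ⟨e + 2 * f, fun l => ?_⟩
  obtain ⟨C, hC⟩ := hE l
  refine ⟨|C| + |C0| * D ^ 2, fun i hi t x hx => ?_⟩
  obtain ⟨q, hq, hb⟩ := h i hi t x hx
  have hn := σ.hn i
  have hΘ := zero_le_one.trans (σ.hΘ i)
  have hn0 : 0 < σ.n i := zero_lt_one.trans_le hn
  have h1 := hC i t x hx
  have h2 : B i t x ^ 2 ≤ (D * σ.n i ^ f * ε i) ^ 2 := sq_le_sq' (abs_le.1 (hD i t x hx)).1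
    (abs_le.1 (hD i t x hx)).2
  have hr : 0 ≤ (σ.Θ i / σ.n i) ^ l := by positivity
  have m1 : σ.n i ^ e ≤ σ.n i ^ (e + 2 * f) := pow_le_pow_right₀ hn (by omega)
  have m2 : σ.n i ^ (2 * f) ≤ σ.n i ^ (e + 2 * f) := pow_le_pow_right₀ hn (by omega)
  rw [hq]
  calc |E i t x - χ t * q| ≤ |E i t x| + |χ t| * |q| := by rw [← abs_mul]; exact abs_sub _ _
    _ ≤ |C| * σ.n i ^ e * (σ.Θ i / σ.n i) ^ l + 1 * (|C0| * (D * σ.n i ^ f * ε i) ^ 2) := by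
        gcongr
        · refine h1.trans ?_
          gcongr
          exact le_abs_self C
        · exact χ1 t
        · refine hb.trans ?_
          gcongr
          exact le_abs_self C0
    _ = |C| * (σ.n i ^ e * (σ.Θ i / σ.n i) ^ l) + |C0| * D ^ 2 * (σ.n i ^ (2 * f) * ε i ^ 2) := by
        rw [pow_mul']; ring
    _ ≤ |C| * (σ.n i ^ (e + 2 * f) * ((σ.Θ i / σ.n i) ^ l + ε i ^ 2)) +
        |C0| * D ^ 2 * (σ.n i ^ (e + 2 * f) * ((σ.Θ i / σ.n i) ^ l + ε i ^ 2)) := by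
        gcongr
        · linarith [sq_nonneg (ε i)]
        · linarith
    _ = _ := by ring

namespace Setting
variable {I : Type*} {P : Prob N} {σ : Scale I} {χ : ℝ → ℝ} {τ r S Cb : ℝ} {c : ℕ}
  {m n : I → ℕ} {s : I → St} (H : Setting P σ χ τ r S Cb c m n s)
include H

theorem newton {ε : I → ℝ} (hε : ∀ i, 0 ≤ ε i)
    (h1 : ∀ i t, ∀ x ∈ Icc (0 : ℝ) 1, |(s i).res1 P χ t x| ≤ ε i)
    (h2 : ∀ i t, ∀ x ∈ Icc (0 : ℝ) 1, |(s i).res2 P χ t x| ≤ ε i) :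
    ∃ u : I → St, (∀ i, Traj (n i) τ (u i).Y (u i).Y' ∧ Traj (n i) τ (u i).V (u i).V') ∧
      (∀ i j, (u i).Y 0 j = 0 ∧ (u i).V 0 j = 0) ∧
      (SCX σ ε (fun i => (u i).Y) ∧ SCX σ ε (fun i => (u i).V) ∧
        SCX σ ε (fun i => (u i).Y') ∧ SCX σ ε (fun i => (u i).V')) ∧
      QuadBound σ ε (fun i => ∀ t, ∀ x ∈ Icc (0 : ℝ) 1, ((s i).add (u i)).pt N t x ∈ P.K)
        (fun i => ((s i).add (u i)).res1 P χ) ∧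
      QuadBound σ ε (fun i => ∀ t, ∀ x ∈ Icc (0 : ℝ) 1, ((s i).add (u i)).pt N t x ∈ P.K)
        (fun i => ((s i).add (u i)).res2 P χ) := by
  have hN := H.hN
  have hmn : ∀ i, m i ≤ n i := fun i => by
    have := H.hmn i
    rw [H.hm, H.hn] at this
    exact_mod_cast this
  have bR1 := H.both_res1
  have bR2 := H.both_res2
  have bga := H.both_comp P.hga
  have bbe := H.both_comp P.hbe
  have bbt := H.both_dt P.hbe
  have sR1 : Sm σ ε 0 (fun i t x => (s i).res1 P χ t x) :=
    ⟨1, fun i t x hx => by simpa using h1 i t x hx⟩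
  have sR2 : Sm σ ε 0 (fun i t x => P.ga ((s i).pt N t x) * (s i).res2 P χ t x) := by
    obtain ⟨C, hC0, hC⟩ := bga.bounded
    refine ⟨C, fun i t x hx => ?_⟩
    rw [abs_mul, pow_zero, mul_one]
    exact mul_le_mul (hC i t x hx) (h2 i t x hx) (abs_nonneg _) hC0
  have gR2 : Both σ (fun i t x => P.ga ((s i).pt N t x) * (s i).res2 P χ t x) := bga.mul bR2
  have out : ∀ i t x, τ ≤ |t| → (s i).res1 P χ t x = 0 ∧
      P.ga ((s i).pt N t x) * (s i).res2 P χ t x = 0 := fun i t x ht => by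
    have hj := H.jet_out (i := i) ht 0 x
    simp [St.res1, St.res2, hj.1, hj.2, H.χ0 t ht]
  obtain ⟨h, q, h', q', T, Z, eqn, tch, tcq, small⟩ := linear_step hN H.hS H.hσ H.hmn H.hn H.hτ
    H.linCoef bR1.1 gR2.1 out
  have Fh : FinSupp n h := ⟨fun i => (T i).1.zero, fun i => (T i).1.continuous⟩
  have Fq : FinSupp n q := ⟨fun i => (T i).2.zero, fun i => (T i).2.continuous⟩
  have Fq' : FinSupp n q' := ⟨fun i => (T i).2.zero', fun i => (T i).2.cont⟩
  obtain ⟨sh, sq⟩ := small ε 0 hε sR1 sR2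
  have sh : SCX σ ε h := ⟨_, sh⟩
  have sq : SCX σ ε q := ⟨_, sq⟩
  have th : TCX σ h := ⟨_, tch⟩
  have tq : TCX σ q := ⟨_, tcq⟩
  set L1 : I → ℝ → ℝ → ℝ := fun i t x =>
    lin1 N (fun k => (s i).cf P χ k t) (h i t) (q i t) x - (s i).res1 P χ t x with hL1
  set L2 : I → ℝ → ℝ → ℝ := fun i t x => lin2 N (fun k => (s i).cf P χ k t) (h i t) (q i t) x -
    P.ga ((s i).pt N t x) * (s i).res2 P χ t x with hL2
  have tL1 : TX σ L1 := (H.tx_lin1 Fh Fq th tq).sub bR1.tx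
  have tL2 : TX σ L2 := (H.tx_lin2 Fh Fq th tq).sub gR2.tx
  have sL1 : SX σ ε L1 := (H.sx_lin1 hε Fh Fq sh sq).sub hε ⟨0, sR1⟩
  have sL2 : SX σ ε L2 := (H.sx_lin2 hε Fh Fq sh sq).sub hε ⟨0, sR2⟩
  have eh' : h' = fun i t => cut N (n i) (L1 i t) := by
    funext i t j
    simp only [cut]
    split_ifs with hj
    · exact (eqn i t j hj).1
    · exact (T i).1.zero' t j (by omega)
  have eq' : q' = fun i t => cut N (n i) (L2 i t) := by
    funext i t j
    simp only [cut]
    split_ifs with hj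
    · exact (eqn i t j hj).2
    · exact (T i).2.zero' t j (by omega)
  have sh' : SCX σ ε h' := eh' ▸ sL1.scx hN (fun i t => tL1.cont i t)
  have sq' : SCX σ ε q' := eq' ▸ sL2.scx hN (fun i t => tL2.cont i t)
  have tq' : TCX σ q' := eq' ▸ tL2.tcx hN H.hS H.hσ H.hmn
  have jq := tq.jet H.hJ H.hn Fq
  have jq' := tq'.jet H.hJ H.hn Fq'
  have kq := sq.jet H.hJ hε H.hn Fq
  have kq' := sq'.jet H.hJ hε H.hn Fq'
  set G1 : I → ℝ → ℝ → ℝ := fun i t x => P.be ((s i).pt N t x) * jet N 0 (q i t) x with hG1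
  set G2 : I → ℝ → ℝ → ℝ := fun i t x => (s i).dt N P.be t x * jet N 0 (q i t) x +
    P.be ((s i).pt N t x) * jet N 0 (q' i t) x with hG2
  have tG1 : TX σ G1 := bbe.tx.mul (jq 0)
  have tG2 : TX σ G2 := (bbt.tx.mul (jq 0)).add (bbe.tx.mul (jq' 0))
  have sG1 : SX σ ε G1 := SX.bmul bbe (kq 0)
  have sG2 : SX σ ε G2 := (SX.bmul bbt (kq 0)).add hε (SX.bmul bbe (kq' 0))
  set k : I → ℝ → ℕ → ℝ := fun i t => cut N (n i) (G1 i t) with hk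
  set k' : I → ℝ → ℕ → ℝ := fun i t => cut N (n i) (G2 i t) with hk'
  have Fk : FinSupp n k := FinSupp.of_cut hN tG1
  have Fk' : FinSupp n k' := FinSupp.of_cut hN tG2
  have sk : SCX σ ε k := sG1.scx hN (fun i t => tG1.cont i t)
  have sk' : SCX σ ε k' := sG2.scx hN (fun i t => tG2.cont i t)
  have Tk : ∀ i, Traj (n i) τ (k i) (k' i) := fun i => {
    zero := Fk.zero i
    zero' := Fk'.zero i
    cont := Fk'.cont i
    deriv := fun t j => by
      simp only [hk, hk', cut]
      split_ifs with hj
      · obtain ⟨e1, g1⟩ := tG1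
        obtain ⟨e2, g2⟩ := tG2
        refine hasDerivAt_jc_time hN (g1.1 i) (g2.1 i) (fun t x hx => ?_) j t
        have d1 := hasDerivAt_comp_D_time (P.hbe _ ((H.good i).mem t x hx)) (H.good i).y (H.good i).v
        exact d1.fun_mul (hasDerivAt_jet_time_finite (Fq.zero i) (Fq'.zero i) (T i).2.deriv 0 x t)
      · exact hasDerivAt_const _ _
    supp := fun t j ht => by
      simp only [hk', cut]
      split_ifs with hj
      · have e1 : q' i t = fun _ => 0 := funext fun j => (T i).2.supp t j ht
        have : G2 i t = fun _ => 0 := by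
          funext x
          simp only [hG2, H.dt_out ht, e1, jet_zero]
          ring
        rw [this, jc_zero]
      · rfl }
  obtain ⟨E1, -⟩ := Err.tail H.hJ H.hS H.hσ H.hn H.hmn tL1
  obtain ⟨E2, -⟩ := Err.tail H.hJ H.hS H.hσ H.hn H.hmn tL2
  have E2 : Err σ (fun i t x => L2 i t x - jet N 0 (q' i t) x) := by
    rw [eq']
    simpa only [jet_cut] using E2
  obtain ⟨E3, -⟩ := Err.tail H.hJ H.hS H.hσ H.hn H.hmn tG2
  obtain ⟨E4, E5⟩ := Err.tail H.hJ H.hS H.hσ H.hn H.hmn tG1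
  have E5 := E5 (fun i t x => (s i).dx N P.be t x * jet N 0 (q i t) x +
    P.be ((s i).pt N t x) * jet N 1 (q i t) x - jet N 1 (k i t) x) fun i t x hx => by
      simp only [hk, jet_cut_one]
      exact ((hasDerivAt_comp_D (P.hbe _ ((H.good i).mem t x hx)) ((H.good i).y.zero t)
        ((H.good i).v.zero t)).fun_mul (hasDerivAt_jet (Fq.zero i t) 0 x)).fun_sub
        ((pj N (n i) (G1 i t)).hasDerivAt x)
  have nD := SX.norm_Dt H.hJ hε H.hn Fh Fk sh sk
  obtain ⟨C1, hC1, Q1⟩ := taylor_remainder P.compact P.convex P.hF1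
  obtain ⟨C2, hC2, Q2⟩ := taylor_remainder P.compact P.convex P.hF2
  have hpt : ∀ i t x, ((s i).add ⟨h i, k i, h' i, k' i⟩).pt N t x =
      (s i).pt N t x + Dt N (h i t) (k i t) x := fun i t x =>
    D_add (n := n i) (fun j hj => (H.good i).y.zero t j ((hmn i).trans_lt hj))
      (fun j hj => (H.good i).v.zero t j ((hmn i).trans_lt hj)) (Fh.zero i t) (Fk.zero i t) x
  refine ⟨fun i => ⟨h i, k i, h' i, k' i⟩, fun i => ⟨(T i).1, Tk i⟩, fun i j => ⟨(Z i j).1, ?_⟩,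
    ⟨sh, sk, sh', sk'⟩, ?_, ?_⟩
  · have e1 : q i 0 = fun _ => 0 := funext fun j => (Z i j).2
    have : G1 i 0 = fun _ => 0 := by
      funext x
      simp only [hG1, e1, jet_zero, mul_zero]
    simp only [hk, cut, this, jc_zero, ite_self]
  · refine QuadBound.of H.χ1 (E1.neg.add (Err.bmul H.both_χ (Err.bmul ((H.both_comp P.hal).mul bga) E4)))
      nD (C0 := C1) fun i hi t x hx => ⟨P.F1 ((s i).pt N t x + Dt N (h i t) (k i t) x) -
        P.F1 ((s i).pt N t x) - fderiv ℝ P.F1 ((s i).pt N t x) (Dt N (h i t) (k i t) x), ?_, ?_⟩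
    · have e := residual_identity (χ := χ t) (P.hbg _ ((H.good i).mem t x hx))
        (F := P.F1 ((s i).pt N t x + Dt N (h i t) (k i t) x))
        (F1 := P.F1 ((s i).pt N t x)) (Q := P.F1 ((s i).pt N t x + Dt N (h i t) (k i t) x) -
          P.F1 ((s i).pt N t x) - fderiv ℝ P.F1 ((s i).pt N t x) (Dt N (h i t) (k i t) x)) (by ring)
        (P.d1 _ ((H.good i).mem t x hx) (Dt N (h i t) (k i t) x) rfl)
        (R := (s i).res1 P χ t x) (Y' := jet N 0 ((s i).Y' t) x) rfl (h' := jet N 0 (h' i t) x)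
        (q0 := jet N 0 (q i t) x)
      have e1 : ((s i).add ⟨h i, k i, h' i, k' i⟩).res1 P χ t x = jet N 0 ((s i).Y' t) x +
          jet N 0 (h' i t) x - χ t * P.F1 ((s i).pt N t x + Dt N (h i t) (k i t) x) := by
        rw [St.res1, hpt]
        simp only [St.add]
        rw [jet_add_finite (n := n i) (fun j hj => (H.good i).y.zero' t j ((hmn i).trans_lt hj))
          ((T i).1.zero' t)]
      rw [e1, e]
      simp only [← jet_cut]
      rw [eh']
      rfl
    · have := Q1 _ ((H.good i).mem t x hx) _ (hpt i t x ▸ hi t x hx)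
      simpa using this
  · refine QuadBound.of H.χ1 ((((Err.bmul H.both_χ (Err.bmul (H.both_comp P.hc0) E4)).add
      (Err.bmul H.both_χ (Err.bmul (H.both_comp P.hc1) E5))).sub (Err.bmul bbe E2)).sub E3)
      nD (C0 := C2) fun i hi t x hx => ⟨P.F2 ((s i).pt N t x + Dt N (h i t) (k i t) x) -
        P.F2 ((s i).pt N t x) - fderiv ℝ P.F2 ((s i).pt N t x) (Dt N (h i t) (k i t) x), ?_, ?_⟩
    · have e := residual_identity_two (χ := χ t) (P.hbg _ ((H.good i).mem t x hx))
        (F := P.F2 ((s i).pt N t x + Dt N (h i t) (k i t) x))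
        (F2 := P.F2 ((s i).pt N t x)) (Q := P.F2 ((s i).pt N t x + Dt N (h i t) (k i t) x) -
          P.F2 ((s i).pt N t x) - fderiv ℝ P.F2 ((s i).pt N t x) (Dt N (h i t) (k i t) x)) (by ring)
        (P.d2 _ ((H.good i).mem t x hx) (Dt N (h i t) (k i t) x) rfl)
        (R := (s i).res2 P χ t x) (V' := jet N 0 ((s i).V' t) x) rfl (k' := jet N 0 (k' i t) x)
        (q0 := jet N 0 (q i t) x) (q1 := jet N 1 (q i t) x) (q' := jet N 0 (q' i t) x)
        (bx := (s i).dx N P.be t x) (bt := (s i).dt N P.be t x)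
      have e1 : ((s i).add ⟨h i, k i, h' i, k' i⟩).res2 P χ t x = jet N 0 ((s i).V' t) x +
          jet N 0 (k' i t) x - χ t * P.F2 ((s i).pt N t x + Dt N (h i t) (k i t) x) := by
        rw [St.res2, hpt]
        simp only [St.add]
        rw [jet_add_finite (n := n i) (fun j hj => (H.good i).v.zero' t j ((hmn i).trans_lt hj))
          ((Tk i).zero' t)]
      rw [e1, e]
      simp only [← jet_cut]
      rfl
    · have := Q2 _ ((H.good i).mem t x hx) _ (hpt i t x ▸ hi t x hx)
      simpa using this

end Setting

/-- Fixed data of the iteration. -/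
structure Env (P : Prob N) (χ : ℝ → ℝ) (τ r S Cb : ℝ) (c : ℕ) : Prop where
  hN : 4 < N
  hJ : JB N Cb c
  hS : JS S
  hτ : 0 ≤ τ
  hr : 0 ≤ r
  χc : Continuous χ
  χ1 : ∀ t, |χ t| ≤ 1
  χ0 : ∀ t, τ ≤ |t| → χ t = 0
  box : ∀ p : Fin 6 → ℝ, p 0 ∈ Icc (0 : ℝ) 1 → (∀ k, k ≠ 0 → |p k| ≤ 16 * Cb * r * Z2) → p ∈ P.K

/-- The supremum of the residuals. -/
noncomputable def St.R (P : Prob N) (χ : ℝ → ℝ) (s : St) : ℝ :=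
  ⨆ p : ℝ × Icc (0 : ℝ) 1, max |s.res1 P χ p.1 p.2| |s.res2 P χ p.1 p.2|

lemma St.R_le {P : Prob N} {χ : ℝ → ℝ} {s : St} {B : ℝ}
    (h : ∀ t, ∀ x ∈ Icc (0 : ℝ) 1, |s.res1 P χ t x| ≤ B ∧ |s.res2 P χ t x| ≤ B) : s.R P χ ≤ B := by
  have : Nonempty (ℝ × Icc (0 : ℝ) 1) := ⟨(0, ⟨0, by simp⟩)⟩
  exact ciSup_le fun p => max_le (h p.1 p.2 p.2.2).1 (h p.1 p.2 p.2.2).2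

lemma St.R_nonneg (P : Prob N) (χ : ℝ → ℝ) (s : St) : 0 ≤ s.R P χ :=
  Real.iSup_nonneg fun _ => le_max_of_le_left (abs_nonneg _)

/-- Indices of the Newton step. -/
def StepIndex (P : Prob N) (τ r : ℝ) (c : ℕ) : Type :=
  {p : St × ℕ × ℕ // p.1.Good P τ r (c + 26) p.2.1 ∧ 1 ≤ p.2.1 ∧ p.2.1 ≤ p.2.2}

lemma Prob.exists_lipschitz (P : Prob N) : ∃ C : ℝ, 0 ≤ C ∧ ∀ p ∈ P.K, ∀ q ∈ P.K, |P.F1 q - P.F1 p| ≤ C * ‖q - p‖ ∧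
    |P.F2 q - P.F2 p| ≤ C * ‖q - p‖ := by
  obtain ⟨C1, h1, hC1⟩ := lipschitz_compact P.compact P.convex P.hF1
  obtain ⟨C2, h2, hC2⟩ := lipschitz_compact P.compact P.convex P.hF2
  refine ⟨C1 + C2, by positivity, fun p hp q hq => ⟨(hC1 p hp q hq).trans ?_, (hC2 p hp q hq).trans ?_⟩⟩
  · exact mul_le_mul_of_nonneg_right (by linarith) (norm_nonneg _)
  · exact mul_le_mul_of_nonneg_right (by linarith) (norm_nonneg _)

namespace Env
variable {P : Prob N} {χ : ℝ → ℝ} {τ r S Cb : ℝ} {c : ℕ} (H : Env P χ τ r S Cb c)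
include H

lemma setting : Setting (I := StepIndex P τ r c) P
    ⟨fun i => i.1.2.1, fun i => i.1.2.2, fun _ => True, fun i => by exact_mod_cast i.2.2.1,
      fun i => by exact_mod_cast i.2.2.1.trans i.2.2.2⟩ χ τ r S Cb c
    (fun i => i.1.2.1) (fun i => i.1.2.2) (fun i => i.1.1) where
  hN := H.hN
  hJ := H.hJ
  hS := H.hS
  hσ := fun _ => trivial
  hm := fun _ => rfl
  hn := fun _ => rfl
  hmn := fun i => Nat.cast_le.2 i.2.2.2
  hτ := H.hτ
  χc := H.χc
  χ1 := H.χ1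
  χ0 := H.χ0
  good := fun i => i.2.1

lemma le_R {s : St} {m : ℕ} (hg : s.Good P τ r (c + 26) m) (hm : 1 ≤ m) {t x : ℝ}
    (hx : x ∈ Icc (0 : ℝ) 1) : |s.res1 P χ t x| ≤ s.R P χ ∧ |s.res2 P χ t x| ≤ s.R P χ := by
  obtain ⟨C1, -, hC1⟩ := H.setting.both_res1.bounded
  obtain ⟨C2, -, hC2⟩ := H.setting.both_res2.bounded
  have h := le_ciSup (f := fun p : ℝ × Icc (0 : ℝ) 1 => max |s.res1 P χ p.1 p.2| |s.res2 P χ p.1 p.2|)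
    ⟨max C1 C2, by
      rintro _ ⟨p, rfl⟩
      exact max_le_max (hC1 ⟨(s, m, m), hg, hm, le_rfl⟩ p.1 p.2 p.2.2)
        (hC2 ⟨(s, m, m), hg, hm, le_rfl⟩ p.1 p.2 p.2.2)⟩ (t, ⟨x, hx⟩)
  exact ⟨(le_max_left _ _).trans h, (le_max_right _ _).trans h⟩

lemma abs_jet {a : ℕ → ℝ} {A x : ℝ} (hA : 0 ≤ A) (ha : ∀ j : ℕ, |a j| * (1 + j : ℝ) ^ (c + 6) ≤ A)
    (hx : x ∈ Icc (0 : ℝ) 1) {i : ℕ} (hi : i ≤ 2) : |jet N i a x| ≤ 16 * Cb * A * Z2 := by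
  have h0 := zero_le_one.trans H.hJ.one_le
  have hz := zero_le_one.trans Z2_ge
  refine (abs_jet_le H.hJ (A := A) (fun j => le_trans ?_ (ha j)) hx).trans ?_
  · have : (0 : ℝ) ≤ j := Nat.cast_nonneg j
    exact mul_le_mul_of_nonneg_left (pow_le_pow_right₀ (by linarith) (by omega)) (abs_nonneg _)
  · have : (4 : ℝ) ^ i ≤ 16 := (pow_le_pow_right₀ (by norm_num) hi).trans (by norm_num)
    calc Cb * 4 ^ i * A * Z2 ≤ Cb * 16 * A * Z2 := by gcongr
      _ = _ := by ring

lemma norm_Dt_le {a b : ℕ → ℝ} {A x : ℝ} (hA : 0 ≤ A) (ha : ∀ j : ℕ, |a j| * (1 + j : ℝ) ^ (c + 6) ≤ A)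
    (hb : ∀ j : ℕ, |b j| * (1 + j : ℝ) ^ (c + 6) ≤ A) (hx : x ∈ Icc (0 : ℝ) 1) :
    ‖Dt N a b x‖ ≤ 16 * Cb * A * Z2 := by
  have h0 := zero_le_one.trans H.hJ.one_le
  have hz := zero_le_one.trans Z2_ge
  have h1 : 0 ≤ 16 * Cb * A * Z2 := by positivity
  refine (pi_norm_le_iff_of_nonneg h1).2 (forall_fin6 ?_ ?_ ?_ ?_ ?_ ?_) <;>
    simp only [Dt, norm_eq_abs]
  · simpa using h1
  · exact H.abs_jet hA ha hx (by omega)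
  · exact H.abs_jet hA ha hx (by omega)
  · exact H.abs_jet hA ha hx (by omega)
  · exact H.abs_jet hA hb hx (by omega)
  · exact H.abs_jet hA hb hx (by omega)

lemma mem {a b : ℕ → ℝ} {x : ℝ} (ha : ∀ j : ℕ, |a j| * (1 + j : ℝ) ^ (c + 26) ≤ r)
    (hb : ∀ j : ℕ, |b j| * (1 + j : ℝ) ^ (c + 26) ≤ r) (hx : x ∈ Icc (0 : ℝ) 1) : D N a b x ∈ P.K := by
  have key : ∀ a : ℕ → ℝ, (∀ j : ℕ, |a j| * (1 + j : ℝ) ^ (c + 26) ≤ r) →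
      ∀ j : ℕ, |a j| * (1 + j : ℝ) ^ (c + 6) ≤ r := fun a ha j => le_trans (by
    have : (0 : ℝ) ≤ j := Nat.cast_nonneg j
    exact mul_le_mul_of_nonneg_left (pow_le_pow_right₀ (by linarith) (by omega)) (abs_nonneg _)) (ha j)
  refine H.box _ hx (forall_fin6 (fun h => absurd rfl h) ?_ ?_ ?_ ?_ ?_) <;> intro _
  · exact H.abs_jet H.hr (key a ha) hx (i := 0) (by omega)
  · exact H.abs_jet H.hr (key a ha) hx (i := 1) (by omega)
  · exact H.abs_jet H.hr (key a ha) hx (i := 2) (by omega)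
  · exact H.abs_jet H.hr (key b hb) hx (i := 0) (by omega)
  · exact H.abs_jet H.hr (key b hb) hx (i := 1) (by omega)

/-- One step of the Newton iteration, with constants that depend only on the problem. -/
theorem exists_step : ∃ (u : St → ℕ → ℕ → St) (f : ℕ) (C : ℝ), 0 ≤ C ∧
    (∀ (s : St) (m n : ℕ), s.Good P τ r (c + 26) m → 1 ≤ m → m ≤ n →
      Traj n τ (u s m n).Y (u s m n).Y' ∧ Traj n τ (u s m n).V (u s m n).V' ∧
      (∀ j, (u s m n).Y 0 j = 0 ∧ (u s m n).V 0 j = 0) ∧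
      ∀ t j, |(u s m n).Y t j| ≤ C * n ^ f * s.R P χ ∧ |(u s m n).V t j| ≤ C * n ^ f * s.R P χ ∧
        |(u s m n).Y' t j| ≤ C * n ^ f * s.R P χ ∧ |(u s m n).V' t j| ≤ C * n ^ f * s.R P χ) ∧
    ∀ l : ℕ, ∃ B : ℝ, 0 ≤ B ∧ ∀ (s : St) (m n : ℕ), s.Good P τ r (c + 26) m → 1 ≤ m → m ≤ n →
      (∀ t, ∀ x ∈ Icc (0 : ℝ) 1, (s.add (u s m n)).pt N t x ∈ P.K) →
      ∀ t, ∀ x ∈ Icc (0 : ℝ) 1,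
        |(s.add (u s m n)).res1 P χ t x| ≤ B * n ^ f * ((m / n : ℝ) ^ l + s.R P χ ^ 2) ∧
        |(s.add (u s m n)).res2 P χ t x| ≤ B * n ^ f * ((m / n : ℝ) ^ l + s.R P χ ^ 2) := by
  classical
  have hs := H.setting
  obtain ⟨u, uT, u0, ⟨⟨f1, D1, b1⟩, ⟨f2, D2, b2⟩, ⟨f3, D3, b3⟩, ⟨f4, D4, b4⟩⟩, ⟨f5, q5⟩, ⟨f6, q6⟩⟩ :=
    hs.newton (ε := fun i => i.1.1.R P χ) (fun i => i.1.1.R_nonneg P χ)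
      (fun i t x hx => (H.le_R i.2.1 i.2.2.1 hx).1)
      (fun i t x hx => (H.le_R i.2.1 i.2.2.1 hx).2)
  simp only at b1 b2 b3 b4 q5 q6 uT u0
  have up : ∀ {D E A : ℝ} {g h n : ℕ}, 1 ≤ n → g ≤ h → 0 ≤ A → D ≤ E → 0 ≤ E →
      D * (n : ℝ) ^ g * A ≤ E * (n : ℝ) ^ h * A := by
    intro D E A g h n hn hg hA hD hE
    have : (1 : ℝ) ≤ n := by exact_mod_cast hn
    have h2 : (n : ℝ) ^ g ≤ (n : ℝ) ^ h := pow_le_pow_right₀ this hg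
    exact mul_le_mul_of_nonneg_right (mul_le_mul hD h2 (by positivity) hE) hA
  refine ⟨fun s m n => if h : s.Good P τ r (c + 26) m ∧ 1 ≤ m ∧ m ≤ n then u ⟨(s, m, n), h⟩ else s,
    f1 + f2 + f3 + f4 + f5 + f6, |D1| + |D2| + |D3| + |D4|, by positivity,
    fun s m n hg h1 hmn => ?_, fun l => ?_⟩
  · simp only [dif_pos (show s.Good P τ r (c + 26) m ∧ 1 ≤ m ∧ m ≤ n from ⟨hg, h1, hmn⟩)]
    set i : StepIndex P τ r c := ⟨(s, m, n), hg, h1, hmn⟩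
    have e := abs_nonneg D1
    have e2 := abs_nonneg D2
    have e3 := abs_nonneg D3
    have e4 := abs_nonneg D4
    have R0 := s.R_nonneg P χ
    refine ⟨(uT i).1, (uT i).2, u0 i, fun t j => ⟨(b1 i t j).trans ?_, (b2 i t j).trans ?_,
      (b3 i t j).trans ?_, (b4 i t j).trans ?_⟩⟩
    · exact up (h1.trans hmn) (by omega) R0 (by linarith [le_abs_self D1]) (by positivity)
    · exact up (h1.trans hmn) (by omega) R0 (by linarith [le_abs_self D2]) (by positivity)
    · exact up (h1.trans hmn) (by omega) R0 (by linarith [le_abs_self D3]) (by positivity)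
    · exact up (h1.trans hmn) (by omega) R0 (by linarith [le_abs_self D4]) (by positivity)
  · obtain ⟨B5, h5⟩ := q5 l
    obtain ⟨B6, h6⟩ := q6 l
    refine ⟨|B5| + |B6|, by positivity, fun s m n hg h1 hmn => ?_⟩
    simp only [dif_pos (show s.Good P τ r (c + 26) m ∧ 1 ≤ m ∧ m ≤ n from ⟨hg, h1, hmn⟩)]
    set i : StepIndex P τ r c := ⟨(s, m, n), hg, h1, hmn⟩
    intro hK t x hx
    have e := abs_nonneg B5
    have e2 := abs_nonneg B6
    have R0 := s.R_nonneg P χ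
    exact ⟨(h5 i hK t x hx).trans (up (h1.trans hmn) (by omega) (by positivity)
      (by linarith [le_abs_self B5]) (by positivity)), (h6 i hK t x hx).trans (up (h1.trans hmn)
      (by omega) (by positivity) (by linarith [le_abs_self B6]) (by positivity))⟩

/-- Adding modes that are constant in time changes the residuals by a controlled amount. -/
lemma exists_residual_add : ∃ C : ℝ, 0 ≤ C ∧ ∀ (s : St) (a b : ℕ → ℝ) (n : ℕ) (A : ℝ), 0 ≤ A →
    (∀ t j, n < j → s.Y t j = 0) → (∀ t j, n < j → s.V t j = 0) →
    (∀ j, n < j → a j = 0) → (∀ j, n < j → b j = 0) →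
    (∀ j : ℕ, |a j| * (1 + j : ℝ) ^ (c + 6) ≤ A) → (∀ j : ℕ, |b j| * (1 + j : ℝ) ^ (c + 6) ≤ A) →
    ∀ t, ∀ x ∈ Icc (0 : ℝ) 1, s.pt N t x ∈ P.K →
      D N (fun j => s.Y t j + a j) (fun j => s.V t j + b j) x ∈ P.K →
      |St.res1 P χ ⟨fun t j => s.Y t j + a j, fun t j => s.V t j + b j, s.Y', s.V'⟩ t x -
        s.res1 P χ t x| ≤ C * A ∧
      |St.res2 P χ ⟨fun t j => s.Y t j + a j, fun t j => s.V t j + b j, s.Y', s.V'⟩ t x -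
        s.res2 P χ t x| ≤ C * A := by
  obtain ⟨L, hL0, hL⟩ := P.exists_lipschitz
  have h0 := zero_le_one.trans H.hJ.one_le
  have hz := zero_le_one.trans Z2_ge
  refine ⟨L * (16 * Cb * Z2), by positivity, fun s a b n A hA sY sV ha hb hab hbb t x hx h1 h2 => ?_⟩
  have e : D N (fun j => s.Y t j + a j) (fun j => s.V t j + b j) x = s.pt N t x + Dt N a b x :=
    D_add (sY t) (sV t) ha hb x
  have key : ∀ y p q : ℝ, |q - p| ≤ L * ‖D N (fun j => s.Y t j + a j) (fun j => s.V t j + b j) x -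
      s.pt N t x‖ → |(y - χ t * q) - (y - χ t * p)| ≤ L * (16 * Cb * Z2) * A := by
    intro y p q h
    rw [e, add_sub_cancel_left] at h
    have := H.norm_Dt_le hA hab hbb hx
    calc |(y - χ t * q) - (y - χ t * p)| = |χ t| * |q - p| := by
          rw [← abs_mul, ← abs_neg]; congr 1; ring
      _ ≤ 1 * (L * (16 * Cb * A * Z2)) := by
          gcongr
          · exact H.χ1 t
          · exact h.trans (by gcongr)
      _ = _ := by ring
  exact ⟨key _ _ _ (hL _ h1 _ h2).1, key _ _ _ (hL _ h1 _ h2).2⟩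

end Env

/-- Square roots of the degrees used in the Newton iteration. -/
def qs (q0 : ℕ) : ℕ → ℕ
  | 0 => q0
  | m + 1 => Nat.sqrt (qs q0 m ^ 3)

lemma qs_sq_le (q0 m : ℕ) : qs q0 (m + 1) ^ 2 ≤ qs q0 m ^ 3 := Nat.sqrt_le' _

lemma two_mul_sqrt_cube {q : ℕ} (hq : 16 ≤ q) : 2 * q ≤ Nat.sqrt (q ^ 3) := by
  rw [Nat.le_sqrt']
  nlinarith [Nat.mul_le_mul_right (q ^ 2) hq]

lemma qs_ge {q0 : ℕ} (hq : 16 ≤ q0) (m : ℕ) : 2 ^ m * q0 ≤ qs q0 m := by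
  induction m with
  | zero => simp [qs]
  | succ m ih =>
    have h1 : 16 ≤ qs q0 m := by nlinarith [Nat.one_le_two_pow (n := m)]
    have h2 := two_mul_sqrt_cube h1
    rw [qs, pow_succ]
    linarith

lemma qs_ge_start {q0 : ℕ} (hq : 16 ≤ q0) (m : ℕ) : q0 ≤ qs q0 m :=
  le_trans (Nat.le_mul_of_pos_left _ (by positivity)) (qs_ge hq m)

lemma qs_le {q0 : ℕ} (hq : 16 ≤ q0) (m : ℕ) : qs q0 m ≤ qs q0 (m + 1) :=
  le_trans (by omega) (two_mul_sqrt_cube (hq.trans (qs_ge_start hq m)))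

lemma qs_cube_le {q0 : ℕ} (hq : 16 ≤ q0) (m : ℕ) : qs q0 m ^ 3 ≤ 4 * qs q0 (m + 1) ^ 2 := by
  have h1 : qs q0 m ^ 3 < (qs q0 (m + 1) + 1) ^ 2 := Nat.lt_succ_sqrt' _
  have h2 : 1 ≤ qs q0 (m + 1) := le_trans (by omega) (qs_ge_start hq (m + 1))
  nlinarith

lemma qs_ratio {q0 : ℕ} (hq : 16 ≤ q0) (m : ℕ) :
    ((qs q0 m ^ 2 : ℕ) / (qs q0 (m + 1) ^ 2 : ℕ) : ℝ) ≤ 4 / qs q0 m := by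
  have h : (qs q0 m : ℝ) ^ 3 ≤ 4 * (qs q0 (m + 1) : ℝ) ^ 2 := by exact_mod_cast qs_cube_le hq m
  have h1 : (0 : ℝ) < qs q0 m := by exact_mod_cast lt_of_lt_of_le (by omega) (qs_ge_start hq m)
  have h2 : (0 : ℝ) < qs q0 (m + 1) := by exact_mod_cast lt_of_lt_of_le (by omega) (qs_ge_start hq (m + 1))
  push_cast
  rw [div_le_div_iff₀ (by positivity) h1]
  linarith

/-- Quadratic convergence improves itself to arbitrary polynomial order. -/
lemma superconvergence {q R : ℕ → ℝ} {f κ : ℕ} (hq : ∀ m, 1 ≤ q m) (hqq : ∀ m, q (m + 1) ^ 2 ≤ q m ^ 3)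
    (hR : ∀ m, 0 ≤ R m)
    (hrec : ∀ l : ℕ, ∃ B, 0 ≤ B ∧ ∀ m, R (m + 1) ≤ B * q m ^ (3 * f) * ((1 / q m) ^ l + R m ^ 2) +
      B * (1 / q m) ^ l) {A0 : ℝ} (h0 : ∀ m, R m * q m ^ (2 * κ) ≤ A0) (hκ : 3 * f + 3 ≤ κ) (K : ℕ) :
    ∃ A, ∀ m, R m * q m ^ (2 * K) ≤ A := by
  have key : ∀ k, ∃ A, ∀ m, R m * q m ^ (2 * (κ + k)) ≤ A := by
    intro k
    induction k with
    | zero => exact ⟨A0, h0⟩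
    | succ k ih =>
      obtain ⟨A, hA⟩ := ih
      obtain ⟨B, hB0, hB⟩ := hrec (3 * f + 3 * (κ + k) + 3)
      refine ⟨max (R 0 * q 0 ^ (2 * (κ + (k + 1)))) (B * (2 + A ^ 2)), fun m => ?_⟩
      rcases m with _ | m
      · exact le_max_left _ _
      refine le_trans ?_ (le_max_right _ _)
      have q1 := hq m
      have qp : 0 < q m := zero_lt_one.trans_le q1
      have hinv : ∀ l : ℕ, q m ^ l * (1 / q m) ^ l = 1 := fun l => by
        rw [← mul_pow, mul_one_div_cancel qp.ne', one_pow]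
      have hle : q m ^ (3 * (κ + (k + 1))) * (1 / q m) ^ (3 * f + 3 * (κ + k) + 3) ≤ 1 := by
        refine le_trans ?_ (hinv (3 * f + 3 * (κ + k) + 3)).le
        exact mul_le_mul_of_nonneg_right (pow_le_pow_right₀ q1 (by omega)) (by positivity)
      have hR2 : q m ^ (3 * f + 3 * (κ + k) + 3) * R m ^ 2 ≤ A ^ 2 := by
        calc q m ^ (3 * f + 3 * (κ + k) + 3) * R m ^ 2 ≤ q m ^ (2 * (2 * (κ + k))) * R m ^ 2 :=
              mul_le_mul_of_nonneg_right (pow_le_pow_right₀ q1 (by omega)) (sq_nonneg _)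
          _ = (R m * q m ^ (2 * (κ + k))) ^ 2 := by rw [pow_mul' (q m) 2]; ring
          _ ≤ A ^ 2 := pow_le_pow_left₀ (mul_nonneg (hR m) (by positivity)) (hA m) 2
      calc R (m + 1) * q (m + 1) ^ (2 * (κ + (k + 1)))
          ≤ R (m + 1) * q m ^ (3 * (κ + (k + 1))) := by
            refine mul_le_mul_of_nonneg_left ?_ (hR _)
            rw [pow_mul, pow_mul]
            exact pow_le_pow_left₀ (sq_nonneg _) (hqq m) _
        _ ≤ (B * q m ^ (3 * f) * ((1 / q m) ^ (3 * f + 3 * (κ + k) + 3) + R m ^ 2) +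
            B * (1 / q m) ^ (3 * f + 3 * (κ + k) + 3)) * q m ^ (3 * (κ + (k + 1))) :=
            mul_le_mul_of_nonneg_right (hB m) (by positivity)
        _ = B * (q m ^ (3 * f + 3 * (κ + k) + 3) * (1 / q m) ^ (3 * f + 3 * (κ + k) + 3)) +
            B * (q m ^ (3 * f + 3 * (κ + k) + 3) * R m ^ 2) +
            B * (q m ^ (3 * (κ + (k + 1))) * (1 / q m) ^ (3 * f + 3 * (κ + k) + 3)) := by
            rw [show 3 * (κ + (k + 1)) = 3 * (κ + k) + 3 by ring, pow_add (q m) (3 * f + 3 * (κ + k)) 3,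
              pow_add (q m) (3 * f), pow_add (q m) (3 * (κ + k)) 3]
            ring
        _ ≤ B * 1 + B * A ^ 2 + B * 1 := by
            rw [hinv]
            gcongr
        _ = _ := by ring
  obtain ⟨A, hA⟩ := key K
  refine ⟨A, fun m => le_trans ?_ (hA m)⟩
  exact mul_le_mul_of_nonneg_left (pow_le_pow_right₀ (hq m) (by omega)) (hR m)

/-- Adding the first modes of the initial data to a state. -/
def St.full (a b : ℕ → ℝ) (k : ℕ) (w : St) : St :=
  ⟨fun t j => w.Y t j + if j ≤ k then a j else 0, fun t j => w.V t j + if j ≤ k then b j else 0,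
    w.Y', w.V'⟩

/-- The Newton iteration. -/
def St.iter (u : St → ℕ → ℕ → St) (a b : ℕ → ℝ) (M : ℕ → ℕ) : ℕ → St
  | 0 => ⟨fun _ _ => 0, fun _ _ => 0, fun _ _ => 0, fun _ _ => 0⟩
  | m + 1 => (St.iter u a b M m).add
      (u (St.full a b (M m) (St.iter u a b M m)) (M m) (M (m + 1)))

lemma data_tail {a : ℕ → ℝ} {v k : ℕ} {D : ℝ} (h : ∀ j : ℕ, |a j| * (1 + j : ℝ) ^ (v + k) ≤ D)
    {q : ℕ} (hq : 1 ≤ q) (n j : ℕ) :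
    |if q ^ 2 < j ∧ j ≤ n then a j else 0| * (1 + j : ℝ) ^ v ≤ D * (1 / q : ℝ) ^ (2 * k) := by
  have hD : 0 ≤ D := le_trans (by positivity) (h 0)
  have q0 : (0 : ℝ) < q := by exact_mod_cast hq
  split_ifs with hj
  · have h1 : (q : ℝ) ^ 2 ≤ 1 + j := by
      have : (q ^ 2 : ℝ) < j := by exact_mod_cast hj.1
      linarith
    have h2 : (q : ℝ) ^ (2 * k) ≤ (1 + j : ℝ) ^ k := by
      rw [pow_mul]
      exact pow_le_pow_left₀ (by positivity) h1 k
    rw [one_div, inv_pow, ← div_eq_mul_inv, le_div_iff₀ (by positivity)]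
    calc |a j| * (1 + j : ℝ) ^ v * (q : ℝ) ^ (2 * k) ≤ |a j| * (1 + j : ℝ) ^ v * (1 + j : ℝ) ^ k := by gcongr
      _ = |a j| * (1 + j : ℝ) ^ (v + k) := by rw [pow_add]; ring
      _ ≤ D := h j
  · rw [abs_zero, zero_mul]
    positivity

lemma weight_le_of_zero {g : ℕ → ℝ} {n : ℕ} {B : ℝ} (hB : ∀ j, |g j| ≤ B) (h : ∀ j, n < j → g j = 0)
    (hn : 1 ≤ n) (w j : ℕ) : |g j| * (1 + j : ℝ) ^ w ≤ B * 2 ^ w * (n : ℝ) ^ w := by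
  have hB0 : 0 ≤ B := (abs_nonneg _).trans (hB 0)
  by_cases hj : n < j
  · rw [h j hj, abs_zero, zero_mul]
    positivity
  · have h1 : (1 + j : ℝ) ≤ 2 * n := by
      have h2 : (j : ℝ) ≤ n := by exact_mod_cast not_lt.1 hj
      have h3 : (1 : ℝ) ≤ n := by exact_mod_cast hn
      linarith
    rw [mul_assoc, ← mul_pow]
    exact mul_le_mul (hB j) (pow_le_pow_left₀ (by positivity) h1 w) (by positivity) hB0

lemma Traj.add {n : ℕ} {τ : ℝ} {h h' k k' : ℝ → ℕ → ℝ} (H : Traj n τ h h') (K : Traj n τ k k') :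
    Traj n τ (fun t j => h t j + k t j) (fun t j => h' t j + k' t j) where
  zero t j hj := by rw [H.zero t j hj, K.zero t j hj, add_zero]
  zero' t j hj := by rw [H.zero' t j hj, K.zero' t j hj, add_zero]
  deriv t j := (H.deriv t j).fun_add (K.deriv t j)
  cont j := (H.cont j).add (K.cont j)
  supp t j ht := by rw [H.supp t j ht, K.supp t j ht, add_zero]

lemma Traj.mono {n m : ℕ} {τ : ℝ} {h h' : ℝ → ℕ → ℝ} (H : Traj n τ h h') (hm : n ≤ m) : Traj m τ h h' where
  zero t j hj := H.zero t j (hm.trans_lt hj)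
  zero' t j hj := H.zero' t j (hm.trans_lt hj)
  deriv := H.deriv
  cont := H.cont
  supp := H.supp

lemma Traj.const (a : ℕ → ℝ) (n : ℕ) (τ : ℝ) :
    Traj n τ (fun _ j => if j ≤ n then a j else 0) (fun _ _ => 0) where
  zero t j hj := if_neg (by omega)
  zero' _ _ _ := rfl
  deriv t j := hasDerivAt_const _ _
  cont j := continuous_const
  supp _ _ _ := rfl

/-- All four coefficient sequences of a state are bounded by `B` with weight `w`. -/
def St.Bd (w : ℕ) (B : ℝ) (s : St) : Prop := ∀ t (j : ℕ), |s.Y t j| * (1 + j : ℝ) ^ w ≤ B ∧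
  |s.V t j| * (1 + j : ℝ) ^ w ≤ B ∧ |s.Y' t j| * (1 + j : ℝ) ^ w ≤ B ∧ |s.V' t j| * (1 + j : ℝ) ^ w ≤ B

lemma abs_add_weight {x y A B w : ℝ} (hw : 0 ≤ w) (hx : |x| * w ≤ A) (hy : |y| * w ≤ B) :
    |x + y| * w ≤ A + B :=
  (mul_le_mul_of_nonneg_right (abs_add_le x y) hw).trans (by linarith)

lemma St.Bd.add {w : ℕ} {A B : ℝ} {s u : St} (hs : s.Bd w A) (hu : u.Bd w B) : (s.add u).Bd w (A + B) :=
  fun t j => by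
    have h : (0 : ℝ) ≤ (1 + j : ℝ) ^ w := by positivity
    obtain ⟨a1, a2, a3, a4⟩ := hs t j
    obtain ⟨b1, b2, b3, b4⟩ := hu t j
    exact ⟨abs_add_weight h a1 b1, abs_add_weight h a2 b2, abs_add_weight h a3 b3, abs_add_weight h a4 b4⟩

lemma St.Bd.mono {w : ℕ} {A B : ℝ} {s : St} (hs : s.Bd w A) (h : A ≤ B) : s.Bd w B := fun t j =>
  ⟨(hs t j).1.trans h, (hs t j).2.1.trans h, (hs t j).2.2.1.trans h, (hs t j).2.2.2.trans h⟩

lemma St.Bd.full {w k : ℕ} {A B : ℝ} {s : St} {a b : ℕ → ℝ} (hs : s.Bd w A)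
    (ha : ∀ j : ℕ, |a j| * (1 + j : ℝ) ^ w ≤ B) (hb : ∀ j : ℕ, |b j| * (1 + j : ℝ) ^ w ≤ B) :
    (St.full a b k s).Bd w (A + B) :=
  fun t j => by
    have h : (0 : ℝ) ≤ (1 + j : ℝ) ^ w := by positivity
    have hB : 0 ≤ B := le_trans (by positivity) (ha 0)
    obtain ⟨a1, a2, a3, a4⟩ := hs t j
    refine ⟨abs_add_weight h a1 ?_, abs_add_weight h a2 ?_, by simpa [St.full] using a3.trans (by linarith),
      by simpa [St.full] using a4.trans (by linarith)⟩
    · split_ifs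
      · exact ha j
      · simpa using hB
    · split_ifs
      · exact hb j
      · simpa using hB

/-- The two trajectories of a state have degree `n`. -/
def St.Tr (n : ℕ) (τ : ℝ) (s : St) : Prop := Traj n τ s.Y s.Y' ∧ Traj n τ s.V s.V'

lemma St.Tr.add {n : ℕ} {τ : ℝ} {s u : St} (hs : s.Tr n τ) (hu : u.Tr n τ) : (s.add u).Tr n τ :=
  ⟨hs.1.add hu.1, hs.2.add hu.2⟩

lemma St.Tr.full {n : ℕ} {τ : ℝ} {s : St} (hs : s.Tr n τ) (a b : ℕ → ℝ) : (St.full a b n s).Tr n τ := by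
  refine ⟨?_, ?_⟩
  · simpa [St.full] using hs.1.add (Traj.const a n τ)
  · simpa [St.full] using hs.2.add (Traj.const b n τ)

lemma quadratic_step {Q Q' R R' B L δ : ℝ} {f κ : ℕ} (hQ : 1 ≤ Q) (hQ' : Q' ^ 2 ≤ Q ^ 3) (hR : 0 ≤ R)
    (hR' : 0 ≤ R') (hB : 0 ≤ B) (hL : 0 ≤ L) (hδ1 : δ ≤ 1) (hκ : 3 * f + 1 ≤ κ)
    (h : R * Q ^ (2 * κ) ≤ 1) (hBQ : B * 4 ^ (3 * f + 3 * κ + 1) + B + L ≤ Q)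
    (hrec : R' ≤ B * Q ^ (3 * f) * (4 ^ (3 * f + 3 * κ + 1) * (1 / Q) ^ (3 * f + 3 * κ + 1) + R ^ 2) +
      L * (δ * (1 / Q) ^ (2 * (2 * κ)))) : R' * Q' ^ (2 * κ) ≤ 1 := by
  have Q0 : 0 < Q := zero_lt_one.trans_le hQ
  have hinv : ∀ l : ℕ, Q ^ l * (1 / Q) ^ l = 1 := fun l => by
    rw [← mul_pow, mul_one_div_cancel Q0.ne', one_pow]
  have e1 : Q * (Q ^ (3 * κ) * (1 / Q) ^ (2 * (2 * κ))) ≤ 1 := by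
    refine le_trans ?_ (hinv (2 * (2 * κ))).le
    rw [← mul_assoc, ← pow_succ']
    exact mul_le_mul_of_nonneg_right (pow_le_pow_right₀ hQ (by omega)) (by positivity)
  have e2 : Q ^ (3 * f + 3 * κ + 1) * R ^ 2 ≤ 1 := by
    calc Q ^ (3 * f + 3 * κ + 1) * R ^ 2 ≤ Q ^ (2 * (2 * κ)) * R ^ 2 :=
          mul_le_mul_of_nonneg_right (pow_le_pow_right₀ hQ (by omega)) (sq_nonneg _)
      _ = (R * Q ^ (2 * κ)) ^ 2 := by rw [pow_mul' Q 2]; ring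
      _ ≤ 1 := pow_le_one₀ (by positivity) h
  refine le_of_mul_le_mul_left ?_ Q0
  calc Q * (R' * Q' ^ (2 * κ)) ≤ Q * (R' * Q ^ (3 * κ)) := by
        rw [pow_mul, pow_mul Q]
        gcongr
    _ ≤ Q * ((B * Q ^ (3 * f) * (4 ^ (3 * f + 3 * κ + 1) * (1 / Q) ^ (3 * f + 3 * κ + 1) + R ^ 2) +
        L * (δ * (1 / Q) ^ (2 * (2 * κ)))) * Q ^ (3 * κ)) := by gcongr
    _ = B * 4 ^ (3 * f + 3 * κ + 1) * (Q ^ (3 * f + 3 * κ + 1) * (1 / Q) ^ (3 * f + 3 * κ + 1)) +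
        B * (Q ^ (3 * f + 3 * κ + 1) * R ^ 2) + L * δ * (Q * (Q ^ (3 * κ) * (1 / Q) ^ (2 * (2 * κ)))) := by
        rw [pow_succ Q, pow_add Q]
        ring
    _ ≤ B * 4 ^ (3 * f + 3 * κ + 1) * 1 + B * 1 + L * 1 * 1 := by
        rw [hinv]
        gcongr
    _ ≤ Q * 1 := by linarith

namespace Env
variable {P : Prob N} {χ : ℝ → ℝ} {τ r S Cb : ℝ} {c : ℕ} (H : Env P χ τ r S Cb c)
include H

lemma pt_mem {s : St} (hs : s.Bd (c + 26) r) (t : ℝ) {x : ℝ} (hx : x ∈ Icc (0 : ℝ) 1) :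
    s.pt N t x ∈ P.K := H.mem (fun j => (hs t j).1) (fun j => (hs t j).2.1) hx

lemma good {s : St} {n : ℕ} (hs : s.Bd (c + 26) r) (ht : s.Tr n τ) : s.Good P τ r (c + 26) n :=
  ⟨ht.1, ht.2, fun t j => (hs t j).1, fun t j => (hs t j).2.1, fun t j => (hs t j).2.2.1,
    fun t j => (hs t j).2.2.2, fun t _ hx => H.pt_mem hs t hx⟩

/-- The Newton iteration converges, faster than any power, for small initial data. -/
theorem exists_approx (hr : 0 < r)
    (hz : ∀ x ∈ Icc (0 : ℝ) 1, P.F1 ![x, 0, 0, 0, 0, 0] = 0 ∧ P.F2 ![x, 0, 0, 0, 0, 0] = 0) :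
    ∃ (w1 : ℕ) (δ : ℝ), 0 < δ ∧ ∀ a b : ℕ → ℝ, Rapid a → Rapid b →
      (∀ j : ℕ, |a j| * (1 + j : ℝ) ^ w1 ≤ δ) → (∀ j : ℕ, |b j| * (1 + j : ℝ) ^ w1 ≤ δ) →
      ∃ (q : ℕ → ℕ) (w u : ℕ → St), (∀ m, 2 ^ m ≤ q m) ∧
        w 0 = ⟨fun _ _ => 0, fun _ _ => 0, fun _ _ => 0, fun _ _ => 0⟩ ∧
        (∀ m, w (m + 1) = (w m).add (u m)) ∧ (∀ m, ∃ n, (u m).Tr n τ) ∧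
        (∀ m j, (u m).Y 0 j = 0 ∧ (u m).V 0 j = 0) ∧
        (∀ l, ∃ A, ∀ m, (u m).Bd l (A * (1 / 2) ^ m)) ∧
        ∀ m, (St.full a b (q m ^ 2) (w m)).Bd (c + 26) r ∧ ∀ t, ∀ x ∈ Icc (0 : ℝ) 1,
          |(St.full a b (q m ^ 2) (w m)).res1 P χ t x| ≤ (1 / 2) ^ m ∧
          |(St.full a b (q m ^ 2) (w m)).res2 P χ t x| ≤ (1 / 2) ^ m := by
  obtain ⟨u, f, C, hC0, hu, hq⟩ := H.exists_step
  obtain ⟨L, hL0, hL⟩ := H.exists_residual_add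
  obtain ⟨κ, hκ⟩ : ∃ κ, κ = 3 * f + 3 * (c + 26) + 3 := ⟨_, rfl⟩
  obtain ⟨B, hB0, hB⟩ := hq (3 * f + 3 * κ + 1)
  obtain ⟨q0, hq0⟩ := exists_nat_ge (max 16 (max (4 * C * 2 ^ (c + 26) / r) (B * 4 ^ (3 * f + 3 * κ + 1) + B + L)))
  have q16 : 16 ≤ q0 := by exact_mod_cast (le_max_left _ _).trans hq0
  have qC : 4 * C * 2 ^ (c + 26) / r ≤ q0 := ((le_max_left _ _).trans (le_max_right _ _)).trans hq0
  have qB : B * 4 ^ (3 * f + 3 * κ + 1) + B + L ≤ q0 := ((le_max_right _ _).trans (le_max_right _ _)).trans hq0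
  rw [div_le_iff₀ hr] at qC
  have q0p : (0 : ℝ) < q0 := by exact_mod_cast lt_of_lt_of_le (by omega) q16
  obtain ⟨δ, hδ⟩ : ∃ δ, δ = min (min 1 (r / 2)) (1 / ((L + 1) * (q0 : ℝ) ^ (2 * κ))) := ⟨_, rfl⟩
  have δ0 : 0 < δ := by rw [hδ]; positivity
  have δ1 : δ ≤ 1 := hδ ▸ (min_le_left _ _).trans (min_le_left _ _)
  have δr : δ ≤ r / 2 := hδ ▸ (min_le_left _ _).trans (min_le_right _ _)
  have δq : δ ≤ 1 / ((L + 1) * (q0 : ℝ) ^ (2 * κ)) := hδ ▸ min_le_right _ _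
  refine ⟨c + 26 + 2 * κ, δ, δ0, fun a b ra rb ha hb => ?_⟩
  have low : ∀ {a : ℕ → ℝ}, (∀ j : ℕ, |a j| * (1 + j : ℝ) ^ (c + 26 + 2 * κ) ≤ δ) →
      ∀ {k : ℕ}, k ≤ c + 26 + 2 * κ → ∀ j : ℕ, |a j| * (1 + j : ℝ) ^ k ≤ δ := fun ha k hk j => by
    refine le_trans ?_ (ha j)
    have : (0 : ℝ) ≤ j := Nat.cast_nonneg j
    exact mul_le_mul_of_nonneg_left (pow_le_pow_right₀ (by linarith) hk) (abs_nonneg _)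
  set q := qs q0 with hqdef
  have q1 : ∀ m, (1 : ℝ) ≤ q m := fun m => by
    exact_mod_cast le_trans (by omega) (qs_ge_start q16 m)
  have qp : ∀ m, (0 : ℝ) < q m := fun m => zero_lt_one.trans_le (q1 m)
  have qN : ∀ m, 1 ≤ q m := fun m => by exact_mod_cast q1 m
  have M1 : ∀ m, 1 ≤ q m ^ 2 := fun m => Nat.one_le_pow _ _ (qN m)
  have MM : ∀ m, q m ^ 2 ≤ q (m + 1) ^ 2 := fun m => Nat.pow_le_pow_left (qs_le q16 m) 2
  have Mq : ∀ m, ((q (m + 1) ^ 2 : ℕ) : ℝ) ≤ (q m : ℝ) ^ 3 := fun m => by exact_mod_cast qs_sq_le q0 m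
  have q0m : ∀ m, (2 : ℝ) ^ m * q0 ≤ q m := fun m => by exact_mod_cast qs_ge q16 m
  set w := St.iter u a b (fun m => q m ^ 2) with hw
  set s : ℕ → St := fun m => St.full a b (q m ^ 2) (w m) with hs
  set v : ℕ → St := fun m => u (s m) (q m ^ 2) (q (m + 1) ^ 2) with hv
  have wv : ∀ m, w (m + 1) = (w m).add (v m) := fun m => rfl
  have vBd : ∀ m, (s m).Bd (c + 26) r → (s m).Tr (q m ^ 2) τ → ∀ l : ℕ,
      (v m).Bd l (C * 2 ^ l * (q m : ℝ) ^ (3 * (f + l)) * (s m).R P χ) := by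
    intro m sb st l t j
    obtain ⟨t1, t2, -, b⟩ := hu (s m) _ _ (H.good sb st) (M1 m) (MM m)
    have R0 := (s m).R_nonneg P χ
    have fin : C * ((q (m + 1) ^ 2 : ℕ) : ℝ) ^ f * (s m).R P χ * 2 ^ l * ((q (m + 1) ^ 2 : ℕ) : ℝ) ^ l ≤
        C * 2 ^ l * (q m : ℝ) ^ (3 * (f + l)) * (s m).R P χ := by
      have : ((q (m + 1) ^ 2 : ℕ) : ℝ) ^ (f + l) ≤ (q m : ℝ) ^ (3 * (f + l)) := by
        rw [pow_mul]
        exact pow_le_pow_left₀ (by positivity) (Mq m) _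
      calc _ = C * 2 ^ l * ((q (m + 1) ^ 2 : ℕ) : ℝ) ^ (f + l) * (s m).R P χ := by rw [pow_add]; ring
        _ ≤ _ := by gcongr
    exact ⟨(weight_le_of_zero (fun j => (b t j).1) (t1.zero t) (M1 _) l j).trans fin,
      (weight_le_of_zero (fun j => (b t j).2.1) (t2.zero t) (M1 _) l j).trans fin,
      (weight_le_of_zero (fun j => (b t j).2.2.1) (t1.zero' t) (M1 _) l j).trans fin,
      (weight_le_of_zero (fun j => (b t j).2.2.2) (t2.zero' t) (M1 _) l j).trans fin⟩
  have step : ∀ m, (s m).Bd (c + 26) r → (s m).Tr (q m ^ 2) τ → ((s m).add (v m)).Bd (c + 26) r →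
      (s (m + 1)).Bd (c + 26) r → ∀ {l k : ℕ} {B D : ℝ}, 0 ≤ B →
      (∀ (s : St) (m n : ℕ), s.Good P τ r (c + 26) m → 1 ≤ m → m ≤ n →
        (∀ t, ∀ x ∈ Icc (0 : ℝ) 1, (s.add (u s m n)).pt N t x ∈ P.K) →
        ∀ t, ∀ x ∈ Icc (0 : ℝ) 1,
        |(s.add (u s m n)).res1 P χ t x| ≤ B * n ^ f * ((m / n : ℝ) ^ l + s.R P χ ^ 2) ∧
        |(s.add (u s m n)).res2 P χ t x| ≤ B * n ^ f * ((m / n : ℝ) ^ l + s.R P χ ^ 2)) →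
      (∀ j : ℕ, |a j| * (1 + j : ℝ) ^ (c + 6 + k) ≤ D) → (∀ j : ℕ, |b j| * (1 + j : ℝ) ^ (c + 6 + k) ≤ D) →
      (s (m + 1)).R P χ ≤ B * (q m : ℝ) ^ (3 * f) * (4 ^ l * (1 / q m : ℝ) ^ l + (s m).R P χ ^ 2) +
        L * (D * (1 / q m : ℝ) ^ (2 * k)) := by
    intro m sb st svb sb' l k B D hB0 hB haD hbD
    obtain ⟨t1, t2, -, -⟩ := hu (s m) _ _ (H.good sb st) (M1 m) (MM m)
    have e : s (m + 1) = ⟨fun t j => ((s m).add (v m)).Y t j +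
          (if q m ^ 2 < j ∧ j ≤ q (m + 1) ^ 2 then a j else 0),
        fun t j => ((s m).add (v m)).V t j + (if q m ^ 2 < j ∧ j ≤ q (m + 1) ^ 2 then b j else 0),
        ((s m).add (v m)).Y', ((s m).add (v m)).V'⟩ := by
      have := MM m
      have key : ∀ (y z : ℝ) (a : ℕ → ℝ) (j : ℕ), y + z + (if j ≤ q (m + 1) ^ 2 then a j else 0) =
          y + (if j ≤ q m ^ 2 then a j else 0) + z +
            (if q m ^ 2 < j ∧ j ≤ q (m + 1) ^ 2 then a j else 0) := by
        intro y z a j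
        split_ifs <;> first | (exfalso; omega) | ring
      simp only [hs, wv, St.full, St.add, St.mk.injEq, and_true]
      exact ⟨funext fun t => funext fun j => key _ _ _ _, funext fun t => funext fun j => key _ _ _ _⟩
    have tr : ((s m).add (v m)).Tr (q (m + 1) ^ 2) τ :=
      St.Tr.add ⟨st.1.mono (MM m), st.2.mono (MM m)⟩ ⟨t1, t2⟩
    have D0 : 0 ≤ D := le_trans (by positivity) (haD 0)
    refine St.R_le fun t x hx => ?_
    have h1 := hB (s m) _ _ (H.good sb st) (M1 m) (MM m) (fun t x hx => H.pt_mem svb t hx) t x hx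
    have h2 := hL ((s m).add (v m)) _ _ (q (m + 1) ^ 2) (D * (1 / q m : ℝ) ^ (2 * k)) (by positivity)
      tr.1.zero tr.2.zero (fun j hj => if_neg (by omega)) (fun j hj => if_neg (by omega))
      (data_tail haD (qN m) (q (m + 1) ^ 2)) (data_tail hbD (qN m) (q (m + 1) ^ 2)) t x hx
      (H.pt_mem svb t hx) (by
        have := H.pt_mem sb' t hx
        rw [e] at this
        exact this)
    rw [← e] at h2
    have h3 : B * ((q (m + 1) ^ 2 : ℕ) : ℝ) ^ f *
        ((((q m ^ 2 : ℕ) : ℝ) / ((q (m + 1) ^ 2 : ℕ) : ℝ)) ^ l + (s m).R P χ ^ 2) ≤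
        B * (q m : ℝ) ^ (3 * f) * (4 ^ l * (1 / q m : ℝ) ^ l + (s m).R P χ ^ 2) := by
      have e1 := qs_ratio q16 m
      rw [← mul_pow, mul_one_div, pow_mul]
      gcongr
      exact Mq m
    have tri : ∀ {x y A B C : ℝ}, |x - y| ≤ A → |y| ≤ B → B ≤ C → |x| ≤ C + A := fun {x y A B C} h1 h2 h3 => by
      linarith [abs_sub_abs_le_abs_sub x y]
    exact ⟨tri h2.1 h1.1 h3, tri h2.2 h1.2 h3⟩
  have inv : ∀ m, (w m).Tr (q m ^ 2) τ ∧ (w m).Bd (c + 26) (r / 2 * (1 - (1 / 2) ^ m)) ∧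
      (s m).R P χ * (q m : ℝ) ^ (2 * κ) ≤ 1 := by
    have zero0 : ∀ (A : ℝ), 0 ≤ A → (w 0).Bd (c + 26) A := fun A hA t j => by simpa [hw, St.iter] using hA
    intro m
    induction m with
    | zero =>
      have t0 : (w 0).Tr (q 0 ^ 2) τ := by
        have := Traj.const 0 (q 0 ^ 2) τ
        simp only [Pi.zero_apply, ite_self] at this
        exact ⟨this, this⟩
      refine ⟨t0, zero0 _ (by simp), ?_⟩
      have hs0 : (s 0).Bd (c + 26) r :=
        ((zero0 _ (by positivity : 0 ≤ r / 2)).full (low ha (by omega)) (low hb (by omega))).mono (by linarith)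
      have hR : (s 0).R P χ ≤ L * δ := by
        refine St.R_le fun t x hx => ?_
        have h2 := hL (w 0) (fun j => if j ≤ q 0 ^ 2 then a j else 0) (fun j => if j ≤ q 0 ^ 2 then b j else 0)
          (q 0 ^ 2) δ δ0.le t0.1.zero t0.2.zero (fun j hj => if_neg (by omega)) (fun j hj => if_neg (by omega))
          (fun j => ?_) (fun j => ?_) t x hx (H.pt_mem (zero0 r hr.le) t hx) (H.pt_mem hs0 t hx)
        · have e : (w 0).pt N t x = ![x, 0, 0, 0, 0, 0] := by
            simp [St.pt, D, hw, St.iter, jet_zero]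
          have e1 : (w 0).res1 P χ t x = 0 := by
            rw [St.res1, e, (hz x hx).1]
            simp [hw, St.iter, jet_zero]
          have e2 : (w 0).res2 P χ t x = 0 := by
            rw [St.res2, e, (hz x hx).2]
            simp [hw, St.iter, jet_zero]
          rw [e1, e2, sub_zero, sub_zero] at h2
          exact h2
        · split_ifs
          · exact low ha (by omega) j
          · simpa using δ0.le
        · split_ifs
          · exact low hb (by omega) j
          · simpa using δ0.le
      rw [le_div_iff₀ (by positivity)] at δq
      have p0 : (0 : ℝ) ≤ (q0 : ℝ) ^ (2 * κ) := by positivity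
      calc (s 0).R P χ * (q 0 : ℝ) ^ (2 * κ) ≤ L * δ * (q0 : ℝ) ^ (2 * κ) :=
            mul_le_mul_of_nonneg_right hR p0
        _ ≤ δ * ((L + 1) * (q0 : ℝ) ^ (2 * κ)) := by nlinarith [mul_nonneg δ0.le p0]
        _ ≤ 1 := δq
    | succ m ih =>
      obtain ⟨wt, wb, wR⟩ := ih
      have pm : (0 : ℝ) < (1 / 2) ^ m := by positivity
      have R0 := (s m).R_nonneg P χ
      have sb : (s m).Bd (c + 26) r :=
        (wb.full (low ha (by omega)) (low hb (by omega))).mono (by nlinarith)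
      have st : (s m).Tr (q m ^ 2) τ := wt.full a b
      have small : C * 2 ^ (c + 26) * (q m : ℝ) ^ (3 * (f + (c + 26))) * (s m).R P χ ≤
          r / 2 * (1 / 2) ^ (m + 1) := by
        have e1 : (s m).R P χ * (q m : ℝ) ^ (3 * (f + (c + 26)) + 1) ≤ 1 :=
          (mul_le_mul_of_nonneg_left (pow_le_pow_right₀ (q1 m) (by omega)) R0).trans wR
        have e2 : (1 / 2 : ℝ) ^ m * q m ≥ q0 := by
          have h1 := mul_le_mul_of_nonneg_left (q0m m) pm.le
          have h2 : (1 / 2 : ℝ) ^ m * 2 ^ m = 1 := by rw [← mul_pow]; norm_num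
          rwa [← mul_assoc, h2, one_mul] at h1
        rw [pow_succ] at e1
        have e3 : C * 2 ^ (c + 26) * ((q m : ℝ) ^ (3 * (f + (c + 26))) * (s m).R P χ) * q m ≤
            r / 2 * (1 / 2) ^ (m + 1) * q m := by
          calc _ = C * 2 ^ (c + 26) * ((s m).R P χ * ((q m : ℝ) ^ (3 * (f + (c + 26))) * q m)) := by ring
            _ ≤ C * 2 ^ (c + 26) * 1 := by gcongr
            _ ≤ r / 4 * q0 := by linarith
            _ ≤ r / 4 * ((1 / 2 : ℝ) ^ m * q m) := by gcongr
            _ = _ := by rw [pow_succ]; ring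
        rw [mul_assoc (C * 2 ^ (c + 26))]
        exact le_of_mul_le_mul_right e3 (qp m)
      have vb := (vBd m sb st (c + 26)).mono small
      have wb' : (w (m + 1)).Bd (c + 26) (r / 2 * (1 - (1 / 2) ^ (m + 1))) :=
        (wb.add vb).mono (by rw [pow_succ]; linarith)
      have pm' : (0 : ℝ) < (1 / 2) ^ (m + 1) := by positivity
      have sb' : (s (m + 1)).Bd (c + 26) r :=
        (wb'.full (low ha (by omega)) (low hb (by omega))).mono (by nlinarith)
      have svb : ((s m).add (v m)).Bd (c + 26) r :=
        ((wb.full (low ha (by omega)) (low hb (by omega))).add vb).mono (by rw [pow_succ] at *; nlinarith)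
      obtain ⟨t1, t2, -, -⟩ := hu (s m) _ _ (H.good sb st) (M1 m) (MM m)
      refine ⟨St.Tr.add ⟨wt.1.mono (MM m), wt.2.mono (MM m)⟩ ⟨t1, t2⟩, wb', ?_⟩
      have hrec := step m sb st svb sb' (k := 2 * κ) hB0 hB (low ha (by omega)) (low hb (by omega))
      refine quadratic_step (q1 m) (by exact_mod_cast qs_sq_le q0 m) R0 ((s (m + 1)).R_nonneg P χ) hB0 hL0
        δ1 (by omega) wR ?_ hrec
      exact qB.trans (by exact_mod_cast qs_ge_start q16 m)
  have sb : ∀ m, (s m).Bd (c + 26) r := fun m => by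
    have pm : (0 : ℝ) < (1 / 2) ^ m := by positivity
    exact ((inv m).2.1.full (low ha (by omega)) (low hb (by omega))).mono (by nlinarith)
  have st : ∀ m, (s m).Tr (q m ^ 2) τ := fun m => (inv m).1.full a b
  have half : ∀ {m : ℕ} {x : ℝ}, 0 ≤ x → 1 / (q m : ℝ) * x ≤ x * (1 / 2) ^ m := fun {m x} hx => by
    have h1 : (2 : ℝ) ^ m ≤ q m := by
      have : (1 : ℝ) ≤ q0 := by exact_mod_cast le_trans (by omega) q16
      nlinarith [q0m m, pow_pos (two_pos : (0 : ℝ) < 2) m]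
    rw [mul_comm, one_div, one_div, inv_pow]
    gcongr
  have su : ∀ K : ℕ, ∃ A, ∀ m, (s m).R P χ * (q m : ℝ) ^ (2 * K) ≤ A := by
    refine superconvergence (f := f) q1 (fun m => by exact_mod_cast qs_sq_le q0 m)
      (fun m => (s m).R_nonneg P χ) (fun l => ?_) (fun m => (inv m).2.2) (by omega)
    obtain ⟨B, hB0, hB⟩ := hq l
    obtain ⟨D1, hD1⟩ := ra (c + 6 + l)
    obtain ⟨D2, hD2⟩ := rb (c + 6 + l)
    have D0 : 0 ≤ D1 := le_trans (by positivity) (hD1 0)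
    refine ⟨B * 4 ^ l + B + L * max D1 D2, by positivity, fun m => ?_⟩
    have svb : ((s m).add (v m)).Bd (c + 26) r := by
      have h := (inv (m + 1)).2.1.full (k := q m ^ 2) (low ha (k := c + 26) (by omega))
        (low hb (by omega))
      have e : (s m).add (v m) = St.full a b (q m ^ 2) (w (m + 1)) := by
        simp only [hs, wv, St.full, St.add, St.mk.injEq, and_true]
        exact ⟨funext fun t => funext fun j => by ring, funext fun t => funext fun j => by ring⟩
      have pm : (0 : ℝ) < (1 / 2) ^ (m + 1) := by positivity
      rw [e]
      exact h.mono (by nlinarith)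
    have hrec := step m (sb m) (st m) svb (sb (m + 1)) (k := l) (D := max D1 D2) hB0 hB
      (fun j => (hD1 j).trans (le_max_left _ _)) (fun j => (hD2 j).trans (le_max_right _ _))
    have Q1 := q1 m
    have i0 : (0 : ℝ) ≤ 1 / q m := by positivity
    have i1 : (1 : ℝ) / q m ≤ 1 := by rw [div_le_one (qp m)]; exact Q1
    have e1 : (1 / q m : ℝ) ^ (2 * l) ≤ (1 / q m : ℝ) ^ l := pow_le_pow_of_le_one i0 i1 (by omega)
    have e2 : (1 : ℝ) ≤ 4 ^ l := one_le_pow₀ (by norm_num)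
    have DM : 0 ≤ max D1 D2 := D0.trans (le_max_left _ _)
    have p0 : (0 : ℝ) ≤ (1 / q m : ℝ) ^ l := by positivity
    calc _ ≤ _ := hrec
      _ ≤ B * (q m : ℝ) ^ (3 * f) * (4 ^ l * (1 / q m : ℝ) ^ l + 4 ^ l * (s m).R P χ ^ 2) +
          L * (max D1 D2 * (1 / q m : ℝ) ^ l) := by
          gcongr
          nlinarith [sq_nonneg ((s m).R P χ)]
      _ = B * 4 ^ l * (q m : ℝ) ^ (3 * f) * ((1 / q m : ℝ) ^ l + (s m).R P χ ^ 2) +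
          L * max D1 D2 * (1 / q m : ℝ) ^ l := by ring
      _ ≤ _ := by
          gcongr
          · linarith [mul_nonneg hL0 DM]
          · linarith [mul_nonneg hB0 (zero_le_one.trans e2)]
  refine ⟨q, w, v, fun m => ?_, rfl, wv, fun m => ?_, fun m j => ?_, fun l => ?_, fun m => ⟨sb m, fun t x hx => ?_⟩⟩
  · exact le_trans (Nat.le_mul_of_pos_right _ (by omega)) (qs_ge q16 m)
  · obtain ⟨t1, t2, -, -⟩ := hu (s m) _ _ (H.good (sb m) (st m)) (M1 m) (MM m)
    exact ⟨_, t1, t2⟩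
  · exact (hu (s m) _ _ (H.good (sb m) (st m)) (M1 m) (MM m)).2.2.1 j
  · obtain ⟨A, hA⟩ := su (3 * (f + l) + 1)
    have A0 : 0 ≤ A := le_trans (mul_nonneg ((s 0).R_nonneg P χ) (by positivity)) (hA 0)
    refine ⟨C * 2 ^ l * A, fun m => (vBd m (sb m) (st m) l).mono ?_⟩
    refine le_trans ?_ (half (m := m) (by positivity : 0 ≤ C * 2 ^ l * A))
    rw [one_div, inv_mul_eq_div, le_div_iff₀ (qp m)]
    have e1 : (s m).R P χ * (q m : ℝ) ^ (3 * (f + l) + 1) ≤ A :=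
      (mul_le_mul_of_nonneg_left (pow_le_pow_right₀ (q1 m) (by omega)) ((s m).R_nonneg P χ)).trans (hA m)
    calc _ = C * 2 ^ l * ((s m).R P χ * (q m : ℝ) ^ (3 * (f + l) + 1)) := by rw [pow_succ]; ring
      _ ≤ _ := by gcongr
  · have hR : (s m).R P χ ≤ (1 / 2) ^ m := by
      have h1 := half (m := m) zero_le_one
      rw [mul_one, one_mul] at h1
      refine le_trans ?_ h1
      rw [le_div_iff₀ (qp m)]
      refine le_trans ?_ (inv m).2.2
      exact mul_le_mul_of_nonneg_left (le_self_pow₀ (q1 m) (by omega)) ((s m).R_nonneg P χ)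
    have h2 := H.le_R (χ := χ) (H.good (sb m) (st m)) (M1 m) (t := t) hx
    exact ⟨h2.1.trans hR, h2.2.trans hR⟩

end Env

section

lemma jc_jet {C : ℝ} {c : ℕ} (hN : 4 < N) (hJ : JB N C c) {a : ℕ → ℝ} (ha : Rapid a) (k : ℕ) :
    jc N k (jet N 0 a) = a k := by
  obtain ⟨A, hA⟩ := ha (c + 2 * 0 + 2 + 1)
  have hA0 : 0 ≤ A := le_trans (by positivity) (hA 0)
  have hCp := zero_le_one.trans hJ.one_le
  have h2 : ∀ j : ℕ, |a j| * (1 + j : ℝ) ^ (c + 2 * 0 + 2) ≤ A := fun j => by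
    refine le_trans ?_ (hA j)
    have : (0 : ℝ) ≤ j := Nat.cast_nonneg j
    exact mul_le_mul_of_nonneg_left (pow_le_pow_right₀ (by linarith) (by omega)) (abs_nonneg _)
  have hcont : ContinuousOn (jet N 0 a) (Icc 0 1) :=
    (cl_jet_low (k := 0) hJ ha le_rfl (by simpa using h2)).continuousOn
  have key : ∀ n, k ≤ n → |jc N k (jet N 0 a) - a k| ≤ C * A * Z2 / (1 + n : ℝ) ^ 1 := fun n hn => by
    have e := jc_sum hN a n k
    rw [if_pos hn] at e
    rw [← e, ← jc_sub hN k hcont (Polynomial.continuous _).continuousOn]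
    refine abs_jc_le hN k (hcont.sub (Polynomial.continuous _).continuousOn) fun x hx => ?_
    have hs := summable_jet hJ (i := 0) h2 hx
    have e1 : jet N 0 a x - (∑ j ∈ Finset.range (n + 1), Polynomial.C (a j) * jp N j).eval x =
        ∑' j, a (j + (n + 1)) * (derivative^[0] (jp N (j + (n + 1)))).eval x := by
      rw [jet, ← hs.sum_add_tsum_nat_add (n + 1)]
      simp [eval_finsetSum]
    rw [e1]
    refine tail_bound (g := fun j => a j * (derivative^[0] (jp N j)).eval x) (fun j => ?_) n
    have h3 := jet_point_le hJ (i := 0) (a := a j * (1 + j : ℝ)) (A := A) (j := j) (by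
      rw [abs_mul, abs_of_nonneg (by positivity : (0 : ℝ) ≤ 1 + j), mul_assoc, ← pow_succ']
      exact hA j) hx
    have hp : (0 : ℝ) < 1 + j := by positivity
    rw [le_div_iff₀ (by positivity)]
    rw [mul_right_comm, abs_mul, abs_of_pos hp, ← div_eq_mul_inv, le_div_iff₀ (by positivity)] at h3
    calc _ = _ := by ring
      _ ≤ _ := h3
      _ = C * A := by ring
  have ht : Tendsto (fun n : ℕ => C * A * Z2 / (1 + n : ℝ) ^ 1) atTop (nhds 0) := by
    simp_rw [pow_one]
    exact tendsto_const_nhds.div_atTop (tendsto_atTop_add_const_left _ _ tendsto_natCast_atTop_atTop)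
  have := ge_of_tendsto ht (eventually_atTop.2 ⟨k, key⟩)
  exact sub_eq_zero.1 (abs_nonpos_iff.1 this)

/-- Coefficient families with uniform rapid decay. -/
def UR (a : ℝ → ℕ → ℝ) : Prop :=
  (∀ j, Continuous fun t => a t j) ∧ ∀ l, ∃ A, ∀ t (j : ℕ), |a t j| * (1 + j : ℝ) ^ l ≤ A

lemma UR.rapid {a : ℝ → ℕ → ℝ} (h : UR a) (t : ℝ) : Rapid (a t) := fun l =>
  let ⟨A, hA⟩ := h.2 l
  ⟨A, hA t⟩

section series
variable {f f' : ℕ → ℝ → ℕ → ℝ}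

lemma series_bound (hb : ∀ l, ∃ A : ℝ, ∀ m t (j : ℕ), |f m t j| * (1 + j : ℝ) ^ l ≤ A * (1 / 2) ^ m) :
    ∃ A : ℝ, ∀ m t j, ‖f m t j‖ ≤ A * (1 / 2) ^ m := by
  obtain ⟨A, hA⟩ := hb 0
  exact ⟨A, fun m t j => by simpa using hA m t j⟩

lemma summable_geom (A : ℝ) : Summable fun m : ℕ => A * (1 / 2 : ℝ) ^ m :=
  summable_geometric_two.mul_left A

lemma series_summable
    (hb : ∀ l, ∃ A : ℝ, ∀ m t (j : ℕ), |f m t j| * (1 + j : ℝ) ^ l ≤ A * (1 / 2) ^ m) (t : ℝ) (j : ℕ) :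
    Summable fun m => f m t j := by
  obtain ⟨A, hA⟩ := series_bound hb
  exact Summable.of_norm_bounded (summable_geom A) fun m => hA m t j

lemma UR.series (hc : ∀ m j, Continuous fun t => f m t j)
    (hb : ∀ l, ∃ A : ℝ, ∀ m t (j : ℕ), |f m t j| * (1 + j : ℝ) ^ l ≤ A * (1 / 2) ^ m) :
    UR (fun t j => ∑' m, f m t j) := by
  obtain ⟨A, hA⟩ := series_bound hb
  refine ⟨fun j => continuous_tsum (fun m => hc m j) (summable_geom A) fun m t => hA m t j, fun l => ?_⟩
  obtain ⟨B, hB⟩ := hb l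
  refine ⟨∑' m : ℕ, B * (1 / 2 : ℝ) ^ m, fun t j => ?_⟩
  rw [← abs_of_nonneg (by positivity : (0 : ℝ) ≤ (1 + j : ℝ) ^ l), ← abs_mul, ← tsum_mul_right,
    ← Real.norm_eq_abs]
  refine tsum_of_norm_bounded (summable_geom B).hasSum fun m => ?_
  rw [Real.norm_eq_abs, abs_mul, abs_of_nonneg (by positivity : (0 : ℝ) ≤ (1 + j : ℝ) ^ l)]
  exact hB m t j

lemma series_deriv (hd : ∀ m t j, HasDerivAt (fun t => f m t j) (f' m t j) t)
    (hb : ∀ l, ∃ A : ℝ, ∀ m t (j : ℕ), |f m t j| * (1 + j : ℝ) ^ l ≤ A * (1 / 2) ^ m)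
    (hb' : ∀ l, ∃ A : ℝ, ∀ m t (j : ℕ), |f' m t j| * (1 + j : ℝ) ^ l ≤ A * (1 / 2) ^ m) (t : ℝ) (j : ℕ) :
    HasDerivAt (fun t => ∑' m, f m t j) (∑' m, f' m t j) t := by
  obtain ⟨A, hA⟩ := series_bound hb'
  exact hasDerivAt_tsum (summable_geom A) (fun m t => hd m t j) (fun m t => hA m t j)
    (series_summable hb 0 j) t

end series

lemma UR.const_add {a : ℕ → ℝ} (ha : Rapid a) {f : ℝ → ℕ → ℝ} (h : UR f) : UR (fun t j => a j + f t j) := by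
  refine ⟨fun j => continuous_const.add (h.1 j), fun l => ?_⟩
  obtain ⟨A, hA⟩ := ha l
  obtain ⟨B, hB⟩ := h.2 l
  exact ⟨A + B, fun t j => abs_add_weight (by positivity) (hA j) (hB t j)⟩

lemma jet_tendsto {C : ℝ} {c : ℕ} (hJ : JB N C c) {a : ℕ → ℕ → ℝ} {b : ℕ → ℝ} {A : ℝ} {i : ℕ}
    (ha : ∀ m (j : ℕ), |a m j| * (1 + j : ℝ) ^ (c + 2 * i + 2) ≤ A)
    (h : ∀ j, Tendsto (fun m => a m j) atTop (nhds (b j))) {x : ℝ} (hx : x ∈ Icc (0 : ℝ) 1) :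
    Tendsto (fun m => jet N i (a m) x) atTop (nhds (jet N i b x)) := by
  refine tendsto_tsum_of_dominated_convergence (bound := fun j : ℕ => C * 4 ^ i * A * ((1 + j : ℝ) ^ 2)⁻¹)
    (summable_sq.mul_left _) (fun j => (h j).mul_const _) (Eventually.of_forall fun m j => ?_)
  exact jet_point_le hJ (ha m j) hx

lemma D_tendsto {C : ℝ} {c : ℕ} (hJ : JB N C c) {a b : ℕ → ℕ → ℝ} {a' b' : ℕ → ℝ} {A : ℝ}
    (ha : ∀ m (j : ℕ), |a m j| * (1 + j : ℝ) ^ (c + 26) ≤ A)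
    (hb : ∀ m (j : ℕ), |b m j| * (1 + j : ℝ) ^ (c + 26) ≤ A)
    (h : ∀ j, Tendsto (fun m => a m j) atTop (nhds (a' j)))
    (h' : ∀ j, Tendsto (fun m => b m j) atTop (nhds (b' j))) {x : ℝ} (hx : x ∈ Icc (0 : ℝ) 1) :
    Tendsto (fun m => D N (a m) (b m) x) atTop (nhds (D N a' b' x)) := by
  have key : ∀ {a : ℕ → ℕ → ℝ} {i : ℕ}, i ≤ 2 → (∀ m (j : ℕ), |a m j| * (1 + j : ℝ) ^ (c + 26) ≤ A) →
      ∀ m (j : ℕ), |a m j| * (1 + j : ℝ) ^ (c + 2 * i + 2) ≤ A := fun hi ha m j => by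
    refine le_trans ?_ (ha m j)
    have : (0 : ℝ) ≤ j := Nat.cast_nonneg j
    exact mul_le_mul_of_nonneg_left (pow_le_pow_right₀ (by linarith) (by omega)) (abs_nonneg _)
  refine tendsto_pi_nhds.2 (forall_fin6 ?_ ?_ ?_ ?_ ?_ ?_)
  · exact tendsto_const_nhds
  · exact jet_tendsto hJ (key (by omega) ha) h hx
  · exact jet_tendsto hJ (key (by omega) ha) h hx
  · exact jet_tendsto hJ (key (by omega) ha) h hx
  · exact jet_tendsto hJ (key (by omega) hb) h' hx
  · exact jet_tendsto hJ (key (by omega) hb) h' hx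

lemma partial_tendsto {a : ℕ → ℝ} {q : ℕ → ℕ} (hq : ∀ m, 2 ^ m ≤ q m) {f : ℕ → ℕ → ℝ} {j : ℕ}
    (hs : Summable fun m => f m j) {g : ℕ → ℝ} (hg : ∀ m, g m = ∑ i ∈ Finset.range m, f i j) :
    Tendsto (fun m => g m + if j ≤ q m ^ 2 then a j else 0) atTop (nhds (a j + ∑' m, f m j)) := by
  rw [add_comm]
  refine Tendsto.add ?_ (tendsto_const_nhds.congr' ?_)
  · rw [funext hg]
    exact hs.hasSum.tendsto_sum_nat
  · filter_upwards [eventually_ge_atTop j] with m hm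
    rw [if_pos]
    calc j ≤ m := hm
      _ ≤ 2 ^ m := Nat.lt_two_pow_self.le
      _ ≤ q m := hq m
      _ ≤ q m ^ 2 := Nat.le_self_pow two_ne_zero _

variable {P : Prob N} {χ : ℝ → ℝ} {τ r S Cb : ℝ} {c : ℕ}

/-- Solutions of the truncated system in coefficients. -/
structure Sol (P : Prob N) (χ : ℝ → ℝ) (r : ℝ) (w : ℕ) (a b : ℕ → ℝ) (Y V Y' V' : ℝ → ℕ → ℝ) : Prop where
  uY : UR Y
  uV : UR V
  uY' : UR Y'
  uV' : UR V'
  dY : ∀ t j, HasDerivAt (fun t => Y t j) (Y' t j) t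
  dV : ∀ t j, HasDerivAt (fun t => V t j) (V' t j) t
  Y0 : ∀ j, Y 0 j = a j
  V0 : ∀ j, V 0 j = b j
  bY : ∀ t (j : ℕ), |Y t j| * (1 + j : ℝ) ^ w ≤ r
  bV : ∀ t (j : ℕ), |V t j| * (1 + j : ℝ) ^ w ≤ r
  eY : ∀ t, ∀ x ∈ Icc (0 : ℝ) 1, jet N 0 (Y' t) x = χ t * P.F1 (D N (Y t) (V t) x)
  eV : ∀ t, ∀ x ∈ Icc (0 : ℝ) 1, jet N 0 (V' t) x = χ t * P.F2 (D N (Y t) (V t) x)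

theorem Env.exists_sol (H : Env P χ τ r S Cb c) (hr : 0 < r)
    (hz : ∀ x ∈ Icc (0 : ℝ) 1, P.F1 ![x, 0, 0, 0, 0, 0] = 0 ∧ P.F2 ![x, 0, 0, 0, 0, 0] = 0) :
    ∃ (w1 : ℕ) (δ : ℝ), 0 < δ ∧ ∀ a b : ℕ → ℝ, Rapid a → Rapid b →
      (∀ j : ℕ, |a j| * (1 + j : ℝ) ^ w1 ≤ δ) → (∀ j : ℕ, |b j| * (1 + j : ℝ) ^ w1 ≤ δ) →
      ∃ Y V Y' V' : ℝ → ℕ → ℝ, Sol P χ r (c + 26) a b Y V Y' V' := by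
  obtain ⟨w1, δ, hδ, h⟩ := H.exists_approx hr hz
  refine ⟨w1, δ, hδ, fun a b ha hb ha1 hb1 => ?_⟩
  obtain ⟨q, w, u, hq, hw0, hw, hT, h0, hB, hR⟩ := h a b ha hb ha1 hb1
  have b1 : ∀ l, ∃ A : ℝ, ∀ m t (j : ℕ), |(u m).Y t j| * (1 + j : ℝ) ^ l ≤ A * (1 / 2) ^ m := fun l =>
    (hB l).imp fun A hA m t j => (hA m t j).1
  have b2 : ∀ l, ∃ A : ℝ, ∀ m t (j : ℕ), |(u m).V t j| * (1 + j : ℝ) ^ l ≤ A * (1 / 2) ^ m := fun l =>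
    (hB l).imp fun A hA m t j => (hA m t j).2.1
  have b3 : ∀ l, ∃ A : ℝ, ∀ m t (j : ℕ), |(u m).Y' t j| * (1 + j : ℝ) ^ l ≤ A * (1 / 2) ^ m := fun l =>
    (hB l).imp fun A hA m t j => (hA m t j).2.2.1
  have b4 : ∀ l, ∃ A : ℝ, ∀ m t (j : ℕ), |(u m).V' t j| * (1 + j : ℝ) ^ l ≤ A * (1 / 2) ^ m := fun l =>
    (hB l).imp fun A hA m t j => (hA m t j).2.2.2
  choose n hn using hT
  have sw : ∀ m, (∀ t j, (w m).Y t j = ∑ i ∈ Finset.range m, (u i).Y t j) ∧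
      (∀ t j, (w m).V t j = ∑ i ∈ Finset.range m, (u i).V t j) ∧
      (∀ t j, (w m).Y' t j = ∑ i ∈ Finset.range m, (u i).Y' t j) ∧
      (∀ t j, (w m).V' t j = ∑ i ∈ Finset.range m, (u i).V' t j) := fun m => by
    induction m with
    | zero => simp [hw0]
    | succ m ih => simp [hw, St.add, Finset.sum_range_succ, ih]
  have tY := fun t j => partial_tendsto (a := a) hq (f := fun m => (u m).Y t) (series_summable b1 t j)
    fun m => (sw m).1 t j
  have tV := fun t j => partial_tendsto (a := b) hq (f := fun m => (u m).V t) (series_summable b2 t j)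
    fun m => (sw m).2.1 t j
  have tY' : ∀ t j, Tendsto (fun m => (w m).Y' t j) atTop (nhds (∑' m, (u m).Y' t j)) := fun t j => by
    simp_rw [(sw _).2.2.1]; exact (series_summable b3 t j).hasSum.tendsto_sum_nat
  have tV' : ∀ t j, Tendsto (fun m => (w m).V' t j) atTop (nhds (∑' m, (u m).V' t j)) := fun t j => by
    simp_rw [(sw _).2.2.2]; exact (series_summable b4 t j).hasSum.tendsto_sum_nat
  have bY : ∀ t (j : ℕ), |a j + ∑' m, (u m).Y t j| * (1 + j : ℝ) ^ (c + 26) ≤ r := fun t j =>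
    le_of_tendsto ((tY t j).abs.mul_const _) (Eventually.of_forall fun m => ((hR m).1 t j).1)
  have bV : ∀ t (j : ℕ), |b j + ∑' m, (u m).V t j| * (1 + j : ℝ) ^ (c + 26) ≤ r := fun t j =>
    le_of_tendsto ((tV t j).abs.mul_const _) (Eventually.of_forall fun m => ((hR m).1 t j).2.1)
  have low : ∀ {g : ℕ → ℝ} {j : ℕ}, |g j| * (1 + j : ℝ) ^ (c + 26) ≤ r →
      |g j| * (1 + j : ℝ) ^ (c + 2 * 0 + 2) ≤ r := fun {g j} h => by
    refine le_trans ?_ h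
    have : (0 : ℝ) ≤ j := Nat.cast_nonneg j
    exact mul_le_mul_of_nonneg_left (pow_le_pow_right₀ (by linarith) (by omega)) (abs_nonneg _)
  have tD : ∀ t, ∀ x ∈ Icc (0 : ℝ) 1, Tendsto (fun m => (St.full a b (q m ^ 2) (w m)).pt N t x) atTop
      (nhds (D N (fun j => a j + ∑' m, (u m).Y t j) (fun j => b j + ∑' m, (u m).V t j) x)) := fun t x hx =>
    D_tendsto H.hJ (fun m j => ((hR m).1 t j).1) (fun m j => ((hR m).1 t j).2.1) (tY t) (tV t) hx
  have ht0 : Tendsto (fun m : ℕ => (1 / 2 : ℝ) ^ m) atTop (nhds 0) :=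
    tendsto_pow_atTop_nhds_zero_of_lt_one (by norm_num) (by norm_num)
  have fin : ∀ {F : (Fin 6 → ℝ) → ℝ} (_ : AnalyticOnNhd ℝ F P.K) {g : ℕ → ℕ → ℝ} {g' : ℕ → ℝ} {t x : ℝ},
      x ∈ Icc (0 : ℝ) 1 → (∀ m (j : ℕ), |g m j| * (1 + j : ℝ) ^ (c + 26) ≤ r) →
      (∀ j, Tendsto (fun m => g m j) atTop (nhds (g' j))) →
      (∀ m, |jet N 0 (g m) x - χ t * F ((St.full a b (q m ^ 2) (w m)).pt N t x)| ≤ (1 / 2) ^ m) →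
      jet N 0 g' x = χ t * F (D N (fun j => a j + ∑' m, (u m).Y t j) (fun j => b j + ∑' m, (u m).V t j) x) :=
    fun {F} hF {g g' t x} hx hg hg' hres => by
      have hj := jet_tendsto H.hJ (i := 0) (fun m j => low (hg m j)) hg' hx
      have hFt := ((hF _ (H.mem (bY t) (bV t) hx)).continuousAt.tendsto.comp (tD t x hx)).const_mul (χ t)
      have := le_of_tendsto_of_tendsto' (hj.sub hFt).abs ht0 hres
      exact sub_eq_zero.1 (abs_nonpos_iff.1 this)
  refine ⟨fun t j => a j + ∑' m, (u m).Y t j, fun t j => b j + ∑' m, (u m).V t j,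
    fun t j => ∑' m, (u m).Y' t j, fun t j => ∑' m, (u m).V' t j, ?_⟩
  exact {
    uY := UR.const_add ha (UR.series (fun m j => (hn m).1.continuous j) b1)
    uV := UR.const_add hb (UR.series (fun m j => (hn m).2.continuous j) b2)
    uY' := UR.series (fun m j => (hn m).1.cont j) b3
    uV' := UR.series (fun m j => (hn m).2.cont j) b4
    dY := fun t j => (series_deriv (fun m t j => (hn m).1.deriv t j) b1 b3 t j).const_add _
    dV := fun t j => (series_deriv (fun m t j => (hn m).2.deriv t j) b2 b4 t j).const_add _
    Y0 := fun j => by simp [h0]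
    V0 := fun j => by simp [h0]
    bY := bY
    bV := bV
    eY := fun t x hx => fin P.hF1 hx (fun m j => ((hR m).1 t j).2.2.1) (tY' t) fun m => ((hR m).2 t x hx).1
    eV := fun t x hx => fin P.hF2 hx (fun m j => ((hR m).1 t j).2.2.2) (tV' t) fun m => ((hR m).2 t x hx).2 }

end

/-- The trivial scale. -/
def unitScale : Scale Unit := ⟨fun _ => 1, fun _ => 1, fun _ => True, fun _ => le_rfl, fun _ => le_rfl⟩

/-- Coefficient families with `r` rapidly decaying time derivatives. -/
def US : ℕ → (ℝ → ℕ → ℝ) → Prop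
  | 0, a => UR a
  | r + 1, a => UR a ∧ ∃ a' : ℝ → ℕ → ℝ, (∀ t j, HasDerivAt (fun t => a t j) (a' t j) t) ∧ US r a'

/-- Functions with `r` time derivatives, all smooth in space. -/
def FS : ℕ → (ℝ → ℝ → ℝ) → Prop
  | 0, G => Tame unitScale 0 (fun _ => G)
  | r + 1, G => Tame unitScale 0 (fun _ => G) ∧ ∃ G' : ℝ → ℝ → ℝ,
      (∀ t, ∀ x ∈ Icc (0 : ℝ) 1, HasDerivAt (fun t => G t x) (G' t x) t) ∧ FS r G'

lemma US.ur {r : ℕ} {a : ℝ → ℕ → ℝ} (h : US r a) : UR a := by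
  cases r with
  | zero => exact h
  | succ r => exact h.1

lemma US.contDiff {r : ℕ} {a : ℝ → ℕ → ℝ} (h : US r a) : (∀ j, ContDiff ℝ r (fun t => a t j)) ∧
    ∀ l, ∃ A, ∀ t (j : ℕ), |iteratedDeriv r (fun t => a t j) t| * (1 + j : ℝ) ^ l ≤ A := by
  induction r generalizing a with
  | zero => exact ⟨fun j => contDiff_zero.2 (h.1 j), fun l => by simpa using h.2 l⟩
  | succ r ih =>
    obtain ⟨h0, a', h1, h2⟩ := h
    have e : ∀ j, deriv (fun t => a t j) = fun t => a' t j := fun j => funext fun t => (h1 t j).deriv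
    refine ⟨fun j => ?_, fun l => ?_⟩
    · push_cast
      refine contDiff_succ_iff_deriv.2 ⟨fun t => (h1 t j).differentiableAt, by simp, ?_⟩
      rw [e]
      exact (ih h2).1 j
    · simp_rw [iteratedDeriv_succ', e]
      exact (ih h2).2 l

namespace FS
variable {r : ℕ} {F G : ℝ → ℝ → ℝ}

lemma tame (h : FS r G) : Tame unitScale 0 (fun _ => G) := by
  cases r with
  | zero => exact h
  | succ r => exact h.1

lemma of_succ (h : FS (r + 1) G) : FS r G := by
  induction r generalizing G with
  | zero => exact h.1
  | succ r ih =>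
    obtain ⟨h0, G', h1, h2⟩ := h
    exact ⟨h0, G', h1, ih h2⟩

lemma add (hF : FS r F) (hG : FS r G) : FS r (fun t x => F t x + G t x) := by
  induction r generalizing F G with
  | zero => exact Tame.add hF hG
  | succ r ih =>
    obtain ⟨h0, F', h1, h2⟩ := hF
    obtain ⟨k0, G', k1, k2⟩ := hG
    exact ⟨Tame.add h0 k0, _, fun t x hx => (h1 t x hx).add (k1 t x hx), ih h2 k2⟩

lemma mul (hF : FS r F) (hG : FS r G) : FS r (fun t x => F t x * G t x) := by
  induction r generalizing F G with
  | zero => exact Tame.mul₀ hF hG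
  | succ r ih =>
    obtain ⟨h0, F', h1, h2⟩ := id hF
    obtain ⟨k0, G', k1, k2⟩ := id hG
    exact ⟨Tame.mul₀ h0 k0, _, fun t x hx => (h1 t x hx).mul (k1 t x hx),
      (ih h2 hG.of_succ).add (ih hF.of_succ k2)⟩

lemma zero (r : ℕ) : FS r (fun _ _ => 0) := by
  induction r with
  | zero => exact Tame.zero
  | succ r ih => exact ⟨Tame.zero, _, fun _ _ _ => hasDerivAt_const _ _, ih⟩

lemma sum {κ : Type*} (s : Finset κ) {F : κ → ℝ → ℝ → ℝ} (h : ∀ a ∈ s, FS r (F a)) :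
    FS r (fun t x => ∑ a ∈ s, F a t x) := by
  classical
  induction s using Finset.induction_on with
  | empty => simpa using zero r
  | insert a s ha ih =>
    simp only [Finset.sum_insert ha]
    exact (h a (by simp)).add (ih fun b hb => h b (by simp [hb]))

lemma id (r : ℕ) : FS r (fun _ x => x) := by
  cases r with
  | zero => exact Tame.id
  | succ r => exact ⟨Tame.id, _, fun _ _ _ => hasDerivAt_const _ _, zero r⟩

lemma time {g : ℝ → ℝ} (hg : ContDiff ℝ ∞ g) (hb : ∀ k, ∃ B, ∀ t, |iteratedDeriv k g t| ≤ B) (r : ℕ) :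
    FS r (fun t _ => g t) := by
  have h0 : ∀ {g : ℝ → ℝ}, ContDiff ℝ ∞ g → (∀ k, ∃ B, ∀ t, |iteratedDeriv k g t| ≤ B) →
      Tame unitScale 0 (fun _ t _ => g t) := fun hg hb => by
    obtain ⟨B, hB⟩ := hb 0
    exact Tame.time (fun _ => hg.continuous) fun _ t => by simpa using hB t
  induction r generalizing g with
  | zero => exact h0 hg hb
  | succ r ih =>
    refine ⟨h0 hg hb, fun t _ => deriv g t, fun t x _ => ?_, ih ?_ fun k => ?_⟩
    · exact (hg.differentiable (by simp) t).hasDerivAt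
    · exact (contDiff_infty_iff_deriv.1 hg).2
    · obtain ⟨B, hB⟩ := hb (k + 1)
      exact ⟨B, fun t => by simpa [iteratedDeriv_succ'] using hB t⟩

lemma comp {m : ℕ} {Φ : (Fin m → ℝ) → ℝ} {K : Set (Fin m → ℝ)} (hK : IsCompact K)
    (hΦ : AnalyticOnNhd ℝ Φ K) {D : ℝ → ℝ → Fin m → ℝ} (hD : ∀ j, FS r (fun t x => D t x j))
    (hDK : ∀ t, ∀ x ∈ Icc (0 : ℝ) 1, D t x ∈ K) : FS r (fun t x => Φ (D t x)) := by
  induction r generalizing Φ with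
  | zero => exact Tame.comp hK hΦ hD fun _ => hDK
  | succ r ih =>
    choose D' h1 h2 using fun j => (hD j).2
    refine ⟨Tame.comp hK hΦ (fun j => (hD j).tame) fun _ => hDK,
      fun t x => ∑ j, fderiv ℝ Φ (D t x) (Pi.single j 1) * D' j t x, fun t x hx => ?_, ?_⟩
    · have hd : HasDerivAt (fun t => D t x) (fun j => D' j t x) t := hasDerivAt_pi.2 fun j => h1 j t x hx
      have := (hΦ _ (hDK t x hx)).differentiableAt.hasFDerivAt.comp_hasDerivAt t hd
      exact this.congr_deriv (fderiv_eq_sum Φ _ _)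
    · exact sum _ fun j _ => (ih (analyticOnNhd_partial hΦ _) fun j => (hD j).of_succ).mul (h2 j)

end FS

lemma US.fs {C : ℝ} {c : ℕ} (hJ : JB N C c) {r : ℕ} {a : ℝ → ℕ → ℝ} (h : US r a) (i : ℕ) :
    FS r (fun t x => jet N i (a t) x) := by
  have h0 : ∀ {a : ℝ → ℕ → ℝ}, UR a → Tame unitScale 0 (fun _ t x => jet N i (a t) x) := fun {a} ha => by
    refine ⟨fun _ => ?_, fun k _ => ?_⟩
    · obtain ⟨A, hA⟩ := ha.2 (c + 2 * i + 2)
      exact continuous_jet hJ hA ha.1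
    · obtain ⟨A, hA⟩ := ha.2 (c + 2 * i + 2 + k)
      refine ⟨C * 4 ^ i * Z2 * A, fun _ t => ?_⟩
      rw [pow_zero, mul_one]
      exact cl_jet_low hJ (ha.rapid t) le_rfl (hA t)
  induction r generalizing a with
  | zero => exact h0 h
  | succ r ih =>
    obtain ⟨u, a', h1, h2⟩ := h
    refine ⟨h0 u, _, fun t x hx => ?_, ih h2⟩
    obtain ⟨A, hA⟩ := u.2 (c + 2 * i + 2)
    obtain ⟨A', hA'⟩ := h2.ur.2 (c + 2 * i + 2)
    exact hasDerivAt_jet_time hJ hA hA' h1 hx t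

lemma FS.us {S : ℝ} (hN : 4 < N) (hS : JS S) {r : ℕ} {G : ℝ → ℝ → ℝ} (h : FS r G) :
    US r (fun t j => jc N j (G t)) := by
  have h0 : ∀ {G : ℝ → ℝ → ℝ}, Tame unitScale 0 (fun _ => G) → UR (fun t j => jc N j (G t)) := fun {G} hG => by
    refine ⟨fun j => ?_, fun l => ?_⟩
    · exact continuous_ip hN (hG.1 ()) ((Polynomial.continuous _).comp (contDiff_xc.continuous.comp continuous_snd))
    · obtain ⟨C, hC⟩ := hG.2 (l + 2) trivial
      refine ⟨4 ^ l * S * (C * unitScale.n () ^ 0 * 1 ^ 2), fun t j => ?_⟩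
      have := jc_weighted hN hS (Θ := 1) le_rfl (hC () t) j
      rwa [div_one] at this
  induction r generalizing G with
  | zero => exact h0 h
  | succ r ih =>
    obtain ⟨u, G', h1, h2⟩ := h
    exact ⟨h0 u, _, fun t j => hasDerivAt_jc_time hN (u.1 ()) (h2.tame.1 ()) h1 j t, ih h2⟩

lemma Sol.us {P : Prob N} {χ : ℝ → ℝ} {τ r S Cb : ℝ} {c : ℕ} {a b : ℕ → ℝ} {Y V Y' V' : ℝ → ℕ → ℝ}
    (h : Sol P χ r (c + 26) a b Y V Y' V') (H : Env P χ τ r S Cb c) (hχ : ContDiff ℝ ∞ χ)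
    (hb : ∀ k, ∃ B, ∀ t, |iteratedDeriv k χ t| ≤ B) (k : ℕ) : US k Y ∧ US k V := by
  induction k with
  | zero => exact ⟨h.uY, h.uV⟩
  | succ k ih =>
    have hD : ∀ i, FS k (fun t x => D N (Y t) (V t) x i) := forall_fin6 (FS.id k)
      (ih.1.fs H.hJ 0) (ih.1.fs H.hJ 1) (ih.1.fs H.hJ 2) (ih.2.fs H.hJ 0) (ih.2.fs H.hJ 1)
    have hK : ∀ t, ∀ x ∈ Icc (0 : ℝ) 1, D N (Y t) (V t) x ∈ P.K := fun t x hx => H.mem (h.bY t) (h.bV t) hx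
    have key : ∀ {F : (Fin 6 → ℝ) → ℝ} (_ : AnalyticOnNhd ℝ F P.K) {Z : ℝ → ℕ → ℝ}, UR Z →
        (∀ t, ∀ x ∈ Icc (0 : ℝ) 1, jet N 0 (Z t) x = χ t * F (D N (Y t) (V t) x)) → US k Z :=
      fun {F} hF {Z} hZ he => by
        have e : Z = fun t j => jc N j (fun x => χ t * F (D N (Y t) (V t) x)) := by
          ext t j
          rw [← jc_jet H.hN H.hJ (hZ.rapid t) j]
          exact jc_congr j (he t)
        rw [e]
        exact ((FS.time hχ hb k).mul (FS.comp P.compact hF hD hK)).us H.hN H.hS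
    exact ⟨⟨h.uY, Y', h.dY, key P.hF1 h.uY' h.eY⟩, ⟨h.uV, V', h.dV, key P.hF2 h.uV' h.eV⟩⟩

lemma bounded_iteratedDeriv {f : ℝ → ℝ} (hf : ContDiff ℝ ∞ f) (hc : HasCompactSupport f) (k : ℕ) :
    ∃ B, ∀ t, |iteratedDeriv k f t| ≤ B := by
  induction k generalizing f with
  | zero => simpa using hf.continuous.bounded_above_of_compact_support hc
  | succ k ih =>
    simp_rw [iteratedDeriv_succ']
    exact ih (contDiff_infty_iff_deriv.1 hf).2 hc.deriv

lemma bounded_smoothTransition (k : ℕ) : ∃ B, ∀ t, |iteratedDeriv k smoothTransition t| ≤ B := by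
  have h : ContDiff ℝ ∞ smoothTransition := smoothTransition.contDiff
  cases k with
  | zero => exact ⟨1, fun t => by
      rw [iteratedDeriv_zero, abs_of_nonneg (smoothTransition.nonneg t)]; exact smoothTransition.le_one t⟩
  | succ k =>
    simp_rw [iteratedDeriv_succ']
    refine bounded_iteratedDeriv (contDiff_infty_iff_deriv.1 h).2
      (HasCompactSupport.intro (isCompact_Icc (a := (0 : ℝ)) (b := 1)) fun x hx => ?_) k
    rcases lt_or_ge x 0 with h0 | h0
    · have : smoothTransition =ᶠ[nhds x] fun _ => 0 := by
        filter_upwards [gt_mem_nhds h0] with y hy using smoothTransition.zero_of_nonpos hy.le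
      rw [this.deriv_eq, deriv_const]
    · have h1 : 1 < x := lt_of_not_ge fun h1 => hx ⟨h0, h1⟩
      have : smoothTransition =ᶠ[nhds x] fun _ => 1 := by
        filter_upwards [lt_mem_nhds h1] with y hy using smoothTransition.one_of_one_le hy.le
      rw [this.deriv_eq, deriv_const]

/-- Spatial cutoff at scale `(1 + j)⁻²` around the unit interval. -/
noncomputable def cutoff (j : ℕ) (x : ℝ) : ℝ :=
  smoothTransition (2 + (1 + j : ℝ) ^ 2 * x) * smoothTransition (2 + (1 + j : ℝ) ^ 2 + (-(1 + j : ℝ) ^ 2) * x)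

/-- Eigenfunctions, cut off outside the unit interval. -/
noncomputable def ext (N : ℝ) (j : ℕ) (x : ℝ) : ℝ := cutoff j x * (jp N j).eval x

lemma cl_affine (k : ℕ) : ∃ B, ∀ a b Θ : ℝ, |b| ≤ Θ → Cl k B Θ (fun x => smoothTransition (a + b * x)) := by
  choose B hB using bounded_smoothTransition
  have h : ContDiff ℝ ∞ smoothTransition := smoothTransition.contDiff
  have hB0 : ∀ i, 0 ≤ B i := fun i => (abs_nonneg _).trans (hB i 0)
  refine ⟨∑ i ∈ Finset.range (k + 1), B i, fun a b Θ hb => ⟨by fun_prop, fun i hi θ => ?_⟩⟩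
  have e : iteratedDeriv i (fun x => smoothTransition (a + b * x)) θ =
      b ^ i * iteratedDeriv i smoothTransition (a + b * θ) := by
    have h1 := iteratedDeriv_comp_const_mul (n := i) (f := fun x => smoothTransition (a + x))
      (by fun_prop) b
    rw [congrFun h1 θ, iteratedDeriv_comp_const_add]
  rw [e, abs_mul, abs_pow, mul_comm]
  refine mul_le_mul ?_ (pow_le_pow_left₀ (abs_nonneg b) hb i) (by positivity)
    (Finset.sum_nonneg fun i _ => hB0 i)
  exact (hB i _).trans (Finset.single_le_sum (f := B) (fun i _ => hB0 i) (Finset.mem_range.2 (Nat.lt_succ_of_le hi)))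

lemma cl_cutoff (k : ℕ) : ∃ B, ∀ j : ℕ, Cl k B ((1 + j : ℝ) ^ 2) (cutoff j) := by
  obtain ⟨B, hB⟩ := cl_affine k
  refine ⟨2 ^ k * (B * B), fun j => ?_⟩
  have h : (0 : ℝ) ≤ (1 + j : ℝ) ^ 2 := by positivity
  exact (hB 2 _ _ (abs_of_nonneg h).le).mul h (hB _ _ _ (by rw [abs_neg, abs_of_nonneg h]))

lemma poly_bound_near {C : ℝ} {c : ℕ} (hJ : JB N C c) (i j : ℕ) {ξ s : ℝ} (hξ : ξ ∈ Icc (0 : ℝ) 1)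
    (hs : |s| * (1 + j : ℝ) ^ 2 ≤ 2) :
    |(derivative^[i] (jp N j)).eval (s + ξ)| ≤ C * 4 ^ i * (1 + j : ℝ) ^ (c + 2 * i) * exp 8 := by
  have hC := zero_le_one.trans hJ.one_le
  rw [← taylor_eval, eval_eq_sum_range]
  refine (Finset.abs_sum_le_sum_abs _ _).trans ?_
  refine le_trans (Finset.sum_le_sum (g := fun k => C * 4 ^ i * (1 + j : ℝ) ^ (c + 2 * i) * (8 ^ k / k.factorial))
    fun k _ => ?_) ?_
  · have h1 : (k.factorial : ℝ) * (taylor ξ (derivative^[i] (jp N j))).coeff k =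
        (derivative^[i + k] (jp N j)).eval ξ := by
      rw [taylor_coeff, add_comm, Function.iterate_add_apply]
      generalize derivative^[i] (jp N j) = q
      rw [← congrFun (factorial_smul_hasseDeriv (R := ℝ) (k := k)) q]
      simp
    have hk : (0 : ℝ) < k.factorial := by exact_mod_cast k.factorial_pos
    have h2 := hJ.bound (i + k) j ξ hξ
    rw [← h1, abs_mul, abs_of_pos hk] at h2
    rw [abs_mul, abs_pow, mul_div_assoc', le_div_iff₀ hk]
    calc _ = ((k.factorial : ℝ) * |(taylor ξ (derivative^[i] (jp N j))).coeff k|) * |s| ^ k := by ring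
      _ ≤ (C * 4 ^ (i + k) * (1 + j : ℝ) ^ (c + 2 * (i + k))) * |s| ^ k := by gcongr
      _ = C * 4 ^ i * (1 + j : ℝ) ^ (c + 2 * i) * (4 * (|s| * (1 + j : ℝ) ^ 2)) ^ k := by
        generalize (1 + j : ℝ) = M
        ring
      _ ≤ _ := by
        gcongr
        linarith
  · rw [← Finset.mul_sum]
    gcongr
    exact Real.sum_le_exp_of_nonneg (by norm_num) _

lemma iteratedDeriv_poly (p : ℝ[X]) (i : ℕ) (x : ℝ) :
    iteratedDeriv i (fun x => p.eval x) x = (derivative^[i] p).eval x := by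
  induction i generalizing p with
  | zero => simp
  | succ i ih =>
    rw [iteratedDeriv_succ', Function.iterate_succ_apply, ← ih]
    congr 1
    exact funext fun x => p.deriv

lemma contDiff_ext (j : ℕ) : ContDiff ℝ ∞ (ext N j) := by
  obtain ⟨B, hB⟩ := cl_cutoff 0
  have := (hB j).1
  have h2 : ContDiff ℝ ∞ (fun x => (jp N j).eval x) := (jp N j).contDiff_aeval ∞
  exact this.mul h2

lemma ext_bound {C : ℝ} {c : ℕ} (hJ : JB N C c) (k : ℕ) :
    ∃ A, 0 ≤ A ∧ ∀ (j : ℕ) x, |iteratedDeriv k (ext N j) x| ≤ A * (1 + j : ℝ) ^ (c + 2 * k) := by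
  obtain ⟨B, hB⟩ := cl_cutoff k
  have hC := zero_le_one.trans hJ.one_le
  have hB0 := (hB 0).nonneg
  refine ⟨∑ i ∈ Finset.range (k + 1), (k.choose i : ℝ) * B * (C * 4 ^ (k - i) * exp 8), by positivity,
    fun j x => ?_⟩
  have hM : (1 : ℝ) ≤ (1 + j : ℝ) ^ 2 := one_le_pow₀ (by simp)
  by_cases hx : -2 ≤ (1 + j : ℝ) ^ 2 * x ∧ (1 + j : ℝ) ^ 2 * (x - 1) ≤ 2
  · have h2 : ContDiff ℝ ∞ (fun x => (jp N j).eval x) := (jp N j).contDiff_aeval ∞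
    have h := norm_iteratedFDeriv_mul_le (hB j).1 h2 x (n := k) (by exact_mod_cast le_top)
    simp only [norm_iteratedFDeriv_eq_norm_iteratedDeriv, Real.norm_eq_abs, iteratedDeriv_poly] at h
    refine h.trans ?_
    rw [Finset.sum_mul]
    refine Finset.sum_le_sum fun i hi => ?_
    have hi' : i ≤ k := by simpa [Nat.lt_succ_iff] using hi
    have hp : |(derivative^[k - i] (jp N j)).eval x| ≤
        C * 4 ^ (k - i) * (1 + j : ℝ) ^ (c + 2 * (k - i)) * exp 8 := by
      rcases lt_or_ge x 0 with h0 | h0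
      · have := poly_bound_near hJ (k - i) j (ξ := 0) (s := x) (by simp) (by rw [abs_of_neg h0]; linarith)
        rwa [add_zero] at this
      · rcases le_or_gt x 1 with h1 | h1
        · have := poly_bound_near hJ (k - i) j (ξ := x) (s := 0) ⟨h0, h1⟩ (by simp)
          rwa [zero_add] at this
        · have := poly_bound_near hJ (k - i) j (ξ := 1) (s := x - 1) (by simp)
            (by rw [abs_of_pos (by linarith)]; linarith)
          rwa [sub_add_cancel] at this
    calc _ ≤ (k.choose i : ℝ) * (B * ((1 + j : ℝ) ^ 2) ^ i) *
          (C * 4 ^ (k - i) * (1 + j : ℝ) ^ (c + 2 * (k - i)) * exp 8) := by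
            gcongr
            exact (hB j).2 i hi' x
      _ = (k.choose i : ℝ) * B * (C * 4 ^ (k - i) * exp 8) * (1 + j : ℝ) ^ (2 * i + (c + 2 * (k - i))) := by
            generalize (1 + j : ℝ) = M
            generalize k - i = m
            ring
      _ = _ := by congr 2; omega
  · have h0 : ext N j =ᶠ[nhds x] fun _ => 0 := by
      rcases not_and_or.1 hx with h | h
      · have : ∀ᶠ y in nhds x, (1 + j : ℝ) ^ 2 * y < -2 :=
          (continuous_const.mul continuous_id).continuousAt.eventually (gt_mem_nhds (not_le.1 h))
        filter_upwards [this] with y hy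
        rw [ext, cutoff, smoothTransition.zero_of_nonpos (by linarith), zero_mul, zero_mul]
      · have : ∀ᶠ y in nhds x, 2 < (1 + j : ℝ) ^ 2 * (y - 1) :=
          (continuous_const.mul (continuous_id.sub continuous_const)).continuousAt.eventually
            (lt_mem_nhds (not_le.1 h))
        filter_upwards [this] with y hy
        rw [ext, cutoff, smoothTransition.zero_of_nonpos (x := 2 + (1 + j : ℝ) ^ 2 + (-(1 + j : ℝ) ^ 2) * y) (by linarith)]
        simp
    rw [h0.iteratedDeriv_eq]
    have : iteratedDeriv k (fun _ : ℝ => (0 : ℝ)) x = 0 := by simp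
    rw [this, abs_zero]
    positivity

lemma iteratedDeriv_ext (k j : ℕ) {x : ℝ} (hx : x ∈ Icc (0 : ℝ) 1) :
    iteratedDeriv k (ext N j) x = (derivative^[k] (jp N j)).eval x := by
  rw [← iteratedDeriv_poly]
  refine EventuallyEq.iteratedDeriv_eq k ?_
  have hM : (0 : ℝ) < (1 + j : ℝ) ^ 2 := by positivity
  have h1 : ∀ᶠ y in nhds x, -1 < (1 + j : ℝ) ^ 2 * y :=
    (by fun_prop : Continuous fun y : ℝ => (1 + j : ℝ) ^ 2 * y).continuousAt.eventually (lt_mem_nhds (by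
      have := mul_nonneg hM.le hx.1
      linarith))
  have h2 : ∀ᶠ y in nhds x, (1 + j : ℝ) ^ 2 * (y - 1) < 1 :=
    (by fun_prop : Continuous fun y : ℝ => (1 + j : ℝ) ^ 2 * (y - 1)).continuousAt.eventually
      (gt_mem_nhds (by
        have := mul_nonneg hM.le (sub_nonneg.2 hx.2)
        linarith))
  filter_upwards [h1, h2] with y hy1 hy2
  rw [ext, cutoff, smoothTransition.one_of_one_le (by linarith), smoothTransition.one_of_one_le (by linarith)]
  ring

lemma rapid_mul_summable {f : ℕ → ℝ} {A B : ℝ} {l : ℕ} {a : ℕ → ℝ}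
    (ha : ∀ j : ℕ, |a j| * (1 + j : ℝ) ^ (l + 2) ≤ A) (hf : ∀ j : ℕ, |f j| ≤ B * (1 + j : ℝ) ^ l) (j : ℕ) :
    |a j| * |f j| ≤ A * B * ((1 + j : ℝ) ^ 2)⁻¹ := by
  have hB : 0 ≤ B := by simpa using (abs_nonneg _).trans (hf 0)
  rw [← div_eq_mul_inv, le_div_iff₀ (by positivity)]
  calc _ ≤ |a j| * (B * (1 + j : ℝ) ^ l) * (1 + j : ℝ) ^ 2 := by gcongr; exact hf j
    _ = (|a j| * (1 + j : ℝ) ^ (l + 2)) * B := by ring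
    _ ≤ _ := by gcongr; exact ha j

lemma hasDerivAt_ext_series {C : ℝ} {c : ℕ} (hJ : JB N C c) {a : ℕ → ℝ} (ha : Rapid a) (k : ℕ) (x : ℝ) :
    HasDerivAt (fun x => ∑' j, a j * iteratedDeriv k (ext N j) x)
      (∑' j, a j * iteratedDeriv (k + 1) (ext N j) x) x := by
  have key : ∀ k, ∃ A, ∀ j x, ‖a j * iteratedDeriv k (ext N j) x‖ ≤ A * ((1 + j : ℝ) ^ 2)⁻¹ := fun k => by
    obtain ⟨B, -, hB⟩ := ext_bound hJ k
    obtain ⟨A, hA⟩ := ha (c + 2 * k + 2)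
    refine ⟨A * B, fun j x => ?_⟩
    rw [Real.norm_eq_abs, abs_mul]
    exact rapid_mul_summable hA (f := fun j => iteratedDeriv k (ext N j) x) (fun j => hB j x) j
  obtain ⟨A, hA⟩ := key (k + 1)
  obtain ⟨A0, hA0⟩ := key k
  refine hasDerivAt_tsum (summable_sq.mul_left A) (fun j x => ?_) hA
    (Summable.of_norm_bounded (summable_sq.mul_left A0) fun j => hA0 j 0) x
  have h := ((contDiff_ext (N := N) j).differentiable_iteratedDeriv k (by exact_mod_cast WithTop.coe_lt_top k)) x
  rw [iteratedDeriv_succ]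
  exact h.hasDerivAt.const_mul _

lemma norm_iteratedFDeriv_comp_clm_le {f : ℝ → ℝ} (hf : ContDiff ℝ ∞ f) (L : ℝ × ℝ →L[ℝ] ℝ) (hL : ‖L‖ ≤ 1)
    (i : ℕ) (p : ℝ × ℝ) : ‖iteratedFDeriv ℝ i (fun p => f (L p)) p‖ ≤ |iteratedDeriv i f (L p)| := by
  have := L.iteratedFDeriv_comp_right hf p (i := i) (by exact_mod_cast le_top)
  rw [show (fun p => f (L p)) = f ∘ L from rfl, this]
  refine (ContinuousMultilinearMap.norm_compContinuousLinearMap_le (iteratedFDeriv ℝ i f (L p)) fun _ => L).trans ?_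
  rw [norm_iteratedFDeriv_eq_norm_iteratedDeriv, Real.norm_eq_abs]
  exact mul_le_of_le_one_right (abs_nonneg _) (Finset.prod_le_one (fun _ _ => norm_nonneg _) fun _ _ => hL)

lemma contDiff_ext_series {C : ℝ} {c : ℕ} (hJ : JB N C c) {Y : ℝ → ℕ → ℝ} (hY : ∀ r, US r Y) :
    ContDiff ℝ ∞ (fun p : ℝ × ℝ => ∑' j, Y p.1 j * ext N j p.2) := by
  have hYc : ∀ j, ContDiff ℝ ∞ (fun t => Y t j) := fun j =>
    contDiff_infty.2 fun r => (hY r).contDiff.1 j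
  choose B hB0 hB using ext_bound hJ
  choose A hA using fun r l => (hY r).contDiff.2 l
  refine contDiff_tsum (𝕜 := ℝ) (N := (⊤ : ℕ∞)) (f := fun j (p : ℝ × ℝ) => Y p.1 j * ext N j p.2) (v := fun k j => ∑ i ∈ Finset.range (k + 1),
    (k.choose i : ℝ) * (A i (c + 2 * (k - i) + 2) * B (k - i) * ((1 + j : ℝ) ^ 2)⁻¹)) (fun j => ?_)
    (fun k _ => ?_) fun k j p _ => ?_
  · exact ((hYc j).comp contDiff_fst).mul ((contDiff_ext j).comp contDiff_snd)
  · exact summable_sum fun i _ => (summable_sq.mul_left _).mul_left _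
  · have h := norm_iteratedFDeriv_mul_le (𝕜 := ℝ) ((hYc j).comp contDiff_fst) ((contDiff_ext (N := N) j).comp contDiff_snd)
      p (n := k) (by exact_mod_cast le_top)
    refine h.trans (Finset.sum_le_sum fun i _ => ?_)
    rw [mul_assoc]
    refine mul_le_mul_of_nonneg_left ?_ (Nat.cast_nonneg _)
    have h1 := norm_iteratedFDeriv_comp_clm_le (hYc j) (ContinuousLinearMap.fst ℝ ℝ ℝ)
      (ContinuousLinearMap.norm_fst_le ℝ ℝ ℝ) i p
    have h2 := norm_iteratedFDeriv_comp_clm_le (contDiff_ext (N := N) j) (ContinuousLinearMap.snd ℝ ℝ ℝ)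
      (ContinuousLinearMap.norm_snd_le ℝ ℝ ℝ) (k - i) p
    refine (mul_le_mul h1 h2 (norm_nonneg _) (abs_nonneg _)).trans ?_
    exact rapid_mul_summable (a := fun j => iteratedDeriv i (fun t => Y t j) p.1)
      (f := fun j => iteratedDeriv (k - i) (ext N j) p.2) (fun j => hA i _ p.1 j)
      (fun j => hB (k - i) j p.2) j

lemma ext_series_eq_jet (k : ℕ) (a : ℕ → ℝ) {x : ℝ} (hx : x ∈ Icc (0 : ℝ) 1) :
    ∑' j, a j * iteratedDeriv k (ext N j) x = jet N k a x :=
  tsum_congr fun j => by rw [iteratedDeriv_ext k j hx]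

/-- Trivial jets. -/
def pt (x : ℝ) : Fin 6 → ℝ := ![x, 0, 0, 0, 0, 0]

/-- Neighborhoods of the trivial jets over the unit interval. -/
def nz : Filter (Fin 6 → ℝ) := nhdsSet (pt '' Icc 0 1)

lemma eventually_nz {Q : (Fin 6 → ℝ) → Prop} :
    (∀ᶠ p in nz, Q p) ↔ ∀ x ∈ Icc (0 : ℝ) 1, ∀ᶠ p in nhds (pt x), Q p := by
  rw [nz, eventually_nhdsSet_iff_forall, forall_mem_image]

lemma continuous_pt : Continuous pt := by
  unfold pt
  fun_prop

lemma exists_box {Q : (Fin 6 → ℝ) → Prop} (h : ∀ᶠ p in nz, Q p) :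
    ∃ ρ, 0 < ρ ∧ ∀ p : Fin 6 → ℝ, p 0 ∈ Icc (0 : ℝ) 1 → (∀ k, k ≠ 0 → |p k| ≤ ρ) → Q p := by
  obtain ⟨O, hO, hs, hQ⟩ := mem_nhdsSet_iff_exists.1 h
  obtain ⟨ρ, hρ, hsub⟩ := (isCompact_Icc.image continuous_pt).exists_cthickening_subset_open hO hs
  refine ⟨ρ, hρ, fun p h0 hp => hQ (hsub ?_)⟩
  refine Metric.mem_cthickening_of_dist_le p (pt (p 0)) ρ _ (mem_image_of_mem _ h0) ?_
  refine (dist_pi_le_iff hρ.le).2 (forall_fin6 ?_ ?_ ?_ ?_ ?_ ?_)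
  · simpa [pt] using hρ.le
  all_goals simpa [pt, Real.dist_eq] using hp _ (by decide)

lemma eventually_analyticAt_nz {Φ : (Fin 6 → ℝ) → ℝ} (h : ∀ x ∈ Icc (0 : ℝ) 1, AnalyticAt ℝ Φ (pt x)) :
    ∀ᶠ p in nz, AnalyticAt ℝ Φ p :=
  eventually_nz.2 fun x hx => (h x hx).eventually_analyticAt

/-- Partial derivatives. -/
noncomputable def pd (i : Fin 6) (Φ : (Fin 6 → ℝ) → ℝ) (p : Fin 6 → ℝ) : ℝ := fderiv ℝ Φ p (Pi.single i 1)

lemma analyticAt_pd {Φ : (Fin 6 → ℝ) → ℝ} {p : Fin 6 → ℝ} (h : AnalyticAt ℝ Φ p) (i : Fin 6) :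
    AnalyticAt ℝ (pd i Φ) p :=
  (ContinuousLinearMap.apply ℝ ℝ (Pi.single i (1 : ℝ) : Fin 6 → ℝ)).analyticAt _ |>.comp h.fderiv

lemma hasDerivAt_pd {Φ : (Fin 6 → ℝ) → ℝ} {p : Fin 6 → ℝ} (h : AnalyticAt ℝ Φ p) (i : Fin 6) :
    HasDerivAt (fun s => Φ (Function.update p i s)) (pd i Φ p) (p i) :=
  HasFDerivAt.comp_hasDerivAt (p i) (f := Function.update p i)
    (by rw [Function.update_eq_self]; exact h.differentiableAt.hasFDerivAt) (hasDerivAt_update p i (p i))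

lemma fderiv_eq_pd (Φ : (Fin 6 → ℝ) → ℝ) (p V : Fin 6 → ℝ) (h : V 0 = 0) :
    fderiv ℝ Φ p V = pd 1 Φ p * V 1 + pd 2 Φ p * V 2 + pd 3 Φ p * V 3 + pd 4 Φ p * V 4 + pd 5 Φ p * V 5 := by
  conv_lhs => rw [pi_eq_sum_univ' V]
  simp only [map_add, map_smul, Fin.sum_univ_six, h, smul_eq_mul, pd, zero_mul, zero_add, mul_comm (V _)]

lemma analyticAt_sqrt {Φ : (Fin 6 → ℝ) → ℝ} {p : Fin 6 → ℝ} (h : AnalyticAt ℝ Φ p) (hp : 0 < Φ p) :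
    AnalyticAt ℝ (fun p => √(Φ p)) p :=
  AnalyticAt.fun_comp (Real.contDiffAt_sqrt hp.ne').analyticAt h

lemma sqrt_mul_sqrt_mul_div {a b : ℝ} (ha : 0 < a) (hb : 0 < b) : √a * √b * (√a / √b) = a := by
  have := Real.sqrt_pos.2 hb
  field_simp
  exact Real.sq_sqrt ha.le

lemma Prob.exists_of_eventually {F1 F2 Jc Hc a1 b1 c1 : (Fin 6 → ℝ) → ℝ}
    (hF1 : ∀ᶠ p in nz, AnalyticAt ℝ F1 p) (hF2 : ∀ᶠ p in nz, AnalyticAt ℝ F2 p)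
    (hJ : ∀ᶠ p in nz, AnalyticAt ℝ Jc p ∧ 0 < Jc p) (hH : ∀ᶠ p in nz, AnalyticAt ℝ Hc p ∧ 0 < Hc p)
    (ha : ∀ᶠ p in nz, AnalyticAt ℝ a1 p) (hb : ∀ᶠ p in nz, AnalyticAt ℝ b1 p)
    (hc : ∀ᶠ p in nz, AnalyticAt ℝ c1 p)
    (d1 : ∀ᶠ p in nz, pd 2 F1 p = p 0 * (1 - p 0) * a1 p ∧ pd 3 F1 p = 0 ∧ pd 4 F1 p = Jc p ∧ pd 5 F1 p = 0)
    (d2 : ∀ᶠ p in nz, pd 2 F2 p = Hc p * bb N (p 0) + p 0 * (1 - p 0) * b1 p ∧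
      pd 3 F2 p = p 0 * (1 - p 0) * Hc p ∧ pd 5 F2 p = p 0 * (1 - p 0) * c1 p)
    {Q : (Fin 6 → ℝ) → Prop} (hQ : ∀ᶠ p in nz, Q p) :
    ∃ (P : Prob N) (ρ : ℝ), 0 < ρ ∧ P.F1 = F1 ∧ P.F2 = F2 ∧
      ∀ p : Fin 6 → ℝ, p 0 ∈ Icc (0 : ℝ) 1 → (∀ k, k ≠ 0 → |p k| ≤ ρ) → p ∈ P.K ∧ Q p := by
  obtain ⟨ρ, hρ, h⟩ := exists_box (hF1.and (hF2.and (hJ.and (hH.and (ha.and (hb.and (hc.and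
    (d1.and (d2.and hQ)))))))))
  set K : Set (Fin 6 → ℝ) := Icc (fun k => if k = 0 then 0 else -ρ) (fun k => if k = 0 then 1 else ρ)
  have hK : ∀ p : Fin 6 → ℝ, p ∈ K ↔ p 0 ∈ Icc (0 : ℝ) 1 ∧ ∀ k, k ≠ 0 → |p k| ≤ ρ := fun p => by
    refine ⟨fun hp => ⟨⟨by simpa using hp.1 0, by simpa using hp.2 0⟩, fun k hk => ?_⟩, fun hp =>
      ⟨fun k => ?_, fun k => ?_⟩⟩
    · exact abs_le.2 ⟨by simpa [hk] using hp.1 k, by simpa [hk] using hp.2 k⟩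
    · by_cases hk : k = 0
      · subst hk; simpa using hp.1.1
      · simpa [hk] using (abs_le.1 (hp.2 k hk)).1
    · by_cases hk : k = 0
      · subst hk; simpa using hp.1.2
      · simpa [hk] using (abs_le.1 (hp.2 k hk)).2
  have hh := fun p (hp : p ∈ K) => h p ((hK p).1 hp).1 ((hK p).1 hp).2
  choose g1 g2 g3 g4 g5 g6 g7 g8 g9 g10 using hh
  have s1 := fun p hp => analyticAt_sqrt (g3 p hp).1 (g3 p hp).2
  have s2 := fun p hp => analyticAt_sqrt (g4 p hp).1 (g4 p hp).2
  have p1 := fun p hp => Real.sqrt_pos.2 (g3 p hp).2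
  have p2 := fun p hp => Real.sqrt_pos.2 (g4 p hp).2
  refine ⟨{
    K := K
    F1 := F1
    F2 := F2
    al := fun p => √(Jc p) * √(Hc p)
    be := fun p => √(Hc p) / √(Jc p)
    ga := fun p => √(Jc p) / √(Hc p)
    a0 := pd 1 F1
    a1 := a1
    b0 := pd 1 F2
    b1 := b1
    c0 := pd 4 F2
    c1 := c1
    compact := isCompact_Icc
    convex := convex_Icc _ _
    hF1 := g1
    hF2 := g2
    hal := fun p hp => (s1 p hp).mul (s2 p hp)
    hbe := fun p hp => (s2 p hp).div (s1 p hp) (p1 p hp).ne'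
    hga := fun p hp => (s1 p hp).div (s2 p hp) (p2 p hp).ne'
    ha0 := fun p hp => analyticAt_pd (g1 p hp) 1
    ha1 := g5
    hb0 := fun p hp => analyticAt_pd (g2 p hp) 1
    hb1 := g6
    hc0 := fun p hp => analyticAt_pd (g2 p hp) 4
    hc1 := g7
    hbg := fun p hp => by
      have := p1 p hp
      have := p2 p hp
      field_simp
    d1 := fun p hp V hV => by
      obtain ⟨e2, e3, e4, e5⟩ := g8 p hp
      rw [fderiv_eq_pd F1 p V hV, e2, e3, e4, e5, sqrt_mul_sqrt_mul_div (g3 p hp).2 (g4 p hp).2]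
      ring
    d2 := fun p hp V hV => by
      obtain ⟨e2, e3, e5⟩ := g9 p hp
      rw [fderiv_eq_pd F2 p V hV, e2, e3, e5, mul_comm √(Jc p),
        sqrt_mul_sqrt_mul_div (g4 p hp).2 (g3 p hp).2, lamV]
      ring }, ρ, hρ, rfl, rfl, fun p h0 hp =>
        ⟨(hK p).2 ⟨h0, hp⟩, g10 p ((hK p).2 ⟨h0, hp⟩)⟩⟩

lemma _root_.ContDiff.analyticAt_real {E F : Type*} [NormedAddCommGroup E] [NormedSpace ℝ E] [NormedAddCommGroup F]
    [NormedSpace ℝ F] {f : E → F} (h : ContDiff ℝ ω f) (x : E) : AnalyticAt ℝ f x :=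
  h.contDiffAt.analyticAt

lemma analyticAt_coord (i : Fin 6) (p : Fin 6 → ℝ) : AnalyticAt ℝ (fun p : Fin 6 → ℝ => p i) p :=
  (contDiff_apply ℝ ℝ i).analyticAt_real p

lemma exists_div {G : (Fin 6 → ℝ) → ℝ} (hG : ∀ x ∈ Icc (0 : ℝ) 1, AnalyticAt ℝ G (pt x))
    {Ω : (Fin 6 → ℝ) → ℝ} (hΩ : AnalyticAt ℝ Ω (pt 1)) (h : ∀ᶠ p in nhds (pt 1), G p = (1 - p 0) * Ω p) :
    ∃ Q, (∀ x ∈ Icc (0 : ℝ) 1, AnalyticAt ℝ Q (pt x)) ∧ ∀ᶠ p in nz, G p = (1 - p 0) * Q p := by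
  classical
  have key : ∀ x ∈ Icc (0 : ℝ) 1, x ≠ 1 → ∀ᶠ p : Fin 6 → ℝ in nhds (pt x), p 0 ≠ 1 := fun x _ h1 =>
    (continuous_apply (0 : Fin 6)).continuousAt.eventually_ne (by simpa [pt] using h1)
  refine ⟨fun p => if p 0 = 1 then Ω p else G p / (1 - p 0), fun x hx => ?_,
    eventually_nz.2 fun x hx => ?_⟩
  · by_cases h1 : x = 1
    · subst h1
      refine hΩ.congr ?_
      filter_upwards [h] with p hp
      split_ifs with h0
      · rfl
      · rw [hp, mul_div_cancel_left₀ _ (sub_ne_zero.2 (Ne.symm h0))]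
    · refine ((hG x hx).fun_div (g := fun p => 1 - p 0) (ContDiff.analyticAt_real (by fun_prop) _) ?_).congr ?_
      · simpa [pt, sub_eq_zero] using Ne.symm h1
      · filter_upwards [key x hx h1] with p hp
        rw [if_neg hp]
  · by_cases h1 : x = 1
    · subst h1
      filter_upwards [h] with p hp
      split_ifs with h0
      · exact hp
      · rw [mul_div_cancel₀ _ (sub_ne_zero.2 (Ne.symm h0))]
    · filter_upwards [key x hx h1] with p hp
      rw [if_neg hp, mul_div_cancel₀ _ (sub_ne_zero.2 (Ne.symm hp))]

/-- Passing from derivatives to derivatives with the weight `x`. -/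
def wm (p : Fin 6 → ℝ) : Fin 6 → ℝ := ![p 0, p 1, p 0 * p 2, p 3, p 4, p 0 * p 5]

lemma wm_pt (x : ℝ) : wm (pt x) = pt x := by
  simp [wm, pt]

lemma analyticAt_wm (p : Fin 6 → ℝ) : AnalyticAt ℝ wm p :=
  analyticAt_pi_iff.2 (forall_fin6 (analyticAt_coord 0 p) (analyticAt_coord 1 p)
    ((analyticAt_coord 0 p).fun_mul (analyticAt_coord 2 p)) (analyticAt_coord 3 p) (analyticAt_coord 4 p)
    ((analyticAt_coord 0 p).fun_mul (analyticAt_coord 5 p)))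

lemma analyticAt_comp_wm {Φ : (Fin 6 → ℝ) → ℝ} {x : ℝ} (h : AnalyticAt ℝ Φ (pt x)) :
    AnalyticAt ℝ (fun p => Φ (wm p)) (pt x) :=
  AnalyticAt.fun_comp (by rwa [wm_pt]) (analyticAt_wm _)

lemma eventually_wm {Φ : (Fin 6 → ℝ) → ℝ} (h : ∀ x ∈ Icc (0 : ℝ) 1, AnalyticAt ℝ Φ (pt x)) :
    ∀ᶠ p in nz, AnalyticAt ℝ Φ (wm p) :=
  eventually_nz.2 fun x hx => (analyticAt_wm (pt x)).continuousAt.eventually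
    (by rw [wm_pt]; exact (h x hx).eventually_analyticAt)

lemma pd_eq {Φ : (Fin 6 → ℝ) → ℝ} {p : Fin 6 → ℝ} (h : AnalyticAt ℝ Φ p) {i : Fin 6} {d : ℝ}
    (hd : HasDerivAt (fun s => Φ (Function.update p i s)) d (p i)) : pd i Φ p = d :=
  (hasDerivAt_pd h i).unique hd

lemma pd_eq_zero {Φ : (Fin 6 → ℝ) → ℝ} {p : Fin 6 → ℝ} (h : AnalyticAt ℝ Φ p) {i : Fin 6}
    (hd : ∀ s, Φ (Function.update p i s) = Φ p) : pd i Φ p = 0 :=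
  pd_eq h (by simp_rw [hd]; exact hasDerivAt_const _ _)

lemma pd_comp_wm {Φ : (Fin 6 → ℝ) → ℝ} {p : Fin 6 → ℝ} (h : AnalyticAt ℝ Φ (wm p)) (i : Fin 6) {c : ℝ}
    (hc : ∀ s, wm (Function.update p i s) = Function.update (wm p) i (c * s)) :
    pd i (fun p => Φ (wm p)) p = c * pd i Φ (wm p) := by
  have hp : wm p i = c * p i := by
    have := congrFun (hc (p i)) i
    rwa [Function.update_eq_self, Function.update_self] at this
  refine pd_eq (AnalyticAt.fun_comp h (analyticAt_wm p)) ?_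
  simp_rw [hc]
  have h1 := hasDerivAt_pd h i
  rw [hp] at h1
  have h2 := h1.comp (p i) ((hasDerivAt_id (p i)).const_mul c)
  exact h2.congr_deriv (by ring)

lemma wm_update2 (p : Fin 6 → ℝ) (s : ℝ) :
    wm (Function.update p 2 s) = Function.update (wm p) 2 (p 0 * s) :=
  funext (forall_fin6 (by simp [wm]) (by simp [wm]) (by simp [wm]) (by simp [wm]) (by simp [wm]) (by simp [wm]))

lemma wm_update5 (p : Fin 6 → ℝ) (s : ℝ) :
    wm (Function.update p 5 s) = Function.update (wm p) 5 (p 0 * s) :=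
  funext (forall_fin6 (by simp [wm]) (by simp [wm]) (by simp [wm]) (by simp [wm]) (by simp [wm]) (by simp [wm]))

lemma pd_mul {Φ Ψ : (Fin 6 → ℝ) → ℝ} {p : Fin 6 → ℝ} (h : AnalyticAt ℝ Φ p) (h' : AnalyticAt ℝ Ψ p)
    (i : Fin 6) : pd i (fun p => Φ p * Ψ p) p = pd i Φ p * Ψ p + Φ p * pd i Ψ p := by
  refine pd_eq (h.fun_mul h') ?_
  have := (hasDerivAt_pd h i).fun_mul (hasDerivAt_pd h' i)
  simpa only [Function.update_eq_self] using this

theorem exists_prob (ℓ₁ L₀ : ℝ → ℝ)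
    (hℓ₁ : AnalyticOnNhd ℝ ℓ₁ (Icc 0 1)) (hL₀ : AnalyticOnNhd ℝ L₀ (Icc 0 1))
    (U : Set ℝ) (hUopen : IsOpen U) (hU0 : (0:ℝ) ∈ U)
    (J : ℝ → ℝ → ℝ → ℝ) (H₁ : ℝ → ℝ → ℝ → ℝ → ℝ) (H₂ : ℝ → ℝ → ℝ → ℝ → ℝ → ℝ)
    (hJ : AnalyticOnNhd ℝ (fun p : ℝ × ℝ × ℝ => J p.1 p.2.1 p.2.2)
      (Icc 0 1 ×ˢ closure U ×ˢ closure U))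
    (hH₁ : AnalyticOnNhd ℝ (fun p : ℝ × ℝ × ℝ × ℝ => H₁ p.1 p.2.1 p.2.2.1 p.2.2.2)
      (Icc 0 1 ×ˢ closure U ×ˢ closure U ×ˢ closure U))
    (hH₂ : AnalyticOnNhd ℝ
      (fun p : ℝ × ℝ × ℝ × ℝ × ℝ => H₂ p.1 p.2.1 p.2.2.1 p.2.2.2.1 p.2.2.2.2)
      (Icc 0 1 ×ˢ closure U ×ˢ closure U ×ˢ closure U ×ˢ closure U))
    (hJpos : ∀ x ∈ Icc (0:ℝ) 1, 0 < J x 0 0) (hHpos : ∀ x ∈ Icc (0:ℝ) 1, 0 < H₁ x 0 0 0)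
    (hB3J : ∃ Ω : ℝ × ℝ × ℝ → ℝ, AnalyticAt ℝ Ω ((1,0,0) : ℝ × ℝ × ℝ) ∧
      ∀ᶠ p : ℝ × ℝ × ℝ in nhds ((1,0,0) : ℝ × ℝ × ℝ),
        deriv (fun z => J p.1 p.2.1 z) p.2.2 = (1 - p.1) * Ω p)
    (hB3H : ∃ Ω : ℝ × ℝ × ℝ × ℝ × ℝ × ℝ → ℝ,
      AnalyticAt ℝ Ω ((1,0,0,0,0,0) : ℝ × ℝ × ℝ × ℝ × ℝ × ℝ) ∧
      ∀ᶠ p : ℝ × ℝ × ℝ × ℝ × ℝ × ℝ in nhds ((1,0,0,0,0,0) : ℝ × ℝ × ℝ × ℝ × ℝ × ℝ),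
        deriv (fun z => H₁ p.1 p.2.1 z p.2.2.2.2.1) (p.1 * p.2.2.1)
            * Lfun N ℓ₁ L₀ p.1 p.2.1 p.2.2.1 p.2.2.2.1
          + deriv (fun z => H₂ p.1 p.2.1 z p.2.2.2.2.1 (p.1 * p.2.2.2.2.2)) (p.1 * p.2.2.1)
          = (1 - p.1) * Ω p)
    (hB3W : ∃ Ω : ℝ × ℝ × ℝ × ℝ × ℝ → ℝ,
      AnalyticAt ℝ Ω ((1,0,0,0,0) : ℝ × ℝ × ℝ × ℝ × ℝ) ∧
      ∀ᶠ p : ℝ × ℝ × ℝ × ℝ × ℝ in nhds ((1,0,0,0,0) : ℝ × ℝ × ℝ × ℝ × ℝ),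
        deriv (fun w => H₂ p.1 p.2.1 p.2.2.1 p.2.2.2.1 w) p.2.2.2.2 = (1 - p.1) * Ω p) :
    ∃ (P : Prob N) (ρ : ℝ), 0 < ρ ∧
      (∀ p, P.F1 p = J (p 0) (p 1) (p 0 * p 2) * p 4) ∧
      (∀ p, P.F2 p = -(H₁ (p 0) (p 1) (p 0 * p 2) (p 4) * Lfun N ℓ₁ L₀ (p 0) (p 1) (p 2) (p 3)) -
        H₂ (p 0) (p 1) (p 0 * p 2) (p 4) (p 0 * p 5)) ∧
      ∀ p : Fin 6 → ℝ, p 0 ∈ Icc (0 : ℝ) 1 → (∀ k, k ≠ 0 → |p k| ≤ ρ) →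
        p ∈ P.K ∧ p 1 ∈ U ∧ p 0 * p 2 ∈ U ∧ p 4 ∈ U ∧ p 0 * p 5 ∈ U := by
  have hUc : (0 : ℝ) ∈ closure U := subset_closure hU0
  set Jt : (Fin 6 → ℝ) → ℝ := fun p => J (p 0) (p 1) (p 2) with hJt
  set At : (Fin 6 → ℝ) → ℝ := fun p => H₁ (p 0) (p 1) (p 2) (p 4) with hAt
  set Bt : (Fin 6 → ℝ) → ℝ := fun p => H₂ (p 0) (p 1) (p 2) (p 4) (p 5) with hBt
  set Lt : (Fin 6 → ℝ) → ℝ := fun p => Lfun N ℓ₁ L₀ (p 0) (p 1) (p 2) (p 3) with hLt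
  have aJ : ∀ x ∈ Icc (0 : ℝ) 1, AnalyticAt ℝ Jt (pt x) := fun x hx =>
    AnalyticAt.fun_comp (f := fun p : Fin 6 → ℝ => (p 0, p 1, p 2)) (hJ _ ⟨hx, hUc, hUc⟩) (ContDiff.analyticAt_real (by fun_prop) _)
  have aA : ∀ x ∈ Icc (0 : ℝ) 1, AnalyticAt ℝ At (pt x) := fun x hx =>
    AnalyticAt.fun_comp (f := fun p : Fin 6 → ℝ => (p 0, p 1, p 2, p 4)) (hH₁ _ ⟨hx, hUc, hUc, hUc⟩)
      (ContDiff.analyticAt_real (by fun_prop) _)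
  have aB : ∀ x ∈ Icc (0 : ℝ) 1, AnalyticAt ℝ Bt (pt x) := fun x hx =>
    AnalyticAt.fun_comp (f := fun p : Fin 6 → ℝ => (p 0, p 1, p 2, p 4, p 5))
      (hH₂ _ ⟨hx, hUc, hUc, hUc, hUc⟩) (ContDiff.analyticAt_real (by fun_prop) _)
  have al : ∀ x ∈ Icc (0 : ℝ) 1, AnalyticAt ℝ (fun p : Fin 6 → ℝ => ℓ₁ (p 0)) (pt x) := fun x hx =>
    AnalyticAt.fun_comp (f := fun p : Fin 6 → ℝ => p 0) (hℓ₁ x hx) (analyticAt_coord 0 _)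
  have aL : ∀ x ∈ Icc (0 : ℝ) 1, AnalyticAt ℝ Lt (pt x) := fun x hx => by
    have h2 : AnalyticAt ℝ (fun p : Fin 6 → ℝ => L₀ (p 0)) (pt x) :=
      AnalyticAt.fun_comp (f := fun p : Fin 6 → ℝ => p 0) (hL₀ x hx) (analyticAt_coord 0 _)
    exact (AnalyticAt.fun_add (ContDiff.analyticAt_real (by fun_prop) _) (((al x hx).fun_mul
      (ContDiff.analyticAt_real (by fun_prop) _)).fun_mul (analyticAt_coord 2 _))).fun_add
      (h2.fun_mul (analyticAt_coord 1 _))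
  have ap : ∀ (i : Fin 6) x, AnalyticAt ℝ (fun p : Fin 6 → ℝ => p i) (pt x) := fun i x => analyticAt_coord i _
  set F1 : (Fin 6 → ℝ) → ℝ := fun p => Jt (wm p) * p 4 with hF1
  set F2 : (Fin 6 → ℝ) → ℝ := fun p => -(At (wm p) * Lt p) - Bt (wm p) with hF2
  have m1 : (1 : ℝ) ∈ Icc (0 : ℝ) 1 := by simp
  have hc1 : ∀ {E : Type} [TopologicalSpace E] {f : (Fin 6 → ℝ) → E} {e : E} {R : E → Prop}, ContinuousAt f (pt 1) →
      f (pt 1) = e → (∀ᶠ q in nhds e, R q) → ∀ᶠ p in nhds (pt 1), R (f p) := fun hf he hR => by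
    subst he
    exact hf.eventually hR
  have near := fun {Φ : (Fin 6 → ℝ) → ℝ} (h : ∀ x ∈ Icc (0 : ℝ) 1, AnalyticAt ℝ Φ (pt x)) =>
    eventually_nz.1 (eventually_wm h) 1 m1
  obtain ⟨a1, ha1, da1⟩ : ∃ Q, (∀ x ∈ Icc (0 : ℝ) 1, AnalyticAt ℝ Q (pt x)) ∧
      ∀ᶠ p in nz, pd 2 Jt (wm p) * p 4 = (1 - p 0) * Q p := by
    obtain ⟨Ω, hΩ, e⟩ := hB3J
    refine exists_div (Ω := fun p => Ω (p 0, p 1, p 0 * p 2) * p 4)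
      (fun x hx => (analyticAt_comp_wm (analyticAt_pd (aJ x hx) 2)).mul (ap 4 x)) (AnalyticAt.fun_mul
      (AnalyticAt.fun_comp (f := fun p : Fin 6 → ℝ => (p 0, p 1, p 0 * p 2))
        (by simpa [pt] using hΩ) (ContDiff.analyticAt_real (by fun_prop) _)) (ap 4 1)) ?_
    filter_upwards [near aJ, hc1 (f := fun p : Fin 6 → ℝ => (p 0, p 1, p 0 * p 2)) (by fun_prop)
      (by simp [pt]) e] with p h1 h2
    have := (hasDerivAt_pd h1 2).deriv
    simp only [hJt, wm, Function.update_self, ne_eq, Fin.reduceEq, not_false_eq_true,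
      Function.update_of_ne, Matrix.cons_val] at this h2
    simp only [hJt, wm]
    rw [← this, h2, mul_assoc]
  obtain ⟨b1, hb1, db1⟩ : ∃ Q, (∀ x ∈ Icc (0 : ℝ) 1, AnalyticAt ℝ Q (pt x)) ∧
      ∀ᶠ p in nz, -(pd 2 At (wm p) * Lt p + pd 2 Bt (wm p)) = (1 - p 0) * Q p := by
    obtain ⟨Ω, hΩ, e⟩ := hB3H
    refine exists_div (Ω := fun p => -Ω (p 0, p 1, p 2, p 3, p 4, p 5))
      (fun x hx => (((analyticAt_comp_wm (analyticAt_pd (aA x hx) 2)).fun_mul (aL x hx)).fun_add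
        (analyticAt_comp_wm (analyticAt_pd (aB x hx) 2))).fun_neg) (AnalyticAt.fun_neg
      (AnalyticAt.fun_comp (f := fun p : Fin 6 → ℝ => (p 0, p 1, p 2, p 3, p 4, p 5))
        (by simpa [pt] using hΩ) (ContDiff.analyticAt_real (by fun_prop) _))) ?_
    filter_upwards [near aA, near aB, hc1 (f := fun p : Fin 6 → ℝ => (p 0, p 1, p 2, p 3, p 4, p 5))
      (by fun_prop) (by simp [pt]) e] with p h1 h1' h2
    have := (hasDerivAt_pd h1 2).deriv
    have e' := (hasDerivAt_pd h1' 2).deriv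
    simp only [hAt, hBt, wm, Function.update_self, ne_eq, Fin.reduceEq, not_false_eq_true,
      Function.update_of_ne, Matrix.cons_val] at this e' h2
    simp only [hAt, hBt, hLt, wm]
    rw [← this, ← e', h2, mul_neg]
  obtain ⟨c1, hc1, dc1⟩ : ∃ Q, (∀ x ∈ Icc (0 : ℝ) 1, AnalyticAt ℝ Q (pt x)) ∧
      ∀ᶠ p in nz, -pd 5 Bt (wm p) = (1 - p 0) * Q p := by
    obtain ⟨Ω, hΩ, e⟩ := hB3W
    refine exists_div (Ω := fun p => -Ω (p 0, p 1, p 0 * p 2, p 4, p 0 * p 5))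
      (fun x hx => (analyticAt_comp_wm (analyticAt_pd (aB x hx) 5)).fun_neg) (AnalyticAt.fun_neg
      (AnalyticAt.fun_comp (f := fun p : Fin 6 → ℝ => (p 0, p 1, p 0 * p 2, p 4, p 0 * p 5))
        (by simpa [pt] using hΩ) (ContDiff.analyticAt_real (by fun_prop) _))) ?_
    filter_upwards [near aB, hc1 (f := fun p : Fin 6 → ℝ => (p 0, p 1, p 0 * p 2, p 4, p 0 * p 5))
      (by fun_prop) (by simp [pt]) e] with p h1 h2
    have := (hasDerivAt_pd h1 5).deriv
    simp only [hBt, wm, Function.update_self, ne_eq, Fin.reduceEq, not_false_eq_true,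
      Function.update_of_ne, Matrix.cons_val] at this h2
    simp only [hBt, wm]
    rw [← this, h2, mul_neg]
  have pos : ∀ {Φ : (Fin 6 → ℝ) → ℝ}, (∀ x ∈ Icc (0 : ℝ) 1, AnalyticAt ℝ Φ (pt x)) →
      (∀ x ∈ Icc (0 : ℝ) 1, 0 < Φ (pt x)) →
      ∀ᶠ p in nz, AnalyticAt ℝ (fun p => Φ (wm p)) p ∧ 0 < Φ (wm p) := fun ha hp =>
    (eventually_analyticAt_nz fun x hx => analyticAt_comp_wm (ha x hx)).and <| eventually_nz.2 fun x hx =>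
      (analyticAt_comp_wm (ha x hx)).continuousAt.eventually (lt_mem_nhds (by beta_reduce; rw [wm_pt]; exact hp x hx))
  have hU : ∀ {Φ : (Fin 6 → ℝ) → ℝ}, Continuous Φ → (∀ x, Φ (pt x) = 0) → ∀ᶠ p in nz, Φ p ∈ U :=
    fun hc h0 => eventually_nz.2 fun x _ => hc.continuousAt.eventually
      (hUopen.mem_nhds (by rw [h0]; exact hU0))
  refine Exists.elim (Prob.exists_of_eventually (N := N) (F1 := F1) (F2 := F2)
    (Jc := fun p => Jt (wm p)) (Hc := fun p => At (wm p)) (a1 := a1)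
    (b1 := fun p => b1 p - At (wm p) * ℓ₁ (p 0)) (c1 := c1)
    (Q := fun p => p 1 ∈ U ∧ p 0 * p 2 ∈ U ∧ p 4 ∈ U ∧ p 0 * p 5 ∈ U)
    (eventually_analyticAt_nz fun x hx => (analyticAt_comp_wm (aJ x hx)).fun_mul (ap 4 x))
    (eventually_analyticAt_nz fun x hx => ((analyticAt_comp_wm (aA x hx)).fun_mul (aL x hx)).fun_neg.fun_sub
      (analyticAt_comp_wm (aB x hx)))
    (pos aJ hJpos) (pos aA hHpos) (eventually_analyticAt_nz ha1)
    (eventually_analyticAt_nz fun x hx => (hb1 x hx).fun_sub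
      ((analyticAt_comp_wm (aA x hx)).fun_mul (al x hx))) (eventually_analyticAt_nz hc1)
    ?_ ?_ ((hU (by fun_prop) (by simp [pt])).and ((hU (by fun_prop) (by simp [pt])).and
      ((hU (by fun_prop) (by simp [pt])).and (hU (by fun_prop) (by simp [pt]))))))
    fun P ⟨ρ, hρ, e1, e2, h⟩ => ⟨P, ρ, hρ, fun p => by rw [e1]; rfl, fun p => by rw [e2]; rfl, h⟩
  · filter_upwards [eventually_wm aJ, da1] with p h1 h2
    have q := AnalyticAt.fun_comp h1 (analyticAt_wm p)
    have q' := analyticAt_coord 4 p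
    have c4 : ∀ i, i ≠ 4 → pd i (fun p : Fin 6 → ℝ => p 4) p = 0 := fun i hi =>
      pd_eq_zero q' fun s => by rw [Function.update_of_ne hi.symm]
    have z : ∀ i : Fin 6, 2 < i → pd i (fun p => Jt (wm p)) p = 0 := fun i hi =>
      pd_eq_zero q fun s => by
        simp only [hJt, wm, Matrix.cons_val, Function.update_of_ne (show (0 : Fin 6) ≠ i by grind),
          Function.update_of_ne (show (1 : Fin 6) ≠ i by grind), Function.update_of_ne (show (2 : Fin 6) ≠ i by grind)]
    refine ⟨?_, ?_, ?_, ?_⟩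
    · rw [hF1, pd_mul q q', pd_comp_wm h1 2 (wm_update2 p), c4 2 (by decide)]
      linear_combination p 0 * h2
    · rw [hF1, pd_mul q q', z 3 (by decide), c4 3 (by decide)]
      ring
    · rw [hF1, pd_mul q q', z 4 (by decide), pd_eq q' (d := 1) (by simpa using hasDerivAt_id' (p 4))]
      ring
    · rw [hF1, pd_mul q q', z 5 (by decide), c4 5 (by decide)]
      ring
  · filter_upwards [eventually_wm aA, eventually_wm aB, eventually_analyticAt_nz aL, db1, dc1]
      with p h1 h1' q' h2 h3
    have q := AnalyticAt.fun_comp h1 (analyticAt_wm p)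
    have q3 := AnalyticAt.fun_comp h1' (analyticAt_wm p)
    have e : ∀ i, pd i F2 p = -(pd i (fun p => At (wm p)) p * Lt p + At (wm p) * pd i Lt p) -
        pd i (fun p => Bt (wm p)) p := fun i => by
      rw [← pd_mul q q']
      refine pd_eq ((q.fun_mul q').fun_neg.fun_sub q3) ?_
      exact (hasDerivAt_pd (q.fun_mul q') i).fun_neg.fun_sub (hasDerivAt_pd q3 i)
    have l2 : pd 2 Lt p = -bb N (p 0) + ℓ₁ (p 0) * (p 0 * (1 - p 0)) := pd_eq q' (by
      simp only [hLt, Lfun, bb, Function.update_self, ne_eq, Fin.reduceEq, not_false_eq_true,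
        Function.update_of_ne]
      exact (((hasDerivAt_const _ _).fun_sub ((hasDerivAt_id (p 2)).const_mul _)).fun_add
        ((hasDerivAt_id (p 2)).const_mul _) |>.fun_add (hasDerivAt_const _ _)).congr_deriv (by ring))
    have l3 : pd 3 Lt p = -(p 0 * (1 - p 0)) := pd_eq q' (by
      simp only [hLt, Lfun, Function.update_self, ne_eq, Fin.reduceEq, not_false_eq_true,
        Function.update_of_ne]
      exact ((((hasDerivAt_id (p 3)).const_mul _).fun_sub (hasDerivAt_const _ _)).fun_add
        (hasDerivAt_const _ _) |>.fun_add (hasDerivAt_const _ _)).congr_deriv (by ring))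
    have l5 : pd 5 Lt p = 0 := pd_eq_zero q' fun s => by simp [hLt]
    have A3 : pd 3 (fun p => At (wm p)) p = 0 := pd_eq_zero q fun s => by simp [hAt, wm]
    have A5 : pd 5 (fun p => At (wm p)) p = 0 := pd_eq_zero q fun s => by simp [hAt, wm]
    have B3 : pd 3 (fun p => Bt (wm p)) p = 0 := pd_eq_zero q3 fun s => by simp [hBt, wm]
    refine ⟨?_, ?_, ?_⟩
    · rw [e, l2, pd_comp_wm h1 2 (wm_update2 p), pd_comp_wm h1' 2 (wm_update2 p)]
      linear_combination p 0 * h2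
    · rw [e, l3, A3, B3]
      ring
    · rw [e, l5, A5, pd_comp_wm h1' 5 (wm_update5 p)]
      linear_combination p 0 * h3

lemma cl_comp_xc {f : ℝ → ℝ} (hf : ContDiff ℝ ∞ f) {k : ℕ} {δ : ℝ} (hδ : 0 ≤ δ)
    (h : ∀ i ≤ k, ∀ x ∈ Icc (0 : ℝ) 1, |iteratedDeriv i f x| ≤ δ) :
    Cl k (k.factorial * δ) 1 (fun θ => f (xc θ)) := by
  have hx : Cl k 1 1 xc := by
    have := (Cl.const_mul (1 / 2) ((Cl.const (k := k) 1 zero_le_one).sub (Cl.cos (k := k) le_rfl)))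
    have e : (fun θ => 1 / 2 * (1 - Real.cos θ)) = xc := by
      ext θ
      rw [xc]
      ring
    rw [e] at this
    exact this.mono (by norm_num) zero_le_one
  refine ⟨hf.comp contDiff_xc, fun i hi θ => ?_⟩
  have := norm_iteratedFDeriv_comp_le (𝕜 := ℝ) (n := i) (N := ∞) (D := 1) (C := δ) hf contDiff_xc
    (by exact_mod_cast le_top) θ (fun l hl => ?_) (fun l _ hl => ?_)
  · rw [norm_iteratedFDeriv_eq_norm_iteratedDeriv, Real.norm_eq_abs, one_pow, mul_one] at this
    rw [one_pow, mul_one]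
    refine this.trans ?_
    gcongr
  · rw [norm_iteratedFDeriv_eq_norm_iteratedDeriv]
    exact h l (hl.trans hi) _ (xc_mem θ)
  · rw [norm_iteratedFDeriv_eq_norm_iteratedDeriv]
    simpa using hx.2 l (hl.trans hi) θ

lemma exists_cl_comp_xc {f : ℝ → ℝ} (hf : ContDiff ℝ ∞ f) (k : ℕ) :
    ∃ B, Cl k B 1 (fun θ => f (xc θ)) := by
  have : ∀ i, ∃ B, ∀ x ∈ Icc (0 : ℝ) 1, ‖iteratedDeriv i f x‖ ≤ B := fun i =>
    isCompact_Icc.exists_bound_of_continuousOn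
      (hf.continuous_iteratedDeriv i (by exact_mod_cast le_top)).continuousOn
  choose B hB using this
  have hB0 : ∀ i, 0 ≤ B i := fun i => (norm_nonneg _).trans (hB i 0 (by simp))
  exact ⟨_, cl_comp_xc hf (Finset.sum_nonneg fun i _ => hB0 i) fun i hi x hx =>
    (hB i x hx).trans (Finset.single_le_sum (f := B) (fun i _ => hB0 i)
      (Finset.mem_range.2 (Nat.lt_succ_of_le hi)))⟩

lemma jc_initial {C S : ℝ} {c : ℕ} (hN : 4 < N) (hJ : JB N C c) (hS : JS S) (w : ℕ) {ε : ℝ} (hε : 0 < ε) :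
    ∃ δ, 0 < δ ∧ ∀ f : ℝ → ℝ, ContDiff ℝ ∞ f →
      (∀ i ≤ w + 2, ∀ x ∈ Icc (0 : ℝ) 1, |iteratedDeriv i f x| ≤ δ) →
      Rapid (fun j => jc N j f) ∧ (∀ j : ℕ, |jc N j f| * (1 + j : ℝ) ^ w ≤ ε) ∧
      ∀ x ∈ Icc (0 : ℝ) 1, jet N 0 (fun j => jc N j f) x = f x := by
  have decay : ∀ {f : ℝ → ℝ} {k : ℕ} {B : ℝ}, Cl (k + 2) B 1 (fun θ => f (xc θ)) →
      ∀ j : ℕ, |jc N j f| * (1 + j : ℝ) ^ k ≤ 2 ^ k * S * B := fun h j => by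
    have := jc_decay hN hS le_rfl h j
    rwa [one_pow, mul_one, le_div_iff₀ (by positivity)] at this
  set M : ℝ := 2 ^ w * |S| * (w + 2).factorial with hM
  have hM0 : 0 ≤ M := by positivity
  refine ⟨ε / (M + 1), by positivity, fun f hf h => ⟨fun k => ?_, fun j => ?_, fun x hx => ?_⟩⟩
  · obtain ⟨B, hB⟩ := exists_cl_comp_xc hf (k + 2)
    exact ⟨_, decay hB⟩
  · refine (decay (cl_comp_xc hf (by positivity) h) j).trans ?_
    calc _ ≤ 2 ^ w * |S| * ((w + 2).factorial * (ε / (M + 1))) := by gcongr; exact le_abs_self S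
      _ = M * (ε / (M + 1)) := by rw [hM]; ring
      _ ≤ (M + 1) * (ε / (M + 1)) := by gcongr; linarith
      _ = ε := by field_simp
  · obtain ⟨θ, rfl⟩ := exists_xc hx
    obtain ⟨B, hB⟩ := exists_cl_comp_xc hf (c + 4)
    exact (hasSum_jc hJ hS le_rfl hB θ).tsum_eq

lemma exists_env (hN : 4 < N) (P : Prob N) {ρ T : ℝ} (hρ : 0 < ρ) (hT : 0 < T)
    (hP : ∀ p : Fin 6 → ℝ, p 0 ∈ Icc (0 : ℝ) 1 → (∀ k, k ≠ 0 → |p k| ≤ ρ) → p ∈ P.K) :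
    ∃ (χ : ℝ → ℝ) (τ r S Cb : ℝ) (c : ℕ), Env P χ τ r S Cb c ∧ 0 < r ∧ 16 * Cb * r * Z2 = ρ ∧
      ContDiff ℝ ∞ χ ∧ (∀ k, ∃ B, ∀ t, |iteratedDeriv k χ t| ≤ B) ∧ ∀ t ∈ Icc 0 T, χ t = 1 := by
  obtain ⟨Cb, c, hJ⟩ := exists_JB hN
  obtain ⟨S, hS⟩ := exists_JS
  have hC := zero_lt_one.trans_le hJ.one_le
  have hz := zero_lt_one.trans_le Z2_ge
  have hr : 16 * Cb * (ρ / (16 * Cb * Z2)) * Z2 = ρ := by field_simp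
  let χ : ContDiffBump (0 : ℝ) := ⟨T, T + 1, hT, by linarith⟩
  refine ⟨χ, T + 1, ρ / (16 * Cb * Z2), S, Cb, c, ⟨hN, hJ, hS, by linarith, by positivity, χ.continuous,
    fun t => ?_, fun t ht => χ.zero_of_le_dist (by simpa using ht), fun p h0 h => hP p h0 (hr ▸ h)⟩,
    by positivity, hr, χ.contDiff, bounded_iteratedDeriv χ.contDiff χ.hasCompactSupport, fun t ht =>
      χ.one_of_mem_closedBall ?_⟩
  · rw [abs_of_nonneg χ.nonneg]
    exact χ.le_one
  · rw [Metric.mem_closedBall, dist_zero_right, Real.norm_eq_abs, abs_of_nonneg ht.1]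
    exact ht.2

/-- The sum of the extended Jacobi series with time-dependent coefficients `Y`. -/
noncomputable def serie (N : ℝ) (Y : ℝ → ℕ → ℝ) (t x : ℝ) : ℝ := ∑' j, Y t j * ext N j x

section serie

variable {C : ℝ} {c : ℕ} {Y Y' : ℝ → ℕ → ℝ}

lemma serie_eq (t : ℝ) {x : ℝ} (hx : x ∈ Icc (0 : ℝ) 1) : serie N Y t x = jet N 0 (Y t) x := by
  simpa [serie] using ext_series_eq_jet (N := N) 0 (Y t) hx

lemma deriv_serie (hJ : JB N C c) (hY : UR Y) (t : ℝ) :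
    deriv (serie N Y t) = fun x => ∑' j, Y t j * iteratedDeriv 1 (ext N j) x := by
  rw [show serie N Y t = fun x => ∑' j, Y t j * iteratedDeriv 0 (ext N j) x by simp [funext_iff, serie]]
  exact funext fun x => (hasDerivAt_ext_series hJ (hY.rapid t) 0 x).deriv

lemma deriv_serie_eq (hJ : JB N C c) (hY : UR Y) (t : ℝ) {x : ℝ} (hx : x ∈ Icc (0 : ℝ) 1) :
    deriv (serie N Y t) x = jet N 1 (Y t) x := by
  rw [deriv_serie hJ hY]
  exact ext_series_eq_jet 1 (Y t) hx

lemma deriv_deriv_serie_eq (hJ : JB N C c) (hY : UR Y) (t : ℝ) {x : ℝ} (hx : x ∈ Icc (0 : ℝ) 1) :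
    deriv (deriv (serie N Y t)) x = jet N 2 (Y t) x := by
  rw [deriv_serie hJ hY, (hasDerivAt_ext_series hJ (hY.rapid t) 1 x).deriv]
  exact ext_series_eq_jet 2 (Y t) hx

lemma deriv_time_serie_eq (hJ : JB N C c) (hY : UR Y) (hY' : UR Y')
    (hd : ∀ t j, HasDerivAt (fun t => Y t j) (Y' t j) t) (t : ℝ) {x : ℝ} (hx : x ∈ Icc (0 : ℝ) 1) :
    deriv (fun s => serie N Y s x) t = jet N 0 (Y' t) x := by
  obtain ⟨A, hA⟩ := hY.2 (c + 2 * 0 + 2)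
  obtain ⟨A', hA'⟩ := hY'.2 (c + 2 * 0 + 2)
  simp_rw [fun s => serie_eq (N := N) (Y := Y) s hx]
  exact (hasDerivAt_jet_time hJ hA hA' hd hx t).deriv

end serie

end Gal

/-- (Theorem 1.)  For every `T > 0` there are `δ > 0` and `𝔎 ∈ ℕ` such that for all smooth
`y*, v*` on `[0,T]×[0,1]`, taking values (together with `x∂ₓy*`, `x∂ₓv*`) in `U` and with all
mixed derivatives of order `≤ 𝔎` bounded by `δ` in sup norm, there is a smooth solution
`(y, v)` of the system with `y(0,·) = y*(0,·)`, `v(0,·) = v*(0,·)`. -/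
theorem theorem1
    -- (B0)
    (N : ℝ) (hN : 4 < N)
    (ℓ₁ L₀ : ℝ → ℝ)
    (hℓ₁ : AnalyticOnNhd ℝ ℓ₁ (Icc 0 1))
    (hL₀ : AnalyticOnNhd ℝ L₀ (Icc 0 1))
    (U : Set ℝ) (hUopen : IsOpen U) (hU0 : (0:ℝ) ∈ U)
    (J : ℝ → ℝ → ℝ → ℝ) (H₁ : ℝ → ℝ → ℝ → ℝ → ℝ) (H₂ : ℝ → ℝ → ℝ → ℝ → ℝ → ℝ)
    -- (B1)
    (hJ : AnalyticOnNhd ℝ (fun p : ℝ × ℝ × ℝ => J p.1 p.2.1 p.2.2)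
      (Icc 0 1 ×ˢ closure U ×ˢ closure U))
    (hH₁ : AnalyticOnNhd ℝ (fun p : ℝ × ℝ × ℝ × ℝ => H₁ p.1 p.2.1 p.2.2.1 p.2.2.2)
      (Icc 0 1 ×ˢ closure U ×ˢ closure U ×ˢ closure U))
    (hH₂ : AnalyticOnNhd ℝ
      (fun p : ℝ × ℝ × ℝ × ℝ × ℝ => H₂ p.1 p.2.1 p.2.2.1 p.2.2.2.1 p.2.2.2.2)
      (Icc 0 1 ×ˢ closure U ×ˢ closure U ×ˢ closure U ×ˢ closure U))
    (hH₂0 : ∀ x ∈ Icc (0:ℝ) 1, H₂ x 0 0 0 0 = 0)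
    (hH₂y : ∀ x ∈ Icc (0:ℝ) 1, deriv (fun y => H₂ x y 0 0 0) 0 = 0)
    (hH₂z : ∀ x ∈ Icc (0:ℝ) 1, deriv (fun z => H₂ x 0 z 0 0) 0 = 0)
    (hH₂v : ∀ x ∈ Icc (0:ℝ) 1, deriv (fun v => H₂ x 0 0 v 0) 0 = 0)
    (hH₂w : ∀ x ∈ Icc (0:ℝ) 1, deriv (fun w => H₂ x 0 0 0 w) 0 = 0)
    -- (B2)
    (hB2 : ∀ x ∈ Icc (0:ℝ) 1, H₁ x 0 0 0 = (J x 0 0)⁻¹)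
    (C₀ : ℝ) (hC₀ : 1 < C₀)
    (hJlow : ∀ x ∈ Icc (0:ℝ) 1, 1 / C₀ < J x 0 0)
    (hJhigh : ∀ x ∈ Icc (0:ℝ) 1, J x 0 0 < C₀)
    -- (B3)
    (hB3J : ∃ Ω : ℝ × ℝ × ℝ → ℝ, AnalyticAt ℝ Ω ((1,0,0) : ℝ × ℝ × ℝ) ∧
      ∀ᶠ p : ℝ × ℝ × ℝ in nhds ((1,0,0) : ℝ × ℝ × ℝ),
        deriv (fun z => J p.1 p.2.1 z) p.2.2 = (1 - p.1) * Ω p)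
    (hB3H : ∃ Ω : ℝ × ℝ × ℝ × ℝ × ℝ × ℝ → ℝ,
      AnalyticAt ℝ Ω ((1,0,0,0,0,0) : ℝ × ℝ × ℝ × ℝ × ℝ × ℝ) ∧
      ∀ᶠ p : ℝ × ℝ × ℝ × ℝ × ℝ × ℝ in nhds ((1,0,0,0,0,0) : ℝ × ℝ × ℝ × ℝ × ℝ × ℝ),
        deriv (fun z => H₁ p.1 p.2.1 z p.2.2.2.2.1) (p.1 * p.2.2.1)
            * Lfun N ℓ₁ L₀ p.1 p.2.1 p.2.2.1 p.2.2.2.1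
          + deriv (fun z => H₂ p.1 p.2.1 z p.2.2.2.2.1 (p.1 * p.2.2.2.2.2)) (p.1 * p.2.2.1)
          = (1 - p.1) * Ω p)
    (hB3W : ∃ Ω : ℝ × ℝ × ℝ × ℝ × ℝ → ℝ,
      AnalyticAt ℝ Ω ((1,0,0,0,0) : ℝ × ℝ × ℝ × ℝ × ℝ) ∧
      ∀ᶠ p : ℝ × ℝ × ℝ × ℝ × ℝ in nhds ((1,0,0,0,0) : ℝ × ℝ × ℝ × ℝ × ℝ),
        deriv (fun w => H₂ p.1 p.2.1 p.2.2.1 p.2.2.2.1 w) p.2.2.2.2 = (1 - p.1) * Ω p)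
    (T : ℝ) (hT : 0 < T) :
    ∃ δ : ℝ, 0 < δ ∧ ∃ 𝔎 : ℕ,
      ∀ ystar vstar : ℝ → ℝ → ℝ,
        ContDiff ℝ (⊤ : ℕ∞) (Function.uncurry ystar) →
        ContDiff ℝ (⊤ : ℕ∞) (Function.uncurry vstar) →
        (∀ t ∈ Icc (0:ℝ) T, ∀ x ∈ Icc (0:ℝ) 1,
          ystar t x ∈ U ∧ x * deriv (ystar t) x ∈ U ∧
          vstar t x ∈ U ∧ x * deriv (vstar t) x ∈ U) →
        (∀ j k : ℕ, j + k ≤ 𝔎 → ∀ t ∈ Icc (0:ℝ) T, ∀ x ∈ Icc (0:ℝ) 1,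
          |iteratedDeriv j (fun s => iteratedDeriv k (fun x' => ystar s x') x) t| ≤ δ ∧
          |iteratedDeriv j (fun s => iteratedDeriv k (fun x' => vstar s x') x) t| ≤ δ) →
        ∃ y v : ℝ → ℝ → ℝ,
          ContDiff ℝ (⊤ : ℕ∞) (Function.uncurry y) ∧
          ContDiff ℝ (⊤ : ℕ∞) (Function.uncurry v) ∧
          (∀ t ∈ Icc (0:ℝ) T, ∀ x ∈ Icc (0:ℝ) 1,
            y t x ∈ U ∧ x * deriv (y t) x ∈ U ∧
            v t x ∈ U ∧ x * deriv (v t) x ∈ U) ∧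
          (∀ x ∈ Icc (0:ℝ) 1, y 0 x = ystar 0 x ∧ v 0 x = vstar 0 x) ∧
          (∀ t ∈ Icc (0:ℝ) T, ∀ x ∈ Icc (0:ℝ) 1,
            deriv (fun s => y s x) t
              - J x (y t x) (x * deriv (y t) x) * v t x = 0 ∧
            deriv (fun s => v s x) t
              + H₁ x (y t x) (x * deriv (y t) x) (v t x) * opL N ℓ₁ L₀ (y t) x
              + H₂ x (y t x) (x * deriv (y t) x) (v t x) (x * deriv (v t) x) = 0) := by
  have hJpos : ∀ x ∈ Icc (0 : ℝ) 1, 0 < J x 0 0 := fun x hx =>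
    (by positivity : 0 < 1 / C₀).trans (hJlow x hx)
  obtain ⟨P, ρ, hρ, e1, e2, hbox⟩ := Gal.exists_prob ℓ₁ L₀ hℓ₁ hL₀ U hUopen hU0 J H₁ H₂ hJ hH₁ hH₂ hJpos
    (fun x hx => by rw [hB2 x hx]; exact inv_pos.2 (hJpos x hx)) hB3J hB3H hB3W
  obtain ⟨χ, τ, r, S, Cb, c, H, hr, hrρ, hχ, hχb, hχ1⟩ :=
    Gal.exists_env hN P hρ hT fun p h0 h => (hbox p h0 h).1
  obtain ⟨w, ε, hε, hsol⟩ := H.exists_sol hr fun x hx => by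
    rw [e1, e2]
    constructor
    · simp
    · simp [Lfun, hH₂0 x hx]
  obtain ⟨δ, hδ, hinit⟩ := Gal.jc_initial hN H.hJ H.hS w hε
  refine ⟨δ, hδ, w + 2, fun ys vs hys hvs _ hb => ?_⟩
  have h0 : (0 : ℝ) ∈ Icc 0 T := ⟨le_rfl, hT.le⟩
  have slice : ∀ {g : ℝ → ℝ → ℝ}, ContDiff ℝ (⊤ : ℕ∞) (Function.uncurry g) → ContDiff ℝ (⊤ : ℕ∞) (g 0) :=
    fun hg => hg.comp (contDiff_const.prodMk contDiff_id)
  obtain ⟨ra, sa, ja⟩ := hinit (ys 0) (slice hys) fun i hi x hx => by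
    simpa using (hb 0 i (by omega) 0 h0 x hx).1
  obtain ⟨rb, sb, jb⟩ := hinit (vs 0) (slice hvs) fun i hi x hx => by
    simpa using (hb 0 i (by omega) 0 h0 x hx).2
  obtain ⟨Y, V, Y', V', h⟩ := hsol _ _ ra rb sa sb
  have hus := h.us H hχ hχb
  have weight : ∀ {Z : ℝ → ℕ → ℝ}, (∀ t (j : ℕ), |Z t j| * (1 + j : ℝ) ^ (c + 26) ≤ r) →
      ∀ t (j : ℕ), |Z t j| * (1 + j : ℝ) ^ (c + 6) ≤ r := fun hZ t j =>
    (mul_le_mul_of_nonneg_left (pow_le_pow_right₀ (by simp) (by omega)) (abs_nonneg _)).trans (hZ t j)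
  have hD : ∀ t, ∀ x ∈ Icc (0 : ℝ) 1, Gal.D N (Y t) (V t) x 1 ∈ U ∧ x * Gal.D N (Y t) (V t) x 2 ∈ U ∧
      Gal.D N (Y t) (V t) x 4 ∈ U ∧ x * Gal.D N (Y t) (V t) x 5 ∈ U := fun t x hx => by
    refine (hbox (Gal.D N (Y t) (V t) x) hx fun k hk => ?_).2
    rw [← hrρ]
    exact Gal.forall_fin6 (p := fun k => k ≠ 0 → |Gal.D N (Y t) (V t) x k| ≤ 16 * Cb * r * Gal.Z2)
      (fun h => absurd rfl h) (fun _ => H.abs_jet hr.le (weight h.bY t) hx (by omega))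
      (fun _ => H.abs_jet hr.le (weight h.bY t) hx (by omega))
      (fun _ => H.abs_jet hr.le (weight h.bY t) hx (by omega))
      (fun _ => H.abs_jet hr.le (weight h.bV t) hx (by omega))
      (fun _ => H.abs_jet hr.le (weight h.bV t) hx (by omega)) k hk
  refine ⟨Gal.serie N Y, Gal.serie N V, Gal.contDiff_ext_series H.hJ fun k => (hus k).1,
    Gal.contDiff_ext_series H.hJ fun k => (hus k).2, fun t _ x hx => ?_, fun x hx => ?_, fun t ht x hx => ?_⟩
  · rw [Gal.serie_eq t hx, Gal.serie_eq t hx, Gal.deriv_serie_eq H.hJ h.uY t hx,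
      Gal.deriv_serie_eq H.hJ h.uV t hx]
    exact hD t x hx
  · rw [Gal.serie_eq 0 hx, Gal.serie_eq 0 hx, funext h.Y0, funext h.V0]
    exact ⟨ja x hx, jb x hx⟩
  · rw [opL, Gal.serie_eq t hx, Gal.serie_eq t hx, Gal.deriv_serie_eq H.hJ h.uY t hx,
      Gal.deriv_serie_eq H.hJ h.uV t hx, Gal.deriv_deriv_serie_eq H.hJ h.uY t hx,
      Gal.deriv_time_serie_eq H.hJ h.uY h.uY' h.dY t hx, Gal.deriv_time_serie_eq H.hJ h.uV h.uV' h.dV t hx,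
      h.eY t x hx, h.eV t x hx, hχ1 t ht, e1, e2]
    simp only [Gal.D, Lfun, Matrix.cons_val]
    constructor <;> ring
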